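/- (Theorem 5.3: incompressible Euler flow in a rectangular cylinder.) Let α ∈ (0,1), p₀ ∈ ℝ a constant, and u₀ ∈ C^{3,α}(𝕋²) with u₀(x₂,x₃) > 0; set B₀ = u₀²/2 + p₀. Let β₂ⁱⁿ, β₃ⁱⁿ, Bⁱⁿ, p_e ∈ C^{3,α}(𝕋²) satisfy the compatibility conditions: ∂₂^j β₂ⁱⁿ(0,x₃) = ∂₂^j β₂ⁱⁿ(1,x₃) = 0 and ∂₃^j β₃ⁱⁿ(x₂,0) = ∂₃^j β₃ⁱⁿ(x₂,1) = 0 for j = 0,2; ∂₂^k Bⁱⁿ(0,x₃) = ∂₂^k Bⁱⁿ(1,x₃) = ∂₃^k Bⁱⁿ(x₂,0) = ∂₃^k Bⁱⁿ(x₂,1) = 0 for k = 1,3; and the same conditions as for Bⁱⁿ hold for p_e (k = 1,3); assume also u₀ satisfies these latter conditions so that all data extend to C^{3,α}(𝕋²). Then there exist ε₀ > 0 and C > 0, depending only on (p₀, u₀) and (β₂ⁱⁿ, β₃ⁱⁿ, Bⁱⁿ, p_e), such that for every 0 < ε < ε₀ there exists a solution (p, u₁, u₂, u₃) ∈ C^{3,α}(Ω_e)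 × (C^{2,α}(Ω_e))³ of the steady incompressible Euler equations on Ω_e with u₁ > 0, satisfying the boundary conditions u_i/u₁(0,x₂,x₃) = ε β_iⁱⁿ(x₂,x₃) for i = 2,3, B(0,x₂,x₃) = B₀(x₂,x₃) + ε Bⁱⁿ(x₂,x₃), and p(1,x₂,x₃) = p₀ + ε p_e(x₂,x₃), and obeying the estimate ‖(u₁,u₂,u₃) − (u₀,0,0)‖_{C^{2,α}(Ω_e)} + ‖p − p₀‖_{C^{3,α}(Ω_e)} ≤ Cε; moreover this solution is unique in the class of solutions satisfying this estimate. -/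

import Mathlib

/-- The cylinder `Ω_e`, realized as the slab `[0,1] × ℝ²`; functions on
`Ω_e = [0,1] × 𝕋²` are identified with functions on the slab that are
2-periodic in `x₂` and `x₃`. -/
def Slab : Set (Fin 3 → ℝ) := {x | x 0 ∈ Set.Icc (0:ℝ) 1}

/-- Partial derivative (within the slab) in direction `i`. -/
noncomputable def pdW (i : Fin 3) (f : (Fin 3 → ℝ) → ℝ) (x : Fin 3 → ℝ) : ℝ :=
  fderivWithin ℝ f Slab x (Pi.single i 1)

/-- Partial derivative in direction `i` of a function on `ℝ²`. -/
noncomputable def pd2 (i : Fin 2) (g : (Fin 2 → ℝ) → ℝ) (v : Fin 2 → ℝ) : ℝ :=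
  fderiv ℝ g v (Pi.single i 1)

/-- 2-periodicity in both variables: a function on `ℝ²` representing a function
on the torus `𝕋²` of period 2. -/
def Per2 (g : (Fin 2 → ℝ) → ℝ) : Prop :=
  ∀ v : Fin 2 → ℝ,
    g (v + (2:ℝ) • (Pi.single 0 1 : Fin 2 → ℝ)) = g v ∧
      g (v + (2:ℝ) • (Pi.single 1 1 : Fin 2 → ℝ)) = g v

/-- 2-periodicity in `x₂`, `x₃` of a function on the slab. -/
def Per3 (f : (Fin 3 → ℝ) → ℝ) : Prop :=
  ∀ x : Fin 3 → ℝ,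
    f (x + (2:ℝ) • (Pi.single 1 1 : Fin 3 → ℝ)) = f x ∧
      f (x + (2:ℝ) • (Pi.single 2 1 : Fin 3 → ℝ)) = f x

/-- Membership in `C^{k,α}(𝕋²)`: `C^k` with `α`-Hölder `k`-th derivatives. -/
def MemHolder2 (k : ℕ) (α : ℝ) (g : (Fin 2 → ℝ) → ℝ) : Prop :=
  ContDiff ℝ (k : ℕ∞) g ∧ ∃ M : ℝ, ∀ v w : Fin 2 → ℝ,
    ‖iteratedFDeriv ℝ k g v - iteratedFDeriv ℝ k g w‖ ≤ M * ‖v - w‖ ^ α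

/-- Membership in `C^{k,α}(Ω_e)`: `C^k` on the slab with bounded derivatives and
`α`-Hölder `k`-th derivatives. -/
def MemHolder3 (k : ℕ) (α : ℝ) (f : (Fin 3 → ℝ) → ℝ) : Prop :=
  ContDiffOn ℝ (k : ℕ∞) f Slab ∧ ∃ M : ℝ, ∀ x ∈ Slab, ∀ y ∈ Slab,
    ‖iteratedFDerivWithin ℝ k f Slab x - iteratedFDerivWithin ℝ k f Slab y‖
      ≤ M * ‖x - y‖ ^ α

/-- The `C^{k,α}(Ω_e)` norm: sum of the sup-norms of the derivatives of order
`≤ k` plus the `α`-Hölder seminorm of the `k`-th derivatives. -/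
noncomputable def normCkα (k : ℕ) (α : ℝ) (f : (Fin 3 → ℝ) → ℝ) : ℝ :=
  (∑ i ∈ Finset.range (k + 1),
    sSup ((fun x => ‖iteratedFDerivWithin ℝ i f Slab x‖) '' Slab))
  + sSup {r : ℝ | ∃ x ∈ Slab, ∃ y ∈ Slab, x ≠ y ∧
      r = ‖iteratedFDerivWithin ℝ k f Slab x - iteratedFDerivWithin ℝ k f Slab y‖
            / ‖x - y‖ ^ α}

/-- Compatibility conditions for `β₂ⁱⁿ`: `∂₂^j β₂ⁱⁿ = 0` on `{x₂ = 0} ∪ {x₂ = 1}`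
for `j = 0, 2`. -/
def CompatBeta2 (g : (Fin 2 → ℝ) → ℝ) : Prop :=
  ∀ t : ℝ, g ![0, t] = 0 ∧ g ![1, t] = 0 ∧
    pd2 0 (pd2 0 g) ![0, t] = 0 ∧ pd2 0 (pd2 0 g) ![1, t] = 0

/-- Compatibility conditions for `β₃ⁱⁿ`: `∂₃^j β₃ⁱⁿ = 0` on `{x₃ = 0} ∪ {x₃ = 1}`
for `j = 0, 2`. -/
def CompatBeta3 (g : (Fin 2 → ℝ) → ℝ) : Prop :=
  ∀ t : ℝ, g ![t, 0] = 0 ∧ g ![t, 1] = 0 ∧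
    pd2 1 (pd2 1 g) ![t, 0] = 0 ∧ pd2 1 (pd2 1 g) ![t, 1] = 0

/-- Compatibility conditions for `Bⁱⁿ`, `p_e` (and `u₀`): `∂₂^k g = 0` on
`{x₂ = 0} ∪ {x₂ = 1}` and `∂₃^k g = 0` on `{x₃ = 0} ∪ {x₃ = 1}` for `k = 1, 3`. -/
def CompatScal (g : (Fin 2 → ℝ) → ℝ) : Prop :=
  ∀ t : ℝ,
    pd2 0 g ![0, t] = 0 ∧ pd2 0 g ![1, t] = 0 ∧
    pd2 0 (pd2 0 (pd2 0 g)) ![0, t] = 0 ∧ pd2 0 (pd2 0 (pd2 0 g)) ![1, t] = 0 ∧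
    pd2 1 g ![t, 0] = 0 ∧ pd2 1 g ![t, 1] = 0 ∧
    pd2 1 (pd2 1 (pd2 1 g)) ![t, 0] = 0 ∧ pd2 1 (pd2 1 (pd2 1 g)) ![t, 1] = 0

/-- The full set of conditions satisfied by the incompressible Euler flow of
Theorem 5.3: regularity and periodicity, the steady incompressible Euler
equations on `Ω_e`, positivity of `u₁`, the boundary conditions at the inlet
and the exit, and the closeness estimate to the background state `(p₀, u₀, 0, 0)`. -/
def IsIncSolution (α ε p₀ C : ℝ) (u₀ β₂in β₃in Bin pe : (Fin 2 → ℝ) → ℝ)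
    (p : (Fin 3 → ℝ) → ℝ) (u : Fin 3 → (Fin 3 → ℝ) → ℝ) : Prop :=
  -- regularity: p ∈ C^{3,α}(Ω_e), u ∈ (C^{2,α}(Ω_e))³
  MemHolder3 3 α p ∧ Per3 p ∧ (∀ i, MemHolder3 2 α (u i) ∧ Per3 (u i)) ∧
  -- the steady incompressible Euler equations on Ω_e
  (∀ x ∈ Slab, pdW 0 (u 0) x + pdW 1 (u 1) x + pdW 2 (u 2) x = 0) ∧
  (∀ i : Fin 3, ∀ x ∈ Slab,
    u 0 x * pdW 0 (u i) x + u 1 x * pdW 1 (u i) x + u 2 x * pdW 2 (u i) x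
      + pdW i p x = 0) ∧
  -- u₁ > 0
  (∀ x ∈ Slab, 0 < u 0 x) ∧
  -- boundary conditions at the inlet x₁ = 0
  (∀ t₂ t₃ : ℝ,
    u 1 ![0, t₂, t₃] / u 0 ![0, t₂, t₃] = ε * β₂in ![t₂, t₃] ∧
    u 2 ![0, t₂, t₃] / u 0 ![0, t₂, t₃] = ε * β₃in ![t₂, t₃] ∧
    (u 0 ![0, t₂, t₃] ^ 2 + u 1 ![0, t₂, t₃] ^ 2 + u 2 ![0, t₂, t₃] ^ 2) / 2
        + p ![0, t₂, t₃]
      = (u₀ ![t₂, t₃] ^ 2 / 2 + p₀) + ε * Bin ![t₂, t₃]) ∧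
  -- boundary condition at the exit x₁ = 1 (prescribed end pressure)
  (∀ t₂ t₃ : ℝ, p ![1, t₂, t₃] = p₀ + ε * pe ![t₂, t₃]) ∧
  -- the estimate ‖(u₁,u₂,u₃) − (u₀,0,0)‖_{C^{2,α}} + ‖p − p₀‖_{C^{3,α}} ≤ Cε
  (normCkα 2 α (fun x => u 0 x - u₀ ![x 1, x 2]) + normCkα 2 α (u 1)
    + normCkα 2 α (u 2) + normCkα 3 α (fun x => p x - p₀) ≤ C * ε)


set_option linter.unusedVariables false
set_option linter.unusedSimpArgs false
open Set Filter Topology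

namespace Inc

theorem slab_convex : Convex ℝ Slab := by
  intro x hx y hy a b ha hb hab
  have := (convex_Icc (0:ℝ) 1) hx hy ha hb hab
  simpa [Slab] using this

theorem slab_interior : (interior Slab).Nonempty := by
  have h : IsOpen {x : Fin 3 → ℝ | x 0 ∈ Ioo (0:ℝ) 1} :=
    isOpen_Ioo.preimage (continuous_apply 0)
  refine ⟨fun _ => 1/2, ?_⟩
  rw [mem_interior]
  exact ⟨_, fun x hx => ⟨le_of_lt hx.1, le_of_lt hx.2⟩, h, by norm_num⟩

theorem slab_ud : UniqueDiffOn ℝ Slab := uniqueDiffOn_convex slab_convex slab_interior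

theorem slab_closed : IsClosed Slab := isClosed_Icc.preimage (continuous_apply 0)

/-- The linear functional with given coefficients. -/
noncomputable def lin (c : Fin 3 → ℝ) : (Fin 3 → ℝ) →L[ℝ] ℝ :=
  ∑ i, c i • ContinuousLinearMap.proj (R := ℝ) (φ := fun _ : Fin 3 => ℝ) i

theorem lin_apply (c v : Fin 3 → ℝ) : lin c v = ∑ i, c i * v i := by
  simp [lin]

theorem lin_single (c : Fin 3 → ℝ) (i : Fin 3) : lin c (Pi.single i 1) = c i := by
  simp [lin_apply, Pi.single_apply]

theorem eq_lin (L : (Fin 3 → ℝ) →L[ℝ] ℝ) : L = lin (fun i => L (Pi.single i 1)) := by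
  ext v
  rw [lin_apply]
  conv_lhs => rw [← Finset.univ_sum_single v]
  rw [map_sum]
  refine Finset.sum_congr rfl fun i _ => ?_
  have : (Pi.single i (v i) : Fin 3 → ℝ) = v i • Pi.single i 1 := by
    ext j; by_cases h : j = i <;> simp [h]
  rw [this, map_smul, smul_eq_mul, mul_comm]

theorem hasFD {f : (Fin 3 → ℝ) → ℝ} (hf : DifferentiableOn ℝ f Slab) {x : Fin 3 → ℝ}
    (hx : x ∈ Slab) : HasFDerivWithinAt f (lin fun i => pdW i f x) Slab x := by
  have := (hf x hx).hasFDerivWithinAt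
  rwa [eq_lin (fderivWithin ℝ f Slab x)] at this

theorem pdW_of_has {f : (Fin 3 → ℝ) → ℝ} {L : (Fin 3 → ℝ) →L[ℝ] ℝ} {x : Fin 3 → ℝ}
    (h : HasFDerivWithinAt f L Slab x) (hx : x ∈ Slab) (i : Fin 3) :
    pdW i f x = L (Pi.single i 1) := by
  rw [pdW, h.fderivWithin (slab_ud x hx)]

theorem pdW_of_lin {f : (Fin 3 → ℝ) → ℝ} {c : Fin 3 → ℝ} {x : Fin 3 → ℝ}
    (h : HasFDerivWithinAt f (lin c) Slab x) (hx : x ∈ Slab) (i : Fin 3) :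
    pdW i f x = c i := by
  rw [pdW_of_has h hx, lin_single]

theorem pdW_congr {f g : (Fin 3 → ℝ) → ℝ} (h : EqOn f g Slab) {x : Fin 3 → ℝ}
    (hx : x ∈ Slab) (i : Fin 3) : pdW i f x = pdW i g x := by
  rw [pdW, pdW, fderivWithin_congr h (h hx)]

theorem pdW_add {f g : (Fin 3 → ℝ) → ℝ} (hf : DifferentiableOn ℝ f Slab)
    (hg : DifferentiableOn ℝ g Slab) {x : Fin 3 → ℝ} (hx : x ∈ Slab) (i : Fin 3) :
    pdW i (fun x => f x + g x) x = pdW i f x + pdW i g x := by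
  refine (pdW_of_has (f := fun x => f x + g x) ((hasFD hf hx).add (hasFD hg hx)) hx i).trans ?_
  simp [lin_single]

theorem pdW_sub {f g : (Fin 3 → ℝ) → ℝ} (hf : DifferentiableOn ℝ f Slab)
    (hg : DifferentiableOn ℝ g Slab) {x : Fin 3 → ℝ} (hx : x ∈ Slab) (i : Fin 3) :
    pdW i (fun x => f x - g x) x = pdW i f x - pdW i g x := by
  refine (pdW_of_has (f := fun x => f x - g x) ((hasFD hf hx).sub (hasFD hg hx)) hx i).trans ?_
  simp [lin_single]

theorem pdW_neg {f : (Fin 3 → ℝ) → ℝ} (hf : DifferentiableOn ℝ f Slab)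
    {x : Fin 3 → ℝ} (hx : x ∈ Slab) (i : Fin 3) :
    pdW i (fun x => - f x) x = - pdW i f x := by
  refine (pdW_of_has (f := fun x => - f x) ((hasFD hf hx).neg) hx i).trans ?_
  simp [lin_single]

theorem pdW_const (c : ℝ) {x : Fin 3 → ℝ} (hx : x ∈ Slab) (i : Fin 3) :
    pdW i (fun _ => c) x = 0 := by
  rw [pdW_of_has (hasFDerivWithinAt_const c x Slab) hx]
  simp

theorem pdW_mul {f g : (Fin 3 → ℝ) → ℝ} (hf : DifferentiableOn ℝ f Slab)
    (hg : DifferentiableOn ℝ g Slab) {x : Fin 3 → ℝ} (hx : x ∈ Slab) (i : Fin 3) :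
    pdW i (fun x => f x * g x) x = pdW i f x * g x + f x * pdW i g x := by
  refine (pdW_of_has (f := fun x => f x * g x) ((hasFD hf hx).mul (hasFD hg hx)) hx i).trans ?_
  simp [lin_single]; ring

theorem pdW_cmul {f : (Fin 3 → ℝ) → ℝ} (c : ℝ) (hf : DifferentiableOn ℝ f Slab)
    {x : Fin 3 → ℝ} (hx : x ∈ Slab) (i : Fin 3) :
    pdW i (fun x => c * f x) x = c * pdW i f x := by
  rw [pdW_mul (differentiableOn_const c) hf hx, pdW_const c hx]; ring

theorem pdW_inv {f : (Fin 3 → ℝ) → ℝ} (hf : DifferentiableOn ℝ f Slab)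
    (h0 : ∀ x ∈ Slab, f x ≠ 0) {x : Fin 3 → ℝ} (hx : x ∈ Slab) (i : Fin 3) :
    pdW i (fun x => (f x)⁻¹) x = - (pdW i f x * ((f x)⁻¹ * (f x)⁻¹)) := by
  have h := (hasDerivAt_inv (h0 x hx)).comp_hasFDerivWithinAt x (hasFD hf hx)
  have h' : HasFDerivWithinAt (fun x => (f x)⁻¹) _ Slab x := h
  rw [pdW_of_has h' hx]
  have := h0 x hx
  simp [lin_single]; field_simp

theorem diff_inv {f : (Fin 3 → ℝ) → ℝ} (hf : DifferentiableOn ℝ f Slab)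
    (h0 : ∀ x ∈ Slab, f x ≠ 0) : DifferentiableOn ℝ (fun x => (f x)⁻¹) Slab :=
  fun x hx => (hf x hx).inv (h0 x hx)

/-- Quantitative `C^{k,α}` bound on the slab. -/
def HH (α : ℝ) : ℕ → ℝ → ((Fin 3 → ℝ) → ℝ) → Prop
  | 0, M, f => (∀ x ∈ Slab, |f x| ≤ M) ∧ ∀ x ∈ Slab, ∀ y ∈ Slab, |f x - f y| ≤ M * ‖x - y‖ ^ α
  | k + 1, M, f => ((∀ x ∈ Slab, |f x| ≤ M) ∧
      ∀ x ∈ Slab, ∀ y ∈ Slab, |f x - f y| ≤ M * ‖x - y‖ ^ α) ∧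
      DifferentiableOn ℝ f Slab ∧ ∀ i, HH α k M (pdW i f)

variable {α : ℝ}

theorem zero_mem_slab : (0 : Fin 3 → ℝ) ∈ Slab := by simp [Slab]

namespace HH

theorem zero : ∀ {k : ℕ} {M : ℝ} {f : (Fin 3 → ℝ) → ℝ}, HH α k M f → HH α 0 M f
  | 0, _, _, h => h
  | _ + 1, _, _, h => h.1

theorem bd {k : ℕ} {M : ℝ} {f : (Fin 3 → ℝ) → ℝ} (h : HH α k M f) {x : Fin 3 → ℝ}
    (hx : x ∈ Slab) : |f x| ≤ M := h.zero.1 x hx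

theorem hol {k : ℕ} {M : ℝ} {f : (Fin 3 → ℝ) → ℝ} (h : HH α k M f) {x y : Fin 3 → ℝ}
    (hx : x ∈ Slab) (hy : y ∈ Slab) : |f x - f y| ≤ M * ‖x - y‖ ^ α := h.zero.2 x hx y hy

theorem nonneg {k : ℕ} {M : ℝ} {f : (Fin 3 → ℝ) → ℝ} (h : HH α k M f) : 0 ≤ M :=
  (abs_nonneg _).trans (h.bd zero_mem_slab)

theorem diff {k : ℕ} {M : ℝ} {f : (Fin 3 → ℝ) → ℝ} (h : HH α (k + 1) M f) :
    DifferentiableOn ℝ f Slab := h.2.1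

theorem pd {k : ℕ} {M : ℝ} {f : (Fin 3 → ℝ) → ℝ} (h : HH α (k + 1) M f) (i : Fin 3) :
    HH α k M (pdW i f) := h.2.2 i

theorem of_succ : ∀ {k : ℕ} {M : ℝ} {f : (Fin 3 → ℝ) → ℝ}, HH α (k + 1) M f → HH α k M f
  | 0, _, _, h => h.1
  | _ + 1, _, _, h => ⟨h.1, h.2.1, fun i => of_succ (h.2.2 i)⟩

theorem lek {k l : ℕ} (hkl : k ≤ l) {M : ℝ} {f : (Fin 3 → ℝ) → ℝ} (h : HH α l M f) :
    HH α k M f := by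
  induction hkl with
  | refl => exact h
  | step _ ih => exact ih h.of_succ

theorem mono : ∀ {k : ℕ} {M N : ℝ} {f : (Fin 3 → ℝ) → ℝ}, HH α k M f → M ≤ N → HH α k N f
  | 0, _, _, _, h, hMN => ⟨fun x hx => (h.1 x hx).trans hMN, fun x hx y hy =>
      (h.2 x hx y hy).trans (mul_le_mul_of_nonneg_right hMN (Real.rpow_nonneg (norm_nonneg _) _))⟩
  | k + 1, _, _, _, h, hMN => ⟨mono (k := 0) h.1 hMN, h.2.1, fun i => mono (h.2.2 i) hMN⟩

theorem congr : ∀ {k : ℕ} {M : ℝ} {f g : (Fin 3 → ℝ) → ℝ}, HH α k M f → EqOn f g Slab →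
    HH α k M g
  | 0, _, _, _, h, hfg => ⟨fun x hx => by rw [← hfg hx]; exact h.1 x hx, fun x hx y hy => by
      rw [← hfg hx, ← hfg hy]; exact h.2 x hx y hy⟩
  | k + 1, _, _, _, h, hfg => ⟨congr (k := 0) h.1 hfg, h.2.1.congr fun x hx => (hfg hx).symm,
      fun i => congr (h.2.2 i) fun _ hx => pdW_congr hfg hx i⟩

theorem add : ∀ {k : ℕ} {M N : ℝ} {f g : (Fin 3 → ℝ) → ℝ}, HH α k M f → HH α k N g →
    HH α k (M + N) (fun x => f x + g x)
  | 0, _, _, _, _, hf, hg => ⟨fun x hx => (abs_add_le _ _).trans (add_le_add (hf.1 x hx) (hg.1 x hx)),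
      fun x hx y hy => by
        rw [add_sub_add_comm, add_mul]
        exact (abs_add_le _ _).trans (add_le_add (hf.2 x hx y hy) (hg.2 x hx y hy))⟩
  | k + 1, _, _, _, _, hf, hg => ⟨add (k := 0) hf.1 hg.1, hf.2.1.add hg.2.1, fun i =>
      congr (add (hf.2.2 i) (hg.2.2 i)) fun _ hx => (pdW_add hf.2.1 hg.2.1 hx i).symm⟩

theorem neg : ∀ {k : ℕ} {M : ℝ} {f : (Fin 3 → ℝ) → ℝ}, HH α k M f → HH α k M (fun x => - f x)
  | 0, _, _, h => ⟨fun x hx => by rw [abs_neg]; exact h.1 x hx, fun x hx y hy => by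
      rw [neg_sub_neg, abs_sub_comm]; exact h.2 x hx y hy⟩
  | k + 1, _, _, h => ⟨neg (k := 0) h.1, h.2.1.neg, fun i =>
      congr (neg (h.2.2 i)) fun _ hx => (pdW_neg h.2.1 hx i).symm⟩

theorem sub {k : ℕ} {M N : ℝ} {f g : (Fin 3 → ℝ) → ℝ} (hf : HH α k M f) (hg : HH α k N g) :
    HH α k (M + N) (fun x => f x - g x) :=
  (hf.add hg.neg).congr fun x _ => (sub_eq_add_neg _ _).symm

theorem const {c : ℝ} : ∀ (k : ℕ), HH α k |c| (fun _ => c)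
  | 0 => ⟨fun _ _ => le_rfl, fun x _ y _ => by
      rw [sub_self, abs_zero]; exact mul_nonneg (abs_nonneg _) (Real.rpow_nonneg (norm_nonneg _) _)⟩
  | k + 1 => ⟨const 0, differentiableOn_const c, fun i =>
      congr (mono (const (c := 0) k) (by simp)) fun _ hx => (pdW_const c hx i).symm⟩

theorem mul : ∀ {k : ℕ} {M N : ℝ} {f g : (Fin 3 → ℝ) → ℝ}, HH α k M f → HH α k N g →
    HH α k (2 ^ (k + 1) * (M * N)) (fun x => f x * g x)
  | 0, M, N, f, g, hf, hg => by
      have hM := hf.nonneg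
      have hN := hg.nonneg
      refine ⟨fun x hx => ?_, fun x hx y hy => ?_⟩
      · rw [abs_mul]
        have := mul_le_mul (hf.1 x hx) (hg.1 x hx) (abs_nonneg _) hM
        have h2 : 0 ≤ M * N := mul_nonneg hM hN
        norm_num; linarith
      · have e : f x * g x - f y * g y = (f x - f y) * g x + f y * (g x - g y) := by ring
        rw [e]
        have hp : 0 ≤ ‖x - y‖ ^ α := Real.rpow_nonneg (norm_nonneg _) _
        have h1 := mul_le_mul (hf.2 x hx y hy) (hg.1 x hx) (abs_nonneg _) (mul_nonneg hM hp)
        have h2 := mul_le_mul (hf.1 y hy) (hg.2 x hx y hy) (abs_nonneg _) hM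
        have := abs_add_le ((f x - f y) * g x) (f y * (g x - g y))
        rw [abs_mul, abs_mul] at this
        norm_num; linarith
  | k + 1, M, N, f, g, hf, hg => by
      have hM := hf.nonneg
      have hN := hg.nonneg
      have h2 : 0 ≤ M * N := mul_nonneg hM hN
      refine ⟨?_, hf.2.1.mul hg.2.1, fun i => ?_⟩
      · refine mono (mul (k := 0) hf.1 hg.1) ?_
        have : (2:ℝ) ^ (0 + 1) ≤ 2 ^ (k + 1 + 1) := pow_le_pow_right₀ (by norm_num) (by omega)
        exact mul_le_mul_of_nonneg_right this h2
      · refine (mono (add (mul (hf.2.2 i) hg.of_succ) (mul hf.of_succ (hg.2.2 i))) ?_).congr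
          fun x hx => (pdW_mul hf.2.1 hg.2.1 hx i).symm
        rw [pow_succ _ (k + 1)]; linarith

theorem cmul (c : ℝ) : ∀ {k : ℕ} {M : ℝ} {f : (Fin 3 → ℝ) → ℝ}, HH α k M f →
    HH α k (|c| * M) (fun x => c * f x)
  | 0, M, f, hf => ⟨fun x hx => by
        rw [abs_mul]; exact mul_le_mul_of_nonneg_left (hf.1 x hx) (abs_nonneg _), fun x hx y hy => by
        rw [← mul_sub, abs_mul, mul_assoc]
        exact mul_le_mul_of_nonneg_left (hf.2 x hx y hy) (abs_nonneg _)⟩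
  | k + 1, M, f, hf => ⟨cmul c (k := 0) hf.1, hf.2.1.const_mul c, fun i =>
      congr (cmul c (hf.2.2 i)) fun _ hx => (pdW_cmul c hf.2.1 hx i).symm⟩

theorem cont {k : ℕ} {M : ℝ} {f : (Fin 3 → ℝ) → ℝ} (hα : 0 < α) (h : HH α k M f) :
    ContinuousOn f Slab := by
  intro x hx
  rw [ContinuousWithinAt, tendsto_iff_dist_tendsto_zero]
  have h1 : Tendsto (fun y => M * ‖y - x‖ ^ α) (𝓝[Slab] x) (𝓝 0) := by
    have : ContinuousAt (fun y : Fin 3 → ℝ => M * ‖y - x‖ ^ α) x := by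
      apply ContinuousAt.mul continuousAt_const
      apply ContinuousAt.rpow_const (by fun_prop) (Or.inr hα.le)
    have h2 := this.tendsto
    simp only [sub_self, norm_zero, Real.zero_rpow hα.ne', mul_zero] at h2
    exact h2.mono_left nhdsWithin_le_nhds
  refine squeeze_zero' (Eventually.of_forall fun _ => dist_nonneg) ?_ h1
  filter_upwards [self_mem_nhdsWithin] with y hy
  rw [Real.dist_eq]; exact h.hol hy hx

end HH

end Inc

set_option linter.unusedVariables false
set_option linter.unusedSimpArgs false
open Set Filter Topology

namespace Inc

variable {α : ℝ}

theorem lin_sub (c d : Fin 3 → ℝ) : lin c - lin d = lin (fun i => c i - d i) := by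
  ext v; simp [lin_apply, sub_mul]

theorem lin_norm_le {c : Fin 3 → ℝ} {A : ℝ} (h : ∀ i, |c i| ≤ A) : ‖lin c‖ ≤ 3 * A := by
  have hA : 0 ≤ A := (abs_nonneg _).trans (h 0)
  refine ContinuousLinearMap.opNorm_le_bound _ (by positivity) fun v => ?_
  rw [lin_apply, Real.norm_eq_abs]
  calc |∑ i, c i * v i| ≤ ∑ i, |c i * v i| := Finset.abs_sum_le_sum_abs _ _
    _ ≤ ∑ _i : Fin 3, A * ‖v‖ := by
        refine Finset.sum_le_sum fun i _ => ?_
        rw [abs_mul]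
        exact mul_le_mul (h i) (norm_le_pi_norm v i) (abs_nonneg _) hA
    _ = 3 * A * ‖v‖ := by simp; ring

theorem lip_of_pd {f : (Fin 3 → ℝ) → ℝ} {A : ℝ} (hf : DifferentiableOn ℝ f Slab)
    (hA : ∀ i, ∀ x ∈ Slab, |pdW i f x| ≤ A) {x y : Fin 3 → ℝ} (hx : x ∈ Slab) (hy : y ∈ Slab) :
    |f x - f y| ≤ 3 * A * ‖x - y‖ :=
  slab_convex.norm_image_sub_le_of_norm_hasFDerivWithin_le (fun z hz => hasFD hf hz)
    (fun z hz => lin_norm_le fun i => hA i z hz) hy hx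

theorem self_le_rpow {t : ℝ} (hα1 : α ≤ 1) (h0 : 0 ≤ t) (h1 : t ≤ 1) : t ≤ t ^ α := by
  rcases eq_or_lt_of_le h0 with h | h
  · rw [← h]; positivity
  · calc t = t ^ (1:ℝ) := (Real.rpow_one t).symm
      _ ≤ t ^ α := Real.rpow_le_rpow_of_exponent_ge h h1 hα1

theorem HH0_of_lip {f : (Fin 3 → ℝ) → ℝ} {A L : ℝ} (hα0 : 0 ≤ α) (hα1 : α ≤ 1)
    (hA : ∀ x ∈ Slab, |f x| ≤ A) (hL0 : 0 ≤ L)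
    (hL : ∀ x ∈ Slab, ∀ y ∈ Slab, |f x - f y| ≤ L * ‖x - y‖) : HH α 0 (2 * A + L) f := by
  have hA0 : 0 ≤ A := (abs_nonneg _).trans (hA 0 zero_mem_slab)
  refine ⟨fun x hx => (hA x hx).trans (by linarith), fun x hx y hy => ?_⟩
  have hp : 0 ≤ ‖x - y‖ ^ α := Real.rpow_nonneg (norm_nonneg _) _
  rcases le_total ‖x - y‖ 1 with h | h
  · have h1 := self_le_rpow hα1 (norm_nonneg (x - y)) h
    have h2 := hL x hx y hy
    nlinarith [mul_le_mul_of_nonneg_left h1 hL0]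
  · have h1 : 1 ≤ ‖x - y‖ ^ α := Real.one_le_rpow h hα0
    have h2 := abs_sub (f x) (f y)
    nlinarith [hA x hx, hA y hy]

theorem HH.taylor {f : (Fin 3 → ℝ) → ℝ} {M : ℝ} {k : ℕ} (hα : 0 ≤ α) (h : HH α (k + 1) M f)
    {x y : Fin 3 → ℝ} (hx : x ∈ Slab) (hy : y ∈ Slab) :
    |f y - f x - ∑ i, pdW i f x * (y - x) i| ≤ 3 * (M * ‖y - x‖ ^ α) * ‖y - x‖ := by
  rw [← lin_apply]
  have hseg : segment ℝ x y ⊆ Slab := slab_convex.segment_subset hx hy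
  refine (convex_segment x y).norm_image_sub_le_of_norm_hasFDerivWithin_le'
    (f' := fun z => lin fun i => pdW i f z)
    (fun z hz => (hasFD h.diff (hseg hz)).mono hseg) (fun z hz => ?_)
    (left_mem_segment ℝ x y) (right_mem_segment ℝ x y)
  rw [lin_sub]
  refine lin_norm_le fun i => ?_
  refine ((h.pd i).hol (hseg hz) hx).trans ?_
  refine mul_le_mul_of_nonneg_left ?_ h.nonneg
  refine Real.rpow_le_rpow (norm_nonneg _) ?_ hα
  exact norm_sub_le_of_mem_segment hz

theorem has_of_taylor {f : (Fin 3 → ℝ) → ℝ} {g : Fin 3 → ℝ} {x : Fin 3 → ℝ} {K : ℝ}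
    {S : Set (Fin 3 → ℝ)} (hα : 0 < α)
    (h : ∀ y ∈ S, |f y - f x - ∑ i, g i * (y - x) i| ≤ K * ‖y - x‖ ^ α * ‖y - x‖) :
    HasFDerivWithinAt f (lin g) S x := by
  rw [hasFDerivWithinAt_iff_tendsto]
  have h1 : Tendsto (fun y => K * ‖y - x‖ ^ α) (𝓝[S] x) (𝓝 0) := by
    have : ContinuousAt (fun y : Fin 3 → ℝ => K * ‖y - x‖ ^ α) x := by
      apply ContinuousAt.mul continuousAt_const
      apply ContinuousAt.rpow_const (by fun_prop) (Or.inr hα.le)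
    have h2 := this.tendsto
    simp only [sub_self, norm_zero, Real.zero_rpow hα.ne', mul_zero] at h2
    exact h2.mono_left nhdsWithin_le_nhds
  refine squeeze_zero' (Eventually.of_forall fun _ => by positivity) ?_ h1
  filter_upwards [self_mem_nhdsWithin] with y hy
  rw [lin_apply, Real.norm_eq_abs]
  rcases eq_or_lt_of_le (norm_nonneg (y - x)) with h0 | h0
  · rw [← h0, Real.zero_rpow hα.ne']; simp
  · rw [inv_mul_le_iff₀ h0, mul_comm ‖y - x‖]; exact h y hy

/-- Criterion for membership. -/
theorem HH.mk_of_has {f : (Fin 3 → ℝ) → ℝ} {g : Fin 3 → (Fin 3 → ℝ) → ℝ} {M : ℝ} {k : ℕ}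
    (h0 : HH α 0 M f) (h : ∀ x ∈ Slab, HasFDerivWithinAt f (lin fun i => g i x) Slab x)
    (hg : ∀ i, HH α k M (g i)) : HH α (k + 1) M f :=
  ⟨h0, fun x hx => (h x hx).differentiableWithinAt, fun i =>
    (hg i).congr fun x hx => (pdW_of_lin (h x hx) hx i).symm⟩

theorem lim_ultra {ι : Type*} (U : Ultrafilter ι) {M : ℝ} {F : ι → (Fin 3 → ℝ) → ℝ}
    {f : (Fin 3 → ℝ) → ℝ} (hα : 0 < α) (hF : ∀ᶠ n in (U : Filter ι), HH α 1 M (F n))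
    (hl : ∀ x ∈ Slab, Tendsto (fun n => F n x) U (𝓝 (f x))) :
    DifferentiableOn ℝ f Slab ∧
      ∀ i, ∀ x ∈ Slab, Tendsto (fun n => pdW i (F n) x) U (𝓝 (pdW i f x)) := by
  have key : ∀ x ∈ Slab, ∃ c : Fin 3 → ℝ, HasFDerivWithinAt f (lin c) Slab x ∧
      ∀ i, Tendsto (fun n => pdW i (F n) x) U (𝓝 (c i)) := by
    intro x hx
    have hc : ∀ i, ∃ c : ℝ, Tendsto (fun n => pdW i (F n) x) U (𝓝 c) := by
      intro i
      have hK : IsCompact (Icc (-M) M) := isCompact_Icc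
      have : Icc (-M) M ∈ U.map (fun n => pdW i (F n) x) := by
        rw [Ultrafilter.mem_map]
        filter_upwards [hF] with n hn
        exact abs_le.mp ((hn.pd i).bd hx)
      obtain ⟨c, _, hc⟩ := hK.ultrafilter_le_nhds' _ this
      exact ⟨c, hc⟩
    choose c hc using hc
    refine ⟨c, has_of_taylor (K := 3 * M) hα fun y hy => ?_, hc⟩
    have ht : Tendsto (fun n => |F n y - F n x - ∑ i, pdW i (F n) x * (y - x) i|) U
        (𝓝 |f y - f x - ∑ i, c i * (y - x) i|) :=
      (((hl y hy).sub (hl x hx)).sub (tendsto_finsetSum _ fun i _ =>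
        (hc i).mul_const _)).abs
    refine le_of_tendsto ht ?_
    filter_upwards [hF] with n hn
    have := hn.taylor hα.le hx hy
    linarith
  refine ⟨fun x hx => ?_, fun i x hx => ?_⟩
  · obtain ⟨c, hc, _⟩ := key x hx
    exact hc.differentiableWithinAt
  · obtain ⟨c, hc, h⟩ := key x hx
    rw [pdW_of_lin hc hx]; exact h i

theorem HH.lim_pd {ι : Type*} {l : Filter ι} {M : ℝ} {k : ℕ} {F : ι → (Fin 3 → ℝ) → ℝ}
    {f : (Fin 3 → ℝ) → ℝ} (hα : 0 < α) (hF : ∀ᶠ n in l, HH α (k + 1) M (F n))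
    (hl : ∀ x ∈ Slab, Tendsto (fun n => F n x) l (𝓝 (f x))) (i : Fin 3) {x : Fin 3 → ℝ}
    (hx : x ∈ Slab) : Tendsto (fun n => pdW i (F n) x) l (𝓝 (pdW i f x)) := by
  rw [tendsto_iff_ultrafilter]
  intro U hU
  exact (lim_ultra U hα ((hF.filter_mono hU).mono fun n h => h.lek (by omega))
    fun x hx => (hl x hx).mono_left hU).2 i x hx

theorem HH.lim {ι : Type*} {l : Filter ι} [l.NeBot] (hα : 0 < α) : ∀ {k : ℕ} {M : ℝ}
    {F : ι → (Fin 3 → ℝ) → ℝ} {f : (Fin 3 → ℝ) → ℝ}, (∀ᶠ n in l, HH α k M (F n)) →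
    (∀ x ∈ Slab, Tendsto (fun n => F n x) l (𝓝 (f x))) → HH α k M f
  | 0, M, F, f, hF, hl => by
      refine ⟨fun x hx => ?_, fun x hx y hy => ?_⟩
      · exact le_of_tendsto (hl x hx).abs (hF.mono fun n h => h.1 x hx)
      · exact le_of_tendsto ((hl x hx).sub (hl y hy)).abs (hF.mono fun n h => h.2 x hx y hy)
  | k + 1, M, F, f, hF, hl => by
      refine ⟨HH.lim hα (k := 0) (hF.mono fun n h => h.1) hl, ?_, fun i => ?_⟩
      · exact (lim_ultra (Ultrafilter.of l) hα
          ((hF.filter_mono (Ultrafilter.of_le l)).mono fun n h => h.lek (by omega))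
          fun x hx => (hl x hx).mono_left (Ultrafilter.of_le l)).1
      · exact HH.lim hα (hF.mono fun n h => h.2.2 i) fun x hx => HH.lim_pd hα hF hl i hx

/-! Composition -/

theorem pdW_comp {f : (Fin 3 → ℝ) → ℝ} {Φ : (Fin 3 → ℝ) → (Fin 3 → ℝ)}
    {D : Fin 3 → (Fin 3 → ℝ) → ℝ}
    (hΦ : ∀ x ∈ Slab, ∀ j, Φ x j = x j + D j x) (hm : MapsTo Φ Slab Slab)
    (hf : DifferentiableOn ℝ f Slab) (hD : ∀ j, DifferentiableOn ℝ (D j) Slab)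
    {x : Fin 3 → ℝ} (hx : x ∈ Slab) :
    HasFDerivWithinAt (fun x => f (Φ x))
      (lin fun i => ∑ j, pdW j f (Φ x) * ((if i = j then 1 else 0) + pdW i (D j) x)) Slab x := by
  have h1 : HasFDerivWithinAt Φ (ContinuousLinearMap.pi fun j =>
      (ContinuousLinearMap.proj (R := ℝ) (φ := fun _ : Fin 3 => ℝ) j) +
        lin fun i => pdW i (D j) x) Slab x := by
    rw [hasFDerivWithinAt_pi]
    intro j
    have h2 : HasFDerivWithinAt (fun x : Fin 3 → ℝ => x j + D j x) _ Slab x :=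
      ((ContinuousLinearMap.proj (R := ℝ) (φ := fun _ : Fin 3 => ℝ) j).hasFDerivWithinAt).add
        (hasFD (hD j) hx)
    exact h2.congr (fun y hy => hΦ y hy j) (hΦ x hx j)
  have h3 := (hasFD hf (hm hx)).comp x h1 hm
  have h4 : HasFDerivWithinAt (fun x => f (Φ x)) _ Slab x := h3
  refine h4.congr_fderiv ((eq_lin _).trans (congrArg lin (funext fun i => ?_)))
  simp only [ContinuousLinearMap.comp_apply, lin_apply]
  refine Finset.sum_congr rfl fun j _ => ?_
  simp [lin_apply, Pi.single_apply, eq_comm]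

/-- Composition constants. -/
noncomputable def Cc : ℕ → ℝ
  | 0 => 4
  | k + 1 => 4 + 3 * (2 ^ (k + 1) * (Cc k * 2))

theorem Cc_ge : ∀ k, 4 ≤ Cc k
  | 0 => le_rfl
  | k + 1 => by
      have := Cc_ge k
      have h : 0 ≤ 3 * (2 ^ (k + 1) * (Cc k * 2)) := by positivity
      simp only [Cc]; linarith

theorem HH.sum3 {k : ℕ} {M : ℝ} {f : Fin 3 → (Fin 3 → ℝ) → ℝ} (h : ∀ j, HH α k M (f j)) :
    HH α k (3 * M) (fun x => ∑ j, f j x) :=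
  ((((h 0).add (h 1)).add (h 2)).mono (by linarith)).congr fun x _ => by
    simp [Fin.sum_univ_three]

theorem HH.comp (hα0 : 0 ≤ α) (hα1 : α ≤ 1) {Φ : (Fin 3 → ℝ) → (Fin 3 → ℝ)}
    {D : Fin 3 → (Fin 3 → ℝ) → ℝ}
    (hΦ : ∀ x ∈ Slab, ∀ j, Φ x j = x j + D j x) (hm : MapsTo Φ Slab Slab)
    (hL : ∀ x ∈ Slab, ∀ y ∈ Slab, ‖Φ x - Φ y‖ ≤ 4 * ‖x - y‖) :
    ∀ {k : ℕ} {M : ℝ} {f : (Fin 3 → ℝ) → ℝ}, (∀ j, HH α k 1 (D j)) → HH α k M f →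
      HH α k (Cc k * M) (fun x => f (Φ x))
  | 0, M, f, hD, hf => by
      have hM := hf.nonneg
      refine ⟨fun x hx => (hf.bd (hm hx)).trans (by simp only [Cc]; linarith), fun x hx y hy => ?_⟩
      refine (hf.hol (hm hx) (hm hy)).trans ?_
      have h1 : ‖Φ x - Φ y‖ ^ α ≤ 4 * ‖x - y‖ ^ α := by
        refine (Real.rpow_le_rpow (norm_nonneg _) (hL x hx y hy) hα0).trans ?_
        rw [Real.mul_rpow (by norm_num) (norm_nonneg _)]
        refine mul_le_mul_of_nonneg_right ?_ (Real.rpow_nonneg (norm_nonneg _) _)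
        calc (4:ℝ) ^ α ≤ 4 ^ (1:ℝ) := Real.rpow_le_rpow_of_exponent_le (by norm_num) hα1
          _ = 4 := Real.rpow_one 4
      simp only [Cc]
      nlinarith [mul_le_mul_of_nonneg_left h1 hM]
  | k + 1, M, f, hD, hf => by
      have hM := hf.nonneg
      have hC := Cc_ge k
      refine HH.mk_of_has ?_ (fun x hx => pdW_comp hΦ hm hf.diff (fun j => (hD j).diff) hx)
        fun i => ?_
      · refine (HH.comp hα0 hα1 hΦ hm hL (k := 0) (fun j => (hD j).zero) hf.zero).mono ?_
        exact mul_le_mul_of_nonneg_right (Cc_ge _) hM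
      · have h1 : ∀ j, HH α k (2 ^ (k + 1) * (Cc k * M * 2)) (fun x => pdW j f (Φ x) *
            ((if i = j then 1 else 0) + pdW i (D j) x)) := by
          intro j
          refine HH.mul (HH.comp hα0 hα1 hΦ hm hL (fun j => (hD j).of_succ) (hf.pd j)) ?_
          refine ((HH.const (c := if i = j then 1 else 0) k).add ((hD j).pd i)).mono ?_
          split_ifs <;> norm_num
        refine (HH.sum3 h1).mono ?_
        simp only [Cc]
        nlinarith

/-! Inverse -/
theorem HH.inv (m : ℝ) (hm : 0 < m) : ∀ (k : ℕ) (M : ℝ), ∃ N, 0 ≤ N ∧ ∀ f : (Fin 3 → ℝ) → ℝ,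
    HH α k M f → (∀ x ∈ Slab, m ≤ f x) → HH α k N (fun x => (f x)⁻¹)
  | 0, M => by
      refine ⟨m⁻¹ + |M| * (m⁻¹ * m⁻¹), by positivity, fun f hf h => ?_⟩
      have hM := hf.nonneg
      have hi : ∀ x ∈ Slab, |(f x)⁻¹| ≤ m⁻¹ := fun x hx => by
        have h0 : 0 < f x := hm.trans_le (h x hx)
        rw [abs_of_pos (inv_pos.mpr h0)]
        exact inv_anti₀ hm (h x hx)
      refine ⟨fun x hx => (hi x hx).trans (by have : 0 ≤ |M| * (m⁻¹ * m⁻¹) := by positivity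
                                              linarith), fun x hx y hy => ?_⟩
      have hx0 : f x ≠ 0 := (hm.trans_le (h x hx)).ne'
      have hy0 : f y ≠ 0 := (hm.trans_le (h y hy)).ne'
      have e : (f x)⁻¹ - (f y)⁻¹ = -((f x - f y) * ((f x)⁻¹ * (f y)⁻¹)) := by field_simp; ring
      rw [e, abs_neg, abs_mul, abs_mul]
      have h1 := mul_le_mul (hi x hx) (hi y hy) (abs_nonneg _) (by positivity)
      have h2 := mul_le_mul (hf.hol hx hy) h1 (by positivity)
        (mul_nonneg hM (Real.rpow_nonneg (norm_nonneg _) _))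
      rw [abs_of_nonneg hM]
      have hp : 0 ≤ ‖x - y‖ ^ α := Real.rpow_nonneg (norm_nonneg _) _
      have : 0 ≤ m⁻¹ * ‖x - y‖ ^ α := by positivity
      nlinarith
  | k + 1, M => by
      obtain ⟨N0, hN0, h0⟩ := HH.inv m hm 0 M
      obtain ⟨N, hN, h⟩ := HH.inv m hm k M
      refine ⟨N0 + 2 ^ (k + 1) * (|M| * (2 ^ (k + 1) * (N * N))), by positivity,
        fun f hf hfm => ?_⟩
      have hne : ∀ x ∈ Slab, f x ≠ 0 := fun x hx => (hm.trans_le (hfm x hx)).ne'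
      refine ⟨?_, diff_inv hf.diff hne, fun i => ?_⟩
      · refine (h0 f hf.zero hfm).mono ?_
        have : 0 ≤ 2 ^ (k + 1) * (|M| * (2 ^ (k + 1) * (N * N))) := by positivity
        linarith
      · have h1 := h f hf.of_succ hfm
        refine (((hf.pd i).mul (h1.mul h1)).neg.mono ?_).congr fun x hx =>
          (pdW_inv hf.diff hne hx i).symm
        rw [abs_of_nonneg hf.nonneg]; linarith

/-! Integrals -/
theorem HH.integral (hα : 0 < α) {a b : ℝ} (hab : a ≤ b) (hab1 : b - a ≤ 1) :
    ∀ {k : ℕ} {M : ℝ} {F : ℝ → (Fin 3 → ℝ) → ℝ}, (∀ t ∈ Icc a b, HH α k M (F t)) →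
    (∀ x ∈ Slab, ContinuousOn (fun t => F t x) (Icc a b)) →
    HH α k M (fun x => ∫ t in a..b, F t x)
  | 0, M, F, hF, hc => by
      have hM : 0 ≤ M := (hF a ⟨le_rfl, hab⟩).nonneg
      have hii : ∀ x ∈ Slab, IntervalIntegrable (fun t => F t x) MeasureTheory.volume a b :=
        fun x hx => (hc x hx).intervalIntegrable_of_Icc hab
      refine ⟨fun x hx => ?_, fun x hx y hy => ?_⟩
      · have := intervalIntegral.norm_integral_le_of_norm_le_const (a := a) (b := b) (C := M)
          (f := fun t => F t x) (fun t ht => by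
            rw [uIoc_of_le hab] at ht
            exact (hF t ⟨ht.1.le, ht.2⟩).bd hx)
        rw [Real.norm_eq_abs, abs_of_nonneg (sub_nonneg.mpr hab)] at this
        nlinarith
      · rw [← intervalIntegral.integral_sub (hii x hx) (hii y hy)]
        have := intervalIntegral.norm_integral_le_of_norm_le_const (a := a) (b := b)
          (C := M * ‖x - y‖ ^ α) (f := fun t => F t x - F t y) (fun t ht => by
            rw [uIoc_of_le hab] at ht
            exact (hF t ⟨ht.1.le, ht.2⟩).hol hx hy)
        rw [Real.norm_eq_abs, abs_of_nonneg (sub_nonneg.mpr hab)] at this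
        have hp : 0 ≤ M * ‖x - y‖ ^ α := mul_nonneg hM (Real.rpow_nonneg (norm_nonneg _) _)
        nlinarith
  | k + 1, M, F, hF, hc => by
      have hM : 0 ≤ M := (hF a ⟨le_rfl, hab⟩).nonneg
      have hii : ∀ x ∈ Slab, IntervalIntegrable (fun t => F t x) MeasureTheory.volume a b :=
        fun x hx => (hc x hx).intervalIntegrable_of_Icc hab
      have hpc : ∀ i, ∀ x ∈ Slab, ContinuousOn (fun t => pdW i (F t) x) (Icc a b) := by
        intro i x hx t ht
        exact HH.lim_pd (k := k) (M := M) hα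
          (by filter_upwards [self_mem_nhdsWithin] with s hs using hF s hs)
          (fun y hy => hc y hy t ht) i hx
      have hpi : ∀ i, ∀ x ∈ Slab,
          IntervalIntegrable (fun t => pdW i (F t) x) MeasureTheory.volume a b :=
        fun i x hx => (hpc i x hx).intervalIntegrable_of_Icc hab
      refine HH.mk_of_has (g := fun i x => ∫ t in a..b, pdW i (F t) x)
        (HH.integral hα hab hab1 (k := 0) (fun t ht => (hF t ht).zero) hc) (fun x hx => ?_)
        fun i => HH.integral hα hab hab1 (fun t ht => (hF t ht).pd i) (hpc i)
      refine has_of_taylor (K := 3 * M) hα fun y hy => ?_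
      have e : (∫ t in a..b, F t y) - (∫ t in a..b, F t x) -
          ∑ i, (∫ t in a..b, pdW i (F t) x) * (y - x) i =
          ∫ t in a..b, (F t y - F t x - ∑ i, pdW i (F t) x * (y - x) i) := by
        have hs : IntervalIntegrable (fun t => ∑ i, pdW i (F t) x * (y - x) i)
            MeasureTheory.volume a b :=
          (continuousOn_finset_sum _ fun i _ =>
            (hpc i x hx).mul continuousOn_const).intervalIntegrable_of_Icc hab
        rw [intervalIntegral.integral_sub ((hii y hy).sub (hii x hx)) hs,
          intervalIntegral.integral_sub (hii y hy) (hii x hx),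
          intervalIntegral.integral_finsetSum fun i _ => (hpi i x hx).mul_const _]
        simp only [intervalIntegral.integral_mul_const]
      rw [e]
      have := intervalIntegral.norm_integral_le_of_norm_le_const (a := a) (b := b)
          (C := 3 * (M * ‖y - x‖ ^ α) * ‖y - x‖)
          (f := fun t => F t y - F t x - ∑ i, pdW i (F t) x * (y - x) i) (fun t ht => by
            rw [uIoc_of_le hab] at ht
            exact (hF t ⟨ht.1.le, ht.2⟩).taylor hα.le hx hy)
      rw [Real.norm_eq_abs, abs_of_nonneg (sub_nonneg.mpr hab)] at this
      have hp : 0 ≤ 3 * (M * ‖y - x‖ ^ α) * ‖y - x‖ := by positivity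
      nlinarith

end Inc

set_option linter.unusedVariables false
set_option linter.unusedSimpArgs false
open Set Filter Topology MeasureTheory

namespace Inc

variable {α : ℝ}

/-- Gaussian density on `ℝ³`. -/
noncomputable def gk (z : Fin 3 → ℝ) : ℝ := (Real.sqrt (2 * Real.pi) ^ 3)⁻¹ * ∏ j, Real.exp (-(1/2) * (z j) ^ 2)

theorem gk_nonneg (z : Fin 3 → ℝ) : 0 ≤ gk z := by unfold gk; positivity

theorem gk_cont : Continuous gk := by unfold gk; fun_prop

theorem integrable_gauss (b : ℝ) (hb : 0 < b) :
    Integrable (fun z : Fin 3 → ℝ => ∏ j, Real.exp (-b * (z j) ^ 2)) :=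
  Integrable.fintype_prod (f := fun (_ : Fin 3) (t : ℝ) => Real.exp (-b * t ^ 2))
    fun _ => integrable_exp_neg_mul_sq hb

theorem gk_int : ∫ z, gk z = 1 := by
  unfold gk
  rw [integral_const_mul, integral_fintype_prod_volume_eq_pow (fun t : ℝ => Real.exp (-(1/2) * t ^ 2)),
    integral_gaussian]
  have : Real.pi / (1 / 2) = 2 * Real.pi := by ring
  rw [this]
  have h : Real.sqrt (2 * Real.pi) ≠ 0 := by positivity
  simp; field_simp

/-- Dominating weight. -/
noncomputable def Gk (z : Fin 3 → ℝ) : ℝ := (1 + ∑ j, (z j) ^ 2) * gk z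

theorem Gk_nonneg (z : Fin 3 → ℝ) : 0 ≤ Gk z := by
  have := gk_nonneg z
  unfold Gk; positivity

theorem Gk_integrable : Integrable Gk := by
  have h := (integrable_gauss (3/8) (by norm_num)).const_mul (8 * (Real.sqrt (2 * Real.pi) ^ 3)⁻¹)
  have hc : Continuous Gk := by unfold Gk; have := gk_cont; fun_prop
  refine h.mono' hc.aestronglyMeasurable (Eventually.of_forall fun z => ?_)
  rw [Real.norm_eq_abs, abs_of_nonneg (Gk_nonneg z)]
  unfold Gk gk
  rw [← Real.exp_sum, ← Real.exp_sum]
  have h1 : 1 + ∑ j, (z j) ^ 2 ≤ 8 * Real.exp ((∑ j, (z j) ^ 2) / 8) := by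
    have := Real.add_one_le_exp ((∑ j, (z j) ^ 2) / 8)
    linarith
  have h2 : Real.exp (∑ j, -(3/8) * (z j) ^ 2) =
      Real.exp ((∑ j, (z j) ^ 2) / 8) * Real.exp (∑ j, -(1/2) * (z j) ^ 2) := by
    rw [← Real.exp_add]; congr 1
    simp only [← Finset.mul_sum]; ring
  rw [h2]
  have h3 : 0 ≤ (Real.sqrt (2 * Real.pi) ^ 3)⁻¹ * Real.exp (∑ j, -(1/2) * (z j) ^ 2) := by positivity
  nlinarith [mul_le_mul_of_nonneg_right h1 h3]

/-- Total mass of the dominating weight. -/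
noncomputable def kap : ℝ := ∫ z, Gk z

theorem kap_nonneg : 0 ≤ kap := integral_nonneg Gk_nonneg

/-- Weights: density or `z_i` times density. -/
noncomputable def wt : Option (Fin 3) → (Fin 3 → ℝ) → ℝ
  | none, z => gk z
  | some i, z => z i * gk z

theorem wt_cont (o : Option (Fin 3)) : Continuous (wt o) := by
  cases o
  · exact gk_cont
  · exact (continuous_apply _).mul gk_cont

theorem sq_le_sum (z : Fin 3 → ℝ) (i : Fin 3) : (z i) ^ 2 ≤ ∑ j, (z j) ^ 2 :=
  Finset.single_le_sum (f := fun j => (z j) ^ 2) (fun j _ => sq_nonneg _) (Finset.mem_univ i)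

theorem wt_le (o : Option (Fin 3)) (z : Fin 3 → ℝ) : |wt o z| ≤ Gk z := by
  have hg := gk_nonneg z
  cases o with
  | none =>
    simp only [wt, Gk]
    rw [abs_of_nonneg hg]
    have : 0 ≤ ∑ j, (z j) ^ 2 := Finset.sum_nonneg fun j _ => sq_nonneg _
    nlinarith
  | some i =>
    simp only [wt, Gk]
    rw [abs_mul, abs_of_nonneg hg]
    refine mul_le_mul_of_nonneg_right ?_ hg
    have := sq_le_sum z i
    nlinarith [sq_nonneg (|z i| - 1), sq_abs (z i)]

theorem wt_integrable (o : Option (Fin 3)) : Integrable (wt o) :=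
  Gk_integrable.mono' (wt_cont o).aestronglyMeasurable (Eventually.of_forall fun z => wt_le o z)

theorem wt_norm_int (o : Option (Fin 3)) : ∫ z, |wt o z| ≤ kap :=
  integral_mono (wt_integrable o).abs Gk_integrable fun z => wt_le o z

/-- Bounded measurable functions. -/
def BM (A : ℝ) (f : (Fin 3 → ℝ) → ℝ) : Prop := Measurable f ∧ ∀ x, |f x| ≤ A

theorem BM.nonneg {A : ℝ} {f : (Fin 3 → ℝ) → ℝ} (h : BM A f) : 0 ≤ A :=
  (abs_nonneg _).trans (h.2 0)

/-- Gaussian averages. -/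
noncomputable def Av (o : Option (Fin 3)) (s : ℝ) (f : (Fin 3 → ℝ) → ℝ) (x : Fin 3 → ℝ) : ℝ :=
  ∫ z, wt o z * f (x + s • z)

theorem shift_meas (x : Fin 3 → ℝ) (s : ℝ) : Measurable fun z : Fin 3 → ℝ => x + s • z := by
  fun_prop

theorem Av_integrand {A : ℝ} {f : (Fin 3 → ℝ) → ℝ} (h : BM A f) (o : Option (Fin 3)) (s : ℝ)
    (x : Fin 3 → ℝ) : Integrable fun z => wt o z * f (x + s • z) :=
  (wt_integrable o).mul_bdd (c := A) (h.1.comp (shift_meas x s)).aestronglyMeasurable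
    (Eventually.of_forall fun z => h.2 _)

theorem Av_le {A : ℝ} {f : (Fin 3 → ℝ) → ℝ} (h : BM A f) (o : Option (Fin 3)) (s : ℝ)
    (x : Fin 3 → ℝ) : |Av o s f x| ≤ kap * A := by
  have h1 : |Av o s f x| ≤ ∫ z, Gk z * A :=
    norm_integral_le_of_norm_le (f := fun z => wt o z * f (x + s • z))
      (Gk_integrable.mul_const A) (Eventually.of_forall fun z => by
      rw [Real.norm_eq_abs, abs_mul]
      exact mul_le_mul (wt_le o z) (h.2 _) (abs_nonneg _) (Gk_nonneg z))
  rwa [integral_mul_const] at h1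

theorem Av_none_le {A : ℝ} {f : (Fin 3 → ℝ) → ℝ} (h : BM A f) (s : ℝ)
    (x : Fin 3 → ℝ) : |Av none s f x| ≤ A := by
  have h1 : |Av none s f x| ≤ ∫ z, gk z * A :=
    norm_integral_le_of_norm_le (f := fun z => wt none z * f (x + s • z))
      ((wt_integrable none).mul_const A) (Eventually.of_forall fun z => by
      rw [Real.norm_eq_abs, abs_mul]
      exact mul_le_mul (by simp [wt, abs_of_nonneg (gk_nonneg z)]) (h.2 _) (abs_nonneg _) (gk_nonneg z))
  rwa [integral_mul_const, gk_int, one_mul] at h1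

/-- Joint measurability. -/
theorem Av_meas2 {β : Type*} [MeasurableSpace β] {f : β → (Fin 3 → ℝ) → ℝ} {s : β → ℝ}
    {X : β → (Fin 3 → ℝ)}
    (hf : Measurable (Function.uncurry f)) (hs : Measurable s) (hX : Measurable X)
    (o : Option (Fin 3)) :
    Measurable fun b => Av o (s b) (f b) (X b) := by
  have h : Measurable (Function.uncurry fun (b : β) (z : Fin 3 → ℝ) => wt o z * f b (X b + s b • z)) := by
    refine ((wt_cont o).measurable.comp measurable_snd).mul ?_
    have h1 : Measurable fun p : β × (Fin 3 → ℝ) => (p.1, X p.1 + s p.1 • p.2) := by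
      refine measurable_fst.prodMk ((hX.comp measurable_fst).add ?_)
      exact (hs.comp measurable_fst).smul measurable_snd
    exact hf.comp h1
  exact (StronglyMeasurable.integral_prod_right h.stronglyMeasurable).measurable

theorem Av_BM {A : ℝ} {f : (Fin 3 → ℝ) → ℝ} (h : BM A f) (o : Option (Fin 3)) (s : ℝ) :
    BM (kap * A) (Av o s f) :=
  ⟨Av_meas2 (β := Fin 3 → ℝ) (f := fun _ => f) (s := fun _ => s) (X := id)
    (h.1.comp measurable_snd) measurable_const measurable_id o, fun x => Av_le h o s x⟩

theorem Av_none_BM {A : ℝ} {f : (Fin 3 → ℝ) → ℝ} (h : BM A f) (s : ℝ) :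
    BM A (Av none s f) := ⟨(Av_BM h none s).1, fun x => Av_none_le h s x⟩

theorem Av_comm {A : ℝ} {f : (Fin 3 → ℝ) → ℝ} (h : BM A f) (o o' : Option (Fin 3)) (s s' : ℝ) :
    Av o s (Av o' s' f) = Av o' s' (Av o s f) := by
  funext x
  unfold Av
  simp_rw [← integral_const_mul]
  rw [integral_integral_swap]
  · congr 1; funext z'; congr 1; funext z
    rw [add_right_comm]; ring
  · have h1 : Integrable (fun p : (Fin 3 → ℝ) × (Fin 3 → ℝ) => wt o p.1 * wt o' p.2)
      (volume.prod volume) := (wt_integrable o).mul_prod (wt_integrable o')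
    have h2 : Measurable fun p : (Fin 3 → ℝ) × (Fin 3 → ℝ) => f (x + s • p.1 + s' • p.2) :=
      h.1.comp (by fun_prop)
    refine (h1.mul_bdd (c := A) h2.aestronglyMeasurable (Eventually.of_forall fun p => h.2 _)).congr
      (Eventually.of_forall fun p => ?_)
    simp [Function.uncurry]; ring

/-- Partial derivatives on the whole space. -/
def PD (i : Fin 3) (f g : (Fin 3 → ℝ) → ℝ) : Prop :=
  ∀ x, HasDerivAt (fun h : ℝ => f (x + Pi.single i h)) (g x) 0

theorem PD.at {i : Fin 3} {f g : (Fin 3 → ℝ) → ℝ} (h : PD i f g) (x : Fin 3 → ℝ) (t : ℝ) :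
    HasDerivAt (fun h : ℝ => f (x + Pi.single i h)) (g (x + Pi.single i t)) t := by
  have h1 := h (x + Pi.single i t)
  have h2 : HasDerivAt (fun r : ℝ => r - t) 1 t := (hasDerivAt_id t).sub_const t
  have h3 : HasDerivAt (fun h : ℝ => f (x + Pi.single i t + Pi.single i h)) (g (x + Pi.single i t))
    (t - t) := by rw [sub_self]; exact h1
  have h4 := HasDerivAt.comp (h := fun r : ℝ => r - t) t h3 h2
  rw [mul_one] at h4
  refine h4.congr_of_eventuallyEq (Eventually.of_forall fun r => ?_)
  simp only [Function.comp]
  rw [add_assoc, ← Pi.single_add]; congr 3; ring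

theorem PD.unique {i : Fin 3} {f g g' : (Fin 3 → ℝ) → ℝ} (h : PD i f g) (h' : PD i f g') : g = g' :=
  funext fun x => (h x).unique (h' x)

theorem Av_PD {i : Fin 3} {A B : ℝ} {f g : (Fin 3 → ℝ) → ℝ} (h : PD i f g) (hf : BM A f)
    (hg : BM B g) (o : Option (Fin 3)) (s : ℝ) : PD i (Av o s f) (Av o s g) := by
  intro x
  have := (hasDerivAt_integral_of_dominated_loc_of_deriv_le (μ := volume)
    (F := fun (h : ℝ) (z : Fin 3 → ℝ) => wt o z * f (x + Pi.single i h + s • z))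
    (F' := fun (h : ℝ) (z : Fin 3 → ℝ) => wt o z * g (x + Pi.single i h + s • z))
    (x₀ := (0:ℝ)) (s := univ) (bound := fun z => Gk z * B) univ_mem
    (Eventually.of_forall fun h => (Av_integrand hf o s _).aestronglyMeasurable)
    (Av_integrand hf o s _) (Av_integrand hg o s _).aestronglyMeasurable
    (Eventually.of_forall fun z h _ => by
      rw [Real.norm_eq_abs, abs_mul]
      exact mul_le_mul (wt_le o z) (hg.2 _) (abs_nonneg _) (Gk_nonneg z))
    (Gk_integrable.mul_const B)
    (Eventually.of_forall fun z h _ => by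
      have := (PD.at ‹PD i f g› (x + s • z) h).const_mul (wt o z)
      rw [add_right_comm x] at this
      refine this.congr_of_eventuallyEq (Eventually.of_forall fun r => ?_)
      simp only [add_right_comm x])).2
  simpa [Av] using this

theorem gk_shift (z : Fin 3 → ℝ) (i : Fin 3) (a : ℝ) :
    HasDerivAt (fun a => gk (z - Pi.single i a)) ((z i - a) * gk (z - Pi.single i a)) a := by
  unfold gk
  have e : ∀ a : ℝ, ∏ j, Real.exp (-(1/2) * ((z - Pi.single i a : Fin 3 → ℝ) j) ^ 2) =
      Real.exp (∑ j, -(1/2) * ((z - Pi.single i a : Fin 3 → ℝ) j) ^ 2) := fun a => (Real.exp_sum _ _).symm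
  simp only [e]
  have h1 : HasDerivAt (fun a : ℝ => ∑ j, -(1/2) * ((z - Pi.single i a : Fin 3 → ℝ) j) ^ 2)
      (z i - a) a := by
    have : ∀ j ∈ Finset.univ, HasDerivAt (fun a : ℝ => -(1/2) * ((z - Pi.single i a : Fin 3 → ℝ) j) ^ 2)
        (if j = i then z i - a else 0) a := by
      intro j _
      by_cases hj : j = i
      · subst hj
        simp only [Pi.sub_apply, Pi.single_eq_same, if_true]
        have := (((hasDerivAt_id a).const_sub (z j)).pow 2).const_mul (-(1/2):ℝ)
        refine this.congr_deriv ?_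
        simp
      · simp only [Pi.sub_apply, Pi.single_eq_of_ne hj, if_neg hj]
        exact hasDerivAt_const _ _
    have := HasDerivAt.fun_sum this
    simpa using this
  have := h1.exp.const_mul ((Real.sqrt (2 * Real.pi) ^ 3)⁻¹)
  refine this.congr_deriv ?_
  ring

/-- Domination of the shifted kernel. -/
theorem gk_dom : ∃ H : (Fin 3 → ℝ) → ℝ, Integrable H ∧ ∀ (z : Fin 3 → ℝ) (i : Fin 3) (a : ℝ),
    |a| ≤ 1 → |(z i - a) * gk (z - Pi.single i a)| ≤ H z := by
  refine ⟨fun z => (Real.sqrt (2 * Real.pi) ^ 3)⁻¹ * (Real.exp 1 * ∏ j, Real.exp (-(1/8) * (z j) ^ 2)),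
    ((integrable_gauss (1/8) (by norm_num)).const_mul _).const_mul _, fun z i a ha => ?_⟩
  rw [abs_mul, abs_of_nonneg (gk_nonneg _)]
  unfold gk
  rw [mul_left_comm]
  refine mul_le_mul_of_nonneg_left ?_ (by positivity)
  rw [← Real.exp_sum, ← Real.exp_sum, ← Real.exp_add]
  set y := z i - a with hy
  have h1 : |y| ≤ Real.exp (y ^ 2 / 4) := by
    have := Real.add_one_le_exp (y ^ 2 / 4)
    nlinarith [sq_nonneg (|y| - 2), sq_abs y]
  refine (mul_le_mul_of_nonneg_right h1 (Real.exp_pos _).le).trans ?_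
  rw [← Real.exp_add]
  refine Real.exp_le_exp.mpr ?_
  have hsq : a ^ 2 ≤ 1 := by nlinarith [abs_nonneg a, sq_abs a]
  have h2 : y ^ 2 ≥ (z i) ^ 2 / 2 - 1 := by rw [hy]; nlinarith [sq_nonneg (z i - 2 * a)]
  have h0 := sq_nonneg (z 0)
  have h10 := sq_nonneg (z 1)
  have h20 := sq_nonneg (z 2)
  have h3 : ∑ j, -(1/2) * ((z - Pi.single i a : Fin 3 → ℝ) j) ^ 2 =
      -(1/2) * (∑ j, (z j) ^ 2) + (1/2) * (z i) ^ 2 - (1/2) * y ^ 2 := by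
    clear_value y; subst hy
    fin_cases i <;> simp [Fin.sum_univ_three, Pi.single_apply] <;> ring
  have h4 : ∑ j, -(1/8) * (z j) ^ 2 = -(1/8) * (∑ j, (z j) ^ 2) := by rw [Finset.mul_sum]
  rw [h3, h4]
  have h5 := sq_le_sum z i
  nlinarith

theorem Av_shift {f : (Fin 3 → ℝ) → ℝ} (i : Fin 3) {s : ℝ} (hs : 0 < s) (x : Fin 3 → ℝ) (h : ℝ) :
    Av none s f (x + Pi.single i h) =
      ∫ z, gk (z - Pi.single i (s⁻¹ * h)) * f (x + s • z) := by
  have := integral_add_right_eq_self (μ := (volume : Measure (Fin 3 → ℝ)))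
    (fun z => gk (z - Pi.single i (s⁻¹ * h)) * f (x + s • z)) (Pi.single i (s⁻¹ * h))
  rw [← this]
  unfold Av
  congr 1; funext z
  simp only [wt, add_sub_cancel_right, smul_add]
  congr 2
  have h2 : s • (Pi.single i (s⁻¹ * h) : Fin 3 → ℝ) = Pi.single i h := by
    rw [← Pi.single_smul, smul_eq_mul, mul_inv_cancel_left₀ hs.ne']
  rw [h2, add_assoc, add_comm (s • z)]

theorem gk_shift' (z : Fin 3 → ℝ) (i : Fin 3) (s c h : ℝ) :
    HasDerivAt (fun h => gk (z - Pi.single i (s⁻¹ * h)) * c)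
      ((z i - s⁻¹ * h) * gk (z - Pi.single i (s⁻¹ * h)) * s⁻¹ * c) h := by
  have h1 : HasDerivAt (fun h : ℝ => s⁻¹ * h) s⁻¹ h := by
    simpa using (hasDerivAt_id h).const_mul s⁻¹
  exact (HasDerivAt.comp (h := fun h : ℝ => s⁻¹ * h) h (gk_shift z i (s⁻¹ * h)) h1).mul_const c

theorem dom_deriv {G G' : ℝ → (Fin 3 → ℝ) → ℝ} {S : Set ℝ} {bound : (Fin 3 → ℝ) → ℝ} {x₀ : ℝ}
    (hs : S ∈ 𝓝 x₀)
    (hF_meas : ∀ᶠ x in 𝓝 x₀, AEStronglyMeasurable (G x) volume) (hF_int : Integrable (G x₀) volume)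
    (hF'_meas : AEStronglyMeasurable (G' x₀) volume)
    (h_bound : ∀ a, ∀ x ∈ S, ‖G' x a‖ ≤ bound a) (bound_integrable : Integrable bound volume)
    (h_diff : ∀ a, ∀ x ∈ S, HasDerivAt (fun x => G x a) (G' x a) x) :
    HasDerivAt (fun n ↦ ∫ a, G n a) (∫ a, G' x₀ a) x₀ :=
  (hasDerivAt_integral_of_dominated_loc_of_deriv_le hs hF_meas hF_int hF'_meas
    (Eventually.of_forall h_bound) bound_integrable (Eventually.of_forall h_diff)).2

theorem shift_deriv {A : ℝ} {F : (Fin 3 → ℝ) → ℝ} (hF : BM A F) (i : Fin 3) {s : ℝ} (hs : 0 < s) :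
    HasDerivAt (fun h : ℝ => ∫ z, gk (z - Pi.single i (s⁻¹ * h)) * F z)
      (∫ z, (z i - s⁻¹ * 0) * gk (z - Pi.single i (s⁻¹ * 0)) * s⁻¹ * F z) 0 := by
  obtain ⟨H, hH, hd⟩ := gk_dom
  have hgm : ∀ h : ℝ, Measurable fun z : Fin 3 → ℝ => gk (z - Pi.single i (s⁻¹ * h)) := fun h =>
    gk_cont.measurable.comp (measurable_id.sub_const _)
  have hi : Integrable (fun z => gk (z - Pi.single i (s⁻¹ * 0)) * F z) := by
    have h1 := (wt_integrable none).mul_bdd (c := A) hF.1.aestronglyMeasurable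
      (Eventually.of_forall fun z => hF.2 z)
    simpa [wt] using h1
  have hb : ∀ z : Fin 3 → ℝ, ∀ h ∈ Icc (-s) s,
      ‖(z i - s⁻¹ * h) * gk (z - Pi.single i (s⁻¹ * h)) * s⁻¹ * F z‖ ≤ H z * s⁻¹ * A := by
    intro z h hh
    rw [Real.norm_eq_abs, abs_mul, abs_mul, abs_of_pos (inv_pos.mpr hs)]
    have h1 := hd z i (s⁻¹ * h) (by
      rw [abs_mul, abs_of_pos (inv_pos.mpr hs), inv_mul_le_iff₀ hs, mul_one]
      exact abs_le.mpr hh)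
    have h3 : 0 ≤ H z := (abs_nonneg _).trans h1
    exact mul_le_mul (mul_le_mul_of_nonneg_right h1 (inv_pos.mpr hs).le) (hF.2 _) (abs_nonneg _)
      (mul_nonneg h3 (inv_pos.mpr hs).le)
  have hm' : AEStronglyMeasurable (fun z : Fin 3 → ℝ =>
      (z i - s⁻¹ * 0) * gk (z - Pi.single i (s⁻¹ * 0)) * s⁻¹ * F z) volume :=
    (((((measurable_pi_apply i).sub_const _).mul (hgm 0)).mul_const _).mul hF.1).aestronglyMeasurable
  have hH2 : Integrable (fun z => H z * s⁻¹ * A) := (hH.mul_const _).mul_const _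
  have hnhds : Icc (-s) s ∈ 𝓝 (0:ℝ) := Icc_mem_nhds (by linarith) hs
  have hm : ∀ᶠ h in 𝓝 (0:ℝ), AEStronglyMeasurable
      (fun z => gk (z - Pi.single i (s⁻¹ * h)) * F z) volume :=
    Eventually.of_forall fun h => ((hgm h).mul hF.1).aestronglyMeasurable
  have hd2 : ∀ z : Fin 3 → ℝ, ∀ h ∈ Icc (-s) s,
      HasDerivAt (fun h => gk (z - Pi.single i (s⁻¹ * h)) * F z)
      ((z i - s⁻¹ * h) * gk (z - Pi.single i (s⁻¹ * h)) * s⁻¹ * F z) h :=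
    fun z h _ => gk_shift' z i s (F z) h
  exact dom_deriv hnhds hm hi hm' hb hH2 hd2

/-- The partial derivative of a Gaussian average. -/
theorem Av_deriv {A : ℝ} {f : (Fin 3 → ℝ) → ℝ} (hf : BM A f) (i : Fin 3) {s : ℝ} (hs : 0 < s) :
    PD i (Av none s f) (fun x => s⁻¹ * Av (some i) s f x) := by
  intro x
  simp only [Av_shift i hs]
  have e1 : s⁻¹ * Av (some i) s f x = ∫ z, (z i - s⁻¹ * 0) * gk (z - Pi.single i (s⁻¹ * 0)) * s⁻¹ *
      f (x + s • z) := by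
    simp only [mul_zero, Pi.single_zero, sub_zero]
    unfold Av
    rw [← integral_const_mul]
    congr 1; funext z; simp only [wt]; ring
  rw [e1]
  exact shift_deriv (F := fun z => f (x + s • z)) ⟨hf.1.comp (shift_meas x s), fun z => hf.2 _⟩ i hs

/-- Reflection of the `i`-th coordinate. -/
def refl (i : Fin 3) (z : Fin 3 → ℝ) : Fin 3 → ℝ := fun j => if j = i then - z j else z j

theorem refl_mp (i : Fin 3) : MeasurePreserving (refl i) (volume : Measure (Fin 3 → ℝ)) volume := by
  have := volume_preserving_pi (ι := Fin 3) (α' := fun _ => ℝ) (β' := fun _ => ℝ)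
    (f := fun j t => if j = i then - t else t) (fun j => by
      by_cases h : j = i
      · simp only [h, if_true]; exact Measure.measurePreserving_neg volume
      · simp only [h, if_false]; exact MeasurePreserving.id volume)
  exact this

theorem refl_int (i : Fin 3) {F : (Fin 3 → ℝ) → ℝ} (hF : Measurable F) :
    ∫ z, F (refl i z) = ∫ z, F z := by
  conv_rhs => rw [← (refl_mp i).map_eq]
  rw [integral_map (refl_mp i).measurable.aemeasurable hF.aestronglyMeasurable]

theorem gk_refl (i : Fin 3) (z : Fin 3 → ℝ) : gk (refl i z) = gk z := by
  unfold gk refl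
  congr 1
  refine Finset.prod_congr rfl fun j _ => ?_
  split_ifs <;> simp

/-- Tangential Hölder continuity. -/
def TH (α A : ℝ) (f : (Fin 3 → ℝ) → ℝ) : Prop :=
  ∀ x, ∀ i : Fin 3, i ≠ 0 → ∀ h : ℝ, |f (x + Pi.single i h) - f x| ≤ A * |h| ^ α

theorem Av_tan (hα0 : 0 ≤ α) (hα1 : α ≤ 1) {A : ℝ} {f : (Fin 3 → ℝ) → ℝ} (hf : BM A f)
    (ht : TH α A f) {i : Fin 3} (hi : i ≠ 0) {s : ℝ} (hs : 0 ≤ s) (x : Fin 3 → ℝ) :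
    |Av (some i) s f x| ≤ kap * (A * s ^ α) := by
  have hA := hf.nonneg
  have hm : Measurable fun z => wt (some i) z * f (x + s • z) :=
    (wt_cont _).measurable.mul (hf.1.comp (shift_meas x s))
  have e : Av (some i) s f x = - ∫ z, wt (some i) z * f (x + s • refl i z) := by
    unfold Av
    rw [← refl_int i hm, ← integral_neg]
    congr 1; funext z
    simp only [wt, gk_refl]
    simp [refl]
  have hIntg : Integrable fun z => wt (some i) z * f (x + s • refl i z) :=
    (wt_integrable _).mul_bdd (c := A)
      ((hf.1.comp (shift_meas x s)).comp (refl_mp i).measurable).aestronglyMeasurable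
      (Eventually.of_forall fun z => hf.2 _)
  have e2 : Av (some i) s f x = ∫ z, (1/2) * (wt (some i) z * (f (x + s • z) - f (x + s • refl i z))) := by
    rw [integral_const_mul]
    simp only [mul_sub]
    rw [integral_sub (Av_integrand hf _ s x) hIntg]
    have : Av (some i) s f x = ∫ z, wt (some i) z * f (x + s • z) := rfl
    linarith
  rw [e2]
  have h1 : |∫ z, (1/2) * (wt (some i) z * (f (x + s • z) - f (x + s • refl i z)))| ≤
      ∫ z, Gk z * (A * s ^ α) := by
    refine norm_integral_le_of_norm_le
      (f := fun z => (1/2) * (wt (some i) z * (f (x + s • z) - f (x + s • refl i z))))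
      (Gk_integrable.mul_const _) (Eventually.of_forall fun z => ?_)
    have e3 : x + s • z = (x + s • refl i z) + Pi.single i (2 * s * z i) := by
      funext j
      by_cases hj : j = i
      · subst hj; simp [refl]; ring
      · simp [refl, hj]
    have h2 := ht (x + s • refl i z) i hi (2 * s * z i)
    rw [← e3] at h2
    rw [Real.norm_eq_abs, abs_mul, abs_mul]
    simp only [wt]
    rw [abs_mul, abs_of_nonneg (gk_nonneg z)]
    have h3 : |2 * s * z i| ^ α ≤ 2 * (s ^ α * |z i| ^ α) := by
      rw [abs_mul, abs_mul, abs_of_nonneg hs, Real.mul_rpow (by positivity) (abs_nonneg _),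
        Real.mul_rpow (by positivity) hs, mul_assoc]
      refine mul_le_mul_of_nonneg_right ?_ (by positivity)
      simp only [abs_two]
      calc (2:ℝ) ^ α ≤ 2 ^ (1:ℝ) := Real.rpow_le_rpow_of_exponent_le (by norm_num) hα1
        _ = 2 := Real.rpow_one 2
    have h4 : |z i| * |z i| ^ α ≤ 1 + ∑ j, (z j) ^ 2 := by
      have hsq := sq_le_sum z i
      rcases le_total |z i| 1 with h | h
      · have : |z i| ^ α ≤ 1 := Real.rpow_le_one (abs_nonneg _) h hα0
        have hp : 0 ≤ |z i| ^ α := by positivity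
        nlinarith [abs_nonneg (z i), sq_nonneg (z i)]
      · have : |z i| ^ α ≤ |z i| := by
          calc |z i| ^ α ≤ |z i| ^ (1:ℝ) := Real.rpow_le_rpow_of_exponent_le h hα1
            _ = |z i| := Real.rpow_one _
        nlinarith [abs_nonneg (z i), sq_abs (z i)]
    have hg := gk_nonneg z
    have hsα : 0 ≤ s ^ α := by positivity
    have h5 : |f (x + s • z) - f (x + s • refl i z)| ≤ A * (2 * (s ^ α * |z i| ^ α)) :=
      h2.trans (mul_le_mul_of_nonneg_left h3 hA)
    calc |(1/2:ℝ)| * (|z i| * gk z * |f (x + s • z) - f (x + s • refl i z)|)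
        ≤ (1/2) * (|z i| * gk z * (A * (2 * (s ^ α * |z i| ^ α)))) := by
          rw [abs_of_pos (by norm_num : (0:ℝ) < 1/2)]
          gcongr
      _ = (|z i| * |z i| ^ α) * (gk z * (A * s ^ α)) := by ring
      _ ≤ (1 + ∑ j, (z j) ^ 2) * (gk z * (A * s ^ α)) := by gcongr
      _ = Gk z * (A * s ^ α) := by unfold Gk; ring
  rwa [integral_mul_const] at h1

attribute [irreducible] Av

end Inc

set_option linter.unusedVariables false
set_option linter.unusedSimpArgs false
open Set Filter Topology MeasureTheory
namespace Inc
variable {α : ℝ}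

/-- Triple Gaussian average. -/
noncomputable def T (o1 o2 o3 : Option (Fin 3)) (s : ℝ) (f : (Fin 3 → ℝ) → ℝ) : (Fin 3 → ℝ) → ℝ :=
  Av o1 s (Av o2 s (Av o3 s f))

theorem T_meas {f : (Fin 3 → ℝ) → ℝ} (hf : Measurable f) (o1 o2 o3 : Option (Fin 3)) :
    Measurable fun p : ℝ × (Fin 3 → ℝ) => T o1 o2 o3 p.1 f p.2 := by
  unfold T
  have h3 : ∀ {β : Type} [MeasurableSpace β] (s : β → ℝ) (hs : Measurable s) ,
      Measurable (Function.uncurry fun (b : β) (y : Fin 3 → ℝ) => Av o3 (s b) f y) := by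
    intro β _ s hs
    exact Av_meas2 (β := β × (Fin 3 → ℝ)) (f := fun _ => f) (s := fun b => s b.1)
      (X := fun b => b.2) (hf.comp measurable_snd) (hs.comp measurable_fst) measurable_snd o3
  have h2 : ∀ {β : Type} [MeasurableSpace β] (s : β → ℝ) (hs : Measurable s) ,
      Measurable (Function.uncurry fun (b : β) (y : Fin 3 → ℝ) => Av o2 (s b) (Av o3 (s b) f) y) := by
    intro β _ s hs
    exact Av_meas2 (β := β × (Fin 3 → ℝ)) (f := fun b => Av o3 (s b.1) f) (s := fun b => s b.1)
      (X := fun b => b.2) (h3 (fun b : β × (Fin 3 → ℝ) => s b.1) (hs.comp measurable_fst)) (hs.comp measurable_fst) measurable_snd o2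
  exact Av_meas2 (β := ℝ × (Fin 3 → ℝ)) (f := fun b => Av o2 b.1 (Av o3 b.1 f)) (s := fun b => b.1)
      (X := fun b => b.2) (h2 (fun b : ℝ × (Fin 3 → ℝ) => b.1) measurable_fst) measurable_fst measurable_snd o1

theorem T_meas_s {f : (Fin 3 → ℝ) → ℝ} (hf : Measurable f) (o1 o2 o3 : Option (Fin 3)) (x : Fin 3 → ℝ) :
    Measurable fun s : ℝ => T o1 o2 o3 s f x :=
  (T_meas hf o1 o2 o3).comp (measurable_id.prodMk measurable_const)

theorem T_swap12 {A : ℝ} {f : (Fin 3 → ℝ) → ℝ} (h : BM A f) (o1 o2 o3 : Option (Fin 3)) (s : ℝ) :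
    T o1 o2 o3 s f = T o2 o1 o3 s f := Av_comm (Av_BM h o3 s) o1 o2 s s

theorem T_swap23 {A : ℝ} {f : (Fin 3 → ℝ) → ℝ} (h : BM A f) (o1 o2 o3 : Option (Fin 3)) (s : ℝ) :
    T o1 o2 o3 s f = T o1 o3 o2 s f := by
  unfold T; rw [Av_comm h o2 o3 s s]

theorem T_BM {A : ℝ} {f : (Fin 3 → ℝ) → ℝ} (h : BM A f) (o1 o2 o3 : Option (Fin 3)) (s : ℝ) :
    BM (kap ^ 3 * A) (T o1 o2 o3 s f) := by
  have := Av_BM (Av_BM (Av_BM h o3 s) o2 s) o1 s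
  rwa [show kap * (kap * (kap * A)) = kap ^ 3 * A by ring] at this

theorem T_nnn_BM {A : ℝ} {f : (Fin 3 → ℝ) → ℝ} (h : BM A f) (s : ℝ) :
    BM A (T none none none s f) := Av_none_BM (Av_none_BM (Av_none_BM h s) s) s

theorem T_tan_BM (hα0 : 0 ≤ α) (hα1 : α ≤ 1) {A : ℝ} {f : (Fin 3 → ℝ) → ℝ} (hf : BM A f)
    (ht : TH α A f) {i : Fin 3} (hi : i ≠ 0) (o1 o2 : Option (Fin 3)) {s : ℝ} (hs : 0 ≤ s) :
    BM (kap ^ 3 * A * s ^ α) (T o1 o2 (some i) s f) := by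
  have h1 : BM (kap * (A * s ^ α)) (Av (some i) s f) :=
    ⟨(Av_BM hf (some i) s).1, Av_tan hα0 hα1 hf ht hi hs⟩
  have := Av_BM (Av_BM h1 o2 s) o1 s
  rwa [show kap * (kap * (kap * (A * s ^ α))) = kap ^ 3 * A * s ^ α by ring] at this

theorem T_PD {A : ℝ} {f : (Fin 3 → ℝ) → ℝ} (h : BM A f) (k : Fin 3) (o2 o3 : Option (Fin 3)) {s : ℝ}
    (hs : 0 < s) : PD k (T none o2 o3 s f) (fun x => s⁻¹ * T (some k) o2 o3 s f x) :=
  Av_deriv (Av_BM (Av_BM h o3 s) o2 s) k hs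

attribute [irreducible] T

/-- Weighted integral of triple averages. -/
noncomputable def W (ω : ℝ → ℝ) (o1 o2 o3 : Option (Fin 3)) (f : (Fin 3 → ℝ) → ℝ) (x : Fin 3 → ℝ) : ℝ :=
  ∫ s in Ioi (0:ℝ), ω s * T o1 o2 o3 s f x

/-- Integrable bound for the weighted averages. -/
def WB (ω : ℝ → ℝ) (o1 o2 o3 : Option (Fin 3)) (f : (Fin 3 → ℝ) → ℝ) (b : ℝ → ℝ) : Prop :=
  Measurable ω ∧ Measurable f ∧ (∀ s, 0 < s → ∀ x, |ω s * T o1 o2 o3 s f x| ≤ b s) ∧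
    IntegrableOn b (Ioi 0)

theorem WB.meas {ω : ℝ → ℝ} {o1 o2 o3 : Option (Fin 3)} {f : (Fin 3 → ℝ) → ℝ} {b : ℝ → ℝ}
    (h : WB ω o1 o2 o3 f b) (x : Fin 3 → ℝ) : Measurable fun s => ω s * T o1 o2 o3 s f x :=
  h.1.mul (T_meas_s h.2.1 o1 o2 o3 x)

theorem WB.intg {ω : ℝ → ℝ} {o1 o2 o3 : Option (Fin 3)} {f : (Fin 3 → ℝ) → ℝ} {b : ℝ → ℝ}
    (h : WB ω o1 o2 o3 f b) (x : Fin 3 → ℝ) : IntegrableOn (fun s => ω s * T o1 o2 o3 s f x) (Ioi 0) :=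
  h.2.2.2.mono' (h.meas x).aestronglyMeasurable
    ((ae_restrict_iff' measurableSet_Ioi).mpr (Eventually.of_forall fun s hs => h.2.2.1 s hs x))

theorem WB.le {ω : ℝ → ℝ} {o1 o2 o3 : Option (Fin 3)} {f : (Fin 3 → ℝ) → ℝ} {b : ℝ → ℝ}
    (h : WB ω o1 o2 o3 f b) (x : Fin 3 → ℝ) : |W ω o1 o2 o3 f x| ≤ ∫ s in Ioi (0:ℝ), b s :=
  norm_integral_le_of_norm_le (f := fun s => ω s * T o1 o2 o3 s f x) h.2.2.2
    ((ae_restrict_iff' measurableSet_Ioi).mpr (Eventually.of_forall fun s hs => h.2.2.1 s hs x))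

theorem WB.Wmeas {ω : ℝ → ℝ} {o1 o2 o3 : Option (Fin 3)} {f : (Fin 3 → ℝ) → ℝ} {b : ℝ → ℝ}
    (h : WB ω o1 o2 o3 f b) : Measurable (W ω o1 o2 o3 f) := by
  unfold W
  have : Measurable (Function.uncurry fun (x : Fin 3 → ℝ) (s : ℝ) => ω s * T o1 o2 o3 s f x) :=
    (h.1.comp measurable_snd).mul ((T_meas h.2.1 o1 o2 o3).comp measurable_swap)
  exact (this.stronglyMeasurable.integral_prod_right (ν := volume.restrict (Ioi (0:ℝ)))).measurable

theorem WB.BM {ω : ℝ → ℝ} {o1 o2 o3 : Option (Fin 3)} {f : (Fin 3 → ℝ) → ℝ} {b : ℝ → ℝ}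
    (h : WB ω o1 o2 o3 f b) : BM (∫ s in Ioi (0:ℝ), b s) (W ω o1 o2 o3 f) := ⟨h.Wmeas, h.le⟩

/-- Average commutes with the weighted integral. -/
theorem WB.Av_W {ω : ℝ → ℝ} {o1 o2 o3 : Option (Fin 3)} {A : ℝ} {f : (Fin 3 → ℝ) → ℝ} {b : ℝ → ℝ}
    (h : WB ω o1 o2 o3 f b) (hf : Inc.BM A f) (o : Option (Fin 3)) (η : ℝ) :
    Av o η (W ω o1 o2 o3 f) = W ω o1 o2 o3 (Av o η f) := by
  funext x
  have e : ∀ s, T o1 o2 o3 s (Av o η f) = Av o η (T o1 o2 o3 s f) := by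
    intro s
    unfold T
    rw [Av_comm hf o3 o s η, Av_comm (Av_BM hf o3 s) o2 o s η,
      Av_comm (Av_BM (Av_BM hf o3 s) o2 s) o1 o s η]
  unfold W
  simp only [e]
  unfold Av
  simp only [← integral_const_mul]
  rw [integral_integral_swap]
  · congr 1; funext s; congr 1; funext z; ring
  · have hm : Measurable fun p : (Fin 3 → ℝ) × ℝ => wt o p.1 * (ω p.2 * T o1 o2 o3 p.2 f (x + η • p.1)) :=
      ((wt_cont o).measurable.comp measurable_fst).mul ((h.1.comp measurable_snd).mul
        ((T_meas h.2.1 o1 o2 o3).comp (measurable_snd.prodMk ((shift_meas x η).comp measurable_fst))))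
    have hb : Integrable (fun p : (Fin 3 → ℝ) × ℝ => |wt o p.1| * b p.2)
        (volume.prod (volume.restrict (Ioi (0:ℝ)))) :=
      ((wt_integrable o).abs).mul_prod h.2.2.2
    refine hb.mono' hm.aestronglyMeasurable ?_
    have h1 : ∀ᵐ p : (Fin 3 → ℝ) × ℝ ∂(volume.prod (volume.restrict (Ioi (0:ℝ)))), p.2 ∈ Ioi (0:ℝ) :=
      Measure.quasiMeasurePreserving_snd.ae (ae_restrict_mem measurableSet_Ioi)
    filter_upwards [h1] with p hp
    simp only [Function.uncurry, Real.norm_eq_abs]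
    rw [abs_mul]
    exact mul_le_mul_of_nonneg_left (h.2.2.1 p.2 hp _) (abs_nonneg _)

theorem dom_deriv' {G G' : ℝ → ℝ → ℝ} {bound : ℝ → ℝ} {x₀ : ℝ}
    (hF_meas : ∀ x, Measurable (G x)) (hF_int : IntegrableOn (G x₀) (Ioi 0))
    (hF'_meas : Measurable (G' x₀))
    (h_bound : ∀ a, 0 < a → ∀ x, |G' x a| ≤ bound a) (bound_integrable : IntegrableOn bound (Ioi 0))
    (h_diff : ∀ a, 0 < a → ∀ x, HasDerivAt (fun x => G x a) (G' x a) x) :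
    HasDerivAt (fun n ↦ ∫ a in Ioi (0:ℝ), G n a) (∫ a in Ioi (0:ℝ), G' x₀ a) x₀ :=
  (hasDerivAt_integral_of_dominated_loc_of_deriv_le (s := Set.univ) (bound := bound)
    (μ := volume.restrict (Ioi (0:ℝ))) (F := G) (F' := G') univ_mem
    (Eventually.of_forall fun x => (hF_meas x).aestronglyMeasurable) hF_int
    hF'_meas.aestronglyMeasurable
    ((ae_restrict_iff' measurableSet_Ioi).mpr (Eventually.of_forall fun a ha x _ => h_bound a ha x))
    bound_integrable
    ((ae_restrict_iff' measurableSet_Ioi).mpr (Eventually.of_forall fun a ha x _ => h_diff a ha x))).2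

/-- General differentiation of weighted integrals. -/
theorem W_PD_gen {k : Fin 3} {ω ω' : ℝ → ℝ} {o1 o2 o3 o1' o2' o3' : Option (Fin 3)}
    {f g : (Fin 3 → ℝ) → ℝ} {b b' : ℝ → ℝ} (h : WB ω o1 o2 o3 f b) (h' : WB ω' o1' o2' o3' g b')
    (hd : ∀ s, 0 < s → PD k (fun x => ω s * T o1 o2 o3 s f x) (fun x => ω' s * T o1' o2' o3' s g x)) :
    PD k (W ω o1 o2 o3 f) (W ω' o1' o2' o3' g) := by
  intro x
  have := dom_deriv' (G := fun t s => ω s * T o1 o2 o3 s f (x + Pi.single k t))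
    (G' := fun t s => ω' s * T o1' o2' o3' s g (x + Pi.single k t)) (bound := b') (x₀ := 0)
    (fun t => h.meas _) (h.intg _) (h'.meas _) (fun s hs t => h'.2.2.1 s hs _) h'.2.2.2
    (fun s hs t => (hd s hs).at x t)
  simpa [W] using this

theorem PD.cmul {k : Fin 3} {f g : (Fin 3 → ℝ) → ℝ} (h : PD k f g) (c : ℝ) :
    PD k (fun x => c * f x) (fun x => c * g x) := fun x => (h x).const_mul c

theorem W_PD {k : Fin 3} {ω ω' : ℝ → ℝ} {o2 o3 : Option (Fin 3)} {A : ℝ}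
    {f : (Fin 3 → ℝ) → ℝ} {b b' : ℝ → ℝ} (h : WB ω none o2 o3 f b) (h' : WB ω' (some k) o2 o3 f b')
    (hf : BM A f) (hω : ∀ s, 0 < s → ω' s = ω s * s⁻¹) :
    PD k (W ω none o2 o3 f) (W ω' (some k) o2 o3 f) := by
  refine W_PD_gen h h' fun s hs => ?_
  have := (T_PD hf k o2 o3 hs).cmul (ω s)
  simpa [hω s hs, mul_assoc] using this

theorem W_PD' {k : Fin 3} {ω : ℝ → ℝ} {A B : ℝ}
    {f g : (Fin 3 → ℝ) → ℝ} {b b' : ℝ → ℝ} {o1 o2 o3 : Option (Fin 3)} (h : WB ω o1 o2 o3 f b)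
    (h' : WB ω o1 o2 o3 g b')
    (hf : BM A f) (hg : BM B g) (hfg : PD k f g) :
    PD k (W ω o1 o2 o3 f) (W ω o1 o2 o3 g) := by
  refine W_PD_gen h h' fun s hs => ?_
  unfold T
  exact (Av_PD (Av_PD (Av_PD hfg hf hg o3 s) (Av_BM hf o3 s) (Av_BM hg o3 s) o2 s)
    (Av_BM (Av_BM hf o3 s) o2 s) (Av_BM (Av_BM hg o3 s) o2 s) o1 s).cmul (ω s)

/-- Lipschitz bound from partial derivatives. -/
theorem PD.lip1 {k : Fin 3} {f g : (Fin 3 → ℝ) → ℝ} {B : ℝ} (h : PD k f g) (hB : ∀ x, |g x| ≤ B)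
    (x : Fin 3 → ℝ) (t : ℝ) : |f (x + Pi.single k t) - f x| ≤ B * |t| := by
  have := Convex.norm_image_sub_le_of_norm_hasDerivWithin_le (s := Set.univ) (C := B)
    (f := fun t => f (x + Pi.single k t)) (f' := fun t => g (x + Pi.single k t)) (x := 0) (y := t)
    (fun t _ => (h.at x t).hasDerivWithinAt) (fun t _ => hB _) convex_univ trivial trivial
  simpa using this

theorem split3 (v : Fin 3 → ℝ) : v = Pi.single 0 (v 0) + Pi.single 1 (v 1) + Pi.single 2 (v 2) := by
  funext j; fin_cases j <;> simp

theorem abs_sub_le_norm (x y : Fin 3 → ℝ) (i : Fin 3) : |y i - x i| ≤ ‖x - y‖ := by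
  rw [norm_sub_rev]; exact norm_le_pi_norm (y - x) i

theorem PD.lip {f : (Fin 3 → ℝ) → ℝ} {g : Fin 3 → (Fin 3 → ℝ) → ℝ} {B : ℝ} (h : ∀ k, PD k f (g k))
    (hB : ∀ k x, |g k x| ≤ B) (x y : Fin 3 → ℝ) : |f x - f y| ≤ 3 * B * ‖x - y‖ := by
  have hB0 : 0 ≤ B := (abs_nonneg _).trans (hB 0 x)
  have e : y = x + Pi.single 0 (y 0 - x 0) + Pi.single 1 (y 1 - x 1) + Pi.single 2 (y 2 - x 2) := by
    have := split3 (y - x)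
    simp only [Pi.sub_apply] at this
    rw [add_assoc, add_assoc, ← add_assoc (Pi.single 0 _), ← this]; abel
  have h0 := (h 0).lip1 (hB 0) x (y 0 - x 0)
  have h1 := (h 1).lip1 (hB 1) (x + Pi.single 0 (y 0 - x 0)) (y 1 - x 1)
  have h2 := (h 2).lip1 (hB 2) (x + Pi.single 0 (y 0 - x 0) + Pi.single 1 (y 1 - x 1)) (y 2 - x 2)
  rw [← e] at h2
  have m := fun i => mul_le_mul_of_nonneg_left (abs_sub_le_norm x y i) hB0
  have m0 := m 0
  have m1 := m 1
  have m2 := m 2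
  rw [abs_le] at *
  constructor <;> linarith [h0.1, h0.2, h1.1, h1.2, h2.1, h2.2]

end Inc

set_option linter.unusedVariables false
set_option linter.unusedSimpArgs false
open Set Filter Topology MeasureTheory
namespace Inc
variable {α : ℝ}

theorem add_single_norm (i : Fin 3) (h : ℝ) : ‖(Pi.single i h : Fin 3 → ℝ)‖ = |h| := by
  rw [Pi.norm_single, Real.norm_eq_abs]

theorem path3 (x y : Fin 3 → ℝ) :
    x + Pi.single 0 (y 0 - x 0) + Pi.single 1 (y 1 - x 1) + Pi.single 2 (y 2 - x 2) = y := by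
  have := split3 (y - x)
  simp only [Pi.sub_apply] at this
  rw [add_assoc, add_assoc, ← add_assoc (Pi.single 0 _), ← this]; abel

/-- Taylor estimate from coordinate increments. -/
theorem coord_taylor {S : Set (Fin 3 → ℝ)} (hα : 0 ≤ α)
    (hS : ∀ x ∈ S, ∀ y ∈ S, x + Pi.single 0 (y 0 - x 0) ∈ S ∧
      x + Pi.single 0 (y 0 - x 0) + Pi.single 1 (y 1 - x 1) ∈ S)
    {f : (Fin 3 → ℝ) → ℝ} {g : Fin 3 → (Fin 3 → ℝ) → ℝ} {M : ℝ} (hM : 0 ≤ M)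
    (hi : ∀ i, ∀ x ∈ S, ∀ h : ℝ, x + Pi.single i h ∈ S →
      |f (x + Pi.single i h) - f x - g i x * h| ≤ M * |h| ^ α * |h|)
    (hg : ∀ i, ∀ x ∈ S, ∀ y ∈ S, |g i x - g i y| ≤ M * ‖x - y‖ ^ α)
    {x y : Fin 3 → ℝ} (hx : x ∈ S) (hy : y ∈ S) :
    |f y - f x - ∑ i, g i x * (y - x) i| ≤ 8 * M * ‖y - x‖ ^ α * ‖y - x‖ := by
  obtain ⟨p1, p2⟩ := hS x hx y hy
  set x1 := x + Pi.single 0 (y 0 - x 0) with hx1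
  set x2 := x1 + Pi.single 1 (y 1 - x 1) with hx2
  have e : x2 + Pi.single 2 (y 2 - x 2) = y := path3 x y
  have a0 := hi 0 x hx (y 0 - x 0) p1
  have a1 := hi 1 x1 p1 (y 1 - x 1) p2
  have a2 := hi 2 x2 p2 (y 2 - x 2) (by rw [e]; exact hy)
  rw [e] at a2
  rw [← hx1] at a0
  rw [← hx2] at a1
  set r := ‖y - x‖ with hr
  have hd : ∀ i, |y i - x i| ≤ r := fun i => norm_le_pi_norm (y - x) i
  have hpw : ∀ i, |y i - x i| ^ α ≤ r ^ α := fun i => Real.rpow_le_rpow (abs_nonneg _) (hd i) hα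
  have hr0 : 0 ≤ r := norm_nonneg _
  have hrα : 0 ≤ r ^ α := Real.rpow_nonneg hr0 _
  have hb : ∀ i, M * |y i - x i| ^ α * |y i - x i| ≤ M * r ^ α * r := fun i =>
    mul_le_mul (mul_le_mul_of_nonneg_left (hpw i) hM) (hd i) (abs_nonneg _) (by positivity)
  have n1 : ‖x1 - x‖ ≤ r := by
    rw [hx1, add_sub_cancel_left, add_single_norm]; exact hd 0
  have n2 : ‖x2 - x‖ ≤ r := by
    refine (pi_norm_le_iff_of_nonneg hr0).mpr fun j => ?_
    have h0 := hd 0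
    have h1 := hd 1
    fin_cases j <;> simp [hx2, hx1] <;> assumption
  have c1 : |(g 1 x1 - g 1 x) * (y 1 - x 1)| ≤ M * r ^ α * r := by
    rw [abs_mul]
    exact mul_le_mul ((hg 1 x1 p1 x hx).trans
      (mul_le_mul_of_nonneg_left (Real.rpow_le_rpow (norm_nonneg _) n1 hα) hM)) (hd 1) (abs_nonneg _)
      (by positivity)
  have c2 : |(g 2 x2 - g 2 x) * (y 2 - x 2)| ≤ M * r ^ α * r := by
    rw [abs_mul]
    exact mul_le_mul ((hg 2 x2 p2 x hx).trans
      (mul_le_mul_of_nonneg_left (Real.rpow_le_rpow (norm_nonneg _) n2 hα) hM)) (hd 2) (abs_nonneg _)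
      (by positivity)
  have b0 := hb 0
  have b1 := hb 1
  have b2 := hb 2
  have hP : 0 ≤ M * r ^ α * r := by positivity
  rw [Fin.sum_univ_three]
  simp only [Pi.sub_apply]
  rw [abs_le] at *
  constructor <;> linarith [a0.1, a0.2, a1.1, a1.2, a2.1, a2.2, c1.1, c1.2, c2.1, c2.2]

/-- Increment bound from a derivative in a coordinate direction. -/
theorem PD.inc {k : Fin 3} {f g : (Fin 3 → ℝ) → ℝ} {M : ℝ} (hα : 0 ≤ α) (hM : 0 ≤ M) (h : PD k f g)
    {x : Fin 3 → ℝ} (hg : ∀ t : ℝ, |g (x + Pi.single k t) - g x| ≤ M * |t| ^ α) (t : ℝ) :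
    |f (x + Pi.single k t) - f x - g x * t| ≤ M * |t| ^ α * |t| := by
  have := Convex.norm_image_sub_le_of_norm_hasDerivWithin_le (s := uIcc 0 t) (C := M * |t| ^ α)
    (f := fun t => f (x + Pi.single k t) - g x * t) (f' := fun t => g (x + Pi.single k t) - g x)
    (x := 0) (y := t)
    (fun t _ => ((h.at x t).sub (by simpa using (hasDerivAt_id t).const_mul (g x))).hasDerivWithinAt)
    (fun u hu => (hg u).trans (mul_le_mul_of_nonneg_left (Real.rpow_le_rpow (abs_nonneg _) (by
      have := abs_sub_left_of_mem_uIcc hu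
      simpa using this) hα) hM)) (convex_uIcc 0 t) left_mem_uIcc right_mem_uIcc
  simp at this
  convert this using 2
  ring

/-- Families differentiable along dilations. -/
structure SD (B : ℝ) (H Hs : ℝ → (Fin 3 → ℝ) → ℝ) (Hi : Fin 3 → ℝ → (Fin 3 → ℝ) → ℝ) : Prop where
  b0 : ∀ s, BM B (H s)
  bs : ∀ s, BM B (Hs s)
  bi : ∀ i s, BM B (Hi i s)
  hd : ∀ s y z, HasDerivAt (fun s => H s (y + s • z))
    (Hs s (y + s • z) + ∑ i, z i * Hi i s (y + s • z)) s

theorem BM.mono {A B : ℝ} {f : (Fin 3 → ℝ) → ℝ} (h : BM A f) (hAB : A ≤ B) : BM B f :=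
  ⟨h.1, fun x => (h.2 x).trans hAB⟩

theorem SD_Av {B : ℝ} {H Hs : ℝ → (Fin 3 → ℝ) → ℝ} {Hi : Fin 3 → ℝ → (Fin 3 → ℝ) → ℝ}
    (h : SD B H Hs Hi) : SD (B + 3 * (kap * B)) (fun s => Av none s (H s))
      (fun s x => Av none s (Hs s) x + ∑ i, Av (some i) s (Hi i s) x)
      (fun i s => Av none s (Hi i s)) where
  b0 s := (Av_none_BM (h.b0 s) s).mono (by
    have := mul_nonneg kap_nonneg (h.b0 s).nonneg; linarith)
  bi i s := (Av_none_BM (h.bi i s) s).mono (by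
    have := mul_nonneg kap_nonneg (h.b0 s).nonneg; linarith)
  bs s := by
    refine ⟨(Av_none_BM (h.bs s) s).1.add (Finset.measurable_sum _ fun i _ =>
      (Av_BM (h.bi i s) (some i) s).1), fun x => ?_⟩
    refine (abs_add_le _ _).trans (add_le_add (Av_none_le (h.bs s) s x) ?_)
    refine (Finset.abs_sum_le_sum_abs _ _).trans ?_
    refine (Finset.sum_le_sum fun i _ => Av_le (h.bi i s) (some i) s x).trans ?_
    simp
  hd s y z := by
    have hB := (h.b0 0).nonneg
    have e : ∀ s, Av none s (H s) (y + s • z) = ∫ z', gk z' * H s (y + s • (z + z')) := by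
      intro s
      unfold Av
      congr 1; funext z'
      rw [smul_add, add_assoc]; rfl
    simp only [e]
    have hm : ∀ (u : (Fin 3 → ℝ) → ℝ) (s : ℝ), Measurable u →
        Measurable fun z' : Fin 3 → ℝ => u (y + s • (z + z')) := fun u s hu =>
      hu.comp (measurable_const.add ((measurable_const.add measurable_id).const_smul s))
    have hgm := gk_cont.measurable
    have key := dom_deriv (G := fun s z' => gk z' * H s (y + s • (z + z')))
      (G' := fun s z' => gk z' * (Hs s (y + s • (z + z')) + ∑ i, (z + z') i * Hi i s (y + s • (z + z'))))
      (S := Set.univ) (x₀ := s)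
      (bound := fun z' => gk z' * B + ∑ i, (|z i| * (gk z' * B) + |wt (some i) z'| * B)) univ_mem
      (Eventually.of_forall fun s => (hgm.mul (hm _ s (h.b0 s).1)).aestronglyMeasurable)
      ((wt_integrable none).mul_bdd (c := B) (hm _ s (h.b0 s).1).aestronglyMeasurable
        (Eventually.of_forall fun z => (h.b0 s).2 _))
      ((hgm.mul ((hm _ s (h.bs s).1).add (Finset.measurable_sum _ fun i _ =>
        (((measurable_const.add measurable_id).eval (a := i))).mul (hm _ s (h.bi i s).1)))).aestronglyMeasurable)
      (by
        intro z' s _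
        rw [mul_add, Finset.mul_sum, Real.norm_eq_abs]
        have hg := gk_nonneg z'
        refine (abs_add_le _ _).trans (add_le_add ?_ ?_)
        · rw [abs_mul, abs_of_nonneg hg]
          exact mul_le_mul_of_nonneg_left ((h.bs s).2 _) hg
        · refine (Finset.abs_sum_le_sum_abs _ _).trans (Finset.sum_le_sum fun i _ => ?_)
          simp only [wt]
          rw [abs_mul, abs_mul, abs_of_nonneg hg, Pi.add_apply, abs_mul, abs_of_nonneg hg]
          have h1 := abs_add_le (z i) (z' i)
          have h2 := (h.bi i s).2 (y + s • (z + z'))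
          calc gk z' * (|z i + z' i| * |Hi i s (y + s • (z + z'))|)
              ≤ gk z' * ((|z i| + |z' i|) * B) := by gcongr
            _ = _ := by ring)
      (((wt_integrable none).mul_const B).add (integrable_finsetSum _ fun i _ =>
        (((wt_integrable none).mul_const B).const_mul _).add ((wt_integrable (some i)).abs.mul_const B)))
      (fun z' s _ => (h.hd s y (z + z')).const_mul _)
    refine key.congr_deriv ?_
    have e2 : ∀ (z' : Fin 3 → ℝ),
        gk z' * (Hs s (y + s • (z + z')) + ∑ i, (z + z') i * Hi i s (y + s • (z + z'))) =
        wt none z' * Hs s (y + s • z + s • z') + ∑ i, (wt (some i) z' * Hi i s (y + s • z + s • z')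
          + z i * (wt none z' * Hi i s (y + s • z + s • z'))) := by
      intro z'
      rw [smul_add, ← add_assoc, mul_add, Finset.mul_sum]
      congr 1
      refine Finset.sum_congr rfl fun i _ => ?_
      simp only [wt, Pi.add_apply]; ring
    simp only [e2]
    have hI : ∀ i, Integrable (fun a => wt (some i) a * Hi i s (y + s • z + s • a)
        + z i * (wt none a * Hi i s (y + s • z + s • a))) := fun i =>
      (Av_integrand (h.bi i s) (some i) s _).add ((Av_integrand (h.bi i s) none s _).const_mul _)
    rw [integral_add (Av_integrand (h.bs s) none s _) (integrable_finsetSum _ fun i _ => hI i),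
      integral_finsetSum _ fun i _ => hI i]
    have e3 : ∀ i, ∫ z', (wt (some i) z' * Hi i s (y + s • z + s • z')
          + z i * (wt none z' * Hi i s (y + s • z + s • z'))) =
        Av (some i) s (Hi i s) (y + s • z) + z i * Av none s (Hi i s) (y + s • z) := by
      intro i
      rw [integral_add (Av_integrand (h.bi i s) (some i) s _)
        ((Av_integrand (h.bi i s) none s _).const_mul _), integral_const_mul]
      unfold Av; rfl
    simp only [e3]
    have e4 : ∫ z', wt none z' * Hs s (y + s • z + s • z') = Av none s (Hs s) (y + s • z) := by
      unfold Av; rfl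
    rw [e4, Finset.sum_add_distrib]; ring

end Inc

set_option linter.unusedVariables false
set_option linter.unusedSimpArgs false
open Set Filter Topology MeasureTheory
namespace Inc
variable {α : ℝ}

/-- Exponential weights. -/
noncomputable def ee (l s : ℝ) : ℝ := 3 * Real.exp (-(3 * l / 2) * s ^ 2)
noncomputable def om0 (l s : ℝ) : ℝ := s * ee l s
noncomputable def om2 (l s : ℝ) : ℝ := ee l s * s⁻¹

theorem ee_cont (l : ℝ) : Continuous (ee l) := by unfold ee; fun_prop
theorem ee_pos (l s : ℝ) : 0 < ee l s := by unfold ee; positivity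
theorem ee_le {l : ℝ} (hl : 0 < l) (s : ℝ) : ee l s ≤ 3 := by
  unfold ee
  have : Real.exp (-(3 * l / 2) * s ^ 2) ≤ 1 := Real.exp_le_one_iff.mpr (by nlinarith [mul_nonneg hl.le (sq_nonneg s)])
  linarith
theorem om0_meas (l : ℝ) : Measurable (om0 l) := measurable_id.mul (ee_cont l).measurable
theorem om2_meas (l : ℝ) : Measurable (om2 l) := (ee_cont l).measurable.mul measurable_inv

theorem ee_int {l : ℝ} (hl : 0 < l) {β : ℝ} (hβ : -1 < β) :
    IntegrableOn (fun s => s ^ β * ee l s) (Ioi 0) := by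
  have := (integrableOn_rpow_mul_exp_neg_mul_sq (b := 3 * l / 2) (by positivity) hβ).const_mul 3
  refine IntegrableOn.congr_fun this (fun s _ => ?_) measurableSet_Ioi
  simp only [ee]; ring

theorem ee_int0 {l : ℝ} (hl : 0 < l) : IntegrableOn (ee l) (Ioi 0) :=
  (ee_int hl (β := 0) (by norm_num)).congr_fun (fun s _ => by simp) measurableSet_Ioi

theorem om0_int {l : ℝ} (hl : 0 < l) : IntegrableOn (om0 l) (Ioi 0) :=
  (ee_int hl (β := 1) (by norm_num)).congr_fun (fun s _ => by simp [om0]) measurableSet_Ioi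

theorem om0_nonneg (l : ℝ) {s : ℝ} (hs : 0 < s) : 0 ≤ om0 l s := mul_nonneg hs.le (ee_pos l s).le

theorem WB0 {l A : ℝ} (hl : 0 < l) {f : (Fin 3 → ℝ) → ℝ} (hf : BM A f) :
    WB (om0 l) none none none f (fun s => om0 l s * A) := by
  refine ⟨om0_meas l, hf.1, fun s hs x => ?_, (om0_int hl).mul_const A⟩
  rw [abs_mul, abs_of_nonneg (om0_nonneg l hs)]
  exact mul_le_mul_of_nonneg_left ((T_nnn_BM hf s).2 x) (om0_nonneg l hs)

theorem WB1 {l A : ℝ} (hl : 0 < l) {f : (Fin 3 → ℝ) → ℝ} (hf : BM A f) (o1 o2 o3 : Option (Fin 3)) :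
    WB (ee l) o1 o2 o3 f (fun s => ee l s * (kap ^ 3 * A)) := by
  refine ⟨(ee_cont l).measurable, hf.1, fun s hs x => ?_, (ee_int0 hl).mul_const _⟩
  rw [abs_mul, abs_of_nonneg (ee_pos l s).le]
  exact mul_le_mul_of_nonneg_left ((T_BM hf o1 o2 o3 s).2 x) (ee_pos l s).le

theorem WB2 {l A : ℝ} (hl : 0 < l) (hα0 : 0 < α) (hα1 : α ≤ 1) {f : (Fin 3 → ℝ) → ℝ} (hf : BM A f)
    (ht : TH α A f) {i : Fin 3} (hi : i ≠ 0) (o1 o2 : Option (Fin 3)) :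
    WB (om2 l) o1 o2 (some i) f (fun s => s ^ (α - 1) * ee l s * (kap ^ 3 * A)) := by
  refine ⟨om2_meas l, hf.1, fun s hs x => ?_, (ee_int hl (by linarith)).mul_const _⟩
  have h1 := (T_tan_BM hα0.le hα1 hf ht hi o1 o2 hs.le).2 x
  have h2 : 0 ≤ om2 l s := mul_nonneg (ee_pos l s).le (inv_pos.mpr hs).le
  rw [abs_mul, abs_of_nonneg h2]
  refine (mul_le_mul_of_nonneg_left h1 h2).trans (le_of_eq ?_)
  beta_reduce
  rw [Real.rpow_sub hs, Real.rpow_one]; unfold om2; ring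

theorem T_zero (f : (Fin 3 → ℝ) → ℝ) (x : Fin 3 → ℝ) : T none none none 0 f x = f x := by
  have : ∀ g : (Fin 3 → ℝ) → ℝ, Av none 0 g = g := by
    intro g; funext y; unfold Av; simp only [zero_smul, add_zero, wt]
    rw [integral_mul_const, gk_int, one_mul]
  unfold T; simp only [this]

/-- Twice boundedly differentiable functions. -/
structure D2 (B : ℝ) (F : (Fin 3 → ℝ) → ℝ) (F1 : Fin 3 → (Fin 3 → ℝ) → ℝ)
    (F2 : Fin 3 → Fin 3 → (Fin 3 → ℝ) → ℝ) : Prop where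
  b0 : BM B F
  b1 : ∀ i, BM B (F1 i)
  b2 : ∀ i j, BM B (F2 i j)
  d1 : ∀ i, PD i F (F1 i)
  d2 : ∀ i j, PD j (F1 i) (F2 i j)

theorem D2.line {B : ℝ} {F : (Fin 3 → ℝ) → ℝ} {F1 : Fin 3 → (Fin 3 → ℝ) → ℝ}
    {F2 : Fin 3 → Fin 3 → (Fin 3 → ℝ) → ℝ} (h : D2 B F F1 F2) (y z : Fin 3 → ℝ) (s : ℝ) :
    HasDerivAt (fun s : ℝ => F (y + s • z)) (∑ i, z i * F1 i (y + s • z)) s := by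
  have hB := h.b0.nonneg
  have hl : ∀ i x y, |F1 i x - F1 i y| ≤ 3 * B * ‖x - y‖ ^ (1:ℝ) := fun i x y => by
    rw [Real.rpow_one]; exact PD.lip (h.d2 i) (fun k x => (h.b2 i k).2 x) x y
  have hT : ∀ x, HasFDerivWithinAt F (lin fun i => F1 i x) univ x := by
    intro x
    refine has_of_taylor (α := 1) (K := 8 * (3 * B)) one_pos fun y hy => ?_
    refine coord_taylor (S := univ) zero_le_one (fun _ _ _ _ => ⟨trivial, trivial⟩)
      (by positivity) ?_ (fun i x _ y _ => hl i x y) (mem_univ x) (mem_univ y)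
    intro i x _ t _
    refine (h.d1 i).inc zero_le_one (by positivity) (fun t => ?_) t
    have := hl i (x + Pi.single i t) x
    rwa [add_sub_cancel_left, add_single_norm] at this
  have h1 := (hasFDerivWithinAt_univ.mp (hT (y + s • z)))
  have h2 : HasDerivAt (fun s : ℝ => y + s • z) z s := by
    simpa using ((hasDerivAt_id s).smul_const z).const_add y
  have h3 := h1.comp_hasDerivAt s h2
  refine h3.congr_deriv ?_
  rw [lin_apply]
  exact Finset.sum_congr rfl fun i _ => mul_comm _ _

theorem D2.heat {B : ℝ} {F : (Fin 3 → ℝ) → ℝ} {F1 : Fin 3 → (Fin 3 → ℝ) → ℝ}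
    {F2 : Fin 3 → Fin 3 → (Fin 3 → ℝ) → ℝ} (h : D2 B F F1 F2) (x : Fin 3 → ℝ) (s : ℝ) :
    HasDerivAt (fun s => T none none none s F x) (3 * ∑ i, T (some i) none none s (F1 i) x) s := by
  have h0 : SD B (fun _ => F) (fun _ _ => 0) (fun i _ => F1 i) :=
    ⟨fun _ => h.b0, fun _ => ⟨measurable_const, fun _ => by simpa using h.b0.nonneg⟩, fun i _ => h.b1 i,
      fun s y z => by simpa using h.line y z s⟩
  have h3 := (SD_Av (SD_Av (SD_Av h0))).hd s x 0
  simp only [smul_zero, add_zero, Pi.zero_apply, zero_mul, Finset.sum_const_zero] at h3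
  have z0 : (Av none s fun _ => (0:ℝ)) = fun _ => 0 := by funext y; unfold Av; simp
  have lin2 : ∀ (o : Option (Fin 3)) (u v : (Fin 3 → ℝ) → ℝ) (C D : ℝ), BM C u → BM D v → 
      Av o s (fun y => u y + v y) = fun y => Av o s u y + Av o s v y := by
    intro o u v C D hu hv
    funext y
    have : Av o s (fun y => u y + v y) y = ∫ z, (wt o z * u (y + s • z) + wt o z * v (y + s • z)) := by
      unfold Av; congr 1; funext z; ring
    rw [this, integral_add (Av_integrand hu o s y) (Av_integrand hv o s y)]
    unfold Av; rfl
  have hb : ∀ i o1 , BM (kap * B) (Av o1 s (F1 i)) := fun i o1 => Av_BM (h.b1 i) o1 s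
  have hb2 : ∀ i o1 o2, BM (kap * (kap * B)) (Av o2 s (Av o1 s (F1 i))) := fun i o1 o2 => Av_BM (hb i o1) o2 s
  have badd : ∀ (u v : (Fin 3 → ℝ) → ℝ) (C D : ℝ), BM C u → BM D v → BM (C + D) (fun y => u y + v y) :=
    fun u v C D hu hv => ⟨hu.1.add hv.1, fun x => (abs_add_le _ _).trans (add_le_add (hu.2 x) (hv.2 x))⟩
  unfold T
  refine h3.congr_deriv ?_
  simp only [z0, zero_add, Fin.sum_univ_three]
  have key : ∀ (g : Option (Fin 3) → Fin 3 → (Fin 3 → ℝ) → ℝ) (C : ℝ), (∀ o i, BM C (g o i)) →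
      Av none s (fun y => g (some 0) 0 y + g (some 1) 1 y + g (some 2) 2 y) =
      fun y => Av none s (g (some 0) 0) y + Av none s (g (some 1) 1) y + Av none s (g (some 2) 2) y := by
    intro g C hg
    rw [lin2 none _ _ _ _ (badd _ _ _ _ (hg _ _) (hg _ _)) (hg _ _), lin2 none _ _ _ _ (hg _ _) (hg _ _)]
  have k1 := key (fun o i => Av o s (F1 i)) _ (fun o i => hb i o)
  rw [k1]
  have k2 := key (fun o i => Av none s (Av o s (F1 i))) _ (fun o i => hb2 i o none)
  have k3 := key (fun o i => Av o s (Av none s (F1 i))) _ (fun o i => hb2 i none o)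
  have B3 : ∀ (g : Option (Fin 3) → Fin 3 → (Fin 3 → ℝ) → ℝ) (C : ℝ), (∀ o i, BM C (g o i)) →
      BM (C + C + C) (fun y => g (some 0) 0 y + g (some 1) 1 y + g (some 2) 2 y) := fun g C hg =>
    badd _ _ _ _ (badd _ _ _ _ (hg _ _) (hg _ _)) (hg _ _)
  rw [lin2 none (fun y => Av none s (Av (some 0) s (F1 0)) y + Av none s (Av (some 1) s (F1 1)) y + Av none s (Av (some 2) s (F1 2)) y)
    (fun y => Av (some 0) s (Av none s (F1 0)) y + Av (some 1) s (Av none s (F1 1)) y + Av (some 2) s (Av none s (F1 2)) y) _ _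
    (B3 (fun o i => Av none s (Av o s (F1 i))) _ (fun o i => hb2 i o none))
    (B3 (fun o i => Av o s (Av none s (F1 i))) _ (fun o i => hb2 i none o))]
  rw [k2, k3]
  have c1 : ∀ i, Av none s (Av none s (Av (some i) s (F1 i))) = Av (some i) s (Av none s (Av none s (F1 i))) := by
    intro i
    rw [Av_comm (h.b1 i) none (some i) s s, Av_comm (hb i none) none (some i) s s]
  have c2 : ∀ i, Av none s (Av (some i) s (Av none s (F1 i))) = Av (some i) s (Av none s (Av none s (F1 i))) := by
    intro i
    rw [Av_comm (hb i none) none (some i) s s]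
  simp only [c1, c2]
  ring

theorem D2.heat2 {B : ℝ} {F : (Fin 3 → ℝ) → ℝ} {F1 : Fin 3 → (Fin 3 → ℝ) → ℝ}
    {F2 : Fin 3 → Fin 3 → (Fin 3 → ℝ) → ℝ} (h : D2 B F F1 F2) {s : ℝ} (hs : 0 < s) (i : Fin 3)
    (x : Fin 3 → ℝ) :
    T (some i) none none s (F1 i) x = s * T none none none s (F2 i i) x := by
  have h1 := T_PD (h.b1 i) i none none hs
  have h2 : PD i (T none none none s (F1 i)) (T none none none s (F2 i i)) := by
    unfold T
    exact Av_PD (Av_PD (Av_PD (h.d2 i i) (h.b1 i) (h.b2 i i) none s) (Av_BM (h.b1 i) none s)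
      (Av_BM (h.b2 i i) none s) none s) (Av_BM (Av_BM (h.b1 i) none s) none s)
      (Av_BM (Av_BM (h.b2 i i) none s) none s) none s
  have := congrFun (PD.unique h1 h2) x
  rw [← this]; field_simp

/-- Resolvent identity for smooth functions. -/
theorem D2.res {l B : ℝ} (hl : 0 < l) {F : (Fin 3 → ℝ) → ℝ} {F1 : Fin 3 → (Fin 3 → ℝ) → ℝ}
    {F2 : Fin 3 → Fin 3 → (Fin 3 → ℝ) → ℝ} (h : D2 B F F1 F2) (x : Fin 3 → ℝ) :
    l * W (om0 l) none none none F x - ∑ i, W (om0 l) none none none (F2 i i) x = F x := by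
  have hE : ∀ s : ℝ, HasDerivAt (fun s => (1/3) * ee l s) (-(3 * l * s) * ((1/3) * ee l s)) s := by
    intro s
    unfold ee
    have h1 : HasDerivAt (fun s : ℝ => -(3 * l / 2) * s ^ 2) (-(3 * l / 2) * (2 * s)) s := by
      simpa using (hasDerivAt_pow 2 s).const_mul (-(3 * l / 2))
    refine ((h1.exp.const_mul 3).const_mul (1/3)).congr_deriv ?_
    ring
  have hd := fun s => (hE s).mul (h.heat x s)
  have hIntg : IntegrableOn (fun s => -l * (om0 l s * T none none none s F x) +
      ∑ i, om0 l s * T none none none s (F2 i i) x) (Ioi 0) :=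
    (((WB0 hl h.b0).intg x).const_mul _).add (integrable_finsetSum _ fun i _ => (WB0 hl (h.b2 i i)).intg x)
  have heq : EqOn (fun s => -l * (om0 l s * T none none none s F x) +
      ∑ i, om0 l s * T none none none s (F2 i i) x)
      (fun s => -(3 * l * s) * ((1/3) * ee l s) * T none none none s F x +
        (1/3) * ee l s * (3 * ∑ i, T (some i) none none s (F1 i) x)) (Ioi 0) := by
    intro s hs
    simp only [h.heat2 hs, Fin.sum_univ_three, om0]; ring
  have hlim : Tendsto (fun s => (1/3) * ee l s * T none none none s F x) atTop (𝓝 0) := by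
    have h1 : Tendsto (fun s => (1/3) * ee l s * B) atTop (𝓝 0) := by
      have h2 : Tendsto (fun s : ℝ => -(3 * l / 2) * s ^ 2) atTop atBot :=
        (tendsto_pow_atTop (by norm_num)).const_mul_atTop_of_neg (by linarith)
      have h3 := Real.tendsto_exp_atBot.comp h2
      have := ((h3.const_mul 3).const_mul (1/3)).mul_const B
      simpa [ee, Function.comp_def] using this
    refine squeeze_zero_norm (fun s => ?_) h1
    rw [norm_mul, Real.norm_eq_abs, Real.norm_eq_abs, abs_of_nonneg (by have := ee_pos l s; positivity)]
    exact mul_le_mul_of_nonneg_left ((T_nnn_BM h.b0 s).2 x) (by have := ee_pos l s; positivity)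
  have key := integral_Ioi_of_hasDerivAt_of_tendsto (a := 0) (hd 0).continuousAt.continuousWithinAt
    (fun s _ => hd s) (hIntg.congr_fun heq measurableSet_Ioi) hlim
  rw [← setIntegral_congr_fun measurableSet_Ioi heq] at key
  rw [integral_add (((WB0 hl h.b0).intg x).const_mul _)
    (integrable_finsetSum _ fun i _ => (WB0 hl (h.b2 i i)).intg x), integral_const_mul,
    integral_finsetSum _ fun i _ => (WB0 hl (h.b2 i i)).intg x] at key
  simp only [Pi.mul_apply, T_zero] at key
  have e0 : ee l 0 = 3 := by simp [ee]
  rw [e0] at key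
  unfold W
  linarith

end Inc

set_option linter.unusedVariables false
set_option linter.unusedSimpArgs false
open Set Filter Topology MeasureTheory
namespace Inc
variable {α : ℝ}

attribute [local irreducible] W

/-- The resolvent and its derivatives. -/
noncomputable def Rw (l : ℝ) (f : (Fin 3 → ℝ) → ℝ) : (Fin 3 → ℝ) → ℝ := W (om0 l) none none none f
noncomputable def R1 (l : ℝ) (i : Fin 3) (f : (Fin 3 → ℝ) → ℝ) : (Fin 3 → ℝ) → ℝ :=
  W (ee l) none none (some i) f
noncomputable def R2 (l : ℝ) (k i : Fin 3) (f : (Fin 3 → ℝ) → ℝ) : (Fin 3 → ℝ) → ℝ :=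
  W (om2 l) (some k) none (some i) f

theorem W_congr {ω : ℝ → ℝ} {o1 o2 o3 o1' o2' o3' : Option (Fin 3)} {f : (Fin 3 → ℝ) → ℝ}
    (h : ∀ s, T o1 o2 o3 s f = T o1' o2' o3' s f) : W ω o1 o2 o3 f = W ω o1' o2' o3' f := by
  funext x; unfold W; simp only [h]

theorem T_13 {A : ℝ} {f : (Fin 3 → ℝ) → ℝ} (h : BM A f) (o1 o2 o3 : Option (Fin 3)) (s : ℝ) :
    T o1 o2 o3 s f = T o3 o2 o1 s f := by
  rw [T_swap12 h, T_swap23 h, T_swap12 h]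

theorem om0_inv (l : ℝ) {s : ℝ} (hs : 0 < s) : ee l s = om0 l s * s⁻¹ := by
  unfold om0; field_simp

theorem Rw_PD {l A : ℝ} (hl : 0 < l) {f : (Fin 3 → ℝ) → ℝ} (hf : BM A f) (k : Fin 3) :
    PD k (Rw l f) (R1 l k f) := by
  have := W_PD (k := k) (WB0 hl hf) (WB1 hl hf (some k) none none) hf (fun s hs => om0_inv l hs)
  have e : W (ee l) (some k) none none f = R1 l k f := W_congr fun s => T_13 hf _ _ _ s
  rwa [e] at this

theorem R1_PD {l A : ℝ} (hl : 0 < l) (hα0 : 0 < α) (hα1 : α ≤ 1) {f : (Fin 3 → ℝ) → ℝ} (hf : BM A f)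
    (ht : TH α A f) (k : Fin 3) {i : Fin 3} (hi : i ≠ 0) :
    PD k (R1 l i f) (R2 l k i f) :=
  W_PD (k := k) (WB1 hl hf none none (some i)) (WB2 hl hα0 hα1 hf ht hi (some k) none) hf
    (fun s hs => rfl)

theorem R1_PD0 {l A : ℝ} (hl : 0 < l) (hα0 : 0 < α) (hα1 : α ≤ 1) {f : (Fin 3 → ℝ) → ℝ} (hf : BM A f)
    (ht : TH α A f) {j : Fin 3} (hj : j ≠ 0) :
    PD j (R1 l 0 f) (R2 l 0 j f) := by
  have e : W (om2 l) (some j) (some 0) none f = R2 l 0 j f := W_congr fun s => by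
    rw [T_swap12 hf, T_swap23 hf]
  have e0 : R1 l 0 f = W (ee l) none (some 0) none f := W_congr fun s => T_swap23 hf _ _ _ s
  have hb := WB2 hl hα0 hα1 hf ht hj none (some 0)
  have hb' : WB (om2 l) (some j) (some 0) none f (fun s => s ^ (α - 1) * ee l s * (kap ^ 3 * A)) :=
    ⟨hb.1, hb.2.1, fun s hs x => by rw [T_13 hf]; exact hb.2.2.1 s hs x, hb.2.2.2⟩
  have := W_PD (k := j) (WB1 hl hf none (some 0) none) hb' hf (fun s hs => rfl)
  rwa [e, ← e0] at this

theorem T_lip {B : ℝ} {f : (Fin 3 → ℝ) → ℝ} {A : ℝ} (hf : BM A f) (o2 o3 : Option (Fin 3)) {s : ℝ}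
    (hs : 0 < s) (hB : ∀ k x, |T (some k) o2 o3 s f x| ≤ B) (x y : Fin 3 → ℝ) :
    |T none o2 o3 s f x - T none o2 o3 s f y| ≤ 3 * (s⁻¹ * B) * ‖x - y‖ :=
  PD.lip (fun k => T_PD hf k o2 o3 hs) (fun k x => by
    rw [abs_mul, abs_of_pos (inv_pos.mpr hs)]
    exact mul_le_mul_of_nonneg_left (hB k x) (inv_pos.mpr hs).le) x y

theorem cont_of_lip {f : (Fin 3 → ℝ) → ℝ} {K : ℝ} (h : ∀ x y, |f x - f y| ≤ K * ‖x - y‖) :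
    Continuous f := by
  refine (LipschitzWith.of_dist_le_mul (K := ⟨|K|, abs_nonneg K⟩) fun x y => ?_).continuous
  rw [Real.dist_eq, dist_eq_norm]
  exact (h x y).trans (mul_le_mul_of_nonneg_right (le_abs_self K) (norm_nonneg _))

theorem T_cont {A : ℝ} {f : (Fin 3 → ℝ) → ℝ} (hf : BM A f) (o2 o3 : Option (Fin 3)) {s : ℝ}
    (hs : 0 < s) : Continuous (T none o2 o3 s f) :=
  cont_of_lip (T_lip hf o2 o3 hs fun k x => (T_BM hf (some k) o2 o3 s).2 x)

theorem WB.cont {ω : ℝ → ℝ} {o1 o2 o3 : Option (Fin 3)} {f : (Fin 3 → ℝ) → ℝ} {b : ℝ → ℝ}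
    (h : WB ω o1 o2 o3 f b) (hc : ∀ s, 0 < s → Continuous (T o1 o2 o3 s f)) :
    Continuous (W ω o1 o2 o3 f) := by
  unfold W
  refine continuous_of_dominated (bound := b) (fun x => (h.meas x).aestronglyMeasurable)
    (fun x => (ae_restrict_iff' measurableSet_Ioi).mpr (Eventually.of_forall fun s hs => h.2.2.1 s hs x))
    h.2.2.2 ((ae_restrict_iff' measurableSet_Ioi).mpr (Eventually.of_forall fun s hs => ?_))
  exact (hc s hs).const_smul (ω s)

theorem Rw_cont {l A : ℝ} (hl : 0 < l) {f : (Fin 3 → ℝ) → ℝ} (hf : BM A f) : Continuous (Rw l f) :=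
  (WB0 hl hf).cont fun s hs => T_cont hf none none hs

theorem R1_cont {l A : ℝ} (hl : 0 < l) {f : (Fin 3 → ℝ) → ℝ} (hf : BM A f) (i : Fin 3) :
    Continuous (R1 l i f) :=
  (WB1 hl hf none none (some i)).cont fun s hs => T_cont hf none (some i) hs

theorem R2_cont {l A : ℝ} (hl : 0 < l) (hα0 : 0 < α) (hα1 : α ≤ 1) {f : (Fin 3 → ℝ) → ℝ} (hf : BM A f)
    (ht : TH α A f) (k : Fin 3) {i : Fin 3} (hi : i ≠ 0) : Continuous (R2 l k i f) :=
  (WB2 hl hα0 hα1 hf ht hi (some k) none).cont fun s hs => by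
    rw [T_swap12 hf]; exact T_cont hf (some k) (some i) hs

theorem rpow_int_bounds (hα0 : 0 < α) (hα1 : α < 1) {ρ K : ℝ} (hρ : 0 < ρ) (hK : 0 ≤ K) {g : ℝ → ℝ}
    (hg : IntegrableOn g (Ioi 0)) (h1 : ∀ s, 0 < s → |g s| ≤ K * s ^ (α - 1))
    (h2 : ∀ s, 0 < s → |g s| ≤ K * ρ * s ^ (α - 2)) :
    |∫ s in Ioi (0:ℝ), g s| ≤ K * (α⁻¹ + (1 - α)⁻¹) * ρ ^ α := by
  have hsplit : ∫ s in Ioi (0:ℝ), g s = (∫ s in Ioc 0 ρ, g s) + ∫ s in Ioi ρ, g s := by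
    rw [← setIntegral_union (Ioc_disjoint_Ioi le_rfl) measurableSet_Ioi
      (hg.mono_set Ioc_subset_Ioi_self) (hg.mono_set (Ioi_subset_Ioi hρ.le)), Ioc_union_Ioi_eq_Ioi hρ.le]
  have i1 : IntervalIntegrable (fun s : ℝ => s ^ (α - 1)) volume 0 ρ :=
    intervalIntegral.intervalIntegrable_rpow' (by linarith)
  have b1 : |∫ s in Ioc 0 ρ, g s| ≤ K * (ρ ^ α / α) := by
    have := norm_integral_le_of_norm_le (f := g) (μ := volume.restrict (Ioc 0 ρ))
      (g := fun s => K * s ^ (α - 1))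
      (((intervalIntegrable_iff_integrableOn_Ioc_of_le hρ.le).mp i1).const_mul K)
      ((ae_restrict_iff' measurableSet_Ioc).mpr (Eventually.of_forall fun s hs => h1 s hs.1))
    have e : ∫ s in Ioc 0 ρ, s ^ (α - 1) = ρ ^ α / α := by
      rw [← intervalIntegral.integral_of_le hρ.le, integral_rpow (Or.inl (by linarith))]
      simp [Real.zero_rpow hα0.ne']
    rw [integral_const_mul, e] at this
    exact this
  have b2 : |∫ s in Ioi ρ, g s| ≤ K * ρ * (ρ ^ (α - 1) / (1 - α)) := by
    have := norm_integral_le_of_norm_le (f := g) (μ := volume.restrict (Ioi ρ))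
      (g := fun s => K * ρ * s ^ (α - 2))
      ((integrableOn_Ioi_rpow_of_lt (by linarith) hρ).const_mul _)
      ((ae_restrict_iff' measurableSet_Ioi).mpr (Eventually.of_forall fun s hs => h2 s (hρ.trans hs)))
    rw [integral_const_mul, integral_Ioi_rpow_of_lt (by linarith) hρ] at this
    refine this.trans (le_of_eq ?_)
    rw [show α - 2 + 1 = α - 1 by ring, show (1 - α) = -(α - 1) by ring, div_neg, neg_div]
  rw [hsplit]
  refine (abs_add_le _ _).trans ((add_le_add b1 b2).trans (le_of_eq ?_))
  have : ρ ^ α = ρ * ρ ^ (α - 1) := by rw [Real.rpow_sub hρ, Real.rpow_one]; field_simp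
  rw [this]
  field_simp

/-- Uniform bounds. -/
theorem R_bounds {l : ℝ} (hl : 0 < l) (hα0 : 0 < α) (hα1 : α < 1) : ∃ C, 0 ≤ C ∧
    ∀ (A : ℝ) (f : (Fin 3 → ℝ) → ℝ), BM A f → BM (C * A) (Rw l f) ∧ (∀ i, BM (C * A) (R1 l i f)) ∧
      (TH α A f → ∀ k i : Fin 3, i ≠ 0 → BM (C * A) (R2 l k i f) ∧
        ∀ x y, |R2 l k i f x - R2 l k i f y| ≤ C * A * ‖x - y‖ ^ α) := by
  set c0 := ∫ s in Ioi (0:ℝ), om0 l s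
  set c1 := (∫ s in Ioi (0:ℝ), ee l s) * kap ^ 3
  set c2 := (∫ s in Ioi (0:ℝ), s ^ (α - 1) * ee l s) * kap ^ 3
  set c3 := 9 * kap ^ 3 * (α⁻¹ + (1 - α)⁻¹)
  have h0 : 0 ≤ c0 := setIntegral_nonneg measurableSet_Ioi fun s hs => om0_nonneg l hs
  have hk := kap_nonneg
  have h1 : 0 ≤ c1 := mul_nonneg (setIntegral_nonneg measurableSet_Ioi fun s hs => (ee_pos l s).le) (by positivity)
  have h2 : 0 ≤ c2 := mul_nonneg (setIntegral_nonneg measurableSet_Ioi fun s hs =>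
    mul_nonneg (Real.rpow_nonneg (le_of_lt hs) _) (ee_pos l s).le) (by positivity)
  have h1α : 0 < 1 - α := by linarith
  have h3 : 0 ≤ c3 := by positivity
  refine ⟨c0 + c1 + c2 + c3, by positivity, fun A f hf => ?_⟩
  have hA := hf.nonneg
  refine ⟨?_, fun i => ?_, fun ht k i hi => ⟨?_, fun x y => ?_⟩⟩
  · refine (WB0 hl hf).BM.mono ?_
    rw [integral_mul_const]
    exact mul_le_mul_of_nonneg_right (by linarith) hA
  · refine (WB1 hl hf none none (some i)).BM.mono ?_
    rw [integral_mul_const, ← mul_assoc]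
    exact mul_le_mul_of_nonneg_right (by linarith) hA
  · refine (WB2 hl hα0 hα1.le hf ht hi (some k) none).BM.mono ?_
    rw [integral_mul_const, ← mul_assoc]
    exact mul_le_mul_of_nonneg_right (by linarith) hA
  · have hW := WB2 hl hα0 hα1.le hf ht hi (some k) none
    rcases eq_or_ne x y with rfl | hxy
    · simp [Real.zero_rpow hα0.ne']
    have hρ : 0 < ‖x - y‖ := norm_pos_iff.mpr (sub_ne_zero.mpr hxy)
    have e : R2 l k i f x - R2 l k i f y = ∫ s in Ioi (0:ℝ),
        (om2 l s * T (some k) none (some i) s f x - om2 l s * T (some k) none (some i) s f y) := by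
      rw [integral_sub (hW.intg x) (hW.intg y)]; unfold R2 W; rfl
    rw [e]
    have hom : ∀ s, 0 < s → |om2 l s| ≤ 3 * s⁻¹ := fun s hs => by
      unfold om2
      rw [abs_mul, abs_of_pos (ee_pos l s), abs_of_pos (inv_pos.mpr hs)]
      exact mul_le_mul_of_nonneg_right (ee_le hl s) (inv_pos.mpr hs).le
    have hP : ∀ s, 0 < s → 0 ≤ kap ^ 3 * A * s ^ α := fun s hs => by positivity
    refine (rpow_int_bounds hα0 hα1 hρ (K := 9 * kap ^ 3 * A) (by positivity)
      ((hW.intg x).sub (hW.intg y)) (fun s hs => ?_) (fun s hs => ?_)).trans ?_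
    · rw [Pi.sub_apply, ← mul_sub, abs_mul]
      have b1 := (T_tan_BM hα0.le hα1.le hf ht hi (some k) none hs.le).2 x
      have b2 := (T_tan_BM hα0.le hα1.le hf ht hi (some k) none hs.le).2 y
      have b3 : |T (some k) none (some i) s f x - T (some k) none (some i) s f y| ≤ 3 * (kap ^ 3 * A * s ^ α) := by
        have := hP s hs
        rw [abs_le] at *; constructor <;> linarith [b1.1, b1.2, b2.1, b2.2]
      refine (mul_le_mul (hom s hs) b3 (abs_nonneg _) (by positivity)).trans (le_of_eq ?_)
      rw [Real.rpow_sub hs, Real.rpow_one]; field_simp; ring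
    · rw [Pi.sub_apply, ← mul_sub, abs_mul]
      have b3 := T_lip hf (some k) (some i) hs (fun m x => (T_tan_BM hα0.le hα1.le hf ht hi (some m) (some k) hs.le).2 x) x y
      rw [T_swap12 hf none (some k)] at b3
      refine (mul_le_mul (hom s hs) b3 (abs_nonneg _) (by positivity)).trans (le_of_eq ?_)
      rw [Real.rpow_sub hs, Real.rpow_two]; field_simp; ring
    · have : 9 * kap ^ 3 * A * (α⁻¹ + (1 - α)⁻¹) = c3 * A := by simp only [c3]; ring
      rw [this]
      exact mul_le_mul_of_nonneg_right (mul_le_mul_of_nonneg_right (by linarith) hA)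
        (Real.rpow_nonneg (norm_nonneg _) _)

end Inc

set_option linter.unusedVariables false
set_option linter.unusedSimpArgs false
open Set Filter Topology MeasureTheory
namespace Inc
variable {α : ℝ}

attribute [local irreducible] W

noncomputable def AA (η : ℝ) (u : (Fin 3 → ℝ) → ℝ) : (Fin 3 → ℝ) → ℝ := Av none η (Av none η u)

theorem AA_BM {A η : ℝ} {u : (Fin 3 → ℝ) → ℝ} (h : BM A u) : BM A (AA η u) :=
  Av_none_BM (Av_none_BM h η) η

theorem AA_PD {i : Fin 3} {A B η : ℝ} {f g : (Fin 3 → ℝ) → ℝ} (h : PD i f g) (hf : BM A f)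
    (hg : BM B g) : PD i (AA η f) (AA η g) :=
  Av_PD (Av_PD h hf hg none η) (Av_none_BM hf η) (Av_none_BM hg η) none η

theorem BM.cmul {A : ℝ} {f : (Fin 3 → ℝ) → ℝ} (h : BM A f) (c : ℝ) : BM (|c| * A) (fun x => c * f x) :=
  ⟨h.1.const_mul c, fun x => by
    rw [abs_mul]; exact mul_le_mul_of_nonneg_left (h.2 x) (abs_nonneg c)⟩

theorem AA_D2 {A η : ℝ} {f : (Fin 3 → ℝ) → ℝ} (h : BM A f) (hη : 0 < η) : ∃ B,
    D2 B (AA η f) (fun i => Av none η (fun x => η⁻¹ * Av (some i) η f x))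
      (fun i j x => η⁻¹ * Av (some j) η (fun x => η⁻¹ * Av (some i) η f x) x) := by
  have hG : ∀ i : Fin 3, BM (|η⁻¹| * (kap * A)) (fun x => η⁻¹ * Av (some i) η f x) := fun i =>
    (Av_BM h (some i) η).cmul _
  refine ⟨max (max A (|η⁻¹| * (kap * A))) (|η⁻¹| * (kap * (|η⁻¹| * (kap * A)))), ?_, ?_, ?_, ?_, ?_⟩
  · exact (AA_BM h).mono ((le_max_left _ _).trans (le_max_left _ _))
  · exact fun i => (Av_none_BM (hG i) η).mono ((le_max_right _ _).trans (le_max_left _ _))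
  · exact fun i j => ((Av_BM (hG i) (some j) η).cmul _).mono (le_max_right _ _)
  · exact fun i => Av_PD (Av_deriv h i hη) (Av_none_BM h η) (hG i) none η
  · exact fun i j => Av_deriv (hG i) j hη

theorem AA_R1_PD {l A η : ℝ} (hl : 0 < l) (hα0 : 0 < α) (hα1 : α < 1) {f : (Fin 3 → ℝ) → ℝ}
    (hf : BM A f) (ht : TH α A f) (hη : 0 < η) :
    PD 0 (AA η (R1 l 0 f)) (fun x => l * AA η (Rw l f) x - AA η f x - AA η (R2 l 1 1 f) x
      - AA η (R2 l 2 2 f) x) := by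
  obtain ⟨B, hD⟩ := AA_D2 hf hη
  obtain ⟨C, hC, hR⟩ := R_bounds (l := l) hl hα0 hα1
  obtain ⟨b0, b1, b2⟩ := hR A f hf
  have b2 := b2 ht
  have e0 : W (om0 l) none none none (AA η f) = AA η (Rw l f) := by
    rw [AA, AA, Rw, (WB0 hl hf).Av_W hf none η, (WB0 hl (Av_none_BM hf η)).Av_W (Av_none_BM hf η) none η]
  have d1 := fun i => W_PD' (WB0 hl hD.b0) (WB0 hl (hD.b1 i)) hD.b0 (hD.b1 i) (hD.d1 i)
  have d2 := fun i j => W_PD' (WB0 hl (hD.b1 i)) (WB0 hl (hD.b2 i j)) (hD.b1 i) (hD.b2 i j) (hD.d2 i j)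
  have e1 := fun i => (d1 i).unique (e0 ▸ AA_PD (η := η) (Rw_PD hl hf i) b0 (b1 i))
  have e2 : ∀ i : Fin 3, i ≠ 0 → _ := fun i hi => (d2 i i).unique
    (e1 i ▸ AA_PD (η := η) (R1_PD hl hα0 hα1.le hf ht i hi) (b1 i) (b2 i i hi).1)
  have hx := d2 0 0
  rw [e1 0] at hx
  convert hx using 1
  funext x
  have r := hD.res hl x
  rw [Fin.sum_univ_three, e2 1 (by decide), e2 2 (by decide), e0] at r
  linarith

theorem Av_lim {A : ℝ} {h : ℕ → (Fin 3 → ℝ) → ℝ} {X : ℕ → Fin 3 → ℝ} {η : ℕ → ℝ} {c : ℝ}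
    (hb : ∀ n, BM A (h n)) (hl : ∀ z, Tendsto (fun n => h n (X n + η n • z)) atTop (𝓝 c)) :
    Tendsto (fun n => Av none (η n) (h n) (X n)) atTop (𝓝 c) := by
  have e : c = ∫ z, wt none z * c := by
    rw [integral_mul_const]; simp [wt, gk_int]
  rw [e]; unfold Av
  refine tendsto_integral_of_dominated_convergence (fun z => |wt none z| * A)
    (fun n => (Av_integrand (hb n) none (η n) (X n)).aestronglyMeasurable)
    ((wt_integrable none).abs.mul_const A) (fun n => Eventually.of_forall fun z => ?_)
    (Eventually.of_forall fun z => (hl z).const_mul _)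
  rw [Real.norm_eq_abs, abs_mul]
  exact mul_le_mul_of_nonneg_left ((hb n).2 _) (abs_nonneg _)

theorem AA_lim {A : ℝ} {u : (Fin 3 → ℝ) → ℝ} {η : ℕ → ℝ} (hη : Tendsto η atTop (𝓝 0)) (hb : BM A u)
    {y : Fin 3 → ℝ} (hc : ContinuousAt u y) : Tendsto (fun n => AA (η n) u y) atTop (𝓝 (u y)) := by
  refine Av_lim (A := A) (fun n => Av_none_BM hb _) fun z => ?_
  refine Av_lim (A := A) (fun n => hb) fun z' => ?_
  refine hc.tendsto.comp ?_
  have : Tendsto (fun n => y + η n • z + η n • z') atTop (𝓝 (y + (0:ℝ) • z + (0:ℝ) • z')) :=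
    (tendsto_const_nhds.add (hη.smul_const z)).add (hη.smul_const z')
  simpa using this

theorem single_meas (x : Fin 3 → ℝ) (i : Fin 3) : Measurable fun t : ℝ => x + (Pi.single i t : Fin 3 → ℝ) := by
  refine measurable_const.add (measurable_pi_iff.mpr fun j => ?_)
  by_cases hj : j = i
  · subst hj; simp only [Pi.single_eq_same]; exact measurable_id
  · simp [hj]

theorem R1_int {l A : ℝ} (hl : 0 < l) (hα0 : 0 < α) (hα1 : α < 1) {f : (Fin 3 → ℝ) → ℝ}
    (hf : BM A f) (ht : TH α A f) {x : Fin 3 → ℝ} {a b : ℝ} (hab : a ≤ b)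
    (hc : ∀ t ∈ Ioo a b, ContinuousAt f (x + Pi.single 0 t)) :
    R1 l 0 f (x + Pi.single 0 b) - R1 l 0 f (x + Pi.single 0 a) =
      ∫ t in a..b, (fun y => l * Rw l f y - f y - R2 l 1 1 f y - R2 l 2 2 f y) (x + Pi.single 0 t) := by
  obtain ⟨C, hC, hR⟩ := R_bounds (l := l) hl hα0 hα1
  obtain ⟨b0, b1, b2⟩ := hR A f hf
  have b2 := b2 ht
  have c11 := R2_cont hl hα0 hα1.le hf ht 1 (i := 1) (by decide)
  have c22 := R2_cont hl hα0 hα1.le hf ht 2 (i := 2) (by decide)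
  have b11 := (b2 1 1 (by decide)).1
  have b22 := (b2 2 2 (by decide)).1
  set η : ℕ → ℝ := fun n => 1 / ((n:ℝ) + 1) with hηd
  have hη0 : ∀ n, 0 < η n := fun n => by rw [hηd]; positivity
  have hη : Tendsto η atTop (𝓝 0) := tendsto_one_div_add_atTop_nhds_zero_nat
  set g : ℕ → (Fin 3 → ℝ) → ℝ := fun n x => l * AA (η n) (Rw l f) x - AA (η n) f x
    - AA (η n) (R2 l 1 1 f) x - AA (η n) (R2 l 2 2 f) x with hg
  have gm : ∀ n, BM (l * (C * A) + A + C * A + C * A) (g n) := fun n => by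
    have h0 := AA_BM (η := η n) b0
    have h1 := AA_BM (η := η n) hf
    have h2 := AA_BM (η := η n) b11
    have h3 := AA_BM (η := η n) b22
    refine ⟨(((h0.1.const_mul l).sub h1.1).sub h2.1).sub h3.1, fun y => ?_⟩
    have q0 : |l * AA (η n) (Rw l f) y| ≤ l * (C * A) := by
      rw [abs_mul, abs_of_pos hl]; exact mul_le_mul_of_nonneg_left (h0.2 y) hl.le
    have q1 := h1.2 y
    have q2 := h2.2 y
    have q3 := h3.2 y
    rw [abs_le] at *
    constructor <;> simp only [hg] <;> linarith [q0.1, q0.2, q1.1, q1.2, q2.1, q2.2, q3.1, q3.2]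
  have sm := single_meas x 0
  have key : ∀ n, AA (η n) (R1 l 0 f) (x + Pi.single 0 b) - AA (η n) (R1 l 0 f) (x + Pi.single 0 a) =
      ∫ t in a..b, g n (x + Pi.single 0 t) := fun n => by
    refine (intervalIntegral.integral_eq_sub_of_hasDerivAt
      (f := fun t => AA (η n) (R1 l 0 f) (x + Pi.single 0 t))
      (fun t _ => (AA_R1_PD hl hα0 hα1 hf ht (hη0 n)).at x t) ?_).symm
    refine (intervalIntegrable_const (c := (l * (C * A) + A + C * A + C * A))).mono_fun
      (((gm n).1.comp sm).aestronglyMeasurable) (Eventually.of_forall fun t => ?_)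
    exact ((gm n).2 _).trans (le_abs_self _)
  have L1 : Tendsto (fun n => AA (η n) (R1 l 0 f) (x + Pi.single 0 b) -
      AA (η n) (R1 l 0 f) (x + Pi.single 0 a)) atTop
      (𝓝 (R1 l 0 f (x + Pi.single 0 b) - R1 l 0 f (x + Pi.single 0 a))) :=
    (AA_lim hη (b1 0) (R1_cont hl hf 0).continuousAt).sub (AA_lim hη (b1 0) (R1_cont hl hf 0).continuousAt)
  refine tendsto_nhds_unique L1 ?_
  simp_rw [key]
  refine intervalIntegral.tendsto_integral_filter_of_dominated_convergence
    (fun _ => (l * (C * A) + A + C * A + C * A))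
    (Eventually.of_forall fun n => ((gm n).1.comp sm).aestronglyMeasurable)
    (Eventually.of_forall fun n => Eventually.of_forall fun t _ => (gm n).2 _)
    intervalIntegrable_const ?_
  filter_upwards [(Set.countable_singleton b).ae_notMem volume] with t ht' htm
  rw [uIoc_of_le hab] at htm
  have htb : t ∈ Ioo a b := ⟨htm.1, lt_of_le_of_ne htm.2 (by simpa using ht')⟩
  exact ((((AA_lim hη b0 (Rw_cont hl hf).continuousAt).const_mul l).sub (AA_lim hη hf (hc t htb))).sub
    (AA_lim hη b11 c11.continuousAt)).sub (AA_lim hη b22 c22.continuousAt)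

end Inc

set_option linter.unusedVariables false
set_option linter.unusedSimpArgs false
open Set Filter Topology MeasureTheory
namespace Inc
variable {α : ℝ}

attribute [local irreducible] W

theorem R1_hol {l : ℝ} (hl : 0 < l) (hα0 : 0 < α) (hα1 : α < 1) : ∃ C, 0 ≤ C ∧
    ∀ (A : ℝ) (f : (Fin 3 → ℝ) → ℝ), BM A f → ∀ i x y,
      |R1 l i f x - R1 l i f y| ≤ C * A * ‖x - y‖ ^ α := by
  have hk := kap_nonneg
  have hi := ee_int hl (β := -α) (by linarith)
  set c := ∫ s in Ioi (0:ℝ), s ^ (-α) * ee l s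
  have hc : 0 ≤ c := setIntegral_nonneg measurableSet_Ioi fun s hs =>
    mul_nonneg (Real.rpow_nonneg (le_of_lt hs) _) (ee_pos l s).le
  refine ⟨3 * kap ^ 3 * c, by positivity, fun A f hf i x y => ?_⟩
  have hA := hf.nonneg
  have hW := WB1 hl hf none none (some i)
  have e : R1 l i f x - R1 l i f y = ∫ s in Ioi (0:ℝ),
      (ee l s * T none none (some i) s f x - ee l s * T none none (some i) s f y) := by
    rw [integral_sub (hW.intg x) (hW.intg y)]; unfold R1 W; rfl
  have hr := norm_nonneg (x - y)
  set ρ := ‖x - y‖ with hρ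
  have := norm_integral_le_of_norm_le (μ := volume.restrict (Ioi (0:ℝ)))
      (f := fun s => ee l s * T none none (some i) s f x - ee l s * T none none (some i) s f y)
      (g := fun s => s ^ (-α) * ee l s * (3 * (kap ^ 3 * A) * ρ ^ α)) (hi.mul_const _)
      ((ae_restrict_iff' measurableSet_Ioi).mpr (Eventually.of_forall fun s hs => ?_))
  · rw [integral_mul_const] at this
    rw [e]
    refine this.trans (le_of_eq ?_)
    ring
  · have hs : 0 < s := hs
    rw [← mul_sub, Real.norm_eq_abs, abs_mul, abs_of_pos (ee_pos l s)]
    have b1 := (T_BM hf none none (some i) s).2 x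
    have b2 := (T_BM hf none none (some i) s).2 y
    have b3 := T_lip hf none (some i) hs (fun m x => (T_BM hf (some m) none (some i) s).2 x) x y
    rw [← hρ] at b3
    have hK : 0 ≤ kap ^ 3 * A := by positivity
    have ht : 0 ≤ ρ / s := by positivity
    have : |T none none (some i) s f x - T none none (some i) s f y| ≤ 3 * (kap ^ 3 * A) * (ρ / s) ^ α := by
      rcases le_total (ρ / s) 1 with h | h
      · refine b3.trans ?_
        have := self_le_rpow hα1.le ht h
        calc 3 * (s⁻¹ * (kap ^ 3 * A)) * ρ = 3 * (kap ^ 3 * A) * (ρ / s) := by field_simp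
          _ ≤ _ := mul_le_mul_of_nonneg_left this (by positivity)
      · have := Real.one_le_rpow h hα0.le
        have h3 : |T none none (some i) s f x - T none none (some i) s f y| ≤ 3 * (kap ^ 3 * A) * 1 := by
          rw [abs_le] at *; constructor <;> linarith [b1.1, b1.2, b2.1, b2.2]
        exact h3.trans (mul_le_mul_of_nonneg_left this (by positivity))
    refine (mul_le_mul_of_nonneg_left this (ee_pos l s).le).trans (le_of_eq ?_)
    rw [Real.div_rpow hr hs.le, Real.rpow_neg hs.le]; field_simp

/-- sup bound gives a `C^{1,α}` bound -/
theorem R_sup {l : ℝ} (hl : 0 < l) (hα0 : 0 < α) (hα1 : α < 1) : ∃ C, 0 ≤ C ∧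
    ∀ (A : ℝ) (F : (Fin 3 → ℝ) → ℝ), BM A F → HH α 1 (C * A) (Rw l F) ∧
      (∀ x y, |Rw l F x - Rw l F y| ≤ C * A * ‖x - y‖ ^ α) ∧
      ∀ x ∈ Slab, HasFDerivWithinAt (Rw l F) (lin fun i => R1 l i F x) Slab x := by
  obtain ⟨C1, hC1, h1⟩ := R1_hol (l := l) hl hα0 hα1
  obtain ⟨C2, hC2, h2⟩ := R_bounds (l := l) hl hα0 hα1
  refine ⟨C1 + 5 * C2, by positivity, fun A F hF => ?_⟩
  have hA := hF.nonneg
  obtain ⟨b0, b1, -⟩ := h2 A F hF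
  have hH := h1 A F hF
  have e1 : C1 * A ≤ (C1 + 5 * C2) * A := mul_le_mul_of_nonneg_right (by linarith) hA
  have e2 : C2 * A ≤ (C1 + 5 * C2) * A := mul_le_mul_of_nonneg_right (by linarith) hA
  have e0 : 0 ≤ C2 * A := by positivity
  have e0' : 0 ≤ C1 * A := by positivity
  have lip := PD.lip (Rw_PD hl hF) (fun k x => (b1 k).2 x)
  have hol : ∀ x y, |Rw l F x - Rw l F y| ≤ (C1 + 5 * C2) * A * ‖x - y‖ ^ α := fun x y => by
    have hr := norm_nonneg (x - y)
    rcases le_total ‖x - y‖ 1 with h | h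
    · refine (lip x y).trans ?_
      have := self_le_rpow hα1.le hr h
      calc 3 * (C2 * A) * ‖x - y‖ ≤ 3 * (C2 * A) * ‖x - y‖ ^ α := by gcongr
        _ ≤ _ := by
          refine mul_le_mul_of_nonneg_right ?_ (by positivity)
          nlinarith
    · have h1 := Real.one_le_rpow h hα0.le
      have b1 := b0.2 x
      have b2 := b0.2 y
      have h3 : |Rw l F x - Rw l F y| ≤ (C1 + 5 * C2) * A * 1 := by
        rw [abs_le] at *; constructor <;> nlinarith [b1.1, b1.2, b2.1, b2.2]
      exact h3.trans (mul_le_mul_of_nonneg_left h1 (by positivity))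
  have has : ∀ x, HasFDerivWithinAt (Rw l F) (lin fun i => R1 l i F x) Slab x := fun x =>
    has_of_taylor (K := 8 * (C1 * A)) hα0 fun y hy => by
      refine coord_taylor (S := univ) hα0.le (by simp) e0' (fun i x _ h _ => ?_) (fun i x _ y _ => hH i x y)
        (mem_univ x) (mem_univ y)
      refine PD.inc hα0.le e0' (Rw_PD hl hF i) (fun t => ?_) h
      have := hH i (x + Pi.single i t) x
      rwa [add_sub_cancel_left, add_single_norm] at this
  refine ⟨HH.mk_of_has ⟨fun x _ => (b0.2 x).trans e2, fun x _ y _ => hol x y⟩ (fun x _ => has x)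
    fun i => ⟨fun x _ => ((b1 i).2 x).trans e2, fun x _ y _ => (hH i x y).trans ?_⟩, hol, fun x _ => has x⟩
  exact mul_le_mul_of_nonneg_right e1 (by positivity)

/-- The normal second derivative. -/
noncomputable def R00 (l : ℝ) (f F : (Fin 3 → ℝ) → ℝ) (y : Fin 3 → ℝ) : ℝ :=
  l * Rw l F y - f y - R2 l 1 1 F y - R2 l 2 2 F y

theorem R1_inc {l A M : ℝ} (hl : 0 < l) (hα0 : 0 < α) (hα1 : α < 1) {f F : (Fin 3 → ℝ) → ℝ}
    (hF : BM A F) (ht : TH α A F) (hFf : ∀ x : Fin 3 → ℝ, x 0 ∈ Ioo (0:ℝ) 1 → F x = f x)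
    (hf : ContinuousOn f Slab)
    (hM : ∀ x ∈ Slab, ∀ y ∈ Slab, |R00 l f F x - R00 l f F y| ≤ M * ‖x - y‖ ^ α) (hM0 : 0 ≤ M)
    {x : Fin 3 → ℝ} {a b c : ℝ} (ha : 0 ≤ x 0 + a) (hb : x 0 + b ≤ 1) (hc : c ∈ Icc a b) :
    |R1 l 0 F (x + Pi.single 0 b) - R1 l 0 F (x + Pi.single 0 a) -
      R00 l f F (x + Pi.single 0 c) * (b - a)| ≤ M * (b - a) ^ α * (b - a) := by
  have hab : a ≤ b := hc.1.trans hc.2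
  have h0 : ∀ t, (x + Pi.single 0 t : Fin 3 → ℝ) 0 = x 0 + t := fun t => by simp
  have hs : ∀ t ∈ Icc a b, (x + Pi.single 0 t : Fin 3 → ℝ) ∈ Slab := fun t ht => by
    change _ ∈ Icc _ _; rw [h0]; exact ⟨by linarith [ht.1], by linarith [ht.2]⟩
  have hio : ∀ t ∈ Ioo a b, (x + Pi.single 0 t : Fin 3 → ℝ) 0 ∈ Ioo (0:ℝ) 1 := fun t ht => by
    rw [h0]; exact ⟨by linarith [ht.1], by linarith [ht.2]⟩
  have hop : IsOpen {y : Fin 3 → ℝ | y 0 ∈ Ioo (0:ℝ) 1} := isOpen_Ioo.preimage (continuous_apply 0)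
  have hcF : ∀ t ∈ Ioo a b, ContinuousAt F (x + Pi.single 0 t) := fun t ht' => by
    have hn := hop.mem_nhds (hio t ht')
    have : ContinuousAt f (x + Pi.single 0 t) := (hf.mono (s := Slab)
      (fun y (hy : y 0 ∈ Ioo (0:ℝ) 1) => (Ioo_subset_Icc_self hy : y 0 ∈ Icc (0:ℝ) 1))).continuousAt hn
    refine this.congr (Filter.eventuallyEq_of_mem hn fun y hy => (hFf y hy).symm)
  rw [R1_int hl hα0 hα1 hF ht hab hcF]
  obtain ⟨C, hC, hR⟩ := R_bounds (l := l) hl hα0 hα1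
  obtain ⟨b0, b1, b2⟩ := hR A F hF
  have b2 := b2 ht
  have b11 := (b2 1 1 (by decide)).1
  have b22 := (b2 2 2 (by decide)).1
  have hIntg : IntervalIntegrable (fun t => (fun y => l * Rw l F y - F y - R2 l 1 1 F y - R2 l 2 2 F y)
      (x + Pi.single 0 t)) volume a b := by
    refine (intervalIntegrable_const (c := (l * (C * A) + A + C * A + C * A))).mono_fun
      ((((((b0.1.const_mul l).sub hF.1).sub b11.1).sub b22.1).comp (single_meas x 0)).aestronglyMeasurable)
      (Eventually.of_forall fun t => ?_)
    refine le_trans ?_ (le_abs_self _)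
    have q0 : |l * Rw l F (x + Pi.single 0 t)| ≤ l * (C * A) := by
      rw [abs_mul, abs_of_pos hl]; exact mul_le_mul_of_nonneg_left (b0.2 _) hl.le
    have q1 := hF.2 (x + Pi.single 0 t)
    have q2 := b11.2 (x + Pi.single 0 t)
    have q3 := b22.2 (x + Pi.single 0 t)
    beta_reduce
    rw [Real.norm_eq_abs]
    rw [abs_le] at *
    constructor <;> linarith [q0.1, q0.2, q1.1, q1.2, q2.1, q2.2, q3.1, q3.2]
  have e : R00 l f F (x + Pi.single 0 c) * (b - a) = ∫ t in a..b, R00 l f F (x + Pi.single 0 c) := by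
    rw [intervalIntegral.integral_const, smul_eq_mul, mul_comm]
  rw [e, ← intervalIntegral.integral_sub hIntg intervalIntegrable_const]
  have := intervalIntegral.norm_integral_le_of_norm_le_const_ae (a := a) (b := b) (C := M * (b - a) ^ α)
    (f := fun t => (fun y => l * Rw l F y - F y - R2 l 1 1 F y - R2 l 2 2 F y)
      (x + Pi.single 0 t) - R00 l f F (x + Pi.single 0 c)) ?_
  · rwa [abs_of_nonneg (sub_nonneg.mpr hab)] at this
  filter_upwards [(Set.countable_singleton b).ae_notMem volume] with t ht' htm
  rw [uIoc_of_le hab] at htm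
  have htb : t ∈ Ioo a b := ⟨htm.1, lt_of_le_of_ne htm.2 (by simpa using ht')⟩
  have e2 : l * Rw l F (x + Pi.single 0 t) - F (x + Pi.single 0 t) - R2 l 1 1 F (x + Pi.single 0 t)
      - R2 l 2 2 F (x + Pi.single 0 t) = R00 l f F (x + Pi.single 0 t) := by
    simp only [R00]; rw [hFf _ (hio t htb)]
  rw [e2]
  refine (hM _ (hs t (Ioo_subset_Icc_self htb)) _ (hs c hc)).trans ?_
  refine mul_le_mul_of_nonneg_left (Real.rpow_le_rpow (norm_nonneg _) ?_ hα0.le) hM0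
  rw [add_sub_add_left_eq_sub, ← Pi.single_sub, add_single_norm, abs_le]
  constructor <;> linarith [htb.1, htb.2, hc.1, hc.2]

/-- Second order regularity on the slab. -/
theorem R_slab {l : ℝ} (hl : 0 < l) (hα0 : 0 < α) (hα1 : α < 1) : ∃ C, 0 ≤ C ∧
    ∀ (A : ℝ) (f F : (Fin 3 → ℝ) → ℝ), HH α 0 A f → BM A F → TH α A F →
      (∀ x : Fin 3 → ℝ, x 0 ∈ Ioo (0:ℝ) 1 → F x = f x) →
      HH α 2 (C * A) (Rw l F) ∧
      ∀ x ∈ Slab, pdW 0 (pdW 0 (Rw l F)) x + pdW 1 (pdW 1 (Rw l F)) x + pdW 2 (pdW 2 (Rw l F)) x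
        = l * Rw l F x - f x := by
  obtain ⟨C1, hC1, h1⟩ := R_sup (l := l) hl hα0 hα1
  obtain ⟨C2, hC2, h2⟩ := R_bounds (l := l) hl hα0 hα1
  set K := (l + 1) * (C1 + C2) + 1 + 2 * C2 with hK
  refine ⟨K, by positivity, fun A f F hf hF ht hFf => ?_⟩
  have hA := hF.nonneg
  obtain ⟨b0, b1, b2⟩ := h2 A F hF
  have b2 := b2 ht
  obtain ⟨w1, whol, whas⟩ := h1 A F hF
  have hp : ∀ i, ∀ x ∈ Slab, pdW i (Rw l F) x = R1 l i F x := fun i x hx => pdW_of_lin (whas x hx) hx i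
  have k1 : C1 ≤ K := by rw [hK]; nlinarith
  have k2 : C2 ≤ K := by rw [hK]; nlinarith
  have k1A := mul_le_mul_of_nonneg_right k1 hA
  have k2A := mul_le_mul_of_nonneg_right k2 hA
  have hKA : 0 ≤ K * A := by positivity
  have r2 : ∀ k i : Fin 3, i ≠ 0 → HH α 0 (K * A) (R2 l k i F) := fun k i hi =>
    ⟨fun x _ => ((b2 k i hi).1.2 x).trans k2A, fun x _ y _ => ((b2 k i hi).2 x y).trans
      (mul_le_mul_of_nonneg_right k2A (by positivity))⟩
  have r00 : HH α 0 (K * A) (R00 l f F) := by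
    have q := ((((w1.lek (Nat.zero_le 1)).cmul l).sub hf).sub
      (⟨fun x _ => ((b2 1 1 (by decide)).1.2 x), fun x _ y _ => ((b2 1 1 (by decide)).2 x y)⟩ :
        HH α 0 (C2 * A) (R2 l 1 1 F))).sub
      (⟨fun x _ => ((b2 2 2 (by decide)).1.2 x), fun x _ y _ => ((b2 2 2 (by decide)).2 x y)⟩ :
        HH α 0 (C2 * A) (R2 l 2 2 F))
    refine q.mono ?_
    rw [abs_of_pos hl, hK]
    nlinarith [mul_nonneg hC1 hA, mul_nonneg hC2 hA, mul_nonneg (mul_nonneg hl.le hC2) hA]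
  have inct : ∀ (k : Fin 3) (u v : (Fin 3 → ℝ) → ℝ), PD k u v →
      (∀ x y, |v x - v y| ≤ C2 * A * ‖x - y‖ ^ α) → ∀ (x : Fin 3 → ℝ) (h : ℝ),
      |u (x + Pi.single k h) - u x - v x * h| ≤ K * A * |h| ^ α * |h| := fun k u v huv hv x h => by
    refine PD.inc hα0.le hKA huv (fun t => ?_) h
    have := hv (x + Pi.single k t) x
    rw [add_sub_cancel_left, add_single_norm] at this
    exact this.trans (mul_le_mul_of_nonneg_right k2A (by positivity))
  have hSl : ∀ x ∈ Slab, ∀ y ∈ Slab, x + Pi.single 0 (y 0 - x 0) ∈ Slab ∧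
      x + Pi.single 0 (y 0 - x 0) + Pi.single 1 (y 1 - x 1) ∈ Slab := fun x hx y hy => by
    have hy' : y 0 ∈ Icc (0:ℝ) 1 := hy
    constructor <;> change _ ∈ Icc _ _ <;> simpa using hy'
  have hasi : ∀ i : Fin 3, i ≠ 0 → ∀ x ∈ Slab,
      HasFDerivWithinAt (R1 l i F) (lin fun k => R2 l k i F x) Slab x := fun i hi x hx =>
    has_of_taylor (K := 8 * (K * A)) hα0 fun y hy => coord_taylor hα0.le hSl hKA
      (fun k x _ h _ => inct k _ _ (R1_PD hl hα0 hα1.le hF ht k hi) (b2 k i hi).2 x h)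
      (fun k x hx y hy => (r2 k i hi).hol hx hy) hx hy
  set g0 : Fin 3 → (Fin 3 → ℝ) → ℝ := fun k => if k = 0 then R00 l f F else R2 l 0 k F with hg0
  have g0H : ∀ k, HH α 0 (K * A) (g0 k) := fun k => by
    by_cases hk : k = 0
    · simp only [hg0, hk, if_true]; exact r00
    · simp only [hg0, hk, if_false]; exact r2 0 k hk
  have has0 : ∀ x ∈ Slab, HasFDerivWithinAt (R1 l 0 F) (lin fun k => g0 k x) Slab x := fun x hx =>
    has_of_taylor (K := 8 * (K * A)) hα0 fun y hy => coord_taylor hα0.le hSl hKA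
      (fun k x hx h hxh => by
        by_cases hk : k = 0
        · subst hk
          simp only [hg0, if_true]
          have hx' : x 0 ∈ Icc (0:ℝ) 1 := hx
          have hxh' : x 0 + h ∈ Icc (0:ℝ) 1 := by
            have : (x + Pi.single 0 h : Fin 3 → ℝ) 0 ∈ Icc (0:ℝ) 1 := hxh
            simpa using this
          have s0 : x + (Pi.single 0 0 : Fin 3 → ℝ) = x := by simp
          rcases le_total 0 h with h0 | h0
          · have := R1_inc hl hα0 hα1 hF ht hFf (hf.cont hα0) r00.2 hKA (x := x) (a := 0) (b := h) (c := 0)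
              (by simpa using hx'.1) hxh'.2 ⟨le_rfl, h0⟩
            rw [s0, sub_zero] at this
            rwa [abs_of_nonneg h0]
          · have := R1_inc hl hα0 hα1 hF ht hFf (hf.cont hα0) r00.2 hKA (x := x) (a := h) (b := 0) (c := 0)
              hxh'.1 (by simpa using hx'.2) ⟨h0, le_rfl⟩
            rw [s0, zero_sub] at this
            rw [abs_of_nonpos h0]
            rw [← abs_neg] at this
            convert this using 2
            ring
        · simp only [hg0, hk, if_false]
          exact inct k _ _ (R1_PD0 hl hα0 hα1.le hF ht hk) (b2 0 k hk).2 x h)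
      (fun k x hx y hy => (g0H k).hol hx hy) hx hy
  have H1 : ∀ i, HH α 1 (K * A) (pdW i (Rw l F)) := fun i => by
    refine HH.congr (f := R1 l i F) ?_ (fun x hx => (hp i x hx).symm)
    have z : HH α 0 (K * A) (R1 l i F) := ((w1.pd i).mono k1A).congr (fun x hx => hp i x hx)
    by_cases hi : i = 0
    · subst hi; exact HH.mk_of_has z has0 g0H
    · exact HH.mk_of_has z (hasi i hi) (fun k => r2 k i hi)
  refine ⟨⟨(w1.mono k1A).zero, w1.diff, H1⟩, fun x hx => ?_⟩
  rw [pdW_congr (fun x hx => hp 0 x hx) hx 0, pdW_congr (fun x hx => hp 1 x hx) hx 1,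
    pdW_congr (fun x hx => hp 2 x hx) hx 2, pdW_of_lin (has0 x hx) hx, pdW_of_lin (hasi 1 (by decide) x hx) hx,
    pdW_of_lin (hasi 2 (by decide) x hx) hx]
  simp only [hg0, if_true, R00]
  ring

end Inc

set_option linter.unusedVariables false
set_option linter.unusedSimpArgs false
open Set Filter Topology MeasureTheory
namespace Inc
variable {α : ℝ}

attribute [local irreducible] W

noncomputable def linC : (Fin 3 → ℝ) →L[ℝ] ((Fin 3 → ℝ) →L[ℝ] ℝ) :=
  LinearMap.toContinuousLinearMap
    { toFun := lin
      map_add' := fun c d => by ext v; simp [lin_apply, add_mul, Finset.sum_add_distrib]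
      map_smul' := fun a c => by ext v; simp [lin_apply, mul_assoc, Finset.mul_sum] }

theorem linC_apply (c : Fin 3 → ℝ) : linC c = lin c := rfl

theorem pdW_symm {f : (Fin 3 → ℝ) → ℝ} {M : ℝ} (h : HH α 2 M f) (i j : Fin 3) {x : Fin 3 → ℝ}
    (hx : x ∈ Slab) : pdW i (pdW j f) x = pdW j (pdW i f) x := by
  set f'' : (Fin 3 → ℝ) →L[ℝ] ((Fin 3 → ℝ) →L[ℝ] ℝ) :=
    linC.comp (ContinuousLinearMap.pi fun i => lin fun k => pdW k (pdW i f) x) with hf''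
  have h1 : ∀ y ∈ interior Slab, HasFDerivAt f (lin fun i => pdW i f y) y := fun y hy =>
    (hasFD h.diff (interior_subset hy)).hasFDerivAt (mem_interior_iff_mem_nhds.mp hy)
  have h2 : HasFDerivWithinAt (fun y => lin fun i => pdW i f y) f'' (interior Slab) x := by
    have : HasFDerivWithinAt (fun y => fun i => pdW i f y)
        (ContinuousLinearMap.pi fun i => lin fun k => pdW k (pdW i f) x) Slab x :=
      hasFDerivWithinAt_pi.mpr fun i => hasFD (h.pd i).diff hx
    exact (linC.hasFDerivAt.comp_hasFDerivWithinAt x this).mono interior_subset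
  have := slab_convex.second_derivative_within_at_symmetric slab_interior h1 hx h2
    (Pi.single i 1) (Pi.single j 1)
  have e : ∀ a b : Fin 3, f'' (Pi.single a 1) (Pi.single b 1) = pdW a (pdW b f) x := fun a b => by
    simp only [hf'', ContinuousLinearMap.comp_apply, linC_apply]
    rw [lin_single]
    simp only [ContinuousLinearMap.pi_apply]
    rw [lin_single]
  rw [e, e] at this
  exact this

/-- invariance of the resolvent under isometries -/
theorem Rw_inv {l : ℝ} {ι : (Fin 3 → ℝ) → (Fin 3 → ℝ)}
    (hι : ∀ (s : ℝ) (f : (Fin 3 → ℝ) → ℝ), Measurable f →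
      Av none s (fun x => f (ι x)) = fun x => Av none s f (ι x))
    {f : (Fin 3 → ℝ) → ℝ} {A : ℝ} (hf : BM A f) (x : Fin 3 → ℝ) :
    Rw l (fun x => f (ι x)) x = Rw l f (ι x) := by
  unfold Rw W
  congr 1
  funext s
  congr 1
  unfold T
  rw [hι s f hf.1, hι s _ (Av_none_BM hf s).1, hι s _ (Av_none_BM (Av_none_BM hf s) s).1]

theorem Rw_neg {l : ℝ} (f : (Fin 3 → ℝ) → ℝ) (x : Fin 3 → ℝ) :
    Rw l (fun x => - f x) x = - Rw l f x := by
  have h : ∀ (s : ℝ) (f : (Fin 3 → ℝ) → ℝ), Av none s (fun x => - f x) = fun x => - Av none s f x := fun s f => by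
    funext x; unfold Av; rw [← integral_neg]; congr 1; funext z; ring
  unfold Rw W
  rw [← integral_neg]
  congr 1
  funext s
  unfold T
  rw [h, h, h]; ring

theorem Rw_add {l A B : ℝ} (hl : 0 < l) {f g : (Fin 3 → ℝ) → ℝ} (hf : BM A f) (hg : BM B g) (x : Fin 3 → ℝ) :
    Rw l (fun x => f x + g x) x = Rw l f x + Rw l g x := by
  have h : ∀ (s : ℝ) (f g : (Fin 3 → ℝ) → ℝ) (A B : ℝ), BM A f → BM B g →
      Av none s (fun x => f x + g x) = fun x => Av none s f x + Av none s g x := fun s f g A B hf hg => by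
    funext x
    have := integral_add (Av_integrand hf none s x) (Av_integrand hg none s x)
    unfold Av; rw [← this]; congr 1; funext z; ring
  have e : ∀ s, T none none none s (fun x => f x + g x) x = T none none none s f x + T none none none s g x := fun s => by
    unfold T
    rw [h s f g A B hf hg, h s _ _ A B (Av_none_BM hf s) (Av_none_BM hg s),
      h s _ _ A B (Av_none_BM (Av_none_BM hf s) s) (Av_none_BM (Av_none_BM hg s) s)]
  have := integral_add ((WB0 hl hf).intg x) ((WB0 hl hg).intg x)
  unfold Rw W
  rw [← this]
  congr 1; funext s; rw [e]; ring

theorem Rw_sub {l A B : ℝ} (hl : 0 < l) {f g : (Fin 3 → ℝ) → ℝ} (hf : BM A f) (hg : BM B g) (x : Fin 3 → ℝ) :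
    Rw l (fun x => f x - g x) x = Rw l f x - Rw l g x := by
  have hg' : BM B (fun x => - g x) := ⟨hg.1.neg, fun x => by rw [abs_neg]; exact hg.2 x⟩
  rw [sub_eq_add_neg, ← Rw_neg, ← Rw_add hl hf hg']; rfl

theorem Av_trans (v : Fin 3 → ℝ) (s : ℝ) (f : (Fin 3 → ℝ) → ℝ) (hf : Measurable f) :
    Av none s (fun x => f (x + v)) = fun x => Av none s f (x + v) := by
  funext x; unfold Av; congr 1; funext z; rw [add_right_comm]

/-- reflection about `x 0 = c` -/
def rf (c : ℝ) (x : Fin 3 → ℝ) : Fin 3 → ℝ := Pi.single 0 (2 * c) + refl 0 x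

theorem rf_add (c : ℝ) (x z : Fin 3 → ℝ) (s : ℝ) : rf c (x + s • z) = rf c x + s • refl 0 z := by
  funext j; simp only [rf, refl, Pi.add_apply, Pi.smul_apply, smul_eq_mul]; split_ifs <;> ring

theorem Av_rf (c : ℝ) (s : ℝ) (f : (Fin 3 → ℝ) → ℝ) (hf : Measurable f) :
    Av none s (fun x => f (rf c x)) = fun x => Av none s f (rf c x) := by
  funext x; unfold Av
  rw [← refl_int 0 (F := fun z => wt none z * f (rf c x + s • z))
    (((wt_cont none).measurable).mul (hf.comp (shift_meas _ s)))]
  congr 1; funext z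
  simp only [wt, gk_refl, rf_add]

noncomputable def fold (t : ℝ) : ℝ := Real.arccos (Real.cos (Real.pi * t)) / Real.pi

theorem fold_cont : Continuous fold := by unfold fold; fun_prop

theorem fold_mem (t : ℝ) : fold t ∈ Icc (0:ℝ) 1 :=
  ⟨div_nonneg (Real.arccos_nonneg _) Real.pi_pos.le, (div_le_one Real.pi_pos).mpr (Real.arccos_le_pi _)⟩

theorem fold_eq {t : ℝ} (ht : t ∈ Icc (0:ℝ) 1) : fold t = t := by
  unfold fold
  rw [Real.arccos_cos (mul_nonneg Real.pi_pos.le ht.1)]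
  · field_simp
  · nlinarith [Real.pi_pos, ht.2]

theorem fold_neg (t : ℝ) : fold (-t) = fold t := by unfold fold; rw [mul_neg, Real.cos_neg]

theorem fold_two_sub (t : ℝ) : fold (2 - t) = fold t := by
  unfold fold; rw [mul_sub, mul_comm Real.pi 2, Real.cos_two_pi_sub]

noncomputable def fm (x : Fin 3 → ℝ) : Fin 3 → ℝ := Function.update x 0 (fold (x 0))

theorem fm_cont : Continuous fm := by
  unfold fm
  exact continuous_id.update 0 (fold_cont.comp (continuous_apply 0))

theorem fm_mem (x : Fin 3 → ℝ) : fm x ∈ Slab := by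
  change fm x 0 ∈ Icc _ _; simp [fm, fold_mem, -mem_Icc]

theorem fm_eq {x : Fin 3 → ℝ} (hx : x ∈ Slab) : fm x = x := by
  unfold fm; rw [fold_eq hx]; simp

theorem fm_add (x : Fin 3 → ℝ) (v : Fin 3 → ℝ) (hv : v 0 = 0) : fm (x + v) = fm x + v := by
  funext j; unfold fm
  by_cases hj : j = 0
  · subst hj; simp [hv]
  · simp [hj]

noncomputable def sgn (t : ℝ) : ℝ := t * |t|⁻¹
theorem sgn_meas : Measurable sgn := by unfold sgn; fun_prop
theorem sgn_neg (t : ℝ) : sgn (-t) = - sgn t := by unfold sgn; rw [abs_neg]; ring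
theorem sgn_pos {t : ℝ} (ht : 0 < t) : sgn t = 1 := by
  unfold sgn; rw [abs_of_pos ht]; exact mul_inv_cancel₀ ht.ne'
theorem sgn_le (t : ℝ) : |sgn t| ≤ 1 := by
  unfold sgn; rw [abs_mul, abs_inv, abs_abs]; exact mul_inv_le_one

/-- `sg true`: even at 0, odd at 1; `sg false`: odd at 0, even at 1. -/
noncomputable def sg : Bool → ℝ → ℝ
  | true, t => sgn (Real.cos (Real.pi * t / 2))
  | false, t => sgn (Real.sin (Real.pi * t / 2))

theorem sg_meas (b : Bool) : Measurable (sg b) := by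
  cases b <;> exact sgn_meas.comp (by fun_prop)

theorem sg_le (b : Bool) (t : ℝ) : |sg b t| ≤ 1 := by cases b <;> exact sgn_le _

theorem sg_in (b : Bool) {t : ℝ} (ht : t ∈ Ioo (0:ℝ) 1) : sg b t = 1 := by
  have := Real.pi_pos
  cases b
  · exact sgn_pos (Real.sin_pos_of_pos_of_lt_pi (by nlinarith [ht.1]) (by nlinarith [ht.2]))
  · exact sgn_pos (Real.cos_pos_of_mem_Ioo ⟨by nlinarith [ht.1], by nlinarith [ht.2]⟩)

noncomputable def ext (b : Bool) (f : (Fin 3 → ℝ) → ℝ) (x : Fin 3 → ℝ) : ℝ := sg b (x 0) * f (fm x)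

theorem ext_in (b : Bool) (f : (Fin 3 → ℝ) → ℝ) (x : Fin 3 → ℝ) (hx : x 0 ∈ Ioo (0:ℝ) 1) : ext b f x = f x := by
  unfold ext; rw [sg_in b hx, fm_eq (show x 0 ∈ Icc (0:ℝ) 1 from Ioo_subset_Icc_self hx), one_mul]

theorem ext_BM {A : ℝ} {f : (Fin 3 → ℝ) → ℝ} (b : Bool) (hc : ContinuousOn f Slab)
    (hf : ∀ x ∈ Slab, |f x| ≤ A) : BM A (ext b f) := by
  refine ⟨?_, fun x => ?_⟩
  · unfold ext
    refine ((sg_meas b).comp (measurable_pi_apply 0)).mul ?_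
    exact (hc.comp_continuous fm_cont fm_mem).measurable
  · unfold ext; rw [abs_mul]
    exact (mul_le_of_le_one_left (abs_nonneg _) (sg_le b _)).trans (hf _ (fm_mem x))

theorem ext_TH {A : ℝ} {f : (Fin 3 → ℝ) → ℝ} (b : Bool) (hf : HH α 0 A f) : TH α A (ext b f) := by
  intro x i hi h
  have h0 : (Pi.single i h : Fin 3 → ℝ) 0 = 0 := by simp [Pi.single_apply, hi.symm]
  unfold ext
  rw [fm_add x _ h0, Pi.add_apply, h0, add_zero, ← mul_sub, abs_mul]
  refine (mul_le_of_le_one_left (abs_nonneg _) (sg_le b _)).trans ?_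
  have := hf.2 (fm x + Pi.single i h) (by rw [← fm_add x _ h0]; exact fm_mem _) (fm x) (fm_mem x)
  rwa [add_sub_cancel_left, add_single_norm] at this

theorem fm_rf0 (x : Fin 3 → ℝ) : fm (rf 0 x) = fm x := by
  funext j; unfold fm
  by_cases hj : j = 0
  · subst hj; simp [rf, refl, fold_neg]
  · simp [hj, rf, refl]

theorem fm_rf1 (x : Fin 3 → ℝ) : fm (rf 1 x) = fm x := by
  funext j; unfold fm
  by_cases hj : j = 0
  · subst hj
    simp only [rf, refl, Function.update_self, Pi.add_apply, Pi.single_eq_same, if_true]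
    rw [← fold_two_sub]; congr 1; ring
  · simp [hj, rf, refl]

theorem rf_zero (c : ℝ) (x : Fin 3 → ℝ) : rf c x 0 = 2 * c - x 0 := by
  simp [rf, refl]; ring

theorem sg_par (x : ℝ) : sg true (2 * 0 - x) = sg true x ∧ sg false (2 * 1 - x) = sg false x ∧
    sg true (2 * 1 - x) = - sg true x ∧ sg false (2 * 0 - x) = - sg false x := by
  simp only [sg]
  refine ⟨?_, ?_, ?_, ?_⟩
  · rw [show Real.pi * (2 * 0 - x) / 2 = -(Real.pi * x / 2) by ring, Real.cos_neg]
  · rw [show Real.pi * (2 * 1 - x) / 2 = Real.pi - (Real.pi * x / 2) by ring, Real.sin_pi_sub]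
  · rw [show Real.pi * (2 * 1 - x) / 2 = Real.pi - (Real.pi * x / 2) by ring, Real.cos_pi_sub, sgn_neg]
  · rw [show Real.pi * (2 * 0 - x) / 2 = -(Real.pi * x / 2) by ring, Real.sin_neg, sgn_neg]

/-- location of even / odd reflections -/
noncomputable def cE (b : Bool) : ℝ := if b then 0 else 1
noncomputable def cO (b : Bool) : ℝ := if b then 1 else 0

theorem ext_even (b : Bool) (f : (Fin 3 → ℝ) → ℝ) (x : Fin 3 → ℝ) : ext b f (rf (cE b) x) = ext b f x := by
  cases b
  · simp only [cE, ext, rf_zero, if_false, Bool.false_eq_true, fm_rf1, (sg_par (x 0)).2.1]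
  · simp only [cE, ext, rf_zero, if_true, fm_rf0, (sg_par (x 0)).1]

theorem ext_odd (b : Bool) (f : (Fin 3 → ℝ) → ℝ) (x : Fin 3 → ℝ) : ext b f (rf (cO b) x) = - ext b f x := by
  cases b
  · simp only [cO, ext, rf_zero, if_false, Bool.false_eq_true, fm_rf0, (sg_par (x 0)).2.2.2, neg_mul]
  · simp only [cO, ext, rf_zero, if_true, fm_rf1, (sg_par (x 0)).2.2.1, neg_mul]

theorem rf_fix {c : ℝ} {x : Fin 3 → ℝ} (hx : x 0 = c) (h : ℝ) :
    rf c (x + Pi.single 0 h) = x + Pi.single 0 (-h) := by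
  funext j
  by_cases hj : j = 0
  · subst hj; simp [rf, refl, hx]; ring
  · simp [rf, refl, hj]

theorem Rw_odd {l A : ℝ} {b : Bool} {f : (Fin 3 → ℝ) → ℝ} (hF : BM A (ext b f)) {x : Fin 3 → ℝ}
    (hx : x 0 = cO b) : Rw l (ext b f) x = 0 := by
  have h1 := Rw_inv (l := l) (Av_rf (cO b)) hF x
  simp only [ext_odd] at h1
  rw [Rw_neg] at h1
  have h2 : rf (cO b) x = x := by simpa using rf_fix hx 0
  rw [h2] at h1
  linarith

theorem R1_even {l A : ℝ} (hl : 0 < l) {b : Bool} {f : (Fin 3 → ℝ) → ℝ} (hF : BM A (ext b f)) {x : Fin 3 → ℝ}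
    (hx : x 0 = cE b) : R1 l 0 (ext b f) x = 0 := by
  have h1 : ∀ y, Rw l (ext b f) y = Rw l (ext b f) (rf (cE b) y) := fun y => by
    have := Rw_inv (l := l) (Av_rf (cE b)) hF y
    simpa only [ext_even] using this
  have hd := Rw_PD hl hF 0 x
  have hd' : HasDerivAt (fun h : ℝ => Rw l (ext b f) (x + Pi.single 0 h)) (- R1 l 0 (ext b f) x) 0 := by
    have h2 : HasDerivAt (fun h : ℝ => -h) (-1) 0 := hasDerivAt_neg 0
    have hd0 : HasDerivAt (fun h : ℝ => Rw l (ext b f) (x + Pi.single 0 h)) (R1 l 0 (ext b f) x) (-0) := by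
      simpa using hd
    have := hd0.comp 0 h2
    simp only [mul_neg, mul_one] at this
    refine this.congr_of_eventuallyEq (Eventually.of_forall fun h => ?_)
    simp only [Function.comp]
    exact (h1 _).trans (congrArg _ (rf_fix hx h))
  have := hd.unique hd'
  linarith

theorem ext_PD {f : (Fin 3 → ℝ) → ℝ} (b : Bool) (hf : DifferentiableOn ℝ f Slab) {j : Fin 3} (hj : j ≠ 0) :
    PD j (ext b f) (ext b (pdW j f)) := by
  intro x
  have h0 : ∀ h, (Pi.single j h : Fin 3 → ℝ) 0 = 0 := fun h => by simp [Pi.single_apply, hj.symm]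
  have : ∀ h, ext b f (x + Pi.single j h) = sg b (x 0) * f (fm x + Pi.single j h) := fun h => by
    unfold ext; rw [fm_add x _ (h0 h), Pi.add_apply, h0, add_zero]
  simp only [this]
  unfold ext
  refine HasDerivAt.const_mul _ ?_
  have hd := hasFD hf (fm_mem x)
  have hc : HasDerivAt (fun h : ℝ => fm x + (Pi.single j h : Fin 3 → ℝ)) (Pi.single j 1) 0 :=
    (hasDerivAt_single j 0).const_add _
  have e0 : fm x + (Pi.single j (0:ℝ) : Fin 3 → ℝ) = fm x := by simp
  have := HasFDerivWithinAt.comp_hasDerivWithinAt (s := univ) (t := Slab) (0:ℝ)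
    (f := fun h : ℝ => fm x + (Pi.single j h : Fin 3 → ℝ)) (l := f) (by rw [e0]; exact hd) hc.hasDerivWithinAt
    (fun h _ => by beta_reduce; rw [← fm_add x _ (h0 h)]; exact fm_mem _)
  rw [lin_single, hasDerivWithinAt_univ] at this
  exact this

end Inc

set_option linter.unusedVariables false
set_option linter.unusedSimpArgs false
open Set Filter Topology MeasureTheory
namespace Inc
variable {α : ℝ}

/-- Periodicity on the slab. -/
def PerS (f : (Fin 3 → ℝ) → ℝ) : Prop :=
  ∀ x ∈ Slab, f (x + Pi.single 1 2) = f x ∧ f (x + Pi.single 2 2) = f x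

/-- Resolvent on the slab with mixed boundary conditions -/
noncomputable def RR (l : ℝ) (b : Bool) (f : (Fin 3 → ℝ) → ℝ) : (Fin 3 → ℝ) → ℝ := Rw l (ext b f)

/-- Laplacian -/
noncomputable def Lap (f : (Fin 3 → ℝ) → ℝ) (x : Fin 3 → ℝ) : ℝ :=
  pdW 0 (pdW 0 f) x + pdW 1 (pdW 1 f) x + pdW 2 (pdW 2 f) x

theorem RR_odd {l M : ℝ} {b : Bool} {f : (Fin 3 → ℝ) → ℝ} (hα : 0 < α) (hf : HH α 0 M f) {x : Fin 3 → ℝ}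
    (hx : x 0 = cO b) : RR l b f x = 0 := Rw_odd (ext_BM b (hf.cont hα) hf.1) hx

theorem RR_even {l M : ℝ} (hl : 0 < l) {b : Bool} {f : (Fin 3 → ℝ) → ℝ} (hα : 0 < α) (hα1 : α < 1)
    (hf : HH α 0 M f) {x : Fin 3 → ℝ} (hxs : x ∈ Slab)
    (hx : x 0 = cE b) : pdW 0 (RR l b f) x = 0 := by
  have hB := ext_BM b (hf.cont hα) hf.1
  obtain ⟨C, hC, h⟩ := R_sup (l := l) hl hα hα1
  have := pdW_of_lin ((h M _ hB).2.2 x hxs) hxs 0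
  unfold RR
  rw [this]
  exact R1_even hl hB hx

theorem RR_per {l M : ℝ} {b : Bool} {f : (Fin 3 → ℝ) → ℝ} (hα : 0 < α)
    (hf : HH α 0 M f) (hp : PerS f) : PerS (RR l b f) := by
  have hB := ext_BM b (hf.cont hα) hf.1
  have key : ∀ v : Fin 3 → ℝ, v 0 = 0 → (∀ x ∈ Slab, f (x + v) = f x) → ∀ x, RR l b f (x + v) = RR l b f x := by
    intro v hv h x
    unfold RR
    rw [← Rw_inv (ι := fun x => x + v) (Av_trans v) hB]
    congr 1
    funext y
    unfold ext
    rw [fm_add y v hv, h _ (fm_mem y)]; simp [hv]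
  intro x hx
  exact ⟨key _ (by simp) (fun x hx => (hp x hx).1) x, key _ (by simp) (fun x hx => (hp x hx).2) x⟩

theorem RR_sub {l M N : ℝ} (hl : 0 < l) {b : Bool} {f g : (Fin 3 → ℝ) → ℝ} (hα : 0 < α)
    (hf : HH α 0 M f) (hg : HH α 0 N g) (x : Fin 3 → ℝ) :
    RR l b (fun x => f x - g x) x = RR l b f x - RR l b g x := by
  unfold RR
  rw [← Rw_sub hl (ext_BM b (hf.cont hα) hf.1) (ext_BM b (hg.cont hα) hg.1)]
  congr 1
  funext y; unfold ext; ring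

theorem RR_congr {l : ℝ} {b : Bool} {f g : (Fin 3 → ℝ) → ℝ} (h : EqOn f g Slab) : RR l b f = RR l b g := by
  unfold RR; congr 1; funext y; unfold ext; rw [h (fm_mem y)]

theorem RR_tan {l M : ℝ} (hl : 0 < l) {b : Bool} {f : (Fin 3 → ℝ) → ℝ} (hα : 0 < α) (hα1 : α < 1)
    (hf : HH α 1 M f) {j : Fin 3} (hj : j ≠ 0) {x : Fin 3 → ℝ} (hx : x ∈ Slab) :
    pdW j (RR l b f) x = RR l b (pdW j f) x := by
  have hB := ext_BM b (hf.cont hα) hf.zero.1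
  have hB' := ext_BM b ((hf.pd j).cont hα) (hf.pd j).zero.1
  obtain ⟨C, hC, h⟩ := R_sup (l := l) hl hα hα1
  have := pdW_of_lin ((h M _ hB).2.2 x hx) hx j
  unfold RR
  rw [this]
  have h1 := Rw_PD hl hB j
  have h2 := W_PD' (WB0 hl hB) (WB0 hl hB') hB hB' (ext_PD b hf.diff hj)
  exact congrFun (h1.unique h2) x

theorem RR_sup {l : ℝ} (hl : 0 < l) (hα0 : 0 < α) (hα1 : α < 1) : ∃ C, 0 ≤ C ∧
    ∀ (b : Bool) (A : ℝ) (f : (Fin 3 → ℝ) → ℝ), ContinuousOn f Slab → (∀ x ∈ Slab, |f x| ≤ A) →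
      HH α 1 (C * A) (RR l b f) := by
  obtain ⟨C, hC, h⟩ := R_sup (l := l) hl hα0 hα1
  exact ⟨C, hC, fun b A f hc hf => (h A _ (ext_BM b hc hf)).1⟩

theorem RR_reg {l : ℝ} (hl : 0 < l) (hα0 : 0 < α) (hα1 : α < 1) : ∀ k : ℕ, ∃ C, 0 ≤ C ∧
    ∀ (b : Bool) (A : ℝ) (f : (Fin 3 → ℝ) → ℝ), HH α k A f → HH α (k + 2) (C * A) (RR l b f) ∧
      ∀ x ∈ Slab, Lap (RR l b f) x = l * RR l b f x - f x := by
  intro k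
  induction k with
  | zero =>
    obtain ⟨C, hC, h⟩ := R_slab (l := l) hl hα0 hα1
    exact ⟨C, hC, fun b A f hf => h A f _ hf (ext_BM b (hf.cont hα0) hf.1) (ext_TH b hf) (ext_in b f)⟩
  | succ k ih =>
    obtain ⟨C, hC, h⟩ := ih
    refine ⟨(l + 3) * C + 1, by positivity, fun b A f hf => ?_⟩
    have hA := hf.nonneg
    obtain ⟨hw, hL⟩ := h b A f hf.of_succ
    refine ⟨?_, hL⟩
    set w := RR l b f with hwd
    set K := ((l + 3) * C + 1) * A with hK
    have hCA : C * A ≤ K := by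
      rw [hK]; refine mul_le_mul_of_nonneg_right ?_ hA; nlinarith
    have ht : ∀ j : Fin 3, j ≠ 0 → HH α (k + 2) (C * A) (pdW j w) := fun j hj =>
      (h b A _ (hf.pd j)).1.congr fun x hx => (RR_tan hl hα0 hα1 (hf.lek (by omega)) hj hx).symm
    have h0 : HH α (k + 2) K (pdW 0 w) := by
      refine ⟨((hw.pd 0).zero.mono hCA), (hw.pd 0).diff, fun j => ?_⟩
      by_cases hj : j = 0
      · subst hj
        have q := (((hw.of_succ.cmul l).sub hf).sub ((ht 1 (by decide)).pd 1)).sub ((ht 2 (by decide)).pd 2)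
        refine (q.mono ?_).congr fun x hx => ?_
        · rw [abs_of_pos hl, hK]; nlinarith [mul_nonneg hC hA]
        · have := hL x hx
          unfold Lap at this
          linarith
      · exact (((ht j hj).pd 0).mono hCA).congr fun x hx => pdW_symm (hw.lek (by omega)) 0 j hx
    refine ⟨hw.zero.mono hCA, hw.diff, fun i => ?_⟩
    by_cases hi : i = 0
    · subst hi; exact h0
    · exact (ht i hi).mono hCA

end Inc

set_option linter.unusedVariables false
set_option linter.unusedSimpArgs false
open Set Filter Topology MeasureTheory
namespace Inc
variable {α : ℝ}

theorem slab_add {x v : Fin 3 → ℝ} (hx : x ∈ Slab) (hv : v 0 = 0) : x + v ∈ Slab := by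
  simpa [Slab, hv] using hx

theorem PerS.int1 {f : (Fin 3 → ℝ) → ℝ} {j : Fin 3} (hj : j ≠ 0)
    (hf : ∀ x ∈ Slab, f (x + Pi.single j 2) = f x) :
    ∀ (n : ℕ) (x : Fin 3 → ℝ), x ∈ Slab → f (x + Pi.single j (2 * (n : ℝ))) = f x
  | 0, x, hx => by simp
  | n + 1, x, hx => by
      rw [show x + Pi.single j (2 * ((n + 1 : ℕ) : ℝ)) = (x + Pi.single j (2 * (n : ℝ))) + Pi.single j (2 : ℝ) by
        rw [add_assoc, ← Pi.single_add]; congr 2; push_cast; ring]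
      rw [hf _ (slab_add hx (by simp [hj.symm])), PerS.int1 hj hf n x hx]

theorem PerS.int {f : (Fin 3 → ℝ) → ℝ} {j : Fin 3} (hj : j ≠ 0)
    (hf : ∀ x ∈ Slab, f (x + Pi.single j 2) = f x) (n : ℤ) {x : Fin 3 → ℝ} (hx : x ∈ Slab) :
    f (x + Pi.single j (2 * (n : ℝ))) = f x := by
  rcases Int.eq_nat_or_neg n with ⟨m, rfl | rfl⟩
  · simpa using PerS.int1 hj hf m x hx
  · have := PerS.int1 hj hf m (x + Pi.single j (2 * ((-(m : ℤ) : ℤ) : ℝ))) (slab_add hx (by simp [hj.symm]))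
    rw [← this, add_assoc, ← Pi.single_add]; simp

/-- fundamental cell -/
def Cell : Set (Fin 3 → ℝ) := Icc 0 ![1, 2, 2]

theorem Cell_sub : Cell ⊆ Slab := by
  intro x hx
  have h1 := hx.1 0; have h2 := hx.2 0
  exact ⟨by simpa using h1, by simpa using h2⟩

theorem PerS.cell {f : (Fin 3 → ℝ) → ℝ} (hf : PerS f) {x : Fin 3 → ℝ} (hx : x ∈ Slab) :
    ∃ y ∈ Cell, y 0 = x 0 ∧ f y = f x := by
  set n1 : ℤ := -⌊x 1 / 2⌋
  set n2 : ℤ := -⌊x 2 / 2⌋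
  refine ⟨x + Pi.single 1 (2 * (n1 : ℝ)) + Pi.single 2 (2 * (n2 : ℝ)), ?_, by simp, ?_⟩
  · have a1 := Int.floor_le (x 1 / 2); have a2 := Int.lt_floor_add_one (x 1 / 2)
    have b1 := Int.floor_le (x 2 / 2); have b2 := Int.lt_floor_add_one (x 2 / 2)
    have h := hx
    simp only [Slab, mem_ofPred_eq, mem_Icc] at h
    constructor
    · intro i
      fin_cases i <;> simp [n1, n2] <;> linarith
    · intro i
      fin_cases i <;> simp [n1, n2] <;> linarith
  · rw [PerS.int (by decide) (fun x hx => (hf x hx).2) n2 (slab_add hx (by simp)),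
      PerS.int (by decide) (fun x hx => (hf x hx).1) n1 hx]

theorem exists_max {f : (Fin 3 → ℝ) → ℝ} (hp : PerS f) (hc : ContinuousOn f Slab) :
    ∃ x ∈ Slab, ∀ y ∈ Slab, f y ≤ f x := by
  have hK : IsCompact Cell := isCompact_Icc
  obtain ⟨x, hx, h⟩ := hK.exists_isMaxOn ⟨0, by constructor <;> intro i <;> fin_cases i <;> simp⟩
    (hc.mono Cell_sub)
  refine ⟨x, Cell_sub hx, fun y hy => ?_⟩
  obtain ⟨z, hz, -, hfz⟩ := hp.cell hy
  rw [← hfz]; exact h hz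

/-- derivative along a ray -/
theorem ray_deriv {f : (Fin 3 → ℝ) → ℝ} (hf : DifferentiableOn ℝ f Slab) {x : Fin 3 → ℝ} (j : Fin 3) (s : ℝ)
    {S : Set ℝ} (hS : ∀ t ∈ S, x + Pi.single j (t * s) ∈ Slab) {t : ℝ} (ht : t ∈ S) :
    HasDerivWithinAt (fun t => f (x + Pi.single j (t * s))) (s * pdW j f (x + Pi.single j (t * s))) S t := by
  have h1 := hasFD hf (hS t ht)
  have h2 : HasDerivWithinAt (fun t : ℝ => x + (Pi.single j (t * s) : Fin 3 → ℝ)) (Pi.single j s) S t := by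
    rw [hasDerivWithinAt_pi]
    intro i
    by_cases h : i = j
    · subst h
      simpa using ((hasDerivWithinAt_id t S).mul_const s).const_add (x i)
    · simpa [Pi.single_apply, h] using hasDerivWithinAt_const t S (x i)
  have h3 := h1.comp_hasDerivWithinAt t h2 (fun t ht => hS t ht)
  refine h3.congr_deriv ?_
  rw [show (Pi.single j s : Fin 3 → ℝ) = s • Pi.single j 1 by rw [← Pi.single_smul]; simp]
  rw [map_smul, lin_single]; simp

theorem second_le {f : (Fin 3 → ℝ) → ℝ} (hf : DifferentiableOn ℝ f Slab) {j : Fin 3}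
    (hf2 : DifferentiableOn ℝ (pdW j f) Slab) {x : Fin 3 → ℝ} (hx : x ∈ Slab) {s r : ℝ} (hs : s ^ 2 = 1) (hr : 0 < r)
    (hS : ∀ t ∈ Icc 0 r, x + Pi.single j (t * s) ∈ Slab) (hmax : ∀ y ∈ Slab, f y ≤ f x)
    (h0 : 0 ≤ s * pdW j f x) : pdW j (pdW j f) x ≤ 0 := by
  by_contra hpos
  push Not at hpos
  have h00 : (0:ℝ) ∈ Icc 0 r := ⟨le_rfl, hr.le⟩
  have d2 := (ray_deriv hf2 j s hS h00).const_mul s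
  simp only [zero_mul, Pi.single_zero, add_zero] at d2
  rw [show s * (s * pdW j (pdW j f) x) = pdW j (pdW j f) x by rw [← mul_assoc, ← sq, hs, one_mul]] at d2
  set g : ℝ → ℝ := fun t => s * pdW j f (x + Pi.single j (t * s)) with hg
  have hg0 : 0 ≤ g 0 := by simpa [hg] using h0
  have hsl := hasDerivWithinAt_iff_tendsto_slope.1 d2
  have hev : ∀ᶠ t in 𝓝[Icc 0 r \ {0}] (0:ℝ), 0 < slope g 0 t := hsl.eventually (lt_mem_nhds hpos)
  rw [eventually_nhdsWithin_iff, Metric.eventually_nhds_iff] at hev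
  obtain ⟨d, hd, hev⟩ := hev
  set q := min r (d / 2)
  have hq : 0 < q := by positivity
  have hqr : q ≤ r := min_le_left _ _
  have hgpos : ∀ t ∈ Ioc 0 q, 0 < g t := by
    intro t ht
    have := hev (y := t) (by rw [Real.dist_eq, sub_zero, abs_of_pos ht.1]; have := min_le_right r (d/2); linarith [ht.2])
      ⟨⟨ht.1.le, ht.2.trans hqr⟩, by simpa using ht.1.ne'⟩
    rw [slope_def_field, sub_zero] at this
    have h3 := (div_pos_iff_of_pos_right ht.1).1 this
    linarith
  have hmono := strictMonoOn_of_hasDerivWithinAt_pos (convex_Icc 0 q) (f := fun t => f (x + Pi.single j (t * s))) (f' := g)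
    (fun t ht => ((ray_deriv hf j s hS ⟨ht.1, ht.2.trans hqr⟩).continuousWithinAt).mono (Icc_subset_Icc_right hqr))
    (fun t ht => by
      rw [interior_Icc] at ht ⊢
      exact (ray_deriv hf j s hS ⟨ht.1.le, ht.2.le.trans hqr⟩).mono (Ioo_subset_Icc_self.trans (Icc_subset_Icc_right hqr)))
    (fun t ht => by rw [interior_Icc] at ht; exact hgpos t ⟨ht.1, ht.2.le⟩)
  have := hmono (left_mem_Icc.2 hq.le) (right_mem_Icc.2 hq.le) hq
  simp only [zero_mul, Pi.single_zero, add_zero] at this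
  exact absurd (hmax _ (hS q ⟨hq.le, hqr⟩)) (not_le.2 this)

theorem first_le {f : (Fin 3 → ℝ) → ℝ} (hf : DifferentiableOn ℝ f Slab) {j : Fin 3}
    {x : Fin 3 → ℝ} (hx : x ∈ Slab) {s r : ℝ} (hr : 0 < r)
    (hS : ∀ t ∈ Icc 0 r, x + Pi.single j (t * s) ∈ Slab) (hmax : ∀ y ∈ Slab, f y ≤ f x) :
    s * pdW j f x ≤ 0 := by
  have h00 : (0:ℝ) ∈ Icc 0 r := ⟨le_rfl, hr.le⟩
  have d := ray_deriv hf j s hS h00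
  simp only [zero_mul, Pi.single_zero, add_zero] at d
  have hsl := hasDerivWithinAt_iff_tendsto_slope.1 d
  have : Icc 0 r \ {0} = Ioc 0 r := by ext t; simp
  rw [this, nhdsWithin_Ioc_eq_nhdsGT hr] at hsl
  refine le_of_tendsto hsl ?_
  filter_upwards [Ioc_mem_nhdsGT hr] with t ht
  rw [slope_def_field]
  simp only [zero_mul, Pi.single_zero, add_zero, sub_zero]
  exact div_nonpos_of_nonpos_of_nonneg (by linarith [hmax _ (hS t ⟨ht.1.le, ht.2⟩)]) ht.1.le

theorem max_principle {f : (Fin 3 → ℝ) → ℝ} {M : ℝ} (hα : 0 < α) (hf : HH α 2 M f) (hp : PerS f)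
    (hL : ∀ x ∈ Slab, 0 < f x → pdW 1 f x = 0 → pdW 2 f x = 0 → 0 < Lap f x)
    (h0 : ∀ x ∈ Slab, x 0 = 0 → 0 ≤ pdW 0 f x) (h1 : ∀ x ∈ Slab, x 0 = 1 → f x ≤ 0) :
    ∀ x ∈ Slab, f x ≤ 0 := by
  obtain ⟨x, hx, hmax⟩ := exists_max hp (hf.cont hα)
  suffices h : f x ≤ 0 from fun y hy => (hmax y hy).trans h
  by_contra hpos
  push Not at hpos
  have hd := hf.diff
  have tan : ∀ j : Fin 3, j ≠ 0 → ∀ s : ℝ, ∀ t ∈ Icc (0:ℝ) 1, x + Pi.single j (t * s) ∈ Slab :=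
    fun j hj s t _ => slab_add hx (by simp [hj.symm])
  have t1 : ∀ j : Fin 3, j ≠ 0 → pdW j f x = 0 := by
    intro j hj
    have a := first_le hd hx one_pos (tan j hj 1) hmax
    have b := first_le hd hx one_pos (tan j hj (-1)) hmax
    linarith
  have t2 : ∀ j : Fin 3, j ≠ 0 → pdW j (pdW j f) x ≤ 0 := fun j hj =>
    second_le hd (hf.pd j).diff hx (s := 1) (by norm_num) one_pos (tan j hj 1) hmax (by rw [t1 j hj]; simp)
  have hx1 : x 0 < 1 := lt_of_le_of_ne hx.2 (fun h => absurd (h1 x hx h) (not_le.2 hpos))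
  have n2 : pdW 0 (pdW 0 f) x ≤ 0 := by
    have hS : ∀ t ∈ Icc (0:ℝ) (1 - x 0), x + Pi.single 0 (t * 1) ∈ Slab := by
      intro t ht
      have := hx.1
      simp only [Slab, mem_ofPred_eq, mem_Icc, Pi.add_apply, Pi.single_eq_same]
      constructor <;> linarith [ht.1, ht.2]
    rcases eq_or_lt_of_le hx.1 with h | h
    · refine second_le hd (hf.pd 0).diff hx (s := 1) (r := 1 - x 0) (by norm_num) (by linarith) hS hmax ?_
      have := h0 x hx h.symm
      linarith
    · rcases le_total 0 (pdW 0 f x) with h' | h'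
      · exact second_le hd (hf.pd 0).diff hx (s := 1) (r := 1 - x 0) (by norm_num) (by linarith) hS hmax (by linarith)
      · refine second_le hd (hf.pd 0).diff hx (s := -1) (r := x 0) (by norm_num) h ?_ hmax (by linarith)
        intro t ht
        simp only [Slab, mem_ofPred_eq, mem_Icc, Pi.add_apply, Pi.single_eq_same]
        constructor <;> linarith [ht.1, ht.2]
  have := hL x hx hpos (t1 1 (by decide)) (t1 2 (by decide))
  have a := t2 1 (by decide); have b := t2 2 (by decide)
  unfold Lap at this
  linarith

/-- equal on a face gives equal tangential derivatives there -/
theorem face_pd {f g : (Fin 3 → ℝ) → ℝ} (hf : DifferentiableOn ℝ f Slab) (hg : DifferentiableOn ℝ g Slab) {c : ℝ}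
    (h : ∀ x ∈ Slab, x 0 = c → f x = g x) {j : Fin 3} (hj : j ≠ 0) {x : Fin 3 → ℝ} (hx : x ∈ Slab) (hc : x 0 = c) :
    pdW j f x = pdW j g x := by
  have hS : ∀ t ∈ (univ : Set ℝ), x + Pi.single j (t * 1) ∈ Slab := fun t _ => slab_add hx (by simp [hj.symm])
  have a := ray_deriv hf j 1 hS (mem_univ 0)
  have b := ray_deriv hg j 1 hS (mem_univ 0)
  rw [show (fun t => f (x + Pi.single j (t * 1))) = fun t => g (x + Pi.single j (t * 1)) from
    funext fun t => h _ (hS t trivial) (by simp [hj.symm, hc])] at a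
  have := (hasDerivWithinAt_univ.1 a).unique (hasDerivWithinAt_univ.1 b)
  simpa using this
end Inc

set_option linter.unusedVariables false
set_option linter.unusedSimpArgs false
open Set Filter Topology MeasureTheory
namespace Inc
variable {α : ℝ}

theorem Lap_congr {f g : (Fin 3 → ℝ) → ℝ} (h : EqOn f g Slab) {x : Fin 3 → ℝ} (hx : x ∈ Slab) :
    Lap f x = Lap g x := by
  unfold Lap
  have : ∀ i, pdW i (pdW i f) x = pdW i (pdW i g) x := fun i =>
    pdW_congr (fun y hy => pdW_congr h hy i) hx i
  rw [this, this, this]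

theorem Lap_add {f g : (Fin 3 → ℝ) → ℝ} {M N : ℝ} (hf : HH α 2 M f) (hg : HH α 2 N g)
    {x : Fin 3 → ℝ} (hx : x ∈ Slab) : Lap (fun x => f x + g x) x = Lap f x + Lap g x := by
  have : ∀ i, pdW i (pdW i (fun x => f x + g x)) x = pdW i (pdW i f) x + pdW i (pdW i g) x := fun i => by
    rw [pdW_congr (fun y hy => pdW_add hf.diff hg.diff hy i) hx i, pdW_add (hf.pd i).diff (hg.pd i).diff hx]
  unfold Lap; rw [this, this, this]; ring

theorem Lap_cmul {f : (Fin 3 → ℝ) → ℝ} {M : ℝ} (c : ℝ) (hf : HH α 2 M f)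
    {x : Fin 3 → ℝ} (hx : x ∈ Slab) : Lap (fun x => c * f x) x = c * Lap f x := by
  have : ∀ i, pdW i (pdW i (fun x => c * f x)) x = c * pdW i (pdW i f) x := fun i => by
    rw [pdW_congr (fun y hy => pdW_cmul c hf.diff hy i) hx i, pdW_cmul c (hf.pd i).diff hx]
  unfold Lap; rw [this, this, this]; ring

theorem Lap_sub {f g : (Fin 3 → ℝ) → ℝ} {M N : ℝ} (hf : HH α 2 M f) (hg : HH α 2 N g)
    {x : Fin 3 → ℝ} (hx : x ∈ Slab) : Lap (fun x => f x - g x) x = Lap f x - Lap g x := by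
  have : ∀ i, pdW i (pdW i (fun x => f x - g x)) x = pdW i (pdW i f) x - pdW i (pdW i g) x := fun i => by
    rw [pdW_congr (fun y hy => pdW_sub hf.diff hg.diff hy i) hx i, pdW_sub (hf.pd i).diff (hg.pd i).diff hx]
  unfold Lap; rw [this, this, this]; ring

theorem Lap_mul {f g : (Fin 3 → ℝ) → ℝ} {M N : ℝ} (hf : HH α 2 M f) (hg : HH α 2 N g)
    {x : Fin 3 → ℝ} (hx : x ∈ Slab) : Lap (fun x => f x * g x) x = Lap f x * g x + f x * Lap g x
      + 2 * (pdW 0 f x * pdW 0 g x + pdW 1 f x * pdW 1 g x + pdW 2 f x * pdW 2 g x) := by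
  have : ∀ i, pdW i (pdW i (fun x => f x * g x)) x = pdW i (pdW i f) x * g x + f x * pdW i (pdW i g) x
      + 2 * (pdW i f x * pdW i g x) := fun i => by
    rw [pdW_congr (fun y hy => pdW_mul hf.diff hg.diff hy i) hx i,
      pdW_add ((hf.pd i).mul hg.of_succ).diff (hf.of_succ.mul (hg.pd i)).diff hx,
      pdW_mul (hf.pd i).diff hg.diff hx, pdW_mul hf.diff (hg.pd i).diff hx]
    ring
  unfold Lap; rw [this, this, this]; ring

theorem HH.Lap {f : (Fin 3 → ℝ) → ℝ} {M : ℝ} {k : ℕ} (hf : HH α (k + 2) M f) : HH α k (3 * M) (Lap f) := by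
  have := (((hf.pd 0).pd 0).add ((hf.pd 1).pd 1)).add ((hf.pd 2).pd 2)
  exact this.mono (by linarith)

theorem PerS.add {f g : (Fin 3 → ℝ) → ℝ} (hf : PerS f) (hg : PerS g) : PerS (fun x => f x + g x) :=
  fun x hx => ⟨by simp only [(hf x hx).1, (hg x hx).1], by simp only [(hf x hx).2, (hg x hx).2]⟩
theorem PerS.sub {f g : (Fin 3 → ℝ) → ℝ} (hf : PerS f) (hg : PerS g) : PerS (fun x => f x - g x) :=
  fun x hx => ⟨by simp only [(hf x hx).1, (hg x hx).1], by simp only [(hf x hx).2, (hg x hx).2]⟩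
theorem PerS.mul {f g : (Fin 3 → ℝ) → ℝ} (hf : PerS f) (hg : PerS g) : PerS (fun x => f x * g x) :=
  fun x hx => ⟨by simp only [(hf x hx).1, (hg x hx).1], by simp only [(hf x hx).2, (hg x hx).2]⟩
theorem PerS.cmul {f : (Fin 3 → ℝ) → ℝ} (c : ℝ) (hf : PerS f) : PerS (fun x => c * f x) :=
  fun x hx => ⟨by simp only [(hf x hx).1], by simp only [(hf x hx).2]⟩
theorem PerS.neg {f : (Fin 3 → ℝ) → ℝ} (hf : PerS f) : PerS (fun x => - f x) :=
  fun x hx => ⟨by simp only [(hf x hx).1], by simp only [(hf x hx).2]⟩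
theorem PerS.inv {f : (Fin 3 → ℝ) → ℝ} (hf : PerS f) : PerS (fun x => (f x)⁻¹) :=
  fun x hx => ⟨by simp only [(hf x hx).1], by simp only [(hf x hx).2]⟩
theorem PerS.const (c : ℝ) : PerS (fun _ => c) := fun x hx => ⟨rfl, rfl⟩
theorem PerS.x0 : PerS (fun x => x 0) := fun x hx => ⟨by simp, by simp⟩
theorem PerS.congr {f g : (Fin 3 → ℝ) → ℝ} (hf : PerS f) (h : EqOn f g Slab) : PerS g := fun x hx =>
  ⟨by rw [← h hx, ← h (slab_add hx (by simp)), (hf x hx).1], by rw [← h hx, ← h (slab_add hx (by simp)), (hf x hx).2]⟩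

theorem pdW_trans {f : (Fin 3 → ℝ) → ℝ} (hf : DifferentiableOn ℝ f Slab) {v : Fin 3 → ℝ} (hv : v 0 = 0)
    (h : ∀ x ∈ Slab, f (x + v) = f x) (i : Fin 3) {x : Fin 3 → ℝ} (hx : x ∈ Slab) : pdW i f (x + v) = pdW i f x := by
  have h1 := hasFD hf (slab_add hx hv)
  have h2 : HasFDerivWithinAt (fun y => f (y + v)) (lin fun i => pdW i f (x + v)) Slab x := by
    have := h1.comp x ((hasFDerivWithinAt_id x Slab).add_const v) (fun y hy => slab_add hy hv)
    rw [ContinuousLinearMap.comp_id] at this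
    exact this
  rw [← pdW_of_lin h2 hx i]
  exact pdW_congr (fun y hy => h y hy) hx i

theorem PerS.pd {f : (Fin 3 → ℝ) → ℝ} (hp : PerS f) (hf : DifferentiableOn ℝ f Slab) (i : Fin 3) : PerS (pdW i f) :=
  fun x hx => ⟨pdW_trans hf (by simp) (fun x hx => (hp x hx).1) i hx, pdW_trans hf (by simp) (fun x hx => (hp x hx).2) i hx⟩

theorem PerS.Lap {f : (Fin 3 → ℝ) → ℝ} {M : ℝ} (hp : PerS f) (hf : HH α 2 M f) : PerS (Lap f) :=
  (((hp.pd hf.diff 0).pd (hf.pd 0).diff 0).add ((hp.pd hf.diff 1).pd (hf.pd 1).diff 1)).add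
    ((hp.pd hf.diff 2).pd (hf.pd 2).diff 2)

theorem has_x0 (x : Fin 3 → ℝ) : HasFDerivWithinAt (fun x : Fin 3 → ℝ => x 0) (lin (Pi.single 0 1)) Slab x := by
  have h := (ContinuousLinearMap.proj (R := ℝ) (φ := fun _ : Fin 3 => ℝ) 0).hasFDerivAt (x := x)
  have e : lin (Pi.single 0 1) = ContinuousLinearMap.proj (R := ℝ) (φ := fun _ : Fin 3 => ℝ) 0 := by
    ext v; rw [lin_apply]; simp [Fin.sum_univ_three]
  rw [e]; exact h.hasFDerivWithinAt

theorem pdW_x0 (i : Fin 3) {x : Fin 3 → ℝ} (hx : x ∈ Slab) : pdW i (fun x => x 0) x = if i = 0 then 1 else 0 := by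
  rw [pdW_of_lin (has_x0 x) hx]; simp [Pi.single_apply]

theorem HH_x0 (hα0 : 0 < α) (hα1 : α < 1) : ∀ k, HH α k 1 (fun x => x 0) := by
  have h0 : HH α 0 1 (fun x => x 0) := by
    refine ⟨fun x hx => by rw [abs_of_nonneg hx.1]; exact hx.2, fun x hx y hy => ?_⟩
    rw [one_mul]
    have h1 : |x 0 - y 0| ≤ 1 := by rw [abs_le]; constructor <;> linarith [hx.1, hx.2, hy.1, hy.2]
    refine (self_le_rpow hα1.le (abs_nonneg _) h1).trans (Real.rpow_le_rpow (abs_nonneg _) ?_ hα0.le)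
    have := norm_le_pi_norm (x - y) 0
    simpa using this
  intro k
  cases k with
  | zero => exact h0
  | succ k =>
    refine ⟨h0, fun x _ => (has_x0 x).differentiableWithinAt, fun i => ?_⟩
    have : HH α k 1 (fun _ => if i = 0 then (1:ℝ) else 0) :=
      (HH.const k).mono (by split_ifs <;> simp)
    exact this.congr fun x hx => (pdW_x0 i hx).symm

/-- barrier -/
def bar (x : Fin 3 → ℝ) : ℝ := 3 - x 0 - x 0 * x 0

theorem bar_HH (hα0 : 0 < α) (hα1 : α < 1) (k : ℕ) : ∃ N, HH α k N bar :=
  ⟨_, ((HH.const k).sub (HH_x0 hα0 hα1 k)).sub ((HH_x0 hα0 hα1 k).mul (HH_x0 hα0 hα1 k))⟩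

theorem bar_per : PerS bar := ((PerS.const 3).sub PerS.x0).sub (PerS.x0.mul PerS.x0)

theorem bar_pd {x : Fin 3 → ℝ} (hx : x ∈ Slab) (i : Fin 3) :
    pdW i bar x = if i = 0 then -1 - 2 * x 0 else 0 := by
  have d : DifferentiableOn ℝ (fun x : Fin 3 → ℝ => x 0) Slab := fun x _ => (has_x0 x).differentiableWithinAt
  have := pdW_sub (f := fun x : Fin 3 → ℝ => 3 - x 0) (g := fun x => x 0 * x 0)
    ((differentiableOn_const 3).sub d) (d.mul d) hx i
  unfold bar
  rw [this, pdW_sub (differentiableOn_const 3) d hx, pdW_mul d d hx, pdW_const _ hx, pdW_x0 i hx]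
  split_ifs <;> ring

theorem bar_lap {x : Fin 3 → ℝ} (hx : x ∈ Slab) : Lap bar x = -2 := by
  have d : DifferentiableOn ℝ (fun x : Fin 3 → ℝ => x 0) Slab := fun x _ => (has_x0 x).differentiableWithinAt
  have h : ∀ i : Fin 3, pdW i (pdW i bar) x = if i = 0 then -2 else 0 := by
    intro i
    rw [pdW_congr (fun y hy => bar_pd hy i) hx i]
    split_ifs with h
    · rw [pdW_sub (f := fun x : Fin 3 → ℝ => -1) (g := fun x => 2 * x 0) (differentiableOn_const _) (d.const_mul 2) hx,
        pdW_const _ hx, pdW_cmul 2 d hx, pdW_x0 i hx]; simp [h]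
    · exact pdW_const _ hx i
  unfold Lap; rw [h, h, h]; simp

theorem bar_bd {x : Fin 3 → ℝ} (hx : x ∈ Slab) : 1 ≤ bar x ∧ bar x ≤ 3 := by
  unfold bar; have := hx.1; have := hx.2; constructor <;> nlinarith


/-- background profile -/
structure Bg (α : ℝ) (u : (Fin 3 → ℝ) → ℝ) (M m : ℝ) : Prop where
  hh : HH α 3 M u
  per : PerS u
  pos : 0 < m
  le : ∀ x ∈ Slab, m ≤ u x
  x0 : ∀ x ∈ Slab, pdW 0 u x = 0

/-- reciprocal -/
noncomputable def rcp (u : (Fin 3 → ℝ) → ℝ) (x : Fin 3 → ℝ) : ℝ := (u x)⁻¹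
/-- potential -/
noncomputable def pot (u : (Fin 3 → ℝ) → ℝ) (x : Fin 3 → ℝ) : ℝ := u x * Lap (rcp u) x

namespace Bg
variable {u : (Fin 3 → ℝ) → ℝ} {M m : ℝ}
theorem ne (h : Bg α u M m) : ∀ x ∈ Slab, u x ≠ 0 := fun x hx => (h.pos.trans_le (h.le x hx)).ne'
theorem up (h : Bg α u M m) {x : Fin 3 → ℝ} (hx : x ∈ Slab) : 0 < u x := h.pos.trans_le (h.le x hx)
theorem rp (h : Bg α u M m) {x : Fin 3 → ℝ} (hx : x ∈ Slab) : 0 < rcp u x := inv_pos.2 (h.up hx)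
theorem mulr (h : Bg α u M m) {x : Fin 3 → ℝ} (hx : x ∈ Slab) : u x * rcp u x = 1 := mul_inv_cancel₀ (h.ne x hx)
theorem rHH (h : Bg α u M m) : ∃ N, 0 ≤ N ∧ HH α 3 N (rcp u) := by
  obtain ⟨N, hN, H⟩ := HH.inv (α := α) m h.pos 3 M
  exact ⟨N, hN, H u h.hh h.le⟩
theorem rper (h : Bg α u M m) : PerS (rcp u) := h.per.inv
theorem rpd (h : Bg α u M m) (i : Fin 3) {x : Fin 3 → ℝ} (hx : x ∈ Slab) :
    pdW i (rcp u) x = - (pdW i u x * (rcp u x * rcp u x)) := pdW_inv h.hh.diff h.ne hx i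
theorem rpd0 (h : Bg α u M m) {x : Fin 3 → ℝ} (hx : x ∈ Slab) : pdW 0 (rcp u) x = 0 := by
  rw [h.rpd 0 hx, h.x0 x hx]; simp
theorem potHH (h : Bg α u M m) : ∃ N, 0 ≤ N ∧ HH α 1 N (pot u) := by
  obtain ⟨N, hN, H⟩ := h.rHH
  have := (h.hh.lek (k := 1) (by norm_num)).mul (HH.Lap (k := 1) H)
  exact ⟨_, this.nonneg, this⟩
theorem potper (h : Bg α u M m) : PerS (pot u) := by
  obtain ⟨N, hN, H⟩ := h.rHH
  exact h.per.mul (h.rper.Lap H.of_succ)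
theorem lapr (h : Bg α u M m) {x : Fin 3 → ℝ} (hx : x ∈ Slab) : Lap (rcp u) x = pot u x * rcp u x := by
  unfold pot; rw [mul_right_comm, h.mulr hx, one_mul]
/-- Laplacian of u -/
theorem lapu (h : Bg α u M m) {x : Fin 3 → ℝ} (hx : x ∈ Slab) :
    Lap u x = - (u x * pot u x) + 2 * rcp u x * (pdW 1 u x * pdW 1 u x + pdW 2 u x * pdW 2 u x) := by
  obtain ⟨N, hN, H⟩ := h.rHH
  have a := Lap_mul h.hh.of_succ H.of_succ hx
  have b : Lap (fun x => u x * rcp u x) x = 0 := by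
    rw [Lap_congr (g := fun _ => 1) (fun y hy => h.mulr hy) hx]
    have : ∀ i : Fin 3, pdW i (pdW i (fun _ => (1:ℝ))) x = 0 := fun i => by
      rw [pdW_congr (fun y hy => pdW_const 1 hy i) hx i, pdW_const 0 hx]
    unfold Lap; rw [this, this, this]; simp
  rw [b, h.x0 x hx, h.rpd 1 hx, h.rpd 2 hx, h.lapr hx] at a
  have c := h.mulr hx
  have hr := h.rp hx
  have e : Lap u x * (rcp u x * u x) = Lap u x := by rw [mul_comm (rcp u x), c, mul_one]
  have a' := congrArg (fun t => t * u x) a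
  simp only [zero_mul] at a'
  rw [← e]
  set r := rcp u x; set U := u x
  linear_combination a' * (-1) + (2 * r * (pdW 1 u x * pdW 1 u x + pdW 2 u x * pdW 2 u x) - U * pot u x) * c
end Bg
end Inc

set_option linter.unusedVariables false
set_option linter.unusedSimpArgs false
open Set Filter Topology MeasureTheory
namespace Inc
variable {α : ℝ}

/-- weight -/
noncomputable def psi (u : (Fin 3 → ℝ) → ℝ) (x : Fin 3 → ℝ) : ℝ := bar x * rcp u x

namespace Bg
variable {u : (Fin 3 → ℝ) → ℝ} {M m : ℝ}
theorem psi_lap (h : Bg α u M m) (hα0 : 0 < α) (hα1 : α < 1) {x : Fin 3 → ℝ} (hx : x ∈ Slab) :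
    Lap (psi u) x = pot u x * psi u x - 2 * rcp u x := by
  obtain ⟨N, hN, H⟩ := h.rHH
  obtain ⟨N', H'⟩ := bar_HH hα0 hα1 2
  have := Lap_mul H' H.of_succ hx
  unfold psi
  rw [this, bar_lap hx, h.lapr hx, bar_pd hx, bar_pd hx, bar_pd hx, h.rpd0 hx]
  simp; ring

theorem psi_HH (h : Bg α u M m) (hα0 : 0 < α) (hα1 : α < 1) : ∃ N, HH α 2 N (psi u) := by
  obtain ⟨N, hN, H⟩ := h.rHH
  obtain ⟨N', H'⟩ := bar_HH hα0 hα1 2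
  exact ⟨_, H'.mul H.of_succ⟩

theorem psi_per (h : Bg α u M m) : PerS (psi u) := bar_per.mul h.rper

theorem psi_pd0 (h : Bg α u M m) (hα0 : 0 < α) (hα1 : α < 1) {x : Fin 3 → ℝ} (hx : x ∈ Slab) :
    pdW 0 (psi u) x = (-1 - 2 * x 0) * rcp u x := by
  obtain ⟨N, hN, H⟩ := h.rHH
  obtain ⟨N', H'⟩ := bar_HH hα0 hα1 2
  unfold psi
  rw [pdW_mul H'.diff H.diff hx, bar_pd hx, h.rpd0 hx]; simp

theorem psi_pos (h : Bg α u M m) {x : Fin 3 → ℝ} (hx : x ∈ Slab) : 0 < psi u x :=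
  mul_pos (by linarith [(bar_bd hx).1]) (h.rp hx)

theorem compare (h : Bg α u M m) (hα0 : 0 < α) (hα1 : α < 1) {l : ℝ} (hl : 0 < l)
    (hV : ∀ x ∈ Slab, |pot u x| ≤ l) {d : (Fin 3 → ℝ) → ℝ} {N a : ℝ} (hd : HH α 0 N d) (hp : PerS d) (ha : 0 ≤ a)
    (hda : ∀ x ∈ Slab, |d x| ≤ a * psi u x) {x : Fin 3 → ℝ} (hx : x ∈ Slab) :
    |RR l true (fun x => (l - pot u x) * d x) x| ≤ (3 * l / (3 * l + 1)) * a * psi u x := by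
  set t := 3 * l / (3 * l + 1) with ht
  have ht0 : 0 ≤ t := by positivity
  have ht1 : (1 - t) * (3 * l) = t := by rw [ht]; field_simp; ring
  obtain ⟨NV, hNV, HV⟩ := h.potHH
  have hF := ((HH.const (α := α) (c := l) 0).sub HV.of_succ).mul hd
  have hFp : PerS (fun x => (l - pot u x) * d x) := ((PerS.const l).sub h.potper).mul hp
  set F : (Fin 3 → ℝ) → ℝ := fun x => (l - pot u x) * d x with hFdef
  obtain ⟨C, hC, hreg⟩ := RR_reg (l := l) hl hα0 hα1 0
  obtain ⟨hw, hlap⟩ := hreg true _ F hF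
  obtain ⟨Np, hpsi⟩ := h.psi_HH hα0 hα1
  have key : ∀ s : ℝ, |s| = 1 → ∀ x ∈ Slab, s * RR l true F x - (t * a) * psi u x ≤ 0 := by
    intro s hs
    refine max_principle (α := α) hα0 ((hw.cmul s).sub (hpsi.cmul (t * a))) (((RR_per hα0 hF hFp).cmul s).sub
      (h.psi_per.cmul (t * a))) ?_ ?_ ?_
    · intro y hy hpos _ _
      rw [Lap_sub (hw.cmul s) (hpsi.cmul (t * a)) hy, Lap_cmul s hw hy, Lap_cmul _ hpsi hy, h.psi_lap hα0 hα1 hy, hlap y hy]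
      have e1 : s * F y ≤ (l - pot u y) * (a * psi u y) := by
        have h1 : 0 ≤ l - pot u y := by linarith [(abs_le.1 (hV y hy)).2]
        have h2 : s * d y ≤ a * psi u y := by
          refine (le_abs_self _).trans ?_
          rw [abs_mul, hs, one_mul]; exact hda y hy
        calc s * F y = (l - pot u y) * (s * d y) := by rw [hFdef]; ring
          _ ≤ _ := mul_le_mul_of_nonneg_left h2 h1
      have e2 : 0 < l * (s * RR l true F y - (t * a) * psi u y) := mul_pos hl hpos
      have e3 : (1 - t) * (l - pot u y) * psi u y ≤ 2 * t * rcp u y := by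
        have h0 : 0 ≤ 1 - t := by rw [ht, sub_nonneg, div_le_one (by positivity)]; linarith
        have h1 : l - pot u y ≤ 2 * l := by linarith [(abs_le.1 (hV y hy)).1]
        have h2 : psi u y ≤ 3 * rcp u y := mul_le_mul_of_nonneg_right (bar_bd hy).2 (h.rp hy).le
        calc (1 - t) * (l - pot u y) * psi u y ≤ (1 - t) * (2 * l) * (3 * rcp u y) := by
              apply mul_le_mul (mul_le_mul_of_nonneg_left h1 h0) h2 (h.psi_pos hy).le
              positivity
          _ = 2 * t * rcp u y := by linear_combination (2 * rcp u y) * ht1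
      have e4 := mul_le_mul_of_nonneg_left e3 ha
      linarith
    · intro y hy h0
      rw [pdW_sub (hw.cmul s).diff (hpsi.cmul (t * a)).diff hy, pdW_cmul _ hw.diff hy, pdW_cmul _ hpsi.diff hy,
        h.psi_pd0 hα0 hα1 hy, RR_even hl hα0 hα1 hF hy (by simpa [cE] using h0), h0]
      have := h.rp hy
      have : 0 ≤ t * a * rcp u y := by positivity
      linarith
    · intro y hy h1
      rw [RR_odd hα0 hF (by simpa [cO] using h1)]
      have := h.psi_pos hy
      have : 0 ≤ t * a * psi u y := by positivity
      linarith
  rw [abs_le]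
  have h1 := key 1 (by simp) x hx
  have h2 := key (-1) (by simp) x hx
  constructor <;> linarith

theorem schro (h : Bg α u M m) (hα0 : 0 < α) (hα1 : α < 1) (k : ℕ) (hk : k ≤ 1) :
    ∃ C, 0 ≤ C ∧ ∀ A g, HH α k A g → PerS g → ∃ q, HH α (k + 2) (C * A) q ∧ PerS q ∧
      (∀ x ∈ Slab, Lap q x = pot u x * q x + g x) ∧ (∀ x ∈ Slab, x 0 = 0 → pdW 0 q x = 0) ∧
      (∀ x ∈ Slab, x 0 = 1 → q x = 0) := by
  obtain ⟨NV, hNV, HV⟩ := h.potHH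
  set l : ℝ := NV + 1 with hldef
  have hl : 0 < l := by positivity
  have hVl : ∀ x ∈ Slab, |pot u x| ≤ l := fun x hx => (HV.bd hx).trans (by linarith)
  obtain ⟨C1, hC1, hsup⟩ := RR_sup (l := l) hl hα0 hα1
  obtain ⟨C2, hC2, hreg⟩ := RR_reg (l := l) hl hα0 hα1 k
  obtain ⟨Nr, hNr, Hr⟩ := h.rHH
  have hM : 0 ≤ M := h.hh.nonneg
  set t := 3 * l / (3 * l + 1) with ht
  have ht0 : 0 ≤ t := by positivity
  have ht1 : t < 1 := by rw [ht, div_lt_one (by positivity)]; linarith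
  have ht2 : 0 < 1 - t := by linarith
  set K1 : ℝ := C1 * M * (3 * Nr) / (1 - t) with hK1
  have hK1n : 0 ≤ K1 := by positivity
  set K2 : ℝ := C1 * (2 * l * K1 + 1) with hK2
  have hK2n : 0 ≤ K2 := by positivity
  refine ⟨C2 * (2 ^ (k + 1) * ((l + NV) * K2) + 1), by positivity, fun A g hg hgp => ?_⟩
  have hA : 0 ≤ A := hg.nonneg
  set F : ((Fin 3 → ℝ) → ℝ) → (Fin 3 → ℝ) → ℝ := fun q x => (l - pot u x) * q x - g x with hF
  set Q : ℕ → (Fin 3 → ℝ) → ℝ := fun n => Nat.rec (fun _ => 0) (fun _ q => RR l true (F q)) n with hQ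
  have Q0 : Q 0 = fun _ => 0 := rfl
  have Qs : ∀ n, Q (n + 1) = RR l true (F (Q n)) := fun n => rfl
  have HlV : HH α 1 (l + NV) (fun x => l - pot u x) :=
    ((HH.const (c := l) 1).sub HV).mono (by rw [abs_of_pos hl])
  have HF : ∀ q N, HH α 0 N q → HH α 0 (2 ^ 1 * ((l + NV) * N) + A) (F q) := fun q N hq =>
    (HlV.of_succ.mul hq).sub hg.zero
  have PF : ∀ q, PerS q → PerS (F q) := fun q hq => (((PerS.const l).sub h.potper).mul hq).sub hgp
  have hQH : ∀ n, (∃ N, HH α 0 N (Q n)) ∧ PerS (Q n) := by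
    intro n
    induction n with
    | zero => exact ⟨⟨_, HH.const (c := 0) 0⟩, PerS.const 0⟩
    | succ n ih =>
      obtain ⟨⟨N, hN⟩, hp⟩ := ih
      have := HF _ N hN
      rw [Qs]
      exact ⟨⟨_, (hsup true _ _ (this.cont hα0) this.1).of_succ⟩, RR_per hα0 this (PF _ hp)⟩
  choose NQ hNQ using fun n => (hQH n).1
  have hQp := fun n => (hQH n).2
  -- difference formula
  have hdiff : ∀ q q' N N', HH α 0 N q → HH α 0 N' q' → ∀ x, RR l true (F q) x - RR l true (F q') x =
      RR l true (fun x => (l - pot u x) * (q x - q' x)) x := by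
    intro q q' N N' hq hq' x
    rw [← RR_sub hl hα0 (HF _ _ hq) (HF _ _ hq')]
    congr 1
    funext y; simp only [hF]; ring
  set a := C1 * A * M with ha
  have ha0 : 0 ≤ a := by positivity
  have hstep : ∀ n, ∀ x ∈ Slab, |Q (n + 1) x - Q n x| ≤ t ^ n * a * psi u x := by
    intro n
    induction n with
    | zero =>
      intro x hx
      have hF0 : ∀ x ∈ Slab, |F (Q 0) x| ≤ A := fun x hx => by
        simp only [hF, Q0, mul_zero, zero_sub, abs_neg]; exact hg.bd hx
      have := (hsup true A _ ((HF _ _ (hNQ 0)).cont hα0) hF0).bd hx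
      rw [← Qs 0] at this
      have e : Q 0 x = 0 := rfl
      rw [e, sub_zero, pow_zero, one_mul]
      refine this.trans ?_
      have h1 : 1 ≤ M * psi u x := by
        have b1 : 1 ≤ M * rcp u x := by
          rw [← h.mulr hx]; exact mul_le_mul_of_nonneg_right ((le_abs_self _).trans (h.hh.bd hx)) (h.rp hx).le
        have b2 : rcp u x ≤ psi u x := by
          unfold psi; exact le_mul_of_one_le_left (h.rp hx).le (bar_bd hx).1
        exact b1.trans (mul_le_mul_of_nonneg_left b2 hM)
      calc C1 * A = C1 * A * 1 := by ring
        _ ≤ C1 * A * (M * psi u x) := by gcongr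
        _ = _ := by rw [ha]; ring
    | succ n ih =>
      intro x hx
      rw [Qs (n + 1), Qs n, hdiff _ _ _ _ (hNQ (n + 1)) (hNQ n)]
      have := h.compare hα0 hα1 hl hVl ((hNQ (n + 1)).sub (hNQ n)) ((hQp (n + 1)).sub (hQp n))
        (a := t ^ n * a) (by positivity) ih hx
      refine this.trans (le_of_eq ?_)
      rw [← ht, pow_succ]; ring
  have hlim : ∀ x, ∃ y, x ∈ Slab → Tendsto (fun n => Q n x) atTop (𝓝 y) := by
    intro x
    by_cases hx : x ∈ Slab
    · have : CauchySeq (fun n => Q n x) := cauchySeq_of_le_geometric t (a * psi u x) ht1 (fun n => by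
        rw [dist_comm, Real.dist_eq]; refine (hstep n x hx).trans (le_of_eq (by ring)))
      obtain ⟨y, hy⟩ := cauchySeq_tendsto_of_complete this
      exact ⟨y, fun _ => hy⟩
    · exact ⟨0, fun h => absurd h hx⟩
  choose q hq using hlim
  have hdist : ∀ n, ∀ x ∈ Slab, |Q n x - q x| ≤ (t ^ n * (a / (1 - t))) * psi u x := by
    intro n x hx
    have := dist_le_of_le_geometric_of_tendsto t (a * psi u x) ht1 (fun n => by
        rw [dist_comm, Real.dist_eq]; exact (hstep n x hx).trans (le_of_eq (by ring))) (hq x hx) n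
    rw [Real.dist_eq] at this
    refine this.trans (le_of_eq ?_); field_simp
  have hqp : PerS q := by
    intro x hx
    constructor
    · refine tendsto_nhds_unique (hq _ (slab_add hx (by simp))) ?_
      simp only [fun n => (hQp n x hx).1]; exact hq x hx
    · refine tendsto_nhds_unique (hq _ (slab_add hx (by simp))) ?_
      simp only [fun n => (hQp n x hx).2]; exact hq x hx
  -- sup bound on Q n
  have hQb : ∀ n, ∀ x ∈ Slab, |Q n x| ≤ K1 * A := by
    have hpsi : ∀ x ∈ Slab, psi u x ≤ 3 * Nr := fun x hx =>
      mul_le_mul (bar_bd hx).2 ((le_abs_self _).trans (Hr.bd hx)) (h.rp hx).le (by norm_num)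
    have hb : ∀ n, ∀ x ∈ Slab, |Q n x| ≤ (∑ i ∈ Finset.range n, t ^ i) * (a * psi u x) := by
      intro n
      induction n with
      | zero => intro x hx; rw [Q0]; simp
      | succ n ih =>
        intro x hx
        have := hstep n x hx
        have h2 := ih x hx
        rw [Finset.sum_range_succ]
        have h3 : |Q (n + 1) x| ≤ |Q (n + 1) x - Q n x| + |Q n x| := by
          simpa using abs_add_le (Q (n + 1) x - Q n x) (Q n x)
        linarith
    intro n x hx
    refine (hb n x hx).trans ?_
    have hsum : ∑ i ∈ Finset.range n, t ^ i ≤ 1 / (1 - t) := by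
      rw [geom_sum_eq ht1.ne, ← neg_div_neg_eq, neg_sub, neg_sub]
      gcongr
      linarith [pow_nonneg ht0 n]
    have h0 := h.psi_pos hx
    calc _ ≤ (1 / (1 - t)) * (a * (3 * Nr)) := by
          have := hpsi x hx
          gcongr
      _ = K1 * A := by rw [hK1, ha]; ring
  have hQ1 : ∀ n, HH α 1 (K2 * A) (Q (n + 1)) := by
    intro n
    have hb : ∀ x ∈ Slab, |F (Q n) x| ≤ (2 * l * K1 + 1) * A := by
      intro x hx
      have h1 : |l - pot u x| ≤ 2 * l := by
        have := abs_le.1 (hVl x hx); rw [abs_le]; constructor <;> linarith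
      calc |F (Q n) x| ≤ |(l - pot u x) * Q n x| + |g x| := abs_sub _ _
        _ ≤ 2 * l * (K1 * A) + A := by
          rw [abs_mul]
          exact add_le_add (mul_le_mul h1 (hQb n x hx) (abs_nonneg _) (by positivity)) (hg.bd hx)
        _ = _ := by ring
    have := hsup true _ _ ((HF _ _ (hNQ n)).cont hα0) hb
    rw [Qs]
    exact this.mono (by rw [hK2]; apply le_of_eq; ring)
  have hq1 : HH α 1 (K2 * A) q :=
    HH.lim (l := atTop) hα0 (Eventually.of_forall hQ1) (fun x hx => (tendsto_add_atTop_iff_nat 1).2 (hq x hx))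
  have hfix : EqOn (RR l true (F q)) q Slab := by
    intro x hx
    have h1 : Tendsto (fun n => RR l true (F (Q n)) x) atTop (𝓝 (RR l true (F q) x)) := by
      rw [tendsto_iff_dist_tendsto_zero]
      refine squeeze_zero (fun _ => dist_nonneg) (g := fun n => t ^ n * (t * (a / (1 - t)) * psi u x)) ?_ ?_
      · intro n
        rw [Real.dist_eq, hdiff _ _ _ _ (hNQ n) hq1.of_succ]
        have := h.compare hα0 hα1 hl hVl ((hNQ n).sub hq1.of_succ) ((hQp n).sub hqp)
          (a := t ^ n * (a / (1 - t))) (by positivity) (hdist n) hx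
        refine this.trans (le_of_eq ?_)
        rw [← ht]; ring
      · simpa using (tendsto_pow_atTop_nhds_zero_of_lt_one ht0 ht1).mul_const (t * (a / (1 - t)) * psi u x)
    exact tendsto_nhds_unique h1 ((tendsto_add_atTop_iff_nat 1).2 (hq x hx))
  have HFq : HH α k (2 ^ (k + 1) * ((l + NV) * (K2 * A)) + A) (F q) :=
    ((HlV.lek hk).mul (hq1.lek hk)).sub hg
  obtain ⟨hr1, hr2⟩ := hreg true _ _ HFq
  refine ⟨RR l true (F q), hr1.mono (le_of_eq (by ring)), RR_per hα0 HFq.zero (PF _ hqp), ?_, ?_, ?_⟩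
  · intro x hx
    rw [hr2 x hx]
    have := hfix hx
    simp only [hF]
    simp only [hF] at this
    rw [this]; ring
  · intro x hx h0
    exact RR_even hl hα0 hα1 HFq.zero hx (by simpa [cE] using h0)
  · intro x hx h0
    exact RR_odd hα0 HFq.zero (by simpa [cO] using h0)
end Bg
end Inc

set_option linter.unusedVariables false
set_option linter.unusedSimpArgs false
open Set Filter Topology MeasureTheory
namespace Inc
variable {α : ℝ}

/-- the elliptic operator -/
noncomputable def Lop (u p : (Fin 3 → ℝ) → ℝ) (x : Fin 3 → ℝ) : ℝ :=
  Lap p x - 2 * (rcp u x * (pdW 1 u x * pdW 1 p x + pdW 2 u x * pdW 2 p x))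

namespace Bg
variable {u : (Fin 3 → ℝ) → ℝ} {M m : ℝ}

theorem Lop_sub {p q : (Fin 3 → ℝ) → ℝ} {A B : ℝ} (hp : HH α 2 A p) (hq : HH α 2 B q)
    {x : Fin 3 → ℝ} (hx : x ∈ Slab) : Lop u (fun x => p x - q x) x = Lop u p x - Lop u q x := by
  unfold Lop
  rw [Lap_sub hp hq hx, pdW_sub hp.diff hq.diff hx, pdW_sub hp.diff hq.diff hx]; ring

theorem Lop_add {p q : (Fin 3 → ℝ) → ℝ} {A B : ℝ} (hp : HH α 2 A p) (hq : HH α 2 B q)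
    {x : Fin 3 → ℝ} (hx : x ∈ Slab) : Lop u (fun x => p x + q x) x = Lop u p x + Lop u q x := by
  unfold Lop
  rw [Lap_add hp hq hx, pdW_add hp.diff hq.diff hx, pdW_add hp.diff hq.diff hx]; ring

theorem LopHH (h : Bg α u M m) (k : ℕ) (hk : k ≤ 1) : ∃ C, 0 ≤ C ∧ ∀ A p, HH α (k + 2) A p → HH α k (C * A) (Lop u p) := by
  obtain ⟨Nr, hNr, Hr⟩ := h.rHH
  have hM := h.hh.nonneg
  refine ⟨3 + |2| * (2 ^ (k + 1) * (Nr * (2 ^ (k + 1) * M + 2 ^ (k + 1) * M))), by positivity, fun A p hp => ?_⟩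
  have pd : ∀ i, HH α k A (pdW i p) := fun i => (hp.pd i).of_succ
  have ud : ∀ i, HH α k M (pdW i u) := fun i => (h.hh.pd i).lek (by omega)
  have := (HH.Lap hp).sub (((Hr.lek (k := k) (by omega)).mul (((ud 1).mul (pd 1)).add ((ud 2).mul (pd 2)))).cmul 2)
  exact this.mono (le_of_eq (by ring))

theorem Lopper (h : Bg α u M m) {p : (Fin 3 → ℝ) → ℝ} {A : ℝ} (hp : HH α 2 A p) (hper : PerS p) : PerS (Lop u p) :=
  (hper.Lap hp).sub ((h.rper.mul (((h.per.pd h.hh.diff 1).mul (hper.pd hp.diff 1)).add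
    ((h.per.pd h.hh.diff 2).mul (hper.pd hp.diff 2)))).cmul 2)

theorem Lop_mul (h : Bg α u M m) {q : (Fin 3 → ℝ) → ℝ} {A : ℝ} (hq : HH α 2 A q) {x : Fin 3 → ℝ} (hx : x ∈ Slab) :
    Lop u (fun x => u x * q x) x = u x * (Lap q x - pot u x * q x) := by
  unfold Lop
  rw [Lap_mul h.hh.of_succ hq hx, h.lapu hx, h.x0 x hx, pdW_mul h.hh.diff hq.diff hx, pdW_mul h.hh.diff hq.diff hx]
  linear_combination (-2 * (pdW 1 u x * pdW 1 q x + pdW 2 u x * pdW 2 q x)) * h.mulr hx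

theorem ell_unique (h : Bg α u M m) (hα0 : 0 < α) (hα1 : α < 1) {p : (Fin 3 → ℝ) → ℝ} {A : ℝ} (hp : HH α 2 A p) (hper : PerS p)
    (hL : ∀ x ∈ Slab, Lop u p x = 0) (h0 : ∀ x ∈ Slab, x 0 = 0 → pdW 0 p x = 0) (h1 : ∀ x ∈ Slab, x 0 = 1 → p x = 0) :
    ∀ x ∈ Slab, p x = 0 := by
  obtain ⟨N, hb⟩ := bar_HH hα0 hα1 2
  have key : ∀ s d : ℝ, 0 < d → ∀ x ∈ Slab, s * p x - d * bar x ≤ 0 := by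
    intro s d hd
    refine max_principle (α := α) hα0 ((hp.cmul s).sub (hb.cmul d)) ((hper.cmul s).sub (bar_per.cmul d)) ?_ ?_ ?_
    · intro x hx _ a1 a2
      rw [pdW_sub (hp.cmul s).diff (hb.cmul d).diff hx, pdW_cmul _ hp.diff hx, pdW_cmul _ hb.diff hx, bar_pd hx] at a1 a2
      simp at a1 a2
      rw [Lap_sub (hp.cmul s) (hb.cmul d) hx, Lap_cmul _ hp hx, Lap_cmul _ hb hx, bar_lap hx]
      have := hL x hx
      unfold Lop at this
      have e : s * Lap p x = 0 := by
        have e' : s * Lap p x = 2 * (rcp u x * (pdW 1 u x * (s * pdW 1 p x) + pdW 2 u x * (s * pdW 2 p x))) := by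
          linear_combination s * this
        rw [e']
        rcases a1 with r | r <;> rcases a2 with r' | r' <;> simp [r, r']
      linarith
    · intro x hx hx0
      rw [pdW_sub (hp.cmul s).diff (hb.cmul d).diff hx, pdW_cmul _ hp.diff hx, pdW_cmul _ hb.diff hx, bar_pd hx, h0 x hx hx0, hx0]
      simp; exact hd.le
    · intro x hx hx1
      rw [h1 x hx hx1]
      have := mul_pos hd (by linarith [(bar_bd hx).1] : 0 < bar x)
      linarith
  have key2 : ∀ s : ℝ, ∀ x ∈ Slab, s * p x ≤ 0 := by
    intro s x hx
    refine le_of_forall_pos_le_add fun e he => ?_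
    have := key s (e / 3) (by positivity) x hx
    have := mul_le_mul_of_nonneg_left (bar_bd hx).2 (by positivity : 0 ≤ e / 3)
    linarith
  intro x hx
  have a := key2 1 x hx
  have b := key2 (-1) x hx
  linarith

theorem lift (hα0 : 0 < α) (hα1 : α < 1) (k : ℕ) : ∃ C, 0 ≤ C ∧ ∀ A h, HH α (k + 1) A h → PerS h →
    ∃ w, HH α (k + 2) (C * A) w ∧ PerS w ∧ (∀ x ∈ Slab, x 0 = 0 → pdW 0 w x = h x) ∧ (∀ x ∈ Slab, x 0 = 1 → w x = 0) := by
  obtain ⟨C, hC, hreg⟩ := RR_reg (l := 1) one_pos hα0 hα1 (k + 1)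
  refine ⟨C, hC, fun A h hh hper => ?_⟩
  obtain ⟨hw, hlap⟩ := hreg false A h hh
  have hwp : PerS (RR 1 false h) := RR_per hα0 hh.zero hper
  have hw2 : HH α 2 (C * A) (RR 1 false h) := hw.lek (by omega)
  refine ⟨fun x => - pdW 0 (RR 1 false h) x, (hw.pd 0).neg, (hwp.pd hw.diff 0).neg, ?_, ?_⟩
  · intro x hx hx0
    rw [pdW_neg (hw.pd 0).diff hx]
    have e0 : ∀ y ∈ Slab, y 0 = 0 → RR 1 false h y = (fun _ => (0:ℝ)) y := fun y hy hy0 =>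
      RR_odd hα0 hh.zero (by simpa [cO] using hy0)
    have e1 : ∀ j : Fin 3, j ≠ 0 → ∀ y ∈ Slab, y 0 = 0 → pdW j (RR 1 false h) y = (fun _ => (0:ℝ)) y := fun j hj y hy hy0 => by
      rw [face_pd hw.diff (differentiableOn_const 0) e0 hj hy hy0, pdW_const 0 hy]
    have e2 : ∀ j : Fin 3, j ≠ 0 → pdW j (pdW j (RR 1 false h)) x = 0 := fun j hj => by
      rw [face_pd (hw2.pd j).diff (differentiableOn_const 0) (e1 j hj) hj hx hx0, pdW_const 0 hx]
    have := hlap x hx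
    rw [e0 x hx hx0] at this
    unfold Lap at this
    rw [e2 1 (by decide), e2 2 (by decide)] at this
    linarith
  · intro x hx hx1
    have := RR_even (l := 1) one_pos hα0 hα1 hh.zero (b := false) hx (by simpa [cE] using hx1)
    simp [this]

/-- main elliptic existence lemma -/
theorem ell (H : Bg α u M m) (hα0 : 0 < α) (hα1 : α < 1) (k : ℕ) (hk : k ≤ 1) : ∃ C, 0 ≤ C ∧ ∀ A f h e,
    HH α k A f → HH α (k + 1) A h → HH α (k + 2) A e → PerS f → PerS h → PerS e → (∀ x ∈ Slab, pdW 0 e x = 0) →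
    ∃ p, HH α (k + 2) (C * A) p ∧ PerS p ∧ (∀ x ∈ Slab, Lop u p x = f x) ∧
      (∀ x ∈ Slab, x 0 = 0 → pdW 0 p x = h x) ∧ (∀ x ∈ Slab, x 0 = 1 → p x = e x) := by
  obtain ⟨Cl, hCl, hlift⟩ := lift (α := α) hα0 hα1 k
  obtain ⟨CL, hCL, hLop⟩ := H.LopHH k hk
  obtain ⟨CS, hCS, hS⟩ := H.schro hα0 hα1 k hk
  obtain ⟨Nr, hNr, Hr⟩ := H.rHH
  have hM := H.hh.nonneg
  refine ⟨1 + Cl + 2 ^ (k + 2 + 1) * (M * (CS * (2 ^ (k + 1) * (Nr * (1 + CL * (1 + Cl)))))), by positivity,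
    fun A f h e hf hh he pf ph pe he0 => ?_⟩
  obtain ⟨w, hw, pw, w0, w1⟩ := hlift A h hh ph
  have hew := he.add hw
  have pew := pe.add pw
  have hew2 := hew.lek (k := 2) (by omega)
  have hg := (Hr.lek (k := k) (by omega)).mul (hf.sub (hLop _ _ hew))
  obtain ⟨q, hq, pq, ql, q0, q1⟩ := hS _ _ hg (H.rper.mul (pf.sub (H.Lopper hew2 pew)))
  have hq2 := hq.lek (k := 2) (by omega)
  have huq := (H.hh.lek (k := k + 2) (by omega)).mul hq
  have huq2 := huq.lek (k := 2) (by omega)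
  refine ⟨fun x => (e x + w x) + u x * q x, (hew.add huq).mono (le_of_eq (by ring)), pew.add (H.per.mul pq), ?_, ?_, ?_⟩
  · intro x hx
    rw [Lop_add hew2 huq2 hx, H.Lop_mul hq2 hx, ql x hx]
    linear_combination (f x - Lop u (fun x => e x + w x) x) * H.mulr hx
  · intro x hx hx0
    rw [pdW_add hew.diff huq.diff hx, pdW_add he.diff hw.diff hx, he0 x hx, w0 x hx hx0, pdW_mul H.hh.diff hq.diff hx,
      q0 x hx hx0, H.x0 x hx]; simp
  · intro x hx hx1
    simp only [w1 x hx hx1, q1 x hx hx1]; simp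
end Bg
end Inc

set_option linter.unusedVariables false
set_option linter.unusedSimpArgs false
open Set Filter Topology MeasureTheory
namespace Inc
variable {α : ℝ}

/-- vector fields with unit normal component -/
structure Vf (α : ℝ) (k : ℕ) (m : ℝ) (b : Fin 3 → (Fin 3 → ℝ) → ℝ) : Prop where
  b0 : ∀ x, b 0 x = 1
  hh : ∀ j, j ≠ 0 → HH α k m (b j)

/-- path operator -/
noncomputable def Pop (b : Fin 3 → (Fin 3 → ℝ) → ℝ) (x : Fin 3 → ℝ) (e : ℝ → Fin 3 → ℝ) (η : ℝ) (j : Fin 3) : ℝ :=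
  - (x 0 * ∫ ζ in η..1, b j (x + e ζ))

/-- admissible paths -/
structure Adm (x : Fin 3 → ℝ) (e : ℝ → Fin 3 → ℝ) : Prop where
  mem : ∀ ζ ∈ Icc (0:ℝ) 1, x + e ζ ∈ Slab
  cont : ContinuousOn e (Icc 0 1)

namespace Vf
variable {b : Fin 3 → (Fin 3 → ℝ) → ℝ} {k : ℕ} {m : ℝ}

theorem contb (h : Vf α k m b) (hα : 0 < α) (j : Fin 3) : ContinuousOn (b j) Slab := by
  by_cases hj : j = 0
  · subst hj
    exact (continuousOn_const (c := (1:ℝ))).congr fun x _ => h.b0 x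
  · exact (h.hh j hj).cont hα

theorem contp (h : Vf α k m b) (hα : 0 < α) {x : Fin 3 → ℝ} {e : ℝ → Fin 3 → ℝ} (he : Adm x e) (j : Fin 3) :
    ContinuousOn (fun ζ => b j (x + e ζ)) (Icc 0 1) :=
  (h.contb hα j).comp (continuousOn_const.add he.cont) (fun ζ hζ => he.mem ζ hζ)

theorem intb (h : Vf α k m b) (hα : 0 < α) {x : Fin 3 → ℝ} {e : ℝ → Fin 3 → ℝ} (he : Adm x e) (j : Fin 3) {s t : ℝ}
    (hs : s ∈ Icc (0:ℝ) 1) (ht : t ∈ Icc (0:ℝ) 1) :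
    IntervalIntegrable (fun ζ => b j (x + e ζ)) volume s t :=
  ((h.contp hα he j).mono (uIcc_subset_Icc hs ht)).intervalIntegrable

theorem lip (h : Vf α (k + 1) m b) (hm : m ≤ 1 / 6) (j : Fin 3) {x y : Fin 3 → ℝ} (hx : x ∈ Slab) (hy : y ∈ Slab) :
    |b j x - b j y| ≤ (1 / 2) * ‖x - y‖ := by
  by_cases hj : j = 0
  · subst hj; rw [h.b0, h.b0]; simp
  · have := lip_of_pd (h.hh j hj).diff (fun i x hx => ((h.hh j hj).pd i).bd hx) hx hy
    exact this.trans (mul_le_mul_of_nonneg_right (by linarith) (norm_nonneg _))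

theorem contr (h : Vf α (k + 1) m b) (hα : 0 < α) (hm : m ≤ 1 / 6) {x : Fin 3 → ℝ} (hx : x ∈ Slab) {e e' : ℝ → Fin 3 → ℝ}
    (he : Adm x e) (he' : Adm x e') {c : ℝ} (hc : 0 ≤ c) (hd : ∀ ζ ∈ Icc (0:ℝ) 1, ∀ i, |e ζ i - e' ζ i| ≤ c) {η : ℝ}
    (hη : η ∈ Icc (0:ℝ) 1) (j : Fin 3) : |Pop b x e η j - Pop b x e' η j| ≤ c / 2 := by
  have h1 : (1:ℝ) ∈ Icc (0:ℝ) 1 := by simp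
  unfold Pop
  rw [show -(x 0 * ∫ ζ in η..1, b j (x + e ζ)) - -(x 0 * ∫ ζ in η..1, b j (x + e' ζ)) =
    - (x 0 * ∫ ζ in η..1, (b j (x + e ζ) - b j (x + e' ζ))) by
      rw [intervalIntegral.integral_sub (h.intb hα he j hη h1) (h.intb hα he' j hη h1)]; ring]
  rw [abs_neg, abs_mul, abs_of_nonneg hx.1]
  have : ‖∫ ζ in η..1, (b j (x + e ζ) - b j (x + e' ζ))‖ ≤ c / 2 * |1 - η| := by
    refine intervalIntegral.norm_integral_le_of_norm_le_const fun ζ hζ => ?_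
    rw [uIoc_of_le hη.2] at hζ
    have hζ' : ζ ∈ Icc (0:ℝ) 1 := ⟨hη.1.trans hζ.1.le, hζ.2⟩
    refine (h.lip hm j (he.mem ζ hζ') (he'.mem ζ hζ')).trans ?_
    rw [add_sub_add_left_eq_sub, show c / 2 = 1 / 2 * c by ring]
    gcongr
    rw [pi_norm_le_iff_of_nonneg hc]
    exact fun i => hd ζ hζ' i
  rw [Real.norm_eq_abs] at this
  have h2 : |1 - η| ≤ 1 := by rw [abs_of_nonneg (by linarith [hη.2])]; linarith [hη.1]
  calc _ ≤ 1 * (c / 2 * 1) := by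
        apply mul_le_mul hx.2 (this.trans (by gcongr)) (abs_nonneg _) zero_le_one
    _ = _ := by ring

theorem path_unique (h : Vf α (k + 1) m b) (hα : 0 < α) (hm : m ≤ 1 / 6) {x : Fin 3 → ℝ} (hx : x ∈ Slab) {e e' : ℝ → Fin 3 → ℝ}
    (he : Adm x e) (he' : Adm x e') (h1 : ∀ η ∈ Icc (0:ℝ) 1, ∀ j, e η j = Pop b x e η j)
    (h2 : ∀ η ∈ Icc (0:ℝ) 1, ∀ j, e' η j = Pop b x e' η j) : ∀ η ∈ Icc (0:ℝ) 1, e η = e' η := by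
  obtain ⟨C, hC⟩ := isCompact_Icc.exists_bound_of_continuousOn (he.cont.sub he'.cont)
  have hC0 : 0 ≤ C := (norm_nonneg _).trans (hC 0 (by simp))
  have key : ∀ n : ℕ, ∀ η ∈ Icc (0:ℝ) 1, ∀ j, |e η j - e' η j| ≤ C * (1 / 2) ^ n := by
    intro n
    induction n with
    | zero => intro η hη j; simpa using (norm_le_pi_norm _ j).trans (hC η hη)
    | succ n ih =>
      intro η hη j
      rw [h1 η hη j, h2 η hη j]
      exact (h.contr hα hm hx he he' (by positivity) ih hη j).trans (le_of_eq (by rw [pow_succ]; ring))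
  intro η hη
  funext j
  have : Tendsto (fun n : ℕ => C * (1 / 2 : ℝ) ^ n) atTop (𝓝 (C * 0)) :=
    (tendsto_pow_atTop_nhds_zero_of_lt_one (by norm_num) (by norm_num)).const_mul C
  rw [mul_zero] at this
  have := ge_of_tendsto' this (fun n => key n η hη j)
  exact sub_eq_zero.1 (abs_nonpos_iff.1 this)
end Vf

/-- invariant class of displacement fields -/
structure Inv (α : ℝ) (k : ℕ) (E : ℝ → Fin 3 → (Fin 3 → ℝ) → ℝ) : Prop where
  hh : ∀ η ∈ Icc (0:ℝ) 1, ∀ j, HH α k 1 (E η j)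
  e0 : ∀ η ∈ Icc (0:ℝ) 1, ∀ x ∈ Slab, E η 0 x = (η - 1) * x 0
  cont : ∀ x ∈ Slab, ∀ j, ContinuousOn (fun η => E η j x) (Icc 0 1)

namespace Inv
variable {E : ℝ → Fin 3 → (Fin 3 → ℝ) → ℝ} {k : ℕ}

theorem adm (h : Inv α k E) {x : Fin 3 → ℝ} (hx : x ∈ Slab) : Adm x (fun ζ i => E ζ i x) := by
  refine ⟨fun ζ hζ => ?_, continuousOn_pi.2 fun i => h.cont x hx i⟩
  have := h.e0 ζ hζ x hx
  simp only [Slab, mem_ofPred_eq, Pi.add_apply, this]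
  have e : x 0 + (ζ - 1) * x 0 = ζ * x 0 := by ring
  rw [e]
  exact ⟨mul_nonneg hζ.1 hx.1, mul_le_one₀ hζ.2 hx.1 hx.2⟩

theorem comp (h : Inv α (k + 1) E) (hα0 : 0 < α) (hα1 : α < 1) {ζ : ℝ} (hζ : ζ ∈ Icc (0:ℝ) 1) {A : ℝ} {f : (Fin 3 → ℝ) → ℝ}
    (hf : HH α (k + 1) A f) : HH α (k + 1) (Cc (k + 1) * A) (fun x => f (x + fun i => E ζ i x)) := by
  refine HH.comp hα0.le hα1.le (Φ := fun x => x + fun i => E ζ i x) (D := E ζ) (fun x _ j => rfl)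
    (fun x hx => (h.adm hx).mem ζ hζ) ?_ (h.hh ζ hζ) hf
  intro x hx y hy
  rw [pi_norm_le_iff_of_nonneg (by positivity)]
  intro i
  have h1 := lip_of_pd (h.hh ζ hζ i).diff (fun j x hx => ((h.hh ζ hζ i).pd j).bd hx) hx hy
  have h2 := norm_le_pi_norm (x - y) i
  simp only [Pi.sub_apply, Pi.add_apply, Real.norm_eq_abs] at h2 ⊢
  calc |x i + E ζ i x - (y i + E ζ i y)| = |(x i - y i) + (E ζ i x - E ζ i y)| := by congr 1; ring
    _ ≤ _ := abs_add_le _ _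
    _ ≤ _ := by linarith

theorem T (h : Inv α (k + 1) E) (hα0 : 0 < α) (hα1 : α < 1) {b : Fin 3 → (Fin 3 → ℝ) → ℝ} {m : ℝ} (hb : Vf α (k + 1) m b)
    (hm : 2 ^ (k + 2) * (Cc (k + 1) * m) ≤ 1) : Inv α (k + 1) (fun η j x => Pop b x (fun ζ i => E ζ i x) η j) := by
  have e0 : ∀ η ∈ Icc (0:ℝ) 1, ∀ x ∈ Slab, Pop b x (fun ζ i => E ζ i x) η 0 = (η - 1) * x 0 := by
    intro η hη x hx
    unfold Pop
    simp only [hb.b0, intervalIntegral.integral_const]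
    simp; ring
  refine ⟨fun η hη j => ?_, e0, fun x hx j => ?_⟩
  · by_cases hj : j = 0
    · subst hj
      refine HH.congr ?_ (fun x hx => (e0 η hη x hx).symm)
      refine ((HH_x0 hα0 hα1 (k + 1)).cmul (η - 1)).mono ?_
      rw [mul_one, abs_le]; constructor <;> linarith [hη.1, hη.2]
    · have hI := HH.integral (a := η) (b := 1) hα0 hη.2 (by linarith [hη.1])
        (F := fun ζ x => b j (x + fun i => E ζ i x))
        (fun ζ hζ => h.comp hα0 hα1 ⟨hη.1.trans hζ.1, hζ.2⟩ (hb.hh j hj))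
        (fun x hx => (hb.contp hα0 (h.adm hx) j).mono (Icc_subset_Icc_left hη.1))
      refine (((HH_x0 hα0 hα1 (k + 1)).mul hI).neg).mono ?_
      rw [one_mul]; exact hm
  · unfold Pop
    refine (ContinuousOn.mul continuousOn_const ?_).neg
    have hc := hb.contp hα0 (h.adm hx) j
    have := intervalIntegral.continuousOn_primitive_interval_left (a := (0:ℝ)) (b := 1) (μ := volume)
      (f := fun ζ => b j (x + fun i => E ζ i x)) (by rw [uIcc_of_le zero_le_one]; exact hc.integrableOn_Icc)
    rwa [uIcc_of_le zero_le_one] at this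
end Inv

/-- existence of the flow -/
theorem flow {b : Fin 3 → (Fin 3 → ℝ) → ℝ} {m : ℝ} {k : ℕ} (hα0 : 0 < α) (hα1 : α < 1) (hb : Vf α (k + 1) m b)
    (hm6 : m ≤ 1 / 6) (hm : 2 ^ (k + 2) * (Cc (k + 1) * m) ≤ 1) : ∃ E, Inv α (k + 1) E ∧
      ∀ η ∈ Icc (0:ℝ) 1, ∀ x ∈ Slab, ∀ j, E η j x = Pop b x (fun ζ i => E ζ i x) η j := by
  set E0 : ℝ → Fin 3 → (Fin 3 → ℝ) → ℝ := fun η j x => if j = 0 then (η - 1) * x 0 else 0 with hE0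
  set Q : ℕ → ℝ → Fin 3 → (Fin 3 → ℝ) → ℝ := fun n => Nat.rec E0 (fun _ E => fun η j x => Pop b x (fun ζ i => E ζ i x) η j) n
    with hQ
  have Qs : ∀ n η j x, Q (n + 1) η j x = Pop b x (fun ζ i => Q n ζ i x) η j := fun n η j x => rfl
  have hQI : ∀ n, Inv α (k + 1) (Q n) := by
    intro n
    induction n with
    | zero =>
      have z1 : ∀ η x, Q 0 η 0 x = (η - 1) * x 0 := fun η x => by simp [hQ, hE0]
      have z2 : ∀ η j x, j ≠ 0 → Q 0 η j x = 0 := fun η j x hj => by simp [hQ, hE0, hj]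
      refine ⟨fun η hη j => ?_, fun η hη x hx => z1 η x, fun x hx j => ?_⟩
      · by_cases hj : j = 0
        · subst hj
          rw [show Q 0 η 0 = fun x => (η - 1) * x 0 from funext (z1 η)]
          refine ((HH_x0 hα0 hα1 (k + 1)).cmul (η - 1)).mono ?_
          rw [mul_one, abs_le]; constructor <;> linarith [hη.1, hη.2]
        · rw [show Q 0 η j = fun x => 0 from funext fun x => z2 η j x hj]
          exact (HH.const (c := 0) _).mono (by norm_num)
      · by_cases hj : j = 0
        · subst hj
          simp only [z1]; fun_prop
        · simp only [fun η => z2 η j x hj]; fun_prop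
    | succ n ih => exact ih.T hα0 hα1 hb hm
  have hstep : ∀ n, ∀ η ∈ Icc (0:ℝ) 1, ∀ x ∈ Slab, ∀ j, |Q n η j x - Q (n + 1) η j x| ≤ 2 * (1 / 2) ^ n := by
    intro n
    induction n with
    | zero =>
      intro η hη x hx j
      have a := ((hQI 0).hh η hη j).bd hx
      have b := ((hQI 1).hh η hη j).bd hx
      have c := abs_sub (Q 0 η j x) (Q 1 η j x)
      simp only [zero_add, pow_zero]; linarith
    | succ n ih =>
      intro η hη x hx j
      rw [Qs n, Qs (n + 1)]
      exact (hb.contr hα0 hm6 hx ((hQI n).adm hx) ((hQI (n + 1)).adm hx) (by positivity) (fun ζ hζ i => ih ζ hζ x hx i) hη j).trans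
        (le_of_eq (by rw [pow_succ]; ring))
  have hlim : ∀ η j x, ∃ y, η ∈ Icc (0:ℝ) 1 → x ∈ Slab → Tendsto (fun n => Q n η j x) atTop (𝓝 y) := by
    intro η j x
    by_cases hη : η ∈ Icc (0:ℝ) 1
    · by_cases hx : x ∈ Slab
      · have : CauchySeq (fun n => Q n η j x) := cauchySeq_of_le_geometric (1 / 2) 2 (by norm_num)
          (fun n => by rw [Real.dist_eq]; exact hstep n η hη x hx j)
        obtain ⟨y, hy⟩ := cauchySeq_tendsto_of_complete this
        exact ⟨y, fun _ _ => hy⟩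
      · exact ⟨0, fun _ h => absurd h hx⟩
    · exact ⟨0, fun h => absurd h hη⟩
  choose E hE using hlim
  have hdist : ∀ n, ∀ η ∈ Icc (0:ℝ) 1, ∀ x ∈ Slab, ∀ j, |Q n η j x - E η j x| ≤ 4 * (1 / 2) ^ n := by
    intro n η hη x hx j
    have := dist_le_of_le_geometric_of_tendsto (1 / 2) 2 (by norm_num)
          (fun n => by rw [Real.dist_eq]; exact hstep n η hη x hx j) (hE η j x hη hx) n
    rw [Real.dist_eq] at this
    exact this.trans (le_of_eq (by ring))
  have hI : Inv α (k + 1) E := by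
    refine ⟨fun η hη j => HH.lim (l := atTop) hα0 (Eventually.of_forall fun n => (hQI n).hh η hη j) (fun x hx => hE η j x hη hx), ?_, ?_⟩
    · intro η hη x hx
      refine tendsto_nhds_unique (hE η 0 x hη hx) ?_
      simp only [fun n => (hQI n).e0 η hη x hx]; exact tendsto_const_nhds
    · intro x hx j
      have : TendstoUniformlyOn (fun n η => Q n η j x) (fun η => E η j x) atTop (Icc 0 1) := by
        rw [Metric.tendstoUniformlyOn_iff]
        intro ε hε
        have ht : Tendsto (fun n : ℕ => 4 * (1 / 2 : ℝ) ^ n) atTop (𝓝 (4 * 0)) :=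
          (tendsto_pow_atTop_nhds_zero_of_lt_one (by norm_num) (by norm_num)).const_mul 4
        rw [mul_zero] at ht
        filter_upwards [ht.eventually (gt_mem_nhds hε)] with n hn η hη
        rw [dist_comm, Real.dist_eq]
        exact (hdist n η hη x hx j).trans_lt hn
      exact this.continuousOn (Frequently.of_forall fun n => (hQI n).cont x hx j)
  refine ⟨E, hI, fun η hη x hx j => ?_⟩
  have h1 : Tendsto (fun n => Q (n + 1) η j x) atTop (𝓝 (Pop b x (fun ζ i => E ζ i x) η j)) := by
    rw [tendsto_iff_dist_tendsto_zero]
    refine squeeze_zero (fun _ => dist_nonneg) (g := fun n => 2 * (1 / 2 : ℝ) ^ n) ?_ ?_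
    · intro n
      rw [Real.dist_eq, Qs]
      exact (hb.contr hα0 hm6 hx ((hQI n).adm hx) (hI.adm hx) (by positivity) (fun ζ hζ i => hdist n ζ hζ x hx i) hη j).trans
        (le_of_eq (by ring))
    · simpa using (tendsto_pow_atTop_nhds_zero_of_lt_one (by norm_num) (by norm_num : (1 / 2 : ℝ) < 1)).const_mul (2:ℝ)
  exact tendsto_nhds_unique ((tendsto_add_atTop_iff_nat 1).2 (hE η j x hη hx)) h1
end Inc

set_option linter.unusedVariables false
set_option linter.unusedSimpArgs false
open Set Filter Topology MeasureTheory
namespace Inc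
variable {α : ℝ}

theorem prim_right {f : ℝ → ℝ} (hf : ContinuousOn f (Icc 0 1)) {η : ℝ} (hη : η ∈ Icc (0:ℝ) 1) :
    HasDerivWithinAt (fun t => ∫ ζ in (0:ℝ)..t, f ζ) (f η) (Icc 0 1) η := by
  have hc : Continuous (IccExtend (zero_le_one (α := ℝ)) (restrict (Icc 0 1) f)) :=
    (continuousOn_iff_continuous_restrict.1 hf).Icc_extend'
  have h1 := (hc.integral_hasStrictDerivAt 0 η).hasDerivAt.hasDerivWithinAt (s := Icc (0:ℝ) 1)
  have e : ∀ t ∈ Icc (0:ℝ) 1, IccExtend (zero_le_one (α := ℝ)) (restrict (Icc 0 1) f) t = f t := fun t ht => by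
    rw [IccExtend_of_mem _ _ ht]; rfl
  rw [e η hη] at h1
  refine h1.congr_of_mem (fun t ht => ?_) hη
  refine intervalIntegral.integral_congr fun s hs => ?_
  rw [uIcc_of_le ht.1] at hs
  exact (e s ⟨hs.1, hs.2.trans ht.2⟩).symm

theorem prim_left {f : ℝ → ℝ} (hf : ContinuousOn f (Icc 0 1)) {η : ℝ} (hη : η ∈ Icc (0:ℝ) 1) :
    HasDerivWithinAt (fun t => ∫ ζ in t..(1:ℝ), f ζ) (- f η) (Icc 0 1) η := by
  have h1 := (prim_right hf hη).const_sub (∫ ζ in (0:ℝ)..1, f ζ)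
  refine h1.congr_of_mem (fun t ht => ?_) hη
  have i : ∀ s ∈ Icc (0:ℝ) 1, ∀ t ∈ Icc (0:ℝ) 1, IntervalIntegrable f volume s t := fun s hs t ht =>
    (hf.mono (uIcc_subset_Icc hs ht)).intervalIntegrable
  have := intervalIntegral.integral_add_adjacent_intervals (i 0 (by simp) t ht) (i t ht 1 (by simp))
  simp only [← this]; ring

/-- transport operator -/
noncomputable def Tr (b : Fin 3 → (Fin 3 → ℝ) → ℝ) (w : (Fin 3 → ℝ) → ℝ) (x : Fin 3 → ℝ) : ℝ := ∑ j, b j x * pdW j w x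

/-- flow property -/
structure Flow (α : ℝ) (k : ℕ) (b : Fin 3 → (Fin 3 → ℝ) → ℝ) (E : ℝ → Fin 3 → (Fin 3 → ℝ) → ℝ) : Prop where
  inv : Inv α (k + 1) E
  fix : ∀ η ∈ Icc (0:ℝ) 1, ∀ x ∈ Slab, ∀ j, E η j x = Pop b x (fun ζ i => E ζ i x) η j

namespace Flow
variable {b : Fin 3 → (Fin 3 → ℝ) → ℝ} {k : ℕ} {m : ℝ} {E : ℝ → Fin 3 → (Fin 3 → ℝ) → ℝ}

theorem one (h : Flow α k b E) {x : Fin 3 → ℝ} (hx : x ∈ Slab) : (x + fun i => E 1 i x) = x := by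
  funext j
  simp [h.fix 1 (by simp) x hx j, Pop]

theorem face (h : Flow α k b E) {x : Fin 3 → ℝ} (hx : x ∈ Slab) (h0 : x 0 = 0) {η : ℝ} (hη : η ∈ Icc (0:ℝ) 1) :
    (x + fun i => E η i x) = x := by
  funext j
  simp [h.fix η hη x hx j, Pop, h0]

theorem zero (h : Flow α k b E) {x : Fin 3 → ℝ} (hx : x ∈ Slab) : (x + fun i => E 0 i x) 0 = 0 := by
  simp [h.inv.e0 0 (by simp) x hx]

theorem deriv (h : Flow α k b E) (hα : 0 < α) (hb : Vf α (k + 1) m b) {x : Fin 3 → ℝ} (hx : x ∈ Slab) {η : ℝ}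
    (hη : η ∈ Icc (0:ℝ) 1) :
    HasDerivWithinAt (fun η => x + fun i => E η i x) (fun j => x 0 * b j (x + fun i => E η i x)) (Icc 0 1) η := by
  rw [hasDerivWithinAt_pi]
  intro j
  have h1 := ((prim_left (hb.contp hα (h.inv.adm hx) j) hη).const_mul (x 0)).neg.const_add (x j)
  refine (h1.congr_of_mem (fun t ht => ?_) hη).congr_deriv (by ring)
  simp [h.fix t ht x hx j, Pop]

theorem along (h : Flow α k b E) (hα : 0 < α) (hb : Vf α (k + 1) m b) {w : (Fin 3 → ℝ) → ℝ} (hw : DifferentiableOn ℝ w Slab)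
    {x : Fin 3 → ℝ} (hx : x ∈ Slab) {η : ℝ} (hη : η ∈ Icc (0:ℝ) 1) :
    HasDerivWithinAt (fun η => w (x + fun i => E η i x)) (x 0 * Tr b w (x + fun i => E η i x)) (Icc 0 1) η := by
  have := (hasFD hw ((h.inv.adm hx).mem η hη)).comp_hasDerivWithinAt η (h.deriv hα hb hx hη)
    (fun t ht => (h.inv.adm hx).mem t ht)
  refine this.congr_deriv ?_
  rw [lin_apply]; unfold Tr
  rw [Finset.mul_sum]
  exact Finset.sum_congr rfl fun i _ => by ring

theorem unique (h : Flow α k b E) (hα : 0 < α) (hb : Vf α (k + 1) m b) {w : (Fin 3 → ℝ) → ℝ} (hw : DifferentiableOn ℝ w Slab)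
    (hT : ∀ x ∈ Slab, Tr b w x = 0) (h0 : ∀ x ∈ Slab, x 0 = 0 → w x = 0) : ∀ x ∈ Slab, w x = 0 := by
  intro x hx
  have hd := fun η hη => h.along hα hb hw hx (η := η) hη
  have := constant_of_derivWithin_zero (fun η hη => (hd η hη).differentiableWithinAt) (fun η hη => by
    rw [(hd η (Ico_subset_Icc_self hη)).derivWithin (uniqueDiffOn_Icc zero_lt_one η (Ico_subset_Icc_self hη)),
      hT _ ((h.inv.adm hx).mem η (Ico_subset_Icc_self hη)), mul_zero]) 1 (by simp)
  rw [h.one hx, h0 _ ((h.inv.adm hx).mem 0 (by simp)) (h.zero hx)] at this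
  exact this

theorem semi (h : Flow α k b E) (hα : 0 < α) (hb : Vf α (k + 1) m b) (hm : m ≤ 1 / 6) {x : Fin 3 → ℝ} (hx : x ∈ Slab) {η θ : ℝ}
    (hη : η ∈ Icc (0:ℝ) 1) (hθ : θ ∈ Icc (0:ℝ) 1) :
    ((x + fun i => E θ i x) + fun i => E η i (x + fun i => E θ i x)) = x + fun i => E (η * θ) i x := by
  set y := x + fun i => E θ i x with hy
  have hys : y ∈ Slab := (h.inv.adm hx).mem θ hθ
  have hm' : ∀ ζ ∈ Icc (0:ℝ) 1, ζ * θ ∈ Icc (0:ℝ) 1 := fun ζ hζ => ⟨mul_nonneg hζ.1 hθ.1, mul_le_one₀ hζ.2 hθ.1 hθ.2⟩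
  set e : ℝ → Fin 3 → ℝ := fun ζ i => E (ζ * θ) i x - E θ i x with he
  have hye : ∀ ζ, y + e ζ = x + fun i => E (ζ * θ) i x := fun ζ => by
    funext i; simp [hy, he]
  have hadm : Adm y e := by
    refine ⟨fun ζ hζ => by rw [hye]; exact (h.inv.adm hx).mem _ (hm' ζ hζ), ?_⟩
    refine continuousOn_pi.2 fun i => ContinuousOn.sub ?_ continuousOn_const
    exact (h.inv.cont x hx i).comp (by fun_prop) hm'
  have := hb.path_unique hα hm hys (h.inv.adm hys) hadm (fun η hη j => h.fix η hη y hys j) (fun η hη j => by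
    have c := fun j => hb.contp hα (h.inv.adm hx) j
    unfold Pop
    simp only [hye]
    have hy0 : y 0 = x 0 * θ := by simp [hy, h.inv.e0 θ hθ x hx]; ring
    rw [hy0, mul_assoc, intervalIntegral.mul_integral_comp_mul_right (f := fun s => b j (x + fun i => E s i x)), one_mul]
    simp only [he]
    rw [h.fix _ (hm' η hη) x hx, h.fix _ hθ x hx]
    unfold Pop
    have := intervalIntegral.integral_add_adjacent_intervals (hb.intb hα (h.inv.adm hx) j (hm' η hη) hθ)
      (hb.intb hα (h.inv.adm hx) j hθ (by simp : (1:ℝ) ∈ Icc (0:ℝ) 1))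
    rw [← this]; ring) η hη
  rw [this, hye]

theorem exist (h : Flow α k b E) (hα : 0 < α) (hα1 : α < 1) (hb : Vf α (k + 1) m b) (hm : m ≤ 1 / 6) {A : ℝ} {g w0 : (Fin 3 → ℝ) → ℝ}
    (hg : HH α (k + 1) A g) (hw0 : HH α (k + 1) A w0) : ∃ w, HH α (k + 1) ((Cc (k + 1) * (1 + 2 ^ (k + 2))) * A) w ∧
      (∀ x ∈ Slab, Tr b w x = g x) ∧ (∀ x ∈ Slab, x 0 = 0 → w x = w0 x) := by
  have hgc : ∀ x ∈ Slab, ContinuousOn (fun t => g (x + fun i => E t i x)) (Icc 0 1) := fun x hx =>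
    (hg.cont hα).comp (continuousOn_const.add (h.inv.adm hx).cont) (h.inv.adm hx).mem
  set w : (Fin 3 → ℝ) → ℝ := fun x => w0 (x + fun i => E 0 i x) + x 0 * ∫ t in (0:ℝ)..1, g (x + fun i => E t i x) with hw
  have hwH : HH α (k + 1) ((Cc (k + 1) * (1 + 2 ^ (k + 2))) * A) w := by
    have h1 := h.inv.comp hα hα1 (ζ := 0) (by simp) hw0
    have h2 := HH.integral (a := 0) (b := 1) hα zero_le_one (by norm_num) (F := fun t x => g (x + fun i => E t i x))
      (fun t ht => h.inv.comp hα hα1 ht hg) hgc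
    refine (h1.add ((HH_x0 hα hα1 (k + 1)).mul h2)).mono (le_of_eq (by ring))
  refine ⟨w, hwH, ?_, ?_⟩
  · have key : ∀ x ∈ Slab, x 0 * Tr b w x = x 0 * g x := by
      intro x hx
      have d1 := h.along hα hb hwH.diff hx (η := 1) (by simp)
      rw [h.one hx] at d1
      have d2 := ((prim_right (hgc x hx) (η := 1) (by simp)).const_mul (x 0)).const_add (w0 (x + fun i => E 0 i x))
      rw [h.one hx] at d2
      have e : ∀ θ ∈ Icc (0:ℝ) 1, w (x + fun i => E θ i x) =
          w0 (x + fun i => E 0 i x) + x 0 * ∫ t in (0:ℝ)..θ, g (x + fun i => E t i x) := by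
        intro θ hθ
        simp only [hw]
        rw [h.semi hα hb hm hx (by simp) hθ, zero_mul]
        congr 1
        have : ∫ t in (0:ℝ)..1, g ((x + fun i => E θ i x) + fun i => E t i (x + fun i => E θ i x)) =
            ∫ t in (0:ℝ)..1, g (x + fun i => E (t * θ) i x) := by
          refine intervalIntegral.integral_congr fun t ht => ?_
          rw [uIcc_of_le zero_le_one] at ht
          simp only [h.semi hα hb hm hx ht hθ]
        rw [this]
        have hy0 : (x + fun i => E θ i x) 0 = x 0 * θ := by simp [h.inv.e0 θ hθ x hx]; ring
        rw [hy0, mul_assoc, intervalIntegral.mul_integral_comp_mul_right (f := fun s => g (x + fun i => E s i x)), one_mul, zero_mul]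
      have d3 := d2.congr_of_mem e (by simp)
      exact (uniqueDiffOn_Icc zero_lt_one (1:ℝ) (by simp)).eq_deriv _ d1 d3
    intro x hx
    by_cases hx0 : x 0 = 0
    · have hray : ∀ t ∈ Ioc (0:ℝ) 1, x + Pi.single 0 t ∈ Slab := fun t ht => by
        simp [Slab, hx0]; exact ⟨ht.1.le, ht.2⟩
      have cT : ContinuousOn (Tr b w) Slab := by
        unfold Tr
        exact continuousOn_finset_sum _ fun j _ => (hb.contb hα j).mul ((hwH.pd j).cont hα)
      have tr : Tendsto (fun t : ℝ => x + (Pi.single 0 t : Fin 3 → ℝ)) (𝓝[>] 0) (𝓝[Slab] x) := by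
        refine tendsto_nhdsWithin_iff.2 ⟨?_, ?_⟩
        · have : Tendsto (fun t : ℝ => x + (Pi.single 0 t : Fin 3 → ℝ)) (𝓝 0) (𝓝 (x + Pi.single 0 0)) := by
            apply Continuous.tendsto
            exact continuous_const.add (continuous_single (A := fun _ : Fin 3 => ℝ) 0)
          rw [Pi.single_zero, add_zero] at this
          exact this.mono_left nhdsWithin_le_nhds
        · filter_upwards [Ioc_mem_nhdsGT zero_lt_one] with t ht using hray t ht
      have a1 := (cT x hx).tendsto.comp tr
      have a2 := ((hg.cont hα) x hx).tendsto.comp tr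
      refine tendsto_nhds_unique a1 (a2.congr' ?_)
      filter_upwards [Ioc_mem_nhdsGT zero_lt_one] with t ht
      have := key _ (hray t ht)
      have hne : (x + (Pi.single 0 t : Fin 3 → ℝ)) 0 ≠ 0 := by simp [hx0]; exact ht.1.ne'
      exact (mul_left_cancel₀ hne this).symm
    · exact mul_left_cancel₀ hx0 (key x hx)
  · intro x hx hx0
    simp only [hw, hx0, zero_mul, add_zero, h.face hx hx0 (by simp : (0:ℝ) ∈ Icc (0:ℝ) 1)]
end Flow

theorem pdW_shift {f : (Fin 3 → ℝ) → ℝ} (hf : DifferentiableOn ℝ f Slab) {v : Fin 3 → ℝ} (hv : v 0 = 0) {x : Fin 3 → ℝ} (hx : x ∈ Slab) :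
    HasFDerivWithinAt (fun y => f (y + v)) (lin fun i => pdW i f (x + v)) Slab x := by
  have h1 := hasFD hf (slab_add hx hv)
  have := h1.comp x ((hasFDerivWithinAt_id x Slab).add_const v) (fun y hy => slab_add hy hv)
  rw [ContinuousLinearMap.comp_id] at this
  exact this

theorem transport (hα0 : 0 < α) (hα1 : α < 1) (k : ℕ) : ∃ m0, 0 < m0 ∧ ∃ C, 0 ≤ C ∧ ∀ b, Vf α (k + 1) m0 b → (∀ j, PerS (b j)) →
    (∀ w, DifferentiableOn ℝ w Slab → (∀ x ∈ Slab, Tr b w x = 0) → (∀ x ∈ Slab, x 0 = 0 → w x = 0) → ∀ x ∈ Slab, w x = 0) ∧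
    ∀ A g w0, HH α (k + 1) A g → HH α (k + 1) A w0 → PerS g → PerS w0 → ∃ w, HH α (k + 1) (C * A) w ∧ PerS w ∧
      (∀ x ∈ Slab, Tr b w x = g x) ∧ (∀ x ∈ Slab, x 0 = 0 → w x = w0 x) := by
  have hC := Cc_ge (k + 1)
  have hCpos : 0 < 2 ^ (k + 2) * Cc (k + 1) := by positivity
  refine ⟨min (1 / 6) (1 / (2 ^ (k + 2) * Cc (k + 1))), by positivity, Cc (k + 1) * (1 + 2 ^ (k + 2)), by positivity, fun b hb hbp => ?_⟩
  have hm6 : min (1 / 6) (1 / (2 ^ (k + 2) * Cc (k + 1))) ≤ 1 / 6 := min_le_left _ _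
  have hm : 2 ^ (k + 2) * (Cc (k + 1) * min (1 / 6) (1 / (2 ^ (k + 2) * Cc (k + 1)))) ≤ 1 := by
    rw [← mul_assoc]
    calc _ ≤ 2 ^ (k + 2) * Cc (k + 1) * (1 / (2 ^ (k + 2) * Cc (k + 1))) := mul_le_mul_of_nonneg_left (min_le_right _ _) hCpos.le
      _ = 1 := by field_simp
  obtain ⟨E, hI, hfix⟩ := flow hα0 hα1 hb hm6 hm
  have hE : Flow α k b E := ⟨hI, hfix⟩
  refine ⟨fun w => hE.unique hα0 hb, fun A g w0 hg hw0 pg pw0 => ?_⟩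
  obtain ⟨w, hw, hT, hw00⟩ := hE.exist hα0 hα1 hb hm6 hg hw0
  have hper : ∀ v : Fin 3 → ℝ, v 0 = 0 → (∀ j, ∀ x ∈ Slab, b j (x + v) = b j x) → (∀ x ∈ Slab, g (x + v) = g x) →
      (∀ x ∈ Slab, w0 (x + v) = w0 x) → ∀ x ∈ Slab, w (x + v) = w x := by
    intro v hv vb vg vw x hx
    have hd1 : DifferentiableOn ℝ (fun y => w (y + v)) Slab := fun y hy => (pdW_shift hw.diff hv hy).differentiableWithinAt
    have := hE.unique hα0 hb (w := fun x => w (x + v) - w x) (hd1.sub hw.diff) (fun y hy => ?_) (fun y hy hy0 => ?_) x hx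
    · exact sub_eq_zero.1 this
    · have a1 := hT y hy
      have a2 := hT _ (slab_add hy hv)
      unfold Tr at a1 a2 ⊢
      simp only [pdW_sub hd1 hw.diff hy, pdW_of_lin (pdW_shift hw.diff hv hy) hy]
      simp only [vb _ y hy, vg y hy] at a2
      simp only [mul_sub, Finset.sum_sub_distrib]
      rw [a1, a2, sub_self]
    · rw [hw00 _ (slab_add hy hv) (by simp [hv, hy0]), hw00 y hy hy0, vw y hy, sub_self]
  exact ⟨w, hw, fun x hx => ⟨hper _ (by simp) (fun j x hx => (hbp j x hx).1) (fun x hx => (pg x hx).1) (fun x hx => (pw0 x hx).1) x hx,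
    hper _ (by simp) (fun j x hx => (hbp j x hx).2) (fun x hx => (pg x hx).2) (fun x hx => (pw0 x hx).2) x hx⟩, hT, hw00⟩
end Inc

set_option linter.unusedVariables false
set_option linter.unusedSimpArgs false
open Set Filter Topology MeasureTheory
namespace Inc
variable {α : ℝ}

/-- uniform order calculus -/
def OO (α : ℝ) {T : Type} (S : Set T) (k : ℕ) (s : T → ℝ) (F : T → (Fin 3 → ℝ) → ℝ) : Prop :=
  ∃ C, 0 ≤ C ∧ ∀ τ ∈ S, HH α k (C * s τ) (F τ)

namespace OO
variable {T : Type} {S : Set T} {k : ℕ} {s s1 s2 : T → ℝ} {F G : T → (Fin 3 → ℝ) → ℝ}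

theorem add (hF : OO α S k s F) (hG : OO α S k s G) : OO α S k s (fun τ x => F τ x + G τ x) := by
  obtain ⟨C, hC, h⟩ := hF
  obtain ⟨D, hD, g⟩ := hG
  exact ⟨C + D, add_nonneg hC hD, fun τ hτ => ((h τ hτ).add (g τ hτ)).mono (le_of_eq (by ring))⟩

theorem sub (hF : OO α S k s F) (hG : OO α S k s G) : OO α S k s (fun τ x => F τ x - G τ x) := by
  obtain ⟨C, hC, h⟩ := hF
  obtain ⟨D, hD, g⟩ := hG
  exact ⟨C + D, add_nonneg hC hD, fun τ hτ => ((h τ hτ).sub (g τ hτ)).mono (le_of_eq (by ring))⟩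

theorem neg (hF : OO α S k s F) : OO α S k s (fun τ x => - F τ x) := by
  obtain ⟨C, hC, h⟩ := hF
  exact ⟨C, hC, fun τ hτ => (h τ hτ).neg⟩

theorem cmul (c : ℝ) (hF : OO α S k s F) : OO α S k s (fun τ x => c * F τ x) := by
  obtain ⟨C, hC, h⟩ := hF
  exact ⟨|c| * C, by positivity, fun τ hτ => ((h τ hτ).cmul c).mono (le_of_eq (by ring))⟩

theorem mul (hs : ∀ τ ∈ S, s1 τ * s2 τ ≤ s τ) (hF : OO α S k s1 F) (hG : OO α S k s2 G) :
    OO α S k s (fun τ x => F τ x * G τ x) := by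
  obtain ⟨C, hC, h⟩ := hF
  obtain ⟨D, hD, g⟩ := hG
  refine ⟨2 ^ (k + 1) * (C * D), by positivity, fun τ hτ => ((h τ hτ).mul (g τ hτ)).mono ?_⟩
  have := mul_le_mul_of_nonneg_left (hs τ hτ) (by positivity : 0 ≤ 2 ^ (k + 1) * (C * D))
  linarith

theorem mono (K : ℝ) (hK : 0 ≤ K) (hs : ∀ τ ∈ S, s1 τ ≤ K * s τ) (hF : OO α S k s1 F) : OO α S k s F := by
  obtain ⟨C, hC, h⟩ := hF
  refine ⟨C * K, by positivity, fun τ hτ => (h τ hτ).mono ?_⟩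
  have := mul_le_mul_of_nonneg_left (hs τ hτ) hC
  linarith

theorem pd (hF : OO α S (k + 1) s F) (i : Fin 3) : OO α S k s (fun τ => pdW i (F τ)) := by
  obtain ⟨C, hC, h⟩ := hF
  exact ⟨C, hC, fun τ hτ => (h τ hτ).pd i⟩

theorem lek {l : ℕ} (hkl : k ≤ l) (hF : OO α S l s F) : OO α S k s F := by
  obtain ⟨C, hC, h⟩ := hF
  exact ⟨C, hC, fun τ hτ => (h τ hτ).lek hkl⟩

theorem congr (hF : OO α S k s F) (h : ∀ τ ∈ S, EqOn (F τ) (G τ) Slab) : OO α S k s G := by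
  obtain ⟨C, hC, g⟩ := hF
  exact ⟨C, hC, fun τ hτ => (g τ hτ).congr (h τ hτ)⟩

theorem fix {f : (Fin 3 → ℝ) → ℝ} {N : ℝ} (hf : HH α k N f) : OO α S k (fun _ => 1) (fun _ => f) :=
  ⟨N, hf.nonneg, fun τ _ => by simpa using hf⟩

theorem of (h : ∀ τ ∈ S, HH α k (s τ) (F τ)) : OO α S k s F :=
  ⟨1, zero_le_one, fun τ hτ => by simpa using h τ hτ⟩

theorem scal {c : T → ℝ} (hc : ∀ τ ∈ S, |c τ| * s1 τ ≤ s τ) (hF : OO α S k s1 F) : OO α S k s (fun τ x => c τ * F τ x) := by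
  obtain ⟨C, hC, h⟩ := hF
  refine ⟨C, hC, fun τ hτ => ((h τ hτ).cmul (c τ)).mono ?_⟩
  have := mul_le_mul_of_nonneg_left (hc τ hτ) hC
  linarith

theorem zero (hs : ∀ τ ∈ S, 0 ≤ s τ) : OO α S k s (fun _ _ => 0) :=
  ⟨0, le_rfl, fun τ _ => by simpa using HH.const (α := α) (c := 0) k⟩
end OO

/-- differences -/
def DO (α : ℝ) {T : Type} (S : Set T) (k : ℕ) (s l : T → ℝ) (F G : T → (Fin 3 → ℝ) → ℝ) : Prop :=
  OO α S k s F ∧ OO α S k s G ∧ OO α S k l (fun τ x => F τ x - G τ x)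

namespace DO
variable {T : Type} {S : Set T} {k : ℕ} {s l s1 s2 l1 l2 : T → ℝ} {F G F' G' : T → (Fin 3 → ℝ) → ℝ}

theorem add (h : DO α S k s l F G) (h' : DO α S k s l F' G') :
    DO α S k s l (fun τ x => F τ x + F' τ x) (fun τ x => G τ x + G' τ x) :=
  ⟨h.1.add h'.1, h.2.1.add h'.2.1, (h.2.2.add h'.2.2).congr fun τ _ x _ => by ring⟩

theorem sub (h : DO α S k s l F G) (h' : DO α S k s l F' G') :
    DO α S k s l (fun τ x => F τ x - F' τ x) (fun τ x => G τ x - G' τ x) :=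
  ⟨h.1.sub h'.1, h.2.1.sub h'.2.1, (h.2.2.sub h'.2.2).congr fun τ _ x _ => by ring⟩

theorem neg (h : DO α S k s l F G) :
    DO α S k s l (fun τ x => - F τ x) (fun τ x => - G τ x) :=
  ⟨h.1.neg, h.2.1.neg, h.2.2.neg.congr fun τ _ x _ => by ring⟩

theorem cmul (c : ℝ) (h : DO α S k s l F G) :
    DO α S k s l (fun τ x => c * F τ x) (fun τ x => c * G τ x) :=
  ⟨h.1.cmul c, h.2.1.cmul c, (h.2.2.cmul c).congr fun τ _ x _ => by ring⟩

theorem scal {c : T → ℝ} (hc : ∀ τ ∈ S, |c τ| * s1 τ ≤ s τ) (hc' : ∀ τ ∈ S, |c τ| * l1 τ ≤ l τ) (h : DO α S k s1 l1 F G) :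
    DO α S k s l (fun τ x => c τ * F τ x) (fun τ x => c τ * G τ x) :=
  ⟨h.1.scal hc, h.2.1.scal hc, (h.2.2.scal hc').congr fun τ _ x _ => by ring⟩

theorem mul (h0 : ∀ τ ∈ S, s1 τ * s2 τ ≤ s τ) (h1 : ∀ τ ∈ S, l1 τ * s2 τ ≤ l τ) (h2 : ∀ τ ∈ S, s1 τ * l2 τ ≤ l τ)
    (h : DO α S k s1 l1 F G) (h' : DO α S k s2 l2 F' G') :
    DO α S k s l (fun τ x => F τ x * F' τ x) (fun τ x => G τ x * G' τ x) :=
  ⟨OO.mul h0 h.1 h'.1, OO.mul h0 h.2.1 h'.2.1,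
    ((OO.mul h1 h.2.2 h'.1).add (OO.mul h2 h.2.1 h'.2.2)).congr fun τ _ x _ => by ring⟩

theorem mono (hs : ∀ τ ∈ S, s1 τ ≤ s τ) (hl : ∀ τ ∈ S, l1 τ ≤ l τ) (h : DO α S k s1 l1 F G) : DO α S k s l F G :=
  ⟨h.1.mono 1 zero_le_one (by simpa using hs), h.2.1.mono 1 zero_le_one (by simpa using hs),
    h.2.2.mono 1 zero_le_one (by simpa using hl)⟩

theorem pd (h : DO α S (k + 1) s l F G) (i : Fin 3) : DO α S k s l (fun τ => pdW i (F τ)) (fun τ => pdW i (G τ)) := by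
  refine ⟨h.1.pd i, h.2.1.pd i, (h.2.2.pd i).congr fun τ hτ x hx => ?_⟩
  obtain ⟨C, _, h1⟩ := h.1
  obtain ⟨D, _, h2⟩ := h.2.1
  exact pdW_sub (h1 τ hτ).diff (h2 τ hτ).diff hx i

theorem lek {m : ℕ} (hkl : k ≤ m) (h : DO α S m s l F G) : DO α S k s l F G :=
  ⟨h.1.lek hkl, h.2.1.lek hkl, h.2.2.lek hkl⟩

theorem congr (h : DO α S k s l F G) (h1 : ∀ τ ∈ S, EqOn (F τ) (F' τ) Slab) (h2 : ∀ τ ∈ S, EqOn (G τ) (G' τ) Slab) :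
    DO α S k s l F' G' :=
  ⟨h.1.congr h1, h.2.1.congr h2, h.2.2.congr fun τ hτ x hx => by simp only [h1 τ hτ hx, h2 τ hτ hx]⟩

theorem fix {f : (Fin 3 → ℝ) → ℝ} {N : ℝ} (hf : HH α k N f) (hl : ∀ τ ∈ S, 0 ≤ l τ) :
    DO α S k (fun _ => 1) l (fun _ => f) (fun _ => f) :=
  ⟨OO.fix hf, OO.fix hf, (OO.zero hl).congr fun τ _ x _ => by simp⟩
end DO

/-- total axial velocity, its reciprocal, normalized field -/
def uu (u : (Fin 3 → ℝ) → ℝ) (v : Fin 3 → (Fin 3 → ℝ) → ℝ) (x : Fin 3 → ℝ) : ℝ := u x + v 0 x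
noncomputable def rr (u : (Fin 3 → ℝ) → ℝ) (v : Fin 3 → (Fin 3 → ℝ) → ℝ) (x : Fin 3 → ℝ) : ℝ := (uu u v x)⁻¹
noncomputable def bb (u : (Fin 3 → ℝ) → ℝ) (v : Fin 3 → (Fin 3 → ℝ) → ℝ) (j : Fin 3) (x : Fin 3 → ℝ) : ℝ :=
  if j = 0 then 1 else v j x * rr u v x

noncomputable def QQ (v : Fin 3 → (Fin 3 → ℝ) → ℝ) (x : Fin 3 → ℝ) : ℝ :=
  pdW 0 (v 0) x * pdW 0 (v 0) x + pdW 1 (v 1) x * pdW 1 (v 1) x + pdW 2 (v 2) x * pdW 2 (v 2) x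
    + 2 * (pdW 1 (v 0) x * pdW 0 (v 1) x + pdW 2 (v 0) x * pdW 0 (v 2) x + pdW 1 (v 2) x * pdW 2 (v 1) x)

noncomputable def KK (u p : (Fin 3 → ℝ) → ℝ) (v : Fin 3 → (Fin 3 → ℝ) → ℝ) (k : Fin 3) (x : Fin 3 → ℝ) : ℝ :=
  pdW k u x * ((rr u v x - rcp u x) * pdW k p x + rr u v x * (v 1 x * pdW 1 (v k) x + v 2 x * pdW 2 (v k) x))

noncomputable def FF (u p : (Fin 3 → ℝ) → ℝ) (v : Fin 3 → (Fin 3 → ℝ) → ℝ) (x : Fin 3 → ℝ) : ℝ :=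
  2 * (KK u p v 1 x + KK u p v 2 x) - QQ v x

noncomputable def hN (u : (Fin 3 → ℝ) → ℝ) (β v : Fin 3 → (Fin 3 → ℝ) → ℝ) (x : Fin 3 → ℝ) : ℝ :=
  uu u v x * uu u v x * (pdW 1 (β 1) x + pdW 2 (β 2) x)

noncomputable def gT (u : (Fin 3 → ℝ) → ℝ) (v : Fin 3 → (Fin 3 → ℝ) → ℝ) (q : (Fin 3 → ℝ) → ℝ) (k : Fin 3) (x : Fin 3 → ℝ) : ℝ :=
  - (rr u v x * pdW k q x)

noncomputable def gZ (u : (Fin 3 → ℝ) → ℝ) (v : Fin 3 → (Fin 3 → ℝ) → ℝ) (w : Fin 3 → (Fin 3 → ℝ) → ℝ) (x : Fin 3 → ℝ) : ℝ :=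
  - (rr u v x * (w 1 x * pdW 1 u x + w 2 x * pdW 2 u x))

noncomputable def iZ (u : (Fin 3 → ℝ) → ℝ) (β v : Fin 3 → (Fin 3 → ℝ) → ℝ) (Bn q : (Fin 3 → ℝ) → ℝ) (e : ℝ) (x : Fin 3 → ℝ) : ℝ :=
  rcp u x * (e * Bn x - q x - (1 / 2) * (v 0 x * v 0 x)
    - (1 / 2) * (e * (e * (uu u v x * uu u v x * (β 1 x * β 1 x + β 2 x * β 2 x)))))

/-- one step of the iteration -/
structure Step (u : (Fin 3 → ℝ) → ℝ) (β : Fin 3 → (Fin 3 → ℝ) → ℝ) (Bn pe : (Fin 3 → ℝ) → ℝ) (e : ℝ)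
    (p : (Fin 3 → ℝ) → ℝ) (v : Fin 3 → (Fin 3 → ℝ) → ℝ) (q : (Fin 3 → ℝ) → ℝ) (w : Fin 3 → (Fin 3 → ℝ) → ℝ) : Prop where
  ell : ∀ x ∈ Slab, Lop u q x = FF u p v x
  neu : ∀ x ∈ Slab, x 0 = 0 → pdW 0 q x = e * hN u β v x
  dir : ∀ x ∈ Slab, x 0 = 1 → q x = e * pe x
  tr : ∀ k, k ≠ 0 → ∀ x ∈ Slab, Tr (bb u v) (w k) x = gT u v q k x
  inl : ∀ k, k ≠ 0 → ∀ x ∈ Slab, x 0 = 0 → w k x = e * (β k x * uu u v x)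
  tr0 : ∀ x ∈ Slab, Tr (bb u v) (w 0) x = gT u v q 0 x + gZ u v w x
  inl0 : ∀ x ∈ Slab, x 0 = 0 → w 0 x = iZ u β v Bn q e x

/-- fixed data -/
structure Dat (α : ℝ) (u : (Fin 3 → ℝ) → ℝ) (M m N : ℝ) (β : Fin 3 → (Fin 3 → ℝ) → ℝ) (Bn pe : (Fin 3 → ℝ) → ℝ) : Prop where
  bg : Bg α u M m
  a0 : 0 < α
  a1 : α < 1
  βh : ∀ j, HH α 3 N (β j)
  βp : ∀ j, PerS (β j)
  Bh : HH α 3 N Bn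
  Bp : PerS Bn
  ph : HH α 3 N pe
  pp : PerS pe
  p0 : ∀ x ∈ Slab, pdW 0 pe x = 0

/-- ball -/
structure Ball (α δ : ℝ) (p : (Fin 3 → ℝ) → ℝ) (v : Fin 3 → (Fin 3 → ℝ) → ℝ) : Prop where
  hp : HH α 3 δ p
  hv : ∀ j, HH α 2 δ (v j)
  pp : PerS p
  pv : ∀ j, PerS (v j)

theorem Ball.mono {δ δ' : ℝ} {p : (Fin 3 → ℝ) → ℝ} {v : Fin 3 → (Fin 3 → ℝ) → ℝ} (h : Ball α δ p v) (hd : δ ≤ δ') : Ball α δ' p v :=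
  ⟨h.hp.mono hd, fun j => (h.hv j).mono hd, h.pp, h.pv⟩
end Inc

set_option linter.unusedVariables false
set_option linter.unusedSimpArgs false
open Set Filter Topology MeasureTheory
namespace Inc
variable {α : ℝ}

/-- the transport estimate with given constants -/
def TrC (α : ℝ) (k : ℕ) (m0 C : ℝ) : Prop := ∀ b, Vf α (k + 1) m0 b → (∀ j, PerS (b j)) →
    (∀ w, DifferentiableOn ℝ w Slab → (∀ x ∈ Slab, Tr b w x = 0) → (∀ x ∈ Slab, x 0 = 0 → w x = 0) → ∀ x ∈ Slab, w x = 0) ∧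
    ∀ A g w0, HH α (k + 1) A g → HH α (k + 1) A w0 → PerS g → PerS w0 → ∃ w, HH α (k + 1) (C * A) w ∧ PerS w ∧
      (∀ x ∈ Slab, Tr b w x = g x) ∧ (∀ x ∈ Slab, x 0 = 0 → w x = w0 x)

theorem Vf.mono {k : ℕ} {m m' : ℝ} {b : Fin 3 → (Fin 3 → ℝ) → ℝ} (h : Vf α k m b) (hm : m ≤ m') : Vf α k m' b :=
  ⟨h.b0, fun j hj => (h.hh j hj).mono hm⟩
theorem Vf.lek {k l : ℕ} (hkl : k ≤ l) {m : ℝ} {b : Fin 3 → (Fin 3 → ℝ) → ℝ} (h : Vf α l m b) : Vf α k m b :=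
  ⟨h.b0, fun j hj => (h.hh j hj).lek hkl⟩
theorem TrC.mono {k : ℕ} {m m' C : ℝ} (h : TrC α k m' C) (hm : m ≤ m') : TrC α k m C :=
  fun b hb hp => h b (hb.mono hm) hp

theorem trc (hα0 : 0 < α) (hα1 : α < 1) : ∃ m0, 0 < m0 ∧ ∃ C0 C1, 0 ≤ C0 ∧ 0 ≤ C1 ∧ TrC α 0 m0 C0 ∧ TrC α 1 m0 C1 := by
  obtain ⟨m0, h0, C0, hC0, t0⟩ := transport hα0 hα1 0
  obtain ⟨m1, h1, C1, hC1, t1⟩ := transport hα0 hα1 1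
  exact ⟨min m0 m1, lt_min h0 h1, C0, C1, hC0, hC1, TrC.mono t0 (min_le_left _ _), TrC.mono t1 (min_le_right _ _)⟩

theorem Tr_sub {b : Fin 3 → (Fin 3 → ℝ) → ℝ} {f g : (Fin 3 → ℝ) → ℝ} (hf : DifferentiableOn ℝ f Slab) (hg : DifferentiableOn ℝ g Slab)
    {x : Fin 3 → ℝ} (hx : x ∈ Slab) : Tr b (fun x => f x - g x) x = Tr b f x - Tr b g x := by
  unfold Tr
  rw [← Finset.sum_sub_distrib]
  exact Finset.sum_congr rfl fun j _ => by rw [pdW_sub hf hg hx]; ring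

theorem OO.common {T : Type} {S : Set T} {k l : ℕ} {s : T → ℝ} (hs : ∀ τ ∈ S, 0 ≤ s τ) {f g : T → (Fin 3 → ℝ) → ℝ}
    (hf : OO α S k s f) (hg : OO α S l s g) : ∃ C, 0 ≤ C ∧ ∀ τ ∈ S, HH α k (C * s τ) (f τ) ∧ HH α l (C * s τ) (g τ) := by
  obtain ⟨C, hC, h⟩ := hf
  obtain ⟨D, hD, h'⟩ := hg
  refine ⟨C + D, add_nonneg hC hD, fun τ hτ => ⟨(h τ hτ).mono ?_, (h' τ hτ).mono ?_⟩⟩ <;>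
  nlinarith [hs τ hτ, mul_nonneg hC (hs τ hτ), mul_nonneg hD (hs τ hτ)]

theorem OO.trans {T : Type} {S : Set T} {k : ℕ} {s : T → ℝ} (hs : ∀ τ ∈ S, 0 ≤ s τ) {m0 C : ℝ} (hC : 0 ≤ C) (ht : TrC α k m0 C)
    {b : T → Fin 3 → (Fin 3 → ℝ) → ℝ} {w g w0 : T → (Fin 3 → ℝ) → ℝ} (hb : ∀ τ ∈ S, Vf α (k + 1) m0 (b τ)) (hbp : ∀ τ ∈ S, ∀ j, PerS (b τ j))
    (hw : ∀ τ ∈ S, DifferentiableOn ℝ (w τ) Slab) (hg : OO α S (k + 1) s g) (hw0 : OO α S (k + 1) s w0)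
    (pg : ∀ τ ∈ S, PerS (g τ)) (pw0 : ∀ τ ∈ S, PerS (w0 τ)) (e1 : ∀ τ ∈ S, ∀ x ∈ Slab, Tr (b τ) (w τ) x = g τ x)
    (e2 : ∀ τ ∈ S, ∀ x ∈ Slab, x 0 = 0 → w τ x = w0 τ x) : OO α S (k + 1) s w := by
  obtain ⟨D, hD, h⟩ := OO.common hs hg hw0
  refine ⟨C * D, mul_nonneg hC hD, fun τ hτ => ?_⟩
  obtain ⟨uq, ex⟩ := ht (b τ) (hb τ hτ) (hbp τ hτ)
  obtain ⟨w', h1, h2, h3, h4⟩ := ex _ _ _ (h τ hτ).1 (h τ hτ).2 (pg τ hτ) (pw0 τ hτ)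
  refine (h1.mono (le_of_eq (by ring))).congr fun x hx => ?_
  have := uq (fun x => w' x - w τ x) (h1.diff.sub (hw τ hτ)) (fun x hx => by
    rw [Tr_sub h1.diff (hw τ hτ) hx, h3 x hx, e1 τ hτ x hx, sub_self]) (fun x hx h0 => by
    simp only [h4 x hx h0, e2 τ hτ x hx h0, sub_self]) x hx
  exact sub_eq_zero.1 this

theorem OO.ell {u : (Fin 3 → ℝ) → ℝ} {M m : ℝ} (H : Bg α u M m) (hα0 : 0 < α) (hα1 : α < 1) {T : Type} {S : Set T} (k : ℕ) (hk : k ≤ 1)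
    {s : T → ℝ} (hs : ∀ τ ∈ S, 0 ≤ s τ) {q f h e : T → (Fin 3 → ℝ) → ℝ} (hq : ∀ τ ∈ S, ∃ A, HH α 2 A (q τ))
    (hf : OO α S k s f) (hh : OO α S (k + 1) s h) (he : OO α S (k + 2) s e) (pq : ∀ τ ∈ S, PerS (q τ)) (pf : ∀ τ ∈ S, PerS (f τ))
    (ph : ∀ τ ∈ S, PerS (h τ)) (pe : ∀ τ ∈ S, PerS (e τ)) (e0 : ∀ τ ∈ S, ∀ x ∈ Slab, pdW 0 (e τ) x = 0)
    (h1 : ∀ τ ∈ S, ∀ x ∈ Slab, Lop u (q τ) x = f τ x) (h2 : ∀ τ ∈ S, ∀ x ∈ Slab, x 0 = 0 → pdW 0 (q τ) x = h τ x)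
    (h3 : ∀ τ ∈ S, ∀ x ∈ Slab, x 0 = 1 → q τ x = e τ x) : OO α S (k + 2) s q := by
  obtain ⟨C, hC, ex⟩ := H.ell hα0 hα1 k hk
  obtain ⟨D, hD, hd⟩ := OO.common hs hf hh
  obtain ⟨E, hE, he⟩ := he
  refine ⟨C * (D + E), by positivity, fun τ hτ => ?_⟩
  have hDs := mul_nonneg hD (hs τ hτ)
  have hEs := mul_nonneg hE (hs τ hτ)
  obtain ⟨p, a1, a2, a3, a4, a5⟩ := ex ((D + E) * s τ) _ _ _ ((hd τ hτ).1.mono (by linarith)) ((hd τ hτ).2.mono (by linarith))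
    ((he τ hτ).mono (by linarith)) (pf τ hτ) (ph τ hτ) (pe τ hτ) (e0 τ hτ)
  refine (a1.mono (le_of_eq (by ring))).congr fun x hx => ?_
  obtain ⟨A, hA⟩ := hq τ hτ
  have a1' := a1.lek (by omega : 2 ≤ k + 2)
  have := H.ell_unique hα0 hα1 (a1'.sub hA) (a2.sub (pq τ hτ)) (fun x hx => by
    rw [Bg.Lop_sub a1' hA hx, a3 x hx, h1 τ hτ x hx, sub_self]) (fun x hx h0 => by
    rw [pdW_sub a1'.diff hA.diff hx, a4 x hx h0, h2 τ hτ x hx h0, sub_self]) (fun x hx h0 => by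
    simp only [a5 x hx h0, h3 τ hτ x hx h0, sub_self]) x hx
  exact sub_eq_zero.1 this

section per
variable {u p q Bn pe : (Fin 3 → ℝ) → ℝ} {v w β : Fin 3 → (Fin 3 → ℝ) → ℝ}
theorem uu_per (hu : PerS u) (hv : ∀ j, PerS (v j)) : PerS (uu u v) := hu.add (hv 0)
theorem rr_per (hu : PerS u) (hv : ∀ j, PerS (v j)) : PerS (rr u v) := (uu_per hu hv).inv
theorem bb_per (hu : PerS u) (hv : ∀ j, PerS (v j)) (j : Fin 3) : PerS (bb u v j) := by
  unfold bb
  by_cases hj : j = 0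
  · simp only [hj, if_true]; exact PerS.const 1
  · simp only [hj, if_false]; exact (hv j).mul (rr_per hu hv)
theorem QQ_per (hv : ∀ j, PerS (v j)) (dv : ∀ j, DifferentiableOn ℝ (v j) Slab) : PerS (QQ v) := by
  have h := fun i j => (hv j).pd (dv j) i
  exact ((((h 0 0).mul (h 0 0)).add ((h 1 1).mul (h 1 1))).add ((h 2 2).mul (h 2 2))).add
    (PerS.cmul 2 ((((h 1 0).mul (h 0 1)).add ((h 2 0).mul (h 0 2))).add ((h 1 2).mul (h 2 1))))
theorem KK_per (hu : PerS u) (du : DifferentiableOn ℝ u Slab) (hp : PerS p) (dp : DifferentiableOn ℝ p Slab)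
    (hv : ∀ j, PerS (v j)) (dv : ∀ j, DifferentiableOn ℝ (v j) Slab) (k : Fin 3) : PerS (KK u p v k) := by
  have h := fun i j => (hv j).pd (dv j) i
  exact (hu.pd du k).mul ((((rr_per hu hv).sub hu.inv).mul (hp.pd dp k)).add
    ((rr_per hu hv).mul (((hv 1).mul (h 1 k)).add ((hv 2).mul (h 2 k)))))
theorem FF_per (hu : PerS u) (du : DifferentiableOn ℝ u Slab) (hp : PerS p) (dp : DifferentiableOn ℝ p Slab)
    (hv : ∀ j, PerS (v j)) (dv : ∀ j, DifferentiableOn ℝ (v j) Slab) : PerS (FF u p v) :=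
  (PerS.cmul 2 ((KK_per hu du hp dp hv dv 1).add (KK_per hu du hp dp hv dv 2))).sub (QQ_per hv dv)
theorem hN_per (hu : PerS u) (hv : ∀ j, PerS (v j)) (hβ : ∀ j, PerS (β j)) (dβ : ∀ j, DifferentiableOn ℝ (β j) Slab) :
    PerS (hN u β v) :=
  ((uu_per hu hv).mul (uu_per hu hv)).mul (((hβ 1).pd (dβ 1) 1).add ((hβ 2).pd (dβ 2) 2))
theorem gT_per (hu : PerS u) (hv : ∀ j, PerS (v j)) (hq : PerS q) (dq : DifferentiableOn ℝ q Slab) (k : Fin 3) : PerS (gT u v q k) :=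
  ((rr_per hu hv).mul (hq.pd dq k)).neg
theorem gZ_per (hu : PerS u) (du : DifferentiableOn ℝ u Slab) (hv : ∀ j, PerS (v j)) (hw : ∀ j, j ≠ 0 → PerS (w j)) : PerS (gZ u v w) :=
  ((rr_per hu hv).mul (((hw 1 (by decide)).mul (hu.pd du 1)).add ((hw 2 (by decide)).mul (hu.pd du 2)))).neg
theorem iZ_per (hu : PerS u) (hv : ∀ j, PerS (v j)) (hβ : ∀ j, PerS (β j)) (hB : PerS Bn) (hq : PerS q) (e : ℝ) :
    PerS (iZ u β v Bn q e) :=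
  hu.inv.mul ((((hB.cmul e).sub hq).sub (((hv 0).mul (hv 0)).cmul _)).sub
    (PerS.cmul _ (PerS.cmul _ (PerS.cmul _ (((uu_per hu hv).mul (uu_per hu hv)).mul (((hβ 1).mul (hβ 1)).add ((hβ 2).mul (hβ 2))))))))
end per

variable {u : (Fin 3 → ℝ) → ℝ} {M m N : ℝ} {β : Fin 3 → (Fin 3 → ℝ) → ℝ} {Bn pe : (Fin 3 → ℝ) → ℝ}

/-- smallness package -/
structure Sm (α : ℝ) (u : (Fin 3 → ℝ) → ℝ) (m m0 δ0 N1 : ℝ) : Prop where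
  pos : 0 < δ0
  le1 : δ0 ≤ 1
  n1 : 0 ≤ N1
  low : ∀ δ p v, Ball α δ p v → δ ≤ δ0 → ∀ x ∈ Slab, m / 2 ≤ uu u v x
  rh : ∀ δ p v, Ball α δ p v → δ ≤ δ0 → HH α 2 N1 (rr u v)
  vf : ∀ δ p v, Ball α δ p v → δ ≤ δ0 → Vf α 2 m0 (bb u v)

theorem Sm.mono {m0 δ0 δ1 N1 : ℝ} (h : Sm α u m m0 δ0 N1) (h1 : 0 < δ1) (h2 : δ1 ≤ δ0) : Sm α u m m0 δ1 N1 :=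
  ⟨h1, h2.trans h.le1, h.n1, fun δ p v hb hd => h.low δ p v hb (hd.trans h2), fun δ p v hb hd => h.rh δ p v hb (hd.trans h2),
    fun δ p v hb hd => h.vf δ p v hb (hd.trans h2)⟩

theorem exists_Sm (H : Bg α u M m) {m0 : ℝ} (hm0 : 0 < m0) : ∃ δ0 N1, Sm α u m m0 δ0 N1 := by
  have hm := H.pos
  obtain ⟨N1, hN1, hinv⟩ := HH.inv (α := α) (m / 2) (by linarith) 2 (M + 1)
  have hq : 0 < m0 / (8 * N1 + 1) := by positivity
  set δ0 := min (min 1 (m / 2)) (m0 / (8 * N1 + 1)) with hδ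
  have d1 : δ0 ≤ 1 := (min_le_left _ _).trans (min_le_left _ _)
  have d2 : δ0 ≤ m / 2 := (min_le_left _ _).trans (min_le_right _ _)
  have d3 : δ0 ≤ m0 / (8 * N1 + 1) := min_le_right _ _
  have low : ∀ δ p v, Ball α δ p v → δ ≤ δ0 → ∀ x ∈ Slab, m / 2 ≤ uu u v x := by
    intro δ p v hb hd x hx
    have := H.le x hx
    have h2 := (abs_le.1 ((hb.hv 0).bd hx)).1
    unfold uu; linarith
  have rh : ∀ δ p v, Ball α δ p v → δ ≤ δ0 → HH α 2 N1 (rr u v) := by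
    intro δ p v hb hd
    refine hinv (uu u v) ?_ (low δ p v hb hd)
    exact ((H.hh.lek (by norm_num)).add (hb.hv 0)).mono (by linarith)
  refine ⟨δ0, N1, lt_min (lt_min one_pos (by linarith)) hq, d1, hN1, low, rh, ?_⟩
  intro δ p v hb hd
  refine ⟨fun x => by simp [bb], fun j hj => ?_⟩
  refine (((hb.hv j).mul (rh δ p v hb hd)).mono ?_).congr fun x hx => by simp [bb, hj]
  have h0 := (hb.hv j).nonneg
  have : δ * (8 * N1 + 1) ≤ m0 := (mul_le_mul_of_nonneg_right (hd.trans d3) (by positivity)).trans (by rw [div_mul_cancel₀]; positivity)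
  norm_num
  nlinarith
end Inc

set_option linter.unusedVariables false
set_option linter.unusedSimpArgs false
open Set Filter Topology MeasureTheory
namespace Inc
variable {α : ℝ}

/-- parameters of one step -/
structure Par where
  e : ℝ
  δ : ℝ
  p : (Fin 3 → ℝ) → ℝ
  v : Fin 3 → (Fin 3 → ℝ) → ℝ
  q : (Fin 3 → ℝ) → ℝ
  w : Fin 3 → (Fin 3 → ℝ) → ℝ

/-- admissible inputs -/
structure Inp (α δ0 : ℝ) (τ : Par) : Prop where
  e0 : 0 ≤ τ.e
  e1 : τ.e ≤ 1
  le : τ.δ ≤ δ0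
  ball : Ball α τ.δ τ.p τ.v

section
variable {u : (Fin 3 → ℝ) → ℝ} {M m N m0 δ0 N1 : ℝ} {β : Fin 3 → (Fin 3 → ℝ) → ℝ} {Bn pe : (Fin 3 → ℝ) → ℝ} {S : Set Par}

theorem Inp.d0 {τ : Par} (h : Inp α δ0 τ) : 0 ≤ τ.δ := h.ball.hp.nonneg
theorem Inp.d1 {τ : Par} (h : Inp α δ0 τ) (hd : δ0 ≤ 1) : τ.δ ≤ 1 := h.le.trans hd

theorem O_v (hS : ∀ τ ∈ S, Inp α δ0 τ) (j : Fin 3) : OO α S 2 (fun τ => τ.δ) (fun τ => τ.v j) :=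
  OO.of fun τ hτ => (hS τ hτ).ball.hv j
theorem O_p (hS : ∀ τ ∈ S, Inp α δ0 τ) : OO α S 3 (fun τ => τ.δ) (fun τ => τ.p) :=
  OO.of fun τ hτ => (hS τ hτ).ball.hp
theorem O_rr (hm : Sm α u m m0 δ0 N1) (hS : ∀ τ ∈ S, Inp α δ0 τ) : OO α S 2 (fun _ => 1) (fun τ => rr u τ.v) :=
  ⟨N1, hm.n1, fun τ hτ => by simpa using hm.rh _ _ _ (hS τ hτ).ball (hS τ hτ).le⟩
theorem O_uu (H : Bg α u M m) (hd : δ0 ≤ 1) (hS : ∀ τ ∈ S, Inp α δ0 τ) : OO α S 2 (fun _ => 1) (fun τ => uu u τ.v) :=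
  (OO.fix (H.hh.lek (by norm_num))).add ((O_v hS 0).mono 1 zero_le_one fun τ hτ => by simpa using (hS τ hτ).d1 hd)
theorem rr_sub (H : Bg α u M m) (hm : Sm α u m m0 δ0 N1) {δ : ℝ} {p : (Fin 3 → ℝ) → ℝ} {v : Fin 3 → (Fin 3 → ℝ) → ℝ}
    (hb : Ball α δ p v) (hd : δ ≤ δ0) {x : Fin 3 → ℝ} (hx : x ∈ Slab) : - (rr u v x * (rcp u x * v 0 x)) = rr u v x - rcp u x := by
  have h1 := hm.low _ _ _ hb hd x hx
  have h2 := H.pos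
  have h3 : uu u v x ≠ 0 := by linarith
  have h4 := H.ne x hx
  unfold rr rcp
  field_simp
  unfold uu; ring
theorem O_rd (H : Bg α u M m) (hm : Sm α u m m0 δ0 N1) (hS : ∀ τ ∈ S, Inp α δ0 τ) :
    OO α S 2 (fun τ => τ.δ) (fun τ x => rr u τ.v x - rcp u x) := by
  obtain ⟨A, _, hA⟩ := H.rHH
  refine (OO.neg (OO.mul (s1 := fun _ => 1) (s2 := fun τ => τ.δ) (by simp) (O_rr hm hS)
    (OO.mul (s1 := fun _ => 1) (s2 := fun τ => τ.δ) (by simp) (OO.fix (hA.lek (by norm_num))) (O_v hS 0)))).congr ?_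
  exact fun τ hτ x hx => rr_sub H hm (hS τ hτ).ball (hS τ hτ).le hx

theorem O_FF (H : Bg α u M m) (hm : Sm α u m m0 δ0 N1) (hS : ∀ τ ∈ S, Inp α δ0 τ) :
    OO α S 1 (fun τ => τ.δ * τ.δ) (fun τ => FF u τ.p τ.v) := by
  have v1 := fun j => (O_v hS j).lek (by norm_num : 1 ≤ 2)
  have dv := fun i j => (O_v hS j).pd i
  have mm : ∀ {F G : Par → (Fin 3 → ℝ) → ℝ}, OO α S 1 (fun τ => τ.δ) F → OO α S 1 (fun τ => τ.δ) G →
    OO α S 1 (fun τ => τ.δ * τ.δ) (fun τ x => F τ x * G τ x) := fun hF hG => OO.mul (fun _ _ => le_rfl) hF hG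
  have m1 : ∀ {F G : Par → (Fin 3 → ℝ) → ℝ}, OO α S 1 (fun τ => 1) F → OO α S 1 (fun τ => τ.δ * τ.δ) G →
    OO α S 1 (fun τ => τ.δ * τ.δ) (fun τ x => F τ x * G τ x) := fun hF hG => OO.mul (by simp) hF hG
  have hQ : OO α S 1 (fun τ => τ.δ * τ.δ) (fun τ => QQ τ.v) :=
    (((mm (dv 0 0) (dv 0 0)).add (mm (dv 1 1) (dv 1 1))).add (mm (dv 2 2) (dv 2 2))).add
      (OO.cmul 2 (((mm (dv 1 0) (dv 0 1)).add (mm (dv 2 0) (dv 0 2))).add (mm (dv 1 2) (dv 2 1))))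
  have hK : ∀ k, OO α S 1 (fun τ => τ.δ * τ.δ) (fun τ => KK u τ.p τ.v k) := fun k =>
    m1 (OO.fix ((H.hh.pd k).lek (by norm_num))) ((mm ((O_rd H hm hS).lek (by norm_num)) (((O_p hS).pd k).lek (by norm_num))).add
      (m1 ((O_rr hm hS).lek (by norm_num)) ((mm (v1 1) (dv 1 k)).add (mm (v1 2) (dv 2 k)))))
  exact (OO.cmul 2 ((hK 1).add (hK 2))).sub hQ

theorem O_hN (D : Dat α u M m N β Bn pe) (hd : δ0 ≤ 1) (hS : ∀ τ ∈ S, Inp α δ0 τ) : OO α S 2 (fun _ => 1) (fun τ => hN u β τ.v) :=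
  OO.mul (s1 := fun _ => 1) (s2 := fun _ => 1) (by simp)
    (OO.mul (s1 := fun _ => 1) (s2 := fun _ => 1) (by simp) (O_uu D.bg hd hS) (O_uu D.bg hd hS))
    ((OO.fix ((D.βh 1).pd 1)).add (OO.fix ((D.βh 2).pd 2)))

theorem O_gT (hm : Sm α u m m0 δ0 N1) (hS : ∀ τ ∈ S, Inp α δ0 τ) {s : Par → ℝ} (hq : OO α S 3 s (fun τ => τ.q)) (k : Fin 3) :
    OO α S 2 s (fun τ => gT u τ.v τ.q k) :=
  OO.neg (OO.mul (s1 := fun _ => 1) (s2 := s) (by simp) (O_rr hm hS) (hq.pd k))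

theorem O_gZ (H : Bg α u M m) (hm : Sm α u m m0 δ0 N1) (hS : ∀ τ ∈ S, Inp α δ0 τ) {s : Par → ℝ}
    (hw : ∀ j, j ≠ 0 → OO α S 2 s (fun τ => τ.w j)) : OO α S 2 s (fun τ => gZ u τ.v τ.w) :=
  OO.neg (OO.mul (s1 := fun _ => 1) (s2 := s) (by simp) (O_rr hm hS)
    ((OO.mul (s1 := s) (s2 := fun _ => 1) (by simp) (hw 1 (by decide)) (OO.fix (H.hh.pd 1))).add
     (OO.mul (s1 := s) (s2 := fun _ => 1) (by simp) (hw 2 (by decide)) (OO.fix (H.hh.pd 2)))))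

theorem O_iT (D : Dat α u M m N β Bn pe) (hd : δ0 ≤ 1) (hS : ∀ τ ∈ S, Inp α δ0 τ) {s : Par → ℝ} (hes : ∀ τ ∈ S, τ.e ≤ s τ) (k : Fin 3) :
    OO α S 2 s (fun τ x => τ.e * (β k x * uu u τ.v x)) :=
  OO.scal (s1 := fun _ => 1) (fun τ hτ => by rw [abs_of_nonneg (hS τ hτ).e0]; simpa using hes τ hτ)
    (OO.mul (s1 := fun _ => 1) (s2 := fun _ => 1) (by simp) (OO.fix ((D.βh k).lek (by norm_num))) (O_uu D.bg hd hS))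

theorem O_iZ (D : Dat α u M m N β Bn pe) (hd : δ0 ≤ 1) (hS : ∀ τ ∈ S, Inp α δ0 τ) {s : Par → ℝ} (hes : ∀ τ ∈ S, τ.e ≤ s τ)
    (hds : ∀ τ ∈ S, τ.δ * τ.δ ≤ s τ)
    (hq : OO α S 3 s (fun τ => τ.q)) : OO α S 2 s (fun τ => iZ u β τ.v Bn τ.q τ.e) := by
  obtain ⟨A, _, hA⟩ := D.bg.rHH
  have he : ∀ τ ∈ S, |τ.e| * 1 ≤ s τ := fun τ hτ => by rw [abs_of_nonneg (hS τ hτ).e0]; simpa using hes τ hτ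
  have he1 : ∀ τ ∈ S, |τ.e| * s τ ≤ s τ := fun τ hτ => by
    rw [abs_of_nonneg (hS τ hτ).e0]
    have := (hS τ hτ).e0.trans (hes τ hτ)
    exact mul_le_of_le_one_left this (hS τ hτ).e1
  refine OO.mul (s1 := fun _ => 1) (s2 := s) (by simp) (OO.fix (hA.lek (by norm_num))) ?_
  refine OO.sub (OO.sub (OO.sub (OO.scal he (OO.fix (D.Bh.lek (by norm_num)))) (hq.lek (by norm_num)))
    (OO.cmul _ (OO.mul hds (O_v hS 0) (O_v hS 0)))) (OO.cmul _ (OO.scal he1 (OO.scal he ?_)))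
  refine OO.mul (s1 := fun _ => 1) (s2 := fun _ => 1) (by simp)
    (OO.mul (s1 := fun _ => 1) (s2 := fun _ => 1) (by simp) (O_uu D.bg hd hS) (O_uu D.bg hd hS)) ?_
  have hβ := fun k => OO.fix (S := S) ((D.βh k).lek (by norm_num : 2 ≤ 3))
  exact (OO.mul (s1 := fun _ => 1) (s2 := fun _ => 1) (by simp) (hβ 1) (hβ 1)).add
    (OO.mul (s1 := fun _ => 1) (s2 := fun _ => 1) (by simp) (hβ 2) (hβ 2))

theorem step_exists (D : Dat α u M m N β Bn pe) (hm : Sm α u m m0 δ0 N1) {C1 : ℝ} (ht : TrC α 1 m0 C1)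
    {e δ : ℝ} {p : (Fin 3 → ℝ) → ℝ} {v : Fin 3 → (Fin 3 → ℝ) → ℝ} (he0 : 0 ≤ e) (he1 : e ≤ 1) (hδ : δ ≤ δ0) (hb : Ball α δ p v) :
    ∃ q w A, Ball α A q w ∧ Step u β Bn pe e p v q w := by
  have hu := D.bg.per
  have du := D.bg.hh.diff
  have dv := fun j => (hb.hv j).diff
  have dβ := fun j => (D.βh j).diff
  have mem : ∀ q w, ∀ τ ∈ ({⟨e, δ, p, v, q, w⟩} : Set Par), Inp α δ0 τ := by
    intro q w τ hτ; rw [mem_singleton_iff.1 hτ]; exact ⟨he0, he1, hδ, hb⟩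
  have get : ∀ {k : ℕ} {s : Par → ℝ} {F : Par → (Fin 3 → ℝ) → ℝ} (q w), OO α ({⟨e, δ, p, v, q, w⟩} : Set Par) k s F →
      ∃ A, HH α k A (F ⟨e, δ, p, v, q, w⟩) := by
    intro k s F q w ⟨C, hC, h⟩
    exact ⟨_, h _ rfl⟩
  -- pressure
  obtain ⟨A1, h1⟩ := get p v (O_FF D.bg hm (mem p v))
  obtain ⟨A2, h2⟩ := get p v (O_hN D hm.le1 (mem p v))
  obtain ⟨C, hC, ex⟩ := D.bg.ell D.a0 D.a1 1 le_rfl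
  have h2' := h2.cmul e
  have h3 := D.ph.cmul e
  obtain ⟨q, q1, q2, q3, q4, q5⟩ := ex (A1 + |e| * A2 + |e| * N) _ _ _ (h1.mono (by linarith [h2'.nonneg, h3.nonneg]))
    (h2'.mono (by linarith [h1.nonneg, h3.nonneg])) (h3.mono (by linarith [h1.nonneg, h2'.nonneg]))
    (FF_per hu du hb.pp hb.hp.diff hb.pv dv) ((hN_per hu hb.pv D.βp dβ).cmul e) (D.pp.cmul e)
    (fun x hx => by rw [pdW_cmul e D.ph.diff hx, D.p0 x hx, mul_zero])
  have tr := ht (bb u v) (hm.vf _ _ _ hb hδ) (bb_per hu hb.pv)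
  set P := C * (A1 + |e| * A2 + |e| * N) with hP
  have oq : ∀ w, OO α ({⟨e, δ, p, v, q, w⟩} : Set Par) 3 (fun τ => |P| + τ.e + τ.δ * τ.δ) (fun τ => τ.q) := fun w =>
    OO.of fun τ hτ => by
      rw [mem_singleton_iff.1 hτ]; exact q1.mono (by have := le_abs_self P; have := mul_self_nonneg δ; dsimp only; linarith)
  have e1 : ∀ w, ∀ τ ∈ ({⟨e, δ, p, v, q, w⟩} : Set Par), τ.e ≤ |P| + τ.e + τ.δ * τ.δ := fun w τ hτ => by
    nlinarith [abs_nonneg P, mul_self_nonneg τ.δ]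
  have e2 : ∀ w, ∀ τ ∈ ({⟨e, δ, p, v, q, w⟩} : Set Par), τ.δ * τ.δ ≤ |P| + τ.e + τ.δ * τ.δ := fun w τ hτ => by
    nlinarith [abs_nonneg P, (mem q w τ hτ).e0]
  -- tangential velocities
  have wk : ∀ k : Fin 3, k ≠ 0 → ∃ w A, HH α 2 A w ∧ PerS w ∧ (∀ x ∈ Slab, Tr (bb u v) w x = gT u v q k x) ∧
      (∀ x ∈ Slab, x 0 = 0 → w x = e * (β k x * uu u v x)) := by
    intro k hk
    obtain ⟨A3, h3⟩ := get q v (O_gT hm (mem q v) (oq v) k)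
    obtain ⟨A4, h4⟩ := get q v (O_iT D hm.le1 (mem q v) (e1 v) k)
    obtain ⟨w, w1, w2, w3, w4⟩ := tr.2 (A3 + A4) _ _ (h3.mono (by linarith [h4.nonneg])) (h4.mono (by linarith [h3.nonneg]))
      (gT_per hu hb.pv q2 q1.diff k) (PerS.cmul e ((D.βp k).mul (uu_per hu hb.pv)))
    exact ⟨w, _, w1, w2, w3, w4⟩
  obtain ⟨w1, B1, a1, a2, a3, a4⟩ := wk 1 (by decide)
  obtain ⟨w2, B2, b1, b2, b3, b4⟩ := wk 2 (by decide)
  set w' : Fin 3 → (Fin 3 → ℝ) → ℝ := ![w1, w1, w2] with hw'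
  obtain ⟨A3, h3⟩ := get q w' (O_gT hm (mem q w') (oq w') 0)
  obtain ⟨A4, h4⟩ := get q w' (O_gZ D.bg hm (mem q w') (s := fun _ => |B1| + |B2|) (fun j hj => OO.of fun τ hτ => by
    rw [mem_singleton_iff.1 hτ]
    fin_cases j
    · exact absurd rfl hj
    · exact a1.mono (by linarith [le_abs_self B1, abs_nonneg B2])
    · exact b1.mono (by linarith [le_abs_self B2, abs_nonneg B1])))
  obtain ⟨A5, h5⟩ := get q w' (O_iZ D hm.le1 (mem q w') (e1 w') (e2 w') (oq w'))
  have pw' : ∀ j, j ≠ 0 → PerS (w' j) := fun j hj => by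
    fin_cases j
    · exact absurd rfl hj
    · exact a2
    · exact b2
  have h34 := h3.add h4
  obtain ⟨w0, c1, c2, c3, c4⟩ := tr.2 (A3 + A4 + A5) _ _ (h34.mono (by linarith [h5.nonneg])) (h5.mono (by linarith [h34.nonneg]))
    ((gT_per hu hb.pv q2 q1.diff 0).add (gZ_per hu du hb.pv pw')) (iZ_per hu hb.pv D.βp D.Bp q2 e)
  refine ⟨q, ![w0, w1, w2], |P| + |B1| + |B2| + |C1 * (A3 + A4 + A5)|, ⟨?_, ?_, q2, ?_⟩, ⟨q3, q4, q5, ?_, ?_, c3, c4⟩⟩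
  · exact q1.mono (by linarith [le_abs_self P, abs_nonneg B1, abs_nonneg B2, abs_nonneg (C1 * (A3 + A4 + A5))])
  · intro j
    fin_cases j
    · exact c1.mono (by linarith [le_abs_self (C1 * (A3 + A4 + A5)), abs_nonneg B1, abs_nonneg B2, abs_nonneg P])
    · exact a1.mono (by linarith [le_abs_self B1, abs_nonneg P, abs_nonneg B2, abs_nonneg (C1 * (A3 + A4 + A5))])
    · exact b1.mono (by linarith [le_abs_self B2, abs_nonneg P, abs_nonneg B1, abs_nonneg (C1 * (A3 + A4 + A5))])
  · intro j; fin_cases j; exacts [c2, a2, b2]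
  · intro k hk; fin_cases k
    · exact absurd rfl hk
    · exact a3
    · exact b3
  · intro k hk; fin_cases k
    · exact absurd rfl hk
    · exact a4
    · exact b4

/-- a priori bound for one step -/
theorem step_bound (D : Dat α u M m N β Bn pe) (hm : Sm α u m m0 δ0 N1) {C1 : ℝ} (hC1 : 0 ≤ C1) (ht : TrC α 1 m0 C1) :
    ∃ C, 0 ≤ C ∧ ∀ e δ p v q w A, 0 ≤ e → e ≤ 1 → δ ≤ δ0 → Ball α δ p v → Ball α A q w → Step u β Bn pe e p v q w →
      Ball α (C * (e + δ * δ)) q w := by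
  have hu := D.bg.per
  have du := D.bg.hh.diff
  have dβ := fun j => (D.βh j).diff
  set S : Set Par := {τ | Inp α δ0 τ ∧ (∃ A, Ball α A τ.q τ.w) ∧ Step u β Bn pe τ.e τ.p τ.v τ.q τ.w} with hSd
  have hS : ∀ τ ∈ S, Inp α δ0 τ := fun τ hτ => hτ.1
  set s : Par → ℝ := fun τ => τ.e + τ.δ * τ.δ with hs
  have s1 : ∀ τ ∈ S, τ.e ≤ s τ := fun τ hτ => by simp only [hs]; nlinarith [mul_self_nonneg τ.δ]
  have s2 : ∀ τ ∈ S, τ.δ * τ.δ ≤ s τ := fun τ hτ => by simp only [hs]; linarith [(hS τ hτ).e0]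
  have s0 : ∀ τ ∈ S, 0 ≤ s τ := fun τ hτ => (hS τ hτ).e0.trans (s1 τ hτ)
  have he : ∀ τ ∈ S, |τ.e| * 1 ≤ s τ := fun τ hτ => by rw [abs_of_nonneg (hS τ hτ).e0]; simpa using s1 τ hτ
  have bq : ∀ τ ∈ S, PerS τ.q ∧ (∀ j, PerS (τ.w j)) ∧ DifferentiableOn ℝ τ.q Slab ∧ (∀ j, DifferentiableOn ℝ (τ.w j) Slab) :=
    fun τ hτ => by obtain ⟨A, hA⟩ := hτ.2.1; exact ⟨hA.pp, hA.pv, hA.hp.diff, fun j => (hA.hv j).diff⟩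
  have oq : OO α S 3 s (fun τ => τ.q) := by
    refine OO.ell D.bg D.a0 D.a1 1 le_rfl s0 (f := fun τ => FF u τ.p τ.v) (h := fun τ x => τ.e * hN u β τ.v x)
      (e := fun τ x => τ.e * pe x) (fun τ hτ => ?_) ((O_FF D.bg hm hS).mono 1 zero_le_one (by simpa using s2))
      (OO.scal he (O_hN D hm.le1 hS)) (OO.scal he (OO.fix D.ph)) (fun τ hτ => (bq τ hτ).1) (fun τ hτ => ?_) (fun τ hτ => ?_)
      (fun τ hτ => D.pp.cmul _) (fun τ hτ x hx => by rw [pdW_cmul _ D.ph.diff hx, D.p0 x hx, mul_zero])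
      (fun τ hτ => hτ.2.2.ell) (fun τ hτ => hτ.2.2.neu) (fun τ hτ => hτ.2.2.dir)
    · obtain ⟨A, hA⟩ := hτ.2.1; exact ⟨A, hA.hp.of_succ⟩
    · have hb := (hS τ hτ).ball
      exact FF_per hu du hb.pp hb.hp.diff hb.pv (fun j => (hb.hv j).diff)
    · exact (hN_per hu (hS τ hτ).ball.pv D.βp dβ).cmul _
  have vf : ∀ τ ∈ S, Vf α 2 m0 (bb u τ.v) := fun τ hτ => hm.vf _ _ _ (hS τ hτ).ball (hS τ hτ).le
  have vp : ∀ τ ∈ S, ∀ j, PerS (bb u τ.v j) := fun τ hτ => bb_per hu (hS τ hτ).ball.pv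
  have ow : ∀ k, k ≠ 0 → OO α S 2 s (fun τ => τ.w k) := fun k hk =>
    OO.trans s0 hC1 ht vf vp (fun τ hτ => (bq τ hτ).2.2.2 k) (O_gT hm hS oq k) (O_iT D hm.le1 hS s1 k)
      (fun τ hτ => gT_per hu (hS τ hτ).ball.pv (bq τ hτ).1 (bq τ hτ).2.2.1 k)
      (fun τ hτ => PerS.cmul _ ((D.βp k).mul (uu_per hu (hS τ hτ).ball.pv)))
      (fun τ hτ => hτ.2.2.tr k hk) (fun τ hτ => hτ.2.2.inl k hk)
  have ow0 : OO α S 2 s (fun τ => τ.w 0) :=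
    OO.trans s0 hC1 ht vf vp (fun τ hτ => (bq τ hτ).2.2.2 0) ((O_gT hm hS oq 0).add (O_gZ D.bg hm hS ow)) (O_iZ D hm.le1 hS s1 s2 oq)
      (fun τ hτ => (gT_per hu (hS τ hτ).ball.pv (bq τ hτ).1 (bq τ hτ).2.2.1 0).add (gZ_per hu du (hS τ hτ).ball.pv fun j _ => (bq τ hτ).2.1 j))
      (fun τ hτ => iZ_per hu (hS τ hτ).ball.pv D.βp D.Bp (bq τ hτ).1 _)
      (fun τ hτ => hτ.2.2.tr0) (fun τ hτ => hτ.2.2.inl0)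
  have ow' : ∀ j, OO α S 2 s (fun τ => τ.w j) := fun j => by
    by_cases hj : j = 0
    · rw [hj]; exact ow0
    · exact ow j hj
  obtain ⟨K1, k1, g1⟩ := OO.common s0 oq (ow' 0)
  obtain ⟨K2, k2, g2⟩ := OO.common s0 (ow' 1) (ow' 2)
  refine ⟨K1 + K2, by positivity, fun e δ p v q w A he0 he1 hδ hb hb' hst => ?_⟩
  have hτ : (⟨e, δ, p, v, q, w⟩ : Par) ∈ S := ⟨⟨he0, he1, hδ, hb⟩, ⟨A, hb'⟩, hst⟩
  have t0 := s0 _ hτ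
  have t1 := g1 _ hτ
  have t2 := g2 _ hτ
  simp only [hs] at t0 t1 t2
  have l1 : K1 * (e + δ * δ) ≤ (K1 + K2) * (e + δ * δ) := by nlinarith
  have l2 : K2 * (e + δ * δ) ≤ (K1 + K2) * (e + δ * δ) := by nlinarith
  refine ⟨t1.1.mono l1, fun j => ?_, hb'.pp, hb'.pv⟩
  fin_cases j
  exacts [t1.2.mono l1, t2.1.mono l2, t2.2.mono l2]
end
end Inc

set_option linter.unusedVariables false
set_option linter.unusedSimpArgs false
open Set Filter Topology MeasureTheory
namespace Inc
variable {α : ℝ}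

/-- distance in the weak norm -/
structure Dst (α d : ℝ) (p : (Fin 3 → ℝ) → ℝ) (v : Fin 3 → (Fin 3 → ℝ) → ℝ) (p' : (Fin 3 → ℝ) → ℝ) (v' : Fin 3 → (Fin 3 → ℝ) → ℝ) : Prop where
  hp : HH α 2 d (fun x => p x - p' x)
  hv : ∀ j, HH α 1 d (fun x => v j x - v' j x)

/-- parameters of two steps -/
structure Par2 where
  a : Par
  b : Par
  d : ℝ

structure Inp2 (α δ0 : ℝ) (τ : Par2) : Prop where
  ia : Inp α δ0 τ.a
  ib : Inp α δ0 τ.b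
  ee : τ.b.e = τ.a.e
  dd : τ.b.δ = τ.a.δ
  ed : τ.a.e ≤ τ.a.δ
  qa : Ball α τ.a.δ τ.a.q τ.a.w
  qb : Ball α τ.a.δ τ.b.q τ.b.w
  ds : Dst α τ.d τ.a.p τ.a.v τ.b.p τ.b.v

section
variable {u : (Fin 3 → ℝ) → ℝ} {M m N m0 δ0 N1 : ℝ} {β : Fin 3 → (Fin 3 → ℝ) → ℝ} {Bn pe : (Fin 3 → ℝ) → ℝ} {S : Set Par2}

theorem Inp2.d0 {τ : Par2} (h : Inp2 α δ0 τ) : 0 ≤ τ.d := h.ds.hp.nonneg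
theorem Inp2.ballb {τ : Par2} (h : Inp2 α δ0 τ) : Ball α τ.a.δ τ.b.p τ.b.v := h.dd ▸ h.ib.ball

theorem D_v (hS : ∀ τ ∈ S, Inp2 α δ0 τ) (j : Fin 3) : DO α S 1 (fun τ => τ.a.δ) (fun τ => τ.d) (fun τ => τ.a.v j) (fun τ => τ.b.v j) :=
  ⟨OO.of fun τ hτ => ((hS τ hτ).ia.ball.hv j).of_succ, OO.of fun τ hτ => ((hS τ hτ).ballb.hv j).of_succ,
    OO.of fun τ hτ => (hS τ hτ).ds.hv j⟩
theorem D_p (hS : ∀ τ ∈ S, Inp2 α δ0 τ) : DO α S 2 (fun τ => τ.a.δ) (fun τ => τ.d) (fun τ => τ.a.p) (fun τ => τ.b.p) :=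
  ⟨OO.of fun τ hτ => ((hS τ hτ).ia.ball.hp).of_succ, OO.of fun τ hτ => ((hS τ hτ).ballb.hp).of_succ,
    OO.of fun τ hτ => (hS τ hτ).ds.hp⟩
theorem BA {k : ℕ} {F G : Par2 → (Fin 3 → ℝ) → ℝ} (hd : δ0 ≤ 1) (hS : ∀ τ ∈ S, Inp2 α δ0 τ)
    (h : DO α S k (fun τ => τ.a.δ) (fun τ => τ.d) F G) : DO α S k (fun τ => 1) (fun τ => τ.d) F G :=
  h.mono (fun τ hτ => (hS τ hτ).ia.d1 hd) fun _ _ => le_rfl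
theorem mAA {k : ℕ} {F G F' G' : Par2 → (Fin 3 → ℝ) → ℝ}
    (h : DO α S k (fun τ => 1) (fun τ => τ.d) F G) (h' : DO α S k (fun τ => 1) (fun τ => τ.d) F' G') :
    DO α S k (fun τ => 1) (fun τ => τ.d) (fun τ x => F τ x * F' τ x) (fun τ x => G τ x * G' τ x) :=
  h.mul (by simp) (by simp) (by simp) h'
theorem mAB {k : ℕ} {F G F' G' : Par2 → (Fin 3 → ℝ) → ℝ} (hd : δ0 ≤ 1) (hS : ∀ τ ∈ S, Inp2 α δ0 τ)
    (h : DO α S k (fun τ => 1) (fun τ => τ.d) F G) (h' : DO α S k (fun τ => τ.a.δ) (fun τ => τ.d) F' G') :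
    DO α S k (fun τ => τ.a.δ) (fun τ => τ.d) (fun τ x => F τ x * F' τ x) (fun τ x => G τ x * G' τ x) :=
  h.mul (by simp) (fun τ hτ => mul_le_of_le_one_right (hS τ hτ).d0 ((hS τ hτ).ia.d1 hd)) (by simp) h'
theorem mBB {k : ℕ} {F G F' G' : Par2 → (Fin 3 → ℝ) → ℝ} (hd : δ0 ≤ 1) (hS : ∀ τ ∈ S, Inp2 α δ0 τ)
    (h : DO α S k (fun τ => τ.a.δ) (fun τ => τ.d) F G) (h' : DO α S k (fun τ => τ.a.δ) (fun τ => τ.d) F' G') :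
    DO α S k (fun τ => τ.a.δ) (fun τ => τ.a.δ * τ.d) (fun τ x => F τ x * F' τ x) (fun τ x => G τ x * G' τ x) :=
  h.mul (fun τ hτ => mul_le_of_le_one_right (hS τ hτ).ia.d0 ((hS τ hτ).ia.d1 hd)) (fun τ hτ => le_of_eq (mul_comm _ _)) (fun _ _ => le_rfl) h'
theorem mAQ {k : ℕ} {F G F' G' : Par2 → (Fin 3 → ℝ) → ℝ}
    (h : DO α S k (fun τ => 1) (fun τ => τ.d) F G) (h' : DO α S k (fun τ => τ.a.δ) (fun τ => τ.a.δ * τ.d) F' G') :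
    DO α S k (fun τ => τ.a.δ) (fun τ => τ.a.δ * τ.d) (fun τ x => F τ x * F' τ x) (fun τ x => G τ x * G' τ x) :=
  h.mul (by simp) (fun τ hτ => le_of_eq (mul_comm _ _)) (by simp) h'
theorem cA {k : ℕ} {f : (Fin 3 → ℝ) → ℝ} {A : ℝ} (hS : ∀ τ ∈ S, Inp2 α δ0 τ) (hf : HH α k A f) :
    DO α S k (fun τ => 1) (fun τ => τ.d) (fun _ => f) (fun _ => f) := DO.fix hf fun τ hτ => (hS τ hτ).d0
theorem eA {k : ℕ} {F G : Par2 → (Fin 3 → ℝ) → ℝ} (hS : ∀ τ ∈ S, Inp2 α δ0 τ) (h : DO α S k (fun τ => 1) (fun τ => τ.d) F G) :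
    DO α S k (fun τ => τ.a.δ) (fun τ => τ.a.δ * τ.d) (fun τ x => τ.a.e * F τ x) (fun τ x => τ.a.e * G τ x) :=
  h.scal (fun τ hτ => by rw [abs_of_nonneg (hS τ hτ).ia.e0, mul_one]; exact (hS τ hτ).ed) (fun τ hτ => by
    rw [abs_of_nonneg (hS τ hτ).ia.e0]; exact mul_le_mul_of_nonneg_right (hS τ hτ).ed (hS τ hτ).d0)
theorem QB {k : ℕ} {F G : Par2 → (Fin 3 → ℝ) → ℝ} (hd : δ0 ≤ 1) (hS : ∀ τ ∈ S, Inp2 α δ0 τ)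
    (h : DO α S k (fun τ => τ.a.δ) (fun τ => τ.a.δ * τ.d) F G) : DO α S k (fun τ => τ.a.δ) (fun τ => τ.d) F G :=
  h.mono (fun _ _ => le_rfl) fun τ hτ => mul_le_of_le_one_left (hS τ hτ).d0 ((hS τ hτ).ia.d1 hd)

theorem D_uu (H : Bg α u M m) (hd : δ0 ≤ 1) (hS : ∀ τ ∈ S, Inp2 α δ0 τ) :
    DO α S 1 (fun _ => 1) (fun τ => τ.d) (fun τ => uu u τ.a.v) (fun τ => uu u τ.b.v) :=
  (cA hS (H.hh.lek (by norm_num))).add (BA hd hS (D_v hS 0))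

theorem D_rr (H : Bg α u M m) (hm : Sm α u m m0 δ0 N1) (hS : ∀ τ ∈ S, Inp2 α δ0 τ) :
    DO α S 1 (fun _ => 1) (fun τ => τ.d) (fun τ => rr u τ.a.v) (fun τ => rr u τ.b.v) := by
  have h1 : OO α S 1 (fun _ => 1) (fun τ => rr u τ.a.v) :=
    ⟨N1, hm.n1, fun τ hτ => by simpa using (hm.rh _ _ _ (hS τ hτ).ia.ball (hS τ hτ).ia.le).of_succ⟩
  have h2 : OO α S 1 (fun _ => 1) (fun τ => rr u τ.b.v) :=
    ⟨N1, hm.n1, fun τ hτ => by simpa using (hm.rh _ _ _ (hS τ hτ).ib.ball (hS τ hτ).ib.le).of_succ⟩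
  refine ⟨h1, h2, (OO.neg (OO.mul (s1 := fun _ => 1) (s2 := fun τ => τ.d) (by simp) h1
    (OO.mul (s1 := fun _ => 1) (s2 := fun τ => τ.d) (by simp) h2 (D_v hS 0).2.2))).congr fun τ hτ x hx => ?_⟩
  have l1 := hm.low _ _ _ (hS τ hτ).ia.ball (hS τ hτ).ia.le x hx
  have l2 := hm.low _ _ _ (hS τ hτ).ib.ball (hS τ hτ).ib.le x hx
  have h2 := H.pos
  have h3 : uu u τ.a.v x ≠ 0 := by linarith
  have h4 : uu u τ.b.v x ≠ 0 := by linarith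
  unfold rr
  field_simp
  unfold uu; ring

theorem D_rd (H : Bg α u M m) (hm : Sm α u m m0 δ0 N1) (hS : ∀ τ ∈ S, Inp2 α δ0 τ) :
    DO α S 1 (fun τ => τ.a.δ) (fun τ => τ.d) (fun τ x => rr u τ.a.v x - rcp u x) (fun τ x => rr u τ.b.v x - rcp u x) := by
  obtain ⟨A, _, hA⟩ := H.rHH
  refine (DO.neg (mAB hm.le1 hS (D_rr H hm hS) (mAB hm.le1 hS (cA hS (hA.lek (by norm_num))) (D_v hS 0)))).congr
    (fun τ hτ x hx => rr_sub H hm (hS τ hτ).ia.ball (hS τ hτ).ia.le hx) (fun τ hτ x hx => rr_sub H hm (hS τ hτ).ib.ball (hS τ hτ).ib.le hx)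

theorem D_bb (H : Bg α u M m) (hm : Sm α u m m0 δ0 N1) (hS : ∀ τ ∈ S, Inp2 α δ0 τ) (j : Fin 3) :
    DO α S 1 (fun _ => 1) (fun τ => τ.d) (fun τ => bb u τ.a.v j) (fun τ => bb u τ.b.v j) := by
  by_cases hj : j = 0
  · refine (cA hS (HH.const (c := 1) 1)).congr ?_ ?_ <;> exact fun τ hτ x hx => by simp [bb, hj]
  · refine (mAA (BA hm.le1 hS (D_v hS j)) (D_rr H hm hS)).congr ?_ ?_ <;> exact fun τ hτ x hx => by simp [bb, hj]

theorem D_FF (H : Bg α u M m) (hm : Sm α u m m0 δ0 N1) (hS : ∀ τ ∈ S, Inp2 α δ0 τ) :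
    DO α S 0 (fun τ => τ.a.δ) (fun τ => τ.a.δ * τ.d) (fun τ => FF u τ.a.p τ.a.v) (fun τ => FF u τ.b.p τ.b.v) := by
  have v1 := fun j => (D_v hS j).lek (by norm_num : 0 ≤ 1)
  have dv := fun i j => (D_v hS j).pd i
  have hQ : DO α S 0 (fun τ => τ.a.δ) (fun τ => τ.a.δ * τ.d) (fun τ => QQ τ.a.v) (fun τ => QQ τ.b.v) :=
    (((mBB hm.le1 hS (dv 0 0) (dv 0 0)).add (mBB hm.le1 hS (dv 1 1) (dv 1 1))).add (mBB hm.le1 hS (dv 2 2) (dv 2 2))).add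
      (DO.cmul 2 (((mBB hm.le1 hS (dv 1 0) (dv 0 1)).add (mBB hm.le1 hS (dv 2 0) (dv 0 2))).add (mBB hm.le1 hS (dv 1 2) (dv 2 1))))
  have hK : ∀ k, DO α S 0 (fun τ => τ.a.δ) (fun τ => τ.a.δ * τ.d) (fun τ => KK u τ.a.p τ.a.v k) (fun τ => KK u τ.b.p τ.b.v k) := fun k =>
    mAQ (cA hS ((H.hh.pd k).lek (by norm_num))) ((mBB hm.le1 hS ((D_rd H hm hS).lek (by norm_num)) (((D_p hS).pd k).lek (by norm_num))).add
      (mAQ ((D_rr H hm hS).lek (by norm_num)) ((mBB hm.le1 hS (v1 1) (dv 1 k)).add (mBB hm.le1 hS (v1 2) (dv 2 k)))))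
  exact (DO.cmul 2 ((hK 1).add (hK 2))).sub hQ

theorem D_hN (D : Dat α u M m N β Bn pe) (hd : δ0 ≤ 1) (hS : ∀ τ ∈ S, Inp2 α δ0 τ) :
    DO α S 1 (fun _ => 1) (fun τ => τ.d) (fun τ => hN u β τ.a.v) (fun τ => hN u β τ.b.v) :=
  mAA (mAA (D_uu D.bg hd hS) (D_uu D.bg hd hS))
    ((cA hS (((D.βh 1).pd 1).lek (by norm_num))).add (cA hS (((D.βh 2).pd 2).lek (by norm_num))))

theorem D_iT (D : Dat α u M m N β Bn pe) (hd : δ0 ≤ 1) (hS : ∀ τ ∈ S, Inp2 α δ0 τ) (k : Fin 3) :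
    DO α S 1 (fun τ => τ.a.δ) (fun τ => τ.a.δ * τ.d) (fun τ x => τ.a.e * (β k x * uu u τ.a.v x)) (fun τ x => τ.a.e * (β k x * uu u τ.b.v x)) :=
  eA hS (mAA (cA hS ((D.βh k).lek (by norm_num))) (D_uu D.bg hd hS))

theorem D_gT (H : Bg α u M m) (hm : Sm α u m m0 δ0 N1) (hS : ∀ τ ∈ S, Inp2 α δ0 τ)
    (hq : DO α S 2 (fun τ => τ.a.δ) (fun τ => τ.a.δ * τ.d) (fun τ => τ.a.q) (fun τ => τ.b.q)) (k : Fin 3) :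
    DO α S 1 (fun τ => τ.a.δ) (fun τ => τ.a.δ * τ.d) (fun τ => gT u τ.a.v τ.a.q k) (fun τ => gT u τ.b.v τ.b.q k) :=
  DO.neg (mAQ (D_rr H hm hS) (hq.pd k))

theorem D_gZ (H : Bg α u M m) (hm : Sm α u m m0 δ0 N1) (hS : ∀ τ ∈ S, Inp2 α δ0 τ)
    (hw : ∀ j, j ≠ 0 → DO α S 1 (fun τ => τ.a.δ) (fun τ => τ.a.δ * τ.d) (fun τ => τ.a.w j) (fun τ => τ.b.w j)) :
    DO α S 1 (fun τ => τ.a.δ) (fun τ => τ.a.δ * τ.d) (fun τ => gZ u τ.a.v τ.a.w) (fun τ => gZ u τ.b.v τ.b.w) := by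
  have h : ∀ j, j ≠ 0 → DO α S 1 (fun τ => τ.a.δ) (fun τ => τ.a.δ * τ.d) (fun τ x => τ.a.w j x * pdW j u x) (fun τ x => τ.b.w j x * pdW j u x) :=
    fun j hj => (mAQ (cA hS ((H.hh.pd j).lek (by norm_num))) (hw j hj)).congr (fun τ hτ x hx => mul_comm _ _) (fun τ hτ x hx => mul_comm _ _)
  exact DO.neg (mAQ (D_rr H hm hS) ((h 1 (by decide)).add (h 2 (by decide))))

theorem D_iZ (D : Dat α u M m N β Bn pe) (hd : δ0 ≤ 1) (hS : ∀ τ ∈ S, Inp2 α δ0 τ)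
    (hq : DO α S 2 (fun τ => τ.a.δ) (fun τ => τ.a.δ * τ.d) (fun τ => τ.a.q) (fun τ => τ.b.q)) :
    DO α S 1 (fun τ => τ.a.δ) (fun τ => τ.a.δ * τ.d) (fun τ => iZ u β τ.a.v Bn τ.a.q τ.a.e) (fun τ => iZ u β τ.b.v Bn τ.b.q τ.a.e) := by
  obtain ⟨A, _, hA⟩ := D.bg.rHH
  have hβ := fun k => cA hS ((D.βh k).lek (by norm_num : 1 ≤ 3))
  refine mAQ (cA hS (hA.lek (by norm_num))) ?_
  refine DO.sub (DO.sub (DO.sub (eA hS (cA hS (D.Bh.lek (by norm_num)))) (hq.lek (by norm_num)))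
    (DO.cmul _ (mBB hd hS (D_v hS 0) (D_v hS 0)))) (DO.cmul _ (eA hS (BA hd hS (QB hd hS (eA hS ?_)))))
  exact mAA (mAA (D_uu D.bg hd hS) (D_uu D.bg hd hS)) ((mAA (hβ 1) (hβ 1)).add (mAA (hβ 2) (hβ 2)))

theorem contraction (D : Dat α u M m N β Bn pe) (hm : Sm α u m m0 δ0 N1) {C0 : ℝ} (hC0 : 0 ≤ C0) (ht : TrC α 0 m0 C0) :
    ∃ C, 0 ≤ C ∧ ∀ e δ d p v q w p' v' q' w', 0 ≤ e → e ≤ 1 → δ ≤ δ0 → e ≤ δ → Ball α δ p v → Ball α δ p' v' → Ball α δ q w → Ball α δ q' w' →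
      Step u β Bn pe e p v q w → Step u β Bn pe e p' v' q' w' → Dst α d p v p' v' → Dst α (C * (δ * d)) q w q' w' := by
  have hu := D.bg.per
  have du := D.bg.hh.diff
  have dβ := fun j => (D.βh j).diff
  set S : Set Par2 := {τ | Inp2 α δ0 τ ∧ Step u β Bn pe τ.a.e τ.a.p τ.a.v τ.a.q τ.a.w ∧ Step u β Bn pe τ.a.e τ.b.p τ.b.v τ.b.q τ.b.w} with hSd
  have hS : ∀ τ ∈ S, Inp2 α δ0 τ := fun τ hτ => hτ.1
  have s0 : ∀ τ ∈ S, 0 ≤ τ.a.δ * τ.d := fun τ hτ => mul_nonneg (hS τ hτ).ia.d0 (hS τ hτ).d0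
  have oq : OO α S 2 (fun τ => τ.a.δ * τ.d) (fun τ x => τ.a.q x - τ.b.q x) := by
    refine OO.ell D.bg D.a0 D.a1 0 (by norm_num) s0 (f := fun τ x => FF u τ.a.p τ.a.v x - FF u τ.b.p τ.b.v x)
      (h := fun τ x => τ.a.e * hN u β τ.a.v x - τ.a.e * hN u β τ.b.v x)
      (e := fun τ x => 0) (fun τ hτ => ⟨_, ((hS τ hτ).qa.hp.sub (hS τ hτ).qb.hp).of_succ⟩) (D_FF D.bg hm hS).2.2
      (eA hS (D_hN D hm.le1 hS)).2.2 (OO.zero s0) (fun τ hτ => (hS τ hτ).qa.pp.sub (hS τ hτ).qb.pp) (fun τ hτ => ?_) (fun τ hτ => ?_)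
      (fun τ hτ => PerS.const 0) (fun τ hτ x hx => pdW_const 0 hx 0)
      (fun τ hτ x hx => ?_) (fun τ hτ x hx h0 => ?_) (fun τ hτ x hx h0 => ?_)
    · have hb := (hS τ hτ).ia.ball
      have hb' := (hS τ hτ).ib.ball
      exact (FF_per hu du hb.pp hb.hp.diff hb.pv (fun j => (hb.hv j).diff)).sub (FF_per hu du hb'.pp hb'.hp.diff hb'.pv (fun j => (hb'.hv j).diff))
    · exact ((hN_per hu (hS τ hτ).ia.ball.pv D.βp dβ).cmul _).sub ((hN_per hu (hS τ hτ).ib.ball.pv D.βp dβ).cmul _)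
    · rw [Bg.Lop_sub (hS τ hτ).qa.hp.of_succ (hS τ hτ).qb.hp.of_succ hx, hτ.2.1.ell x hx, hτ.2.2.ell x hx]
    · rw [pdW_sub (hS τ hτ).qa.hp.diff (hS τ hτ).qb.hp.diff hx, hτ.2.1.neu x hx h0, hτ.2.2.neu x hx h0]
    · rw [hτ.2.1.dir x hx h0, hτ.2.2.dir x hx h0, sub_self]
  have dq : DO α S 2 (fun τ => τ.a.δ) (fun τ => τ.a.δ * τ.d) (fun τ => τ.a.q) (fun τ => τ.b.q) :=
    ⟨OO.of fun τ hτ => (hS τ hτ).qa.hp.of_succ, OO.of fun τ hτ => (hS τ hτ).qb.hp.of_succ, oq⟩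
  have vf : ∀ τ ∈ S, Vf α 1 m0 (bb u τ.a.v) := fun τ hτ => (hm.vf _ _ _ (hS τ hτ).ia.ball (hS τ hτ).ia.le).lek (by norm_num)
  have vp : ∀ τ ∈ S, ∀ j, PerS (bb u τ.a.v j) := fun τ hτ => bb_per hu (hS τ hτ).ia.ball.pv
  have vp' : ∀ τ ∈ S, ∀ j, PerS (bb u τ.b.v j) := fun τ hτ => bb_per hu (hS τ hτ).ib.ball.pv
  -- generic transport difference
  have gen : ∀ (j : Fin 3) (g g' i i' : Par2 → (Fin 3 → ℝ) → ℝ), DO α S 1 (fun τ => τ.a.δ) (fun τ => τ.a.δ * τ.d) g g' →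
      DO α S 1 (fun τ => τ.a.δ) (fun τ => τ.a.δ * τ.d) i i' → (∀ τ ∈ S, PerS (g τ)) → (∀ τ ∈ S, PerS (g' τ)) →
      (∀ τ ∈ S, PerS (i τ)) → (∀ τ ∈ S, PerS (i' τ)) →
      (∀ τ ∈ S, ∀ x ∈ Slab, Tr (bb u τ.a.v) (τ.a.w j) x = g τ x) → (∀ τ ∈ S, ∀ x ∈ Slab, Tr (bb u τ.b.v) (τ.b.w j) x = g' τ x) →
      (∀ τ ∈ S, ∀ x ∈ Slab, x 0 = 0 → τ.a.w j x = i τ x) → (∀ τ ∈ S, ∀ x ∈ Slab, x 0 = 0 → τ.b.w j x = i' τ x) →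
      DO α S 1 (fun τ => τ.a.δ) (fun τ => τ.a.δ * τ.d) (fun τ => τ.a.w j) (fun τ => τ.b.w j) := by
    intro j g g' i i' hg hi pg pg' pi pi' t t' z z'
    have wa : OO α S 1 (fun τ => τ.a.δ) (fun τ => τ.a.w j) := OO.of fun τ hτ => ((hS τ hτ).qa.hv j).of_succ
    have wb : OO α S 2 (fun τ => τ.a.δ) (fun τ => τ.b.w j) := OO.of fun τ hτ => (hS τ hτ).qb.hv j
    refine ⟨wa, wb.lek (by norm_num), ?_⟩
    have c : ∀ l, OO α S 1 (fun τ => τ.a.δ * τ.d) (fun τ x => (bb u τ.a.v l x - bb u τ.b.v l x) * pdW l (τ.b.w j) x) := fun l =>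
      OO.mul (fun τ hτ => le_of_eq (mul_comm _ _)) (D_bb D.bg hm hS l).2.2 (wb.pd l)
    have pc : ∀ τ ∈ S, ∀ l, PerS (fun x => (bb u τ.a.v l x - bb u τ.b.v l x) * pdW l (τ.b.w j) x) := fun τ hτ l =>
      ((vp τ hτ l).sub (vp' τ hτ l)).mul (((hS τ hτ).qb.pv j).pd ((hS τ hτ).qb.hv j).diff l)
    refine OO.trans s0 hC0 ht vf vp (fun τ hτ => ((hS τ hτ).qa.hv j).diff.sub ((hS τ hτ).qb.hv j).diff)
      (hg.2.2.sub (((c 0).add (c 1)).add (c 2))) hi.2.2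
      (fun τ hτ => ((pg τ hτ).sub (pg' τ hτ)).sub (((pc τ hτ 0).add (pc τ hτ 1)).add (pc τ hτ 2)))
      (fun τ hτ => (pi τ hτ).sub (pi' τ hτ)) (fun τ hτ x hx => ?_) (fun τ hτ x hx h0 => ?_)
    · rw [Tr_sub ((hS τ hτ).qa.hv j).diff ((hS τ hτ).qb.hv j).diff hx, t τ hτ x hx, ← t' τ hτ x hx]
      unfold Tr
      simp only [Fin.sum_univ_three]
      ring
    · dsimp only
      rw [z τ hτ x hx h0, z' τ hτ x hx h0]
  have dw : ∀ k, k ≠ 0 → DO α S 1 (fun τ => τ.a.δ) (fun τ => τ.a.δ * τ.d) (fun τ => τ.a.w k) (fun τ => τ.b.w k) := fun k hk =>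
    gen k _ _ _ _ (D_gT D.bg hm hS dq k) (D_iT D hm.le1 hS k)
      (fun τ hτ => gT_per hu (hS τ hτ).ia.ball.pv (hS τ hτ).qa.pp (hS τ hτ).qa.hp.diff k)
      (fun τ hτ => gT_per hu (hS τ hτ).ib.ball.pv (hS τ hτ).qb.pp (hS τ hτ).qb.hp.diff k)
      (fun τ hτ => PerS.cmul _ ((D.βp k).mul (uu_per hu (hS τ hτ).ia.ball.pv)))
      (fun τ hτ => PerS.cmul _ ((D.βp k).mul (uu_per hu (hS τ hτ).ib.ball.pv)))
      (fun τ hτ => hτ.2.1.tr k hk) (fun τ hτ => hτ.2.2.tr k hk) (fun τ hτ => hτ.2.1.inl k hk) (fun τ hτ => hτ.2.2.inl k hk)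
  have dw0 : DO α S 1 (fun τ => τ.a.δ) (fun τ => τ.a.δ * τ.d) (fun τ => τ.a.w 0) (fun τ => τ.b.w 0) :=
    gen 0 _ _ _ _ ((D_gT D.bg hm hS dq 0).add (D_gZ D.bg hm hS dw)) (D_iZ D hm.le1 hS dq)
      (fun τ hτ => (gT_per hu (hS τ hτ).ia.ball.pv (hS τ hτ).qa.pp (hS τ hτ).qa.hp.diff 0).add
        (gZ_per hu du (hS τ hτ).ia.ball.pv fun j _ => (hS τ hτ).qa.pv j))
      (fun τ hτ => (gT_per hu (hS τ hτ).ib.ball.pv (hS τ hτ).qb.pp (hS τ hτ).qb.hp.diff 0).add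
        (gZ_per hu du (hS τ hτ).ib.ball.pv fun j _ => (hS τ hτ).qb.pv j))
      (fun τ hτ => iZ_per hu (hS τ hτ).ia.ball.pv D.βp D.Bp (hS τ hτ).qa.pp _)
      (fun τ hτ => iZ_per hu (hS τ hτ).ib.ball.pv D.βp D.Bp (hS τ hτ).qb.pp _)
      (fun τ hτ => hτ.2.1.tr0) (fun τ hτ => hτ.2.2.tr0) (fun τ hτ => hτ.2.1.inl0) (fun τ hτ => hτ.2.2.inl0)
  obtain ⟨K1, k1, g1⟩ := OO.common s0 oq dw0.2.2
  obtain ⟨K2, k2, g2⟩ := OO.common s0 (dw 1 (by decide)).2.2 (dw 2 (by decide)).2.2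
  refine ⟨K1 + K2, by positivity, fun e δ d p v q w p' v' q' w' he0 he1 hδ hed b1 b2 b3 b4 st1 st2 hd => ?_⟩
  have hτ : (⟨⟨e, δ, p, v, q, w⟩, ⟨e, δ, p', v', q', w'⟩, d⟩ : Par2) ∈ S :=
    ⟨⟨⟨he0, he1, hδ, b1⟩, ⟨he0, he1, hδ, b2⟩, rfl, rfl, hed, b3, b4, hd⟩, st1, st2⟩
  have t0 := s0 _ hτ
  have t1 := g1 _ hτ
  have t2 := g2 _ hτ
  dsimp only at t0 t1 t2
  have l1 : K1 * (δ * d) ≤ (K1 + K2) * (δ * d) := by nlinarith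
  have l2 : K2 * (δ * d) ≤ (K1 + K2) * (δ * d) := by nlinarith
  refine ⟨t1.1.mono l1, fun j => ?_⟩
  fin_cases j
  exacts [t1.2.mono l1, t2.1.mono l2, t2.2.mono l2]
end
end Inc

set_option linter.unusedVariables false
set_option linter.unusedSimpArgs false
open Set Filter Topology MeasureTheory
namespace Inc
variable {α : ℝ}

theorem Step.congr {u Bn pe : (Fin 3 → ℝ) → ℝ} {β : Fin 3 → (Fin 3 → ℝ) → ℝ} {e : ℝ} {p q q' : (Fin 3 → ℝ) → ℝ}
    {v w w' : Fin 3 → (Fin 3 → ℝ) → ℝ} (h : Step u β Bn pe e p v q w) (hq : EqOn q q' Slab) (hw : ∀ j, EqOn (w j) (w' j) Slab) :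
    Step u β Bn pe e p v q' w' := by
  have c1 : ∀ i, EqOn (pdW i q) (pdW i q') Slab := fun i x hx => pdW_congr hq hx i
  have c2 : ∀ i j, EqOn (pdW i (pdW j q)) (pdW i (pdW j q')) Slab := fun i j x hx => pdW_congr (c1 j) hx i
  have c3 : ∀ i j, EqOn (pdW i (w j)) (pdW i (w' j)) Slab := fun i j x hx => pdW_congr (hw j) hx i
  refine ⟨fun x hx => ?_, fun x hx h0 => ?_, fun x hx h0 => ?_, fun k hk x hx => ?_, fun k hk x hx h0 => ?_, fun x hx => ?_, fun x hx h0 => ?_⟩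
  · rw [← h.ell x hx]
    simp only [Lop, Lap, ← c1 _ hx, ← c2 _ _ hx]
  · rw [← h.neu x hx h0, c1 0 hx]
  · rw [← h.dir x hx h0, hq hx]
  · have := h.tr k hk x hx
    simpa only [Tr, gT, c1 _ hx, c3 _ _ hx] using this
  · rw [← h.inl k hk x hx h0, hw k hx]
  · have := h.tr0 x hx
    simpa only [Tr, gT, gZ, c1 _ hx, c3 _ _ hx, hw _ hx] using this
  · rw [← hw 0 hx, h.inl0 x hx h0]
    simp only [iZ, hq hx]

theorem Ball.dst {δ : ℝ} {p p' : (Fin 3 → ℝ) → ℝ} {v v' : Fin 3 → (Fin 3 → ℝ) → ℝ} (h : Ball α δ p v) (h' : Ball α δ p' v') :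
    Dst α (2 * δ) p v p' v' :=
  ⟨by rw [two_mul]; exact h.hp.of_succ.sub h'.hp.of_succ, fun j => by rw [two_mul]; exact (h.hv j).of_succ.sub (h'.hv j).of_succ⟩

theorem Dst.eq_of {c : ℕ → ℝ} {p p' : (Fin 3 → ℝ) → ℝ} {v v' : Fin 3 → (Fin 3 → ℝ) → ℝ} (h : ∀ n, Dst α (c n) p v p' v')
    (hc : Tendsto c atTop (𝓝 0)) : EqOn p p' Slab ∧ ∀ j, EqOn (v j) (v' j) Slab := by
  have key : ∀ a : ℝ, (∀ n, |a| ≤ c n) → a = 0 := fun a ha => by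
    have := ge_of_tendsto' hc ha
    exact abs_eq_zero.1 (le_antisymm this (abs_nonneg _))
  exact ⟨fun x hx => sub_eq_zero.1 (key _ fun n => (h n).hp.bd hx), fun j x hx => sub_eq_zero.1 (key _ fun n => ((h n).hv j).bd hx)⟩

theorem geo (δ : ℝ) : Tendsto (fun n : ℕ => 2 * δ * (1 / 2) ^ n) atTop (𝓝 0) := by
  have := (tendsto_pow_atTop_nhds_zero_of_lt_one (r := (1/2 : ℝ)) (by norm_num) (by norm_num)).const_mul (2 * δ)
  simpa using this

abbrev Sta := ((Fin 3 → ℝ) → ℝ) × (Fin 3 → (Fin 3 → ℝ) → ℝ)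

theorem fixed_unique {δ : ℝ} {R : Sta → Sta → Prop}
    (con : ∀ d (a b a' b' : Sta), Ball α δ a.1 a.2 → Ball α δ a'.1 a'.2 → Ball α δ b.1 b.2 → Ball α δ b'.1 b'.2 → R a b → R a' b' →
      Dst α d a.1 a.2 a'.1 a'.2 → Dst α (d / 2) b.1 b.2 b'.1 b'.2)
    {a b : Sta} (ha : Ball α δ a.1 a.2) (hb : Ball α δ b.1 b.2) (ra : R a a) (rb : R b b) :
    EqOn a.1 b.1 Slab ∧ ∀ j, EqOn (a.2 j) (b.2 j) Slab := by
  refine Dst.eq_of (α := α) (c := fun n : ℕ => 2 * δ * (1 / 2) ^ n) (fun n => ?_) (geo δ)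
  induction n with
  | zero => simpa using ha.dst hb
  | succ n ih =>
    have := con _ _ _ _ _ ha hb ha hb ra rb ih
    convert this using 1
    rw [pow_succ]; ring

theorem fixed_exists (hα : 0 < α) {δ : ℝ} (hδ : 0 ≤ δ) {R : Sta → Sta → Prop}
    (ex : ∀ a : Sta, Ball α δ a.1 a.2 → ∃ b : Sta, Ball α δ b.1 b.2 ∧ R a b)
    (con : ∀ d (a b a' b' : Sta), Ball α δ a.1 a.2 → Ball α δ a'.1 a'.2 → Ball α δ b.1 b.2 → Ball α δ b'.1 b'.2 → R a b → R a' b' →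
      Dst α d a.1 a.2 a'.1 a'.2 → Dst α (d / 2) b.1 b.2 b'.1 b'.2)
    (cg : ∀ a b b' : Sta, R a b → EqOn b.1 b'.1 Slab → (∀ j, EqOn (b.2 j) (b'.2 j) Slab) → R a b') :
    ∃ a : Sta, Ball α δ a.1 a.2 ∧ R a a := by
  choose! F hF hR using ex
  have z : ∀ k, HH α k δ (fun _ => (0:ℝ)) := fun k => (HH.const (c := 0) k).mono (by simpa using hδ)
  let Z : ℕ → Sta := fun n => F^[n] (fun _ => 0, fun _ _ => 0)
  have Zs : ∀ n, Z (n + 1) = F (Z n) := fun n => Function.iterate_succ_apply' F n _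
  have ZB : ∀ n, Ball α δ (Z n).1 (Z n).2 := by
    intro n
    induction n with
    | zero => exact ⟨z 3, fun j => z 2, PerS.const 0, fun j => PerS.const 0⟩
    | succ n ih => rw [Zs]; exact hF _ ih
  have ZR : ∀ n, R (Z n) (Z (n + 1)) := fun n => by rw [Zs]; exact hR _ (ZB n)
  have ZD : ∀ n k, Dst α (2 * δ * (1 / 2) ^ n) (Z n).1 (Z n).2 (Z (n + k)).1 (Z (n + k)).2 := by
    intro n k
    induction n with
    | zero => simpa using (ZB 0).dst (ZB (0 + k))
    | succ n ih =>
      have := con _ _ _ _ _ (ZB n) (ZB (n + k)) (ZB (n + 1)) (ZB (n + k + 1)) (ZR n) (ZR (n + k)) ih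
      rw [show n + 1 + k = n + k + 1 by ring]
      convert this using 1
      rw [pow_succ]; ring
  have lim : ∀ f : ℕ → ℝ, (∀ n k, |f n - f (n + k)| ≤ 2 * δ * (1 / 2) ^ n) → ∃ L, Tendsto f atTop (𝓝 L) := fun f hf => by
    refine cauchySeq_tendsto_of_complete (cauchySeq_of_le_tendsto_0' _ (fun n m hnm => ?_) (geo δ))
    obtain ⟨k, rfl⟩ := Nat.exists_eq_add_of_le hnm
    exact hf n k
  have lp : ∀ x, x ∈ Slab → ∃ L, Tendsto (fun n => (Z n).1 x) atTop (𝓝 L) := fun x hx => lim _ fun n k => (ZD n k).hp.bd hx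
  have lv : ∀ j x, x ∈ Slab → ∃ L, Tendsto (fun n => (Z n).2 j x) atTop (𝓝 L) := fun j x hx => lim _ fun n k => ((ZD n k).hv j).bd hx
  choose! P hP using lp
  choose! V hV using lv
  have per : ∀ (f : ℕ → (Fin 3 → ℝ) → ℝ) (g : (Fin 3 → ℝ) → ℝ), (∀ n, PerS (f n)) → (∀ x ∈ Slab, Tendsto (fun n => f n x) atTop (𝓝 (g x))) → PerS g := by
    intro f g hf hg x hx
    have aux : ∀ i : Fin 3, i ≠ 0 → (x + (Pi.single i 2 : Fin 3 → ℝ)) ∈ Slab := fun i hi => by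
      simpa [Slab, Pi.single_apply, hi.symm] using hx
    refine ⟨tendsto_nhds_unique ((hg _ (aux 1 (by decide))).congr fun n => (hf n x hx).1) (hg x hx),
      tendsto_nhds_unique ((hg _ (aux 2 (by decide))).congr fun n => (hf n x hx).2) (hg x hx)⟩
  have B : Ball α δ P V := ⟨HH.lim hα (Eventually.of_forall fun n => (ZB n).hp) hP,
    fun j => HH.lim hα (Eventually.of_forall fun n => (ZB n).hv j) (hV j), per _ _ (fun n => (ZB n).pp) hP,
    fun j => per _ _ (fun n => (ZB n).pv j) (hV j)⟩
  have D : ∀ n, Dst α (2 * δ * (1 / 2) ^ n) (Z n).1 (Z n).2 P V := fun n =>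
    ⟨HH.lim (l := atTop) hα (F := fun k x => (Z n).1 x - (Z (n + k)).1 x) (Eventually.of_forall fun k => (ZD n k).hp)
      fun x hx => tendsto_const_nhds.sub (((tendsto_add_atTop_iff_nat n).2 (hP x hx)).congr fun k => by rw [add_comm]),
     fun j => HH.lim (l := atTop) hα (F := fun k x => (Z n).2 j x - (Z (n + k)).2 j x) (Eventually.of_forall fun k => (ZD n k).hv j)
      fun x hx => tendsto_const_nhds.sub (((tendsto_add_atTop_iff_nat n).2 (hV j x hx)).congr fun k => by rw [add_comm])⟩
  have B' := hF (P, V) B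
  have D' : ∀ n, Dst α (2 * δ * (1 / 2) ^ n / 2) (Z (n + 1)).1 (Z (n + 1)).2 (F (P, V)).1 (F (P, V)).2 := fun n =>
    con _ (Z n) _ (P, V) _ (ZB n) B (ZB (n + 1)) B' (ZR n) (hR _ B) (D n)
  have E : EqOn (F (P, V)).1 P Slab ∧ ∀ j, EqOn ((F (P, V)).2 j) (V j) Slab := by
    refine Dst.eq_of (α := α) (c := fun n : ℕ => 2 * δ * (1 / 2) ^ (n + 1) + 2 * δ * (1 / 2) ^ n / 2) (fun n => ⟨?_, fun j => ?_⟩) ?_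
    · exact ((D (n + 1)).hp.sub (D' n).hp).congr fun x hx => by ring
    · exact (((D (n + 1)).hv j).sub ((D' n).hv j)).congr fun x hx => by ring
    · simpa using ((tendsto_add_atTop_iff_nat 1).2 (geo δ)).add ((geo δ).div_const 2)
  exact ⟨(P, V), B, cg _ _ _ (hR _ B) E.1 E.2⟩

variable {u Bn pe : (Fin 3 → ℝ) → ℝ} {β : Fin 3 → (Fin 3 → ℝ) → ℝ} {M m N : ℝ}

/-- Small data: existence of a fixed point of size `K * e`, uniqueness in every ball of size `K' * e`. -/
theorem fixed_main (D : Dat α u M m N β Bn pe) :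
    ∃ K, 0 < K ∧ ∀ K', K ≤ K' → ∃ e0, 0 < e0 ∧ (∀ e p v, 0 < e → e < e0 → Ball α (K' * e) p v → (∀ x ∈ Slab, m / 2 ≤ uu u v x) ∧
        ∀ w, DifferentiableOn ℝ w Slab → (∀ x ∈ Slab, Tr (bb u v) w x = 0) → (∀ x ∈ Slab, x 0 = 0 → w x = 0) → ∀ x ∈ Slab, w x = 0) ∧
      ∀ e, 0 < e → e < e0 →
      (∃ p v, Ball α (K * e) p v ∧ Step u β Bn pe e p v p v) ∧
      ∀ p v p' v', Ball α (K' * e) p v → Ball α (K' * e) p' v' → Step u β Bn pe e p v p v → Step u β Bn pe e p' v' p' v' →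
        EqOn p p' Slab ∧ ∀ j, EqOn (v j) (v' j) Slab := by
  obtain ⟨m0, hm0, C0, C1, hC0, hC1, t0, t1⟩ := trc D.a0 D.a1
  obtain ⟨δ0, N1, hm⟩ := exists_Sm D.bg hm0
  obtain ⟨A, hA, hA'⟩ := step_bound D hm hC1 t1
  obtain ⟨C, hC, hC'⟩ := contraction D hm hC0 t0
  have hd := hm.pos
  refine ⟨2 * A + 1, by positivity, fun K' hK => ?_⟩
  have hK0 : 0 < K' := by linarith
  have hK1 : 1 ≤ K' := by linarith
  let T := 1 + K' + δ0⁻¹ * K' + 2 * C * K' + 2 * A * K' * K'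
  have hT : 1 ≤ T := by
    have : 0 ≤ K' + δ0⁻¹ * K' + 2 * C * K' + 2 * A * K' * K' := by positivity
    simp only [T]; linarith
  have cons : ∀ e, 0 < e → e < T⁻¹ → e ≤ 1 ∧ K' * e ≤ δ0 ∧ C * (K' * e) ≤ 1 / 2 ∧ A * (K' * e) * K' ≤ 1 / 2 := by
    intro e he h
    have h1 : e * T ≤ 1 := by
      have := mul_le_mul_of_nonneg_right h.le (by linarith : 0 ≤ T)
      rwa [inv_mul_cancel₀ (by linarith)] at this
    have p1 : 0 ≤ e * K' := by positivity
    have p2 : 0 ≤ e * (δ0⁻¹ * K') := by positivity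
    have p3 : 0 ≤ e * (2 * C * K') := by positivity
    have p4 : 0 ≤ e * (2 * A * K' * K') := by positivity
    have h2 : e + e * K' + e * (δ0⁻¹ * K') + e * (2 * C * K') + e * (2 * A * K' * K') ≤ 1 := by
      simp only [T] at h1; linarith
    refine ⟨by linarith, ?_, by linarith, by linarith⟩
    have h3 : δ0⁻¹ * (K' * e) ≤ 1 := by linarith
    have := mul_le_mul_of_nonneg_left h3 hd.le
    rwa [← mul_assoc, mul_inv_cancel₀ hd.ne', one_mul, mul_one] at this
  have con : ∀ e k, 0 < e → e < T⁻¹ → 1 ≤ k → k ≤ K' → ∀ d (a b a' b' : Sta), Ball α (k * e) a.1 a.2 → Ball α (k * e) a'.1 a'.2 →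
      Ball α (k * e) b.1 b.2 → Ball α (k * e) b'.1 b'.2 → Step u β Bn pe e a.1 a.2 b.1 b.2 → Step u β Bn pe e a'.1 a'.2 b'.1 b'.2 →
      Dst α d a.1 a.2 a'.1 a'.2 → Dst α (d / 2) b.1 b.2 b'.1 b'.2 := by
    intro e k he h hk hk' d a b a' b' ha ha' hb hb' s s' hD
    obtain ⟨c1, c2, c3, c4⟩ := cons e he h
    have hke : k * e ≤ K' * e := mul_le_mul_of_nonneg_right hk' he.le
    have := hC' e (k * e) d _ _ _ _ _ _ _ _ he.le c1 (by linarith) (by nlinarith) ha ha' hb hb' s s' hD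
    have d0 : 0 ≤ d := hD.hp.nonneg
    have hCk : C * (k * e) ≤ 1 / 2 := le_trans (mul_le_mul_of_nonneg_left hke hC) c3
    have hh : C * (k * e * d) ≤ d / 2 := by nlinarith
    exact ⟨this.hp.mono hh, fun j => (this.hv j).mono hh⟩
  refine ⟨T⁻¹, by positivity, fun e p v he h hb => ⟨hm.low _ _ _ hb (cons e he h).2.1, (t1 _ (hm.vf _ _ _ hb (cons e he h).2.1) (bb_per D.bg.per hb.pv)).1⟩, fun e he h => ⟨?_, ?_⟩⟩
  · obtain ⟨c1, c2, c3, c4⟩ := cons e he h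
    have hke : (2 * A + 1) * e ≤ K' * e := mul_le_mul_of_nonneg_right hK he.le
    obtain ⟨a, ha, sa⟩ := fixed_exists (α := α) D.a0 (δ := (2 * A + 1) * e) (by positivity)
      (R := fun a b => Step u β Bn pe e a.1 a.2 b.1 b.2)
      (fun a ha => by
        obtain ⟨q, w, B, hB, hs⟩ := step_exists D hm t1 he.le c1 (by linarith) ha
        refine ⟨(q, w), ?_, hs⟩
        refine (hA' e _ _ _ _ _ _ he.le c1 (by linarith) ha hB hs).mono ?_
        have : A * ((2 * A + 1) * e * ((2 * A + 1) * e)) ≤ (A * (K' * e) * K') * e := by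
          have : (2 * A + 1) * e * ((2 * A + 1) * e) ≤ K' * e * (K' * e) := by gcongr
          calc _ ≤ A * (K' * e * (K' * e)) := by gcongr
            _ = _ := by ring
        nlinarith)
      (con e _ he h (by linarith) hK) (fun a b b' s h1 h2 => s.congr h1 h2)
    exact ⟨a.1, a.2, ha, sa⟩
  · intro p v p' v' hb hb' s s'
    exact fixed_unique (α := α) (R := fun a b => Step u β Bn pe e a.1 a.2 b.1 b.2) (con e K' he h hK1 le_rfl)
      (a := (p, v)) (b := (p', v')) hb hb' s s'
end Inc

set_option linter.unusedVariables false
set_option linter.unusedSimpArgs false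
open Set Filter Topology MeasureTheory
namespace Inc
variable {α : ℝ}

theorem diff_add {f g : (Fin 3 → ℝ) → ℝ} (hf : DifferentiableOn ℝ f Slab) (hg : DifferentiableOn ℝ g Slab) :
    DifferentiableOn ℝ (fun x => f x + g x) Slab := hf.add hg

theorem div_mom {W : Fin 3 → (Fin 3 → ℝ) → ℝ} {p : (Fin 3 → ℝ) → ℝ} {A : ℝ} (hW : ∀ j, HH α 2 A (W j)) (hp : HH α 2 A p)
    (hm : ∀ i, ∀ x ∈ Slab, W 0 x * pdW 0 (W i) x + W 1 x * pdW 1 (W i) x + W 2 x * pdW 2 (W i) x + pdW i p x = 0)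
    {x : Fin 3 → ℝ} (hx : x ∈ Slab) :
    W 0 x * pdW 0 (fun y => pdW 0 (W 0) y + pdW 1 (W 1) y + pdW 2 (W 2) y) x
      + W 1 x * pdW 1 (fun y => pdW 0 (W 0) y + pdW 1 (W 1) y + pdW 2 (W 2) y) x
      + W 2 x * pdW 2 (fun y => pdW 0 (W 0) y + pdW 1 (W 1) y + pdW 2 (W 2) y) x
      + (pdW 0 (W 0) x * pdW 0 (W 0) x + pdW 1 (W 1) x * pdW 1 (W 1) x + pdW 2 (W 2) x * pdW 2 (W 2) x
        + 2 * (pdW 1 (W 0) x * pdW 0 (W 1) x + pdW 2 (W 0) x * pdW 0 (W 2) x + pdW 1 (W 2) x * pdW 2 (W 1) x))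
      + (pdW 0 (pdW 0 p) x + pdW 1 (pdW 1 p) x + pdW 2 (pdW 2 p) x) = 0 := by
  have d : ∀ j, DifferentiableOn ℝ (W j) Slab := fun j => (hW j).diff
  have dd : ∀ i j, DifferentiableOn ℝ (pdW i (W j)) Slab := fun i j => ((hW j).pd i).diff
  have dm : ∀ k i j, DifferentiableOn ℝ (fun x => W k x * pdW i (W j) x) Slab := fun k i j => (d k).mul (dd i j)
  have e : ∀ i, pdW i (fun x => W 0 x * pdW 0 (W i) x + W 1 x * pdW 1 (W i) x + W 2 x * pdW 2 (W i) x + pdW i p x) x = 0 := fun i => by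
    rw [pdW_congr (g := fun _ => 0) (fun y hy => hm i y hy) hx, pdW_const 0 hx]
  have f : ∀ i, (pdW i (W 0) x * pdW 0 (W i) x + W 0 x * pdW i (pdW 0 (W i)) x)
      + (pdW i (W 1) x * pdW 1 (W i) x + W 1 x * pdW i (pdW 1 (W i)) x)
      + (pdW i (W 2) x * pdW 2 (W i) x + W 2 x * pdW i (pdW 2 (W i)) x) + pdW i (pdW i p) x = 0 := fun i => by
    have := e i
    rwa [pdW_add (diff_add (diff_add (dm _ _ _) (dm _ _ _)) (dm _ _ _)) (hp.pd i).diff hx, pdW_add (diff_add (dm _ _ _) (dm _ _ _)) (dm _ _ _) hx,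
      pdW_add (dm _ _ _) (dm _ _ _) hx, pdW_mul (d 0) (dd _ _) hx, pdW_mul (d 1) (dd _ _) hx, pdW_mul (d 2) (dd _ _) hx] at this
  have g : ∀ i, pdW i (fun y => pdW 0 (W 0) y + pdW 1 (W 1) y + pdW 2 (W 2) y) x
      = pdW i (pdW 0 (W 0)) x + pdW i (pdW 1 (W 1)) x + pdW i (pdW 2 (W 2)) x := fun i => by
    rw [pdW_add (diff_add (dd _ _) (dd _ _)) (dd _ _) hx, pdW_add (dd _ _) (dd _ _) hx]
  have s := fun i j k => pdW_symm (hW k) i j hx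
  rw [g, g, g]
  have f0 := f 0
  have f1 := f 1
  have f2 := f 2
  rw [s 0 1 0, s 0 2 0] at f0
  rw [s 1 0 1, s 1 2 1] at f1
  rw [s 2 0 2, s 2 1 2] at f2
  linear_combination f0 + f1 + f2

/-- the Euler system for perturbations -/
structure Eul (u : (Fin 3 → ℝ) → ℝ) (β : Fin 3 → (Fin 3 → ℝ) → ℝ) (Bn pe : (Fin 3 → ℝ) → ℝ) (e : ℝ)
    (p : (Fin 3 → ℝ) → ℝ) (v : Fin 3 → (Fin 3 → ℝ) → ℝ) : Prop where
  dv : ∀ x ∈ Slab, pdW 0 (v 0) x + pdW 1 (v 1) x + pdW 2 (v 2) x = 0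
  m0 : ∀ x ∈ Slab, uu u v x * pdW 0 (v 0) x + v 1 x * (pdW 1 u x + pdW 1 (v 0) x) + v 2 x * (pdW 2 u x + pdW 2 (v 0) x) + pdW 0 p x = 0
  mt : ∀ k, k ≠ 0 → ∀ x ∈ Slab, uu u v x * pdW 0 (v k) x + v 1 x * pdW 1 (v k) x + v 2 x * pdW 2 (v k) x + pdW k p x = 0
  inl : ∀ k, k ≠ 0 → ∀ x ∈ Slab, x 0 = 0 → v k x = e * (β k x * uu u v x)
  ber : ∀ x ∈ Slab, x 0 = 0 → (uu u v x ^ 2 + v 1 x ^ 2 + v 2 x ^ 2) / 2 + p x = u x ^ 2 / 2 + e * Bn x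
  dir : ∀ x ∈ Slab, x 0 = 1 → p x = e * pe x

variable {u Bn pe p : (Fin 3 → ℝ) → ℝ} {β v : Fin 3 → (Fin 3 → ℝ) → ℝ} {M m N A e : ℝ}

theorem ell_id (D : Dat α u M m N β Bn pe) (hb : Ball α A p v) (hpos : ∀ x ∈ Slab, 0 < uu u v x)
    (h0 : ∀ x ∈ Slab, uu u v x * pdW 0 (v 0) x + v 1 x * (pdW 1 u x + pdW 1 (v 0) x) + v 2 x * (pdW 2 u x + pdW 2 (v 0) x) + pdW 0 p x = 0)
    (hk : ∀ k, k ≠ 0 → ∀ x ∈ Slab, uu u v x * pdW 0 (v k) x + v 1 x * pdW 1 (v k) x + v 2 x * pdW 2 (v k) x + pdW k p x = 0)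
    {x : Fin 3 → ℝ} (hx : x ∈ Slab) :
    uu u v x * Tr (bb u v) (fun y => pdW 0 (v 0) y + pdW 1 (v 1) y + pdW 2 (v 2) y) x = FF u p v x - Lop u p x := by
  have du := D.bg.hh.diff
  have dv := fun j => (hb.hv j).diff
  have dU : ∀ i, ∀ x ∈ Slab, pdW i (uu u v) x = pdW i u x + pdW i (v 0) x := fun i x hx => pdW_add du (dv 0) hx i
  have c0 : ∀ x ∈ Slab, pdW 0 (uu u v) x = pdW 0 (v 0) x := fun x hx => by rw [dU 0 x hx, D.bg.x0 x hx, zero_add]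
  let W : Fin 3 → (Fin 3 → ℝ) → ℝ := ![uu u v, v 1, v 2]
  have hU : HH α 2 (M + A) (uu u v) := D.bg.hh.of_succ.add (hb.hv 0)
  have hM := D.bg.hh.nonneg
  have hA := hb.hp.nonneg
  have hW : ∀ j, HH α 2 (M + A) (W j) := by
    intro j
    fin_cases j
    · exact hU
    · exact (hb.hv 1).mono (by linarith)
    · exact (hb.hv 2).mono (by linarith)
  have key := div_mom hW (hb.hp.of_succ.mono (by linarith : A ≤ M + A)) (fun i x hx => by
    fin_cases i
    · show uu u v x * pdW 0 (uu u v) x + v 1 x * pdW 1 (uu u v) x + v 2 x * pdW 2 (uu u v) x + pdW 0 p x = 0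
      rw [c0 x hx, dU 1 x hx, dU 2 x hx]
      exact h0 x hx
    · exact hk 1 (by decide) x hx
    · exact hk 2 (by decide) x hx) hx
  have W0 : W 0 = uu u v := rfl
  have W1 : W 1 = v 1 := rfl
  have W2 : W 2 = v 2 := rfl
  rw [W0, W1, W2] at key
  have t : EqOn (fun y => pdW 0 (uu u v) y + pdW 1 (v 1) y + pdW 2 (v 2) y) (fun y => pdW 0 (v 0) y + pdW 1 (v 1) y + pdW 2 (v 2) y) Slab :=
    fun y hy => by simp only [c0 y hy]
  rw [pdW_congr t hx, pdW_congr t hx, pdW_congr t hx, c0 x hx, dU 1 x hx, dU 2 x hx] at key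
  have hr : uu u v x * rr u v x = 1 := mul_inv_cancel₀ (hpos x hx).ne'
  have hk1 := hk 1 (by decide) x hx
  have hk2 := hk 2 (by decide) x hx
  have e1 : pdW 0 (v 1) x = - (rr u v x * (v 1 x * pdW 1 (v 1) x + v 2 x * pdW 2 (v 1) x + pdW 1 p x)) := by
    linear_combination rr u v x * hk1 - pdW 0 (v 1) x * hr
  have e2 : pdW 0 (v 2) x = - (rr u v x * (v 1 x * pdW 1 (v 2) x + v 2 x * pdW 2 (v 2) x + pdW 2 p x)) := by
    linear_combination rr u v x * hk2 - pdW 0 (v 2) x * hr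
  simp only [Tr, Fin.sum_univ_three, bb, FF, QQ, KK, Lop, Lap]
  simp only [if_true, show (1 : Fin 3) ≠ 0 by decide, show (2 : Fin 3) ≠ 0 by decide, if_false, one_mul]
  generalize pdW 0 (fun y => pdW 0 (v 0) y + pdW 1 (v 1) y + pdW 2 (v 2) y) x = T0 at *
  generalize pdW 1 (fun y => pdW 0 (v 0) y + pdW 1 (v 1) y + pdW 2 (v 2) y) x = T1 at *
  generalize pdW 2 (fun y => pdW 0 (v 0) y + pdW 1 (v 1) y + pdW 2 (v 2) y) x = T2 at *
  linear_combination key + (v 1 x * T1 + v 2 x * T2) * hr - 2 * pdW 1 u x * e1 - 2 * pdW 2 u x * e2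

theorem inl_id (D : Dat α u M m N β Bn pe) (hb : Ball α A p v)
    (h0 : ∀ x ∈ Slab, uu u v x * pdW 0 (v 0) x + v 1 x * (pdW 1 u x + pdW 1 (v 0) x) + v 2 x * (pdW 2 u x + pdW 2 (v 0) x) + pdW 0 p x = 0)
    (hi : ∀ k, k ≠ 0 → ∀ x ∈ Slab, x 0 = 0 → v k x = e * (β k x * uu u v x))
    {x : Fin 3 → ℝ} (hx : x ∈ Slab) (hx0 : x 0 = 0) :
    uu u v x * (pdW 0 (v 0) x + pdW 1 (v 1) x + pdW 2 (v 2) x) = e * hN u β v x - pdW 0 p x := by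
  have du := D.bg.hh.diff
  have dv := fun j => (hb.hv j).diff
  have dU : DifferentiableOn ℝ (uu u v) Slab := du.add (dv 0)
  have eU : ∀ i, pdW i (uu u v) x = pdW i u x + pdW i (v 0) x := fun i => pdW_add du (dv 0) hx i
  have f : ∀ k, k ≠ 0 → pdW k (v k) x = e * (pdW k (β k) x * uu u v x + β k x * (pdW k u x + pdW k (v 0) x)) := fun k hk => by
    rw [face_pd (dv k) (((D.βh k).diff.mul dU).const_mul e) (hi k hk) hk hx hx0]
    have := pdW_cmul e ((D.βh k).diff.mul dU) hx k
    simp only [Pi.mul_apply] at this ⊢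
    refine this.trans ?_
    rw [← eU k, ← pdW_mul (D.βh k).diff dU hx k]
    rfl
  rw [f 1 (by decide), f 2 (by decide), hN]
  have := h0 x hx
  rw [hi 1 (by decide) x hx hx0, hi 2 (by decide) x hx hx0] at this
  linear_combination this

theorem mom_tr (hpos : ∀ x ∈ Slab, 0 < uu u v x) {f g : (Fin 3 → ℝ) → ℝ} {x : Fin 3 → ℝ} (hx : x ∈ Slab) :
    Tr (bb u v) f x = - (rr u v x * g x) ↔ uu u v x * pdW 0 f x + v 1 x * pdW 1 f x + v 2 x * pdW 2 f x + g x = 0 := by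
  have hr : uu u v x * rr u v x = 1 := mul_inv_cancel₀ (hpos x hx).ne'
  simp only [Tr, Fin.sum_univ_three, bb]
  simp only [if_true, show (1 : Fin 3) ≠ 0 by decide, show (2 : Fin 3) ≠ 0 by decide, if_false, one_mul]
  constructor
  · intro h
    linear_combination uu u v x * h - (v 1 x * pdW 1 f x + v 2 x * pdW 2 f x + g x) * hr
  · intro h
    linear_combination rr u v x * h - pdW 0 f x * hr

theorem eul_of_step (D : Dat α u M m N β Bn pe) (hb : Ball α A p v) (hpos : ∀ x ∈ Slab, 0 < uu u v x)
    (ht : ∀ w, DifferentiableOn ℝ w Slab → (∀ x ∈ Slab, Tr (bb u v) w x = 0) → (∀ x ∈ Slab, x 0 = 0 → w x = 0) → ∀ x ∈ Slab, w x = 0)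
    (s : Step u β Bn pe e p v p v) : Eul u β Bn pe e p v := by
  have h0 : ∀ x ∈ Slab, uu u v x * pdW 0 (v 0) x + v 1 x * (pdW 1 u x + pdW 1 (v 0) x) + v 2 x * (pdW 2 u x + pdW 2 (v 0) x) + pdW 0 p x = 0 := by
    intro x hx
    have := (mom_tr hpos (f := v 0) (g := fun x => pdW 0 p x + (v 1 x * pdW 1 u x + v 2 x * pdW 2 u x)) hx).1
      (by rw [s.tr0 x hx, gT, gZ]; ring)
    linear_combination this
  have hk : ∀ k, k ≠ 0 → ∀ x ∈ Slab, uu u v x * pdW 0 (v k) x + v 1 x * pdW 1 (v k) x + v 2 x * pdW 2 (v k) x + pdW k p x = 0 :=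
    fun k hk x hx => (mom_tr hpos hx).1 (s.tr k hk x hx)
  refine ⟨?_, h0, hk, s.inl, fun x hx hx0 => ?_, s.dir⟩
  · refine ht _ (((hb.hv 0).pd 0).diff.add ((hb.hv 1).pd 1).diff |>.add ((hb.hv 2).pd 2).diff) (fun x hx => ?_) (fun x hx hx0 => ?_)
    · have := ell_id D hb hpos h0 hk hx
      rw [s.ell x hx, sub_self] at this
      exact (mul_eq_zero.1 this).resolve_left (hpos x hx).ne'
    · have := inl_id D hb h0 s.inl hx hx0
      rw [s.neu x hx hx0, sub_self] at this
      exact (mul_eq_zero.1 this).resolve_left (hpos x hx).ne'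
  · have i0 := s.inl0 x hx hx0
    have hu : u x * rcp u x = 1 := mul_inv_cancel₀ (D.bg.ne x hx)
    have i1 : u x * v 0 x = e * Bn x - p x - (1 / 2) * (v 0 x * v 0 x)
        - (1 / 2) * (e * (e * (uu u v x * uu u v x * (β 1 x * β 1 x + β 2 x * β 2 x)))) := by
      unfold iZ at i0
      linear_combination u x * i0 + (e * Bn x - p x - (1 / 2) * (v 0 x * v 0 x)
        - (1 / 2) * (e * (e * (uu u v x * uu u v x * (β 1 x * β 1 x + β 2 x * β 2 x))))) * hu
    rw [s.inl 1 (by decide) x hx hx0, s.inl 2 (by decide) x hx hx0]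
    unfold uu at *
    linear_combination i1

theorem step_of_eul (D : Dat α u M m N β Bn pe) (hb : Ball α A p v) (hpos : ∀ x ∈ Slab, 0 < uu u v x)
    (s : Eul u β Bn pe e p v) : Step u β Bn pe e p v p v := by
  refine ⟨fun x hx => ?_, fun x hx hx0 => ?_, s.dir, fun k hk x hx => (mom_tr hpos hx).2 (s.mt k hk x hx), s.inl, fun x hx => ?_, fun x hx hx0 => ?_⟩
  · have := ell_id D hb hpos s.m0 s.mt hx
    have z : EqOn (fun y => pdW 0 (v 0) y + pdW 1 (v 1) y + pdW 2 (v 2) y) (fun _ => 0) Slab := fun y hy => s.dv y hy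
    simp only [Tr, pdW_congr z hx, pdW_const 0 hx, mul_zero, Finset.sum_const_zero] at this
    linear_combination this
  · have := inl_id D hb s.m0 s.inl hx hx0
    rw [s.dv x hx, mul_zero] at this
    linear_combination this
  · have := (mom_tr hpos (f := v 0) (g := fun x => pdW 0 p x + (v 1 x * pdW 1 u x + v 2 x * pdW 2 u x)) hx).2
      (by linear_combination s.m0 x hx)
    rw [this, gT, gZ]; ring
  · have hu : u x * rcp u x = 1 := mul_inv_cancel₀ (D.bg.ne x hx)
    have b := s.ber x hx hx0
    rw [s.inl 1 (by decide) x hx hx0, s.inl 2 (by decide) x hx hx0] at b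
    unfold iZ
    unfold uu at *
    linear_combination rcp u x * b - v 0 x * hu
end Inc

set_option linter.unusedVariables false
set_option linter.unusedSimpArgs false
open Set Filter Topology MeasureTheory
namespace Inc
variable {α : ℝ}

/-- iterated derivative on the slab -/
noncomputable abbrev dS (n : ℕ) (f : (Fin 3 → ℝ) → ℝ) (x : Fin 3 → ℝ) := iteratedFDerivWithin ℝ n f Slab x
/-- evaluation at a basis vector -/
noncomputable abbrev evS (i : Fin 3) : ((Fin 3 → ℝ) →L[ℝ] ℝ) →L[ℝ] ℝ := ContinuousLinearMap.apply ℝ ℝ (Pi.single i 1 : Fin 3 → ℝ)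

theorem evS_norm (i : Fin 3) : ‖evS i‖ ≤ 1 := by
  refine ContinuousLinearMap.opNorm_le_bound _ zero_le_one fun L => ?_
  have h : ‖(Pi.single i 1 : Fin 3 → ℝ)‖ ≤ 1 := by
    refine (pi_norm_le_iff_of_nonneg zero_le_one).2 fun j => ?_
    by_cases h : j = i
    · subst h; simp
    · simp [h]
  calc ‖L (Pi.single i 1)‖ ≤ ‖L‖ * ‖(Pi.single i 1 : Fin 3 → ℝ)‖ := L.le_opNorm _
    _ ≤ ‖L‖ * 1 := by gcongr
    _ = 1 * ‖L‖ := by ring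

theorem ev_down {n : ℕ} (T : ContinuousMultilinearMap ℝ (fun _ : Fin n => (Fin 3 → ℝ)) ((Fin 3 → ℝ) →L[ℝ] ℝ)) (i : Fin 3) :
    ‖(evS i).compContinuousMultilinearMap T‖ ≤ ‖T‖ := by
  refine (ContinuousLinearMap.norm_compContinuousMultilinearMap_le _ _).trans ?_
  have := mul_le_mul_of_nonneg_right (evS_norm i) (norm_nonneg T)
  linarith

theorem ev_up {n : ℕ} (T : ContinuousMultilinearMap ℝ (fun _ : Fin n => (Fin 3 → ℝ)) ((Fin 3 → ℝ) →L[ℝ] ℝ)) {A : ℝ}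
    (h : ∀ i, ‖(evS i).compContinuousMultilinearMap T‖ ≤ A) : ‖T‖ ≤ 3 * A := by
  have hA : 0 ≤ A := (norm_nonneg _).trans (h 0)
  refine ContinuousMultilinearMap.opNorm_le_bound (by positivity) fun m => ?_
  rw [eq_lin (T m), mul_assoc]
  refine lin_norm_le fun i => ?_
  have := ((evS i).compContinuousMultilinearMap T).le_of_opNorm_le (h i) m
  simpa using this

theorem dS_succ {n : ℕ} {f : (Fin 3 → ℝ) → ℝ} {x : Fin 3 → ℝ} (hx : x ∈ Slab) :
    dS (n + 1) f x = (continuousMultilinearCurryRightEquiv' ℝ n (Fin 3 → ℝ) ℝ).symm (iteratedFDerivWithin ℝ n (fderivWithin ℝ f Slab) Slab x) :=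
  iteratedFDerivWithin_succ_eq_comp_right slab_ud hx

theorem dS_succ2 {n : ℕ} {f : (Fin 3 → ℝ) → ℝ} {x y : Fin 3 → ℝ} (hx : x ∈ Slab) (hy : y ∈ Slab) :
    ‖dS (n + 1) f x - dS (n + 1) f y‖ = ‖iteratedFDerivWithin ℝ n (fderivWithin ℝ f Slab) Slab x - iteratedFDerivWithin ℝ n (fderivWithin ℝ f Slab) Slab y‖ := by
  rw [dS_succ hx, dS_succ hy, ← dist_eq_norm, ← dist_eq_norm]
  exact LinearIsometryEquiv.dist_map _ _ _

theorem dS_pd {n : ℕ} {f : (Fin 3 → ℝ) → ℝ} (hf : ContDiffOn ℝ n (fderivWithin ℝ f Slab) Slab) {x : Fin 3 → ℝ} (hx : x ∈ Slab) (i : Fin 3) :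
    dS n (pdW i f) x = (evS i).compContinuousMultilinearMap (iteratedFDerivWithin ℝ n (fderivWithin ℝ f Slab) Slab x) :=
  (evS i).iteratedFDerivWithin_comp_left (hf x hx) slab_ud hx le_rfl

theorem ev_sub {n : ℕ} (T S : ContinuousMultilinearMap ℝ (fun _ : Fin n => (Fin 3 → ℝ)) ((Fin 3 → ℝ) →L[ℝ] ℝ)) (i : Fin 3) :
    (evS i).compContinuousMultilinearMap T - (evS i).compContinuousMultilinearMap S = (evS i).compContinuousMultilinearMap (T - S) := by
  ext m; simp

variable {n : ℕ} {f : (Fin 3 → ℝ) → ℝ} {x y : Fin 3 → ℝ} {A : ℝ}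

theorem dS_down (hf : ContDiffOn ℝ n (fderivWithin ℝ f Slab) Slab) (hx : x ∈ Slab) (i : Fin 3) : ‖dS n (pdW i f) x‖ ≤ ‖dS (n + 1) f x‖ := by
  rw [dS_succ hx, dS_pd hf hx, LinearIsometryEquiv.norm_map]
  exact ev_down _ i
theorem dS_down2 (hf : ContDiffOn ℝ n (fderivWithin ℝ f Slab) Slab) (hx : x ∈ Slab) (hy : y ∈ Slab) (i : Fin 3) :
    ‖dS n (pdW i f) x - dS n (pdW i f) y‖ ≤ ‖dS (n + 1) f x - dS (n + 1) f y‖ := by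
  rw [dS_succ2 hx hy, dS_pd hf hx, dS_pd hf hy, ev_sub]
  exact ev_down _ i
theorem dS_up (hf : ContDiffOn ℝ n (fderivWithin ℝ f Slab) Slab) (hx : x ∈ Slab) (h : ∀ i, ‖dS n (pdW i f) x‖ ≤ A) : ‖dS (n + 1) f x‖ ≤ 3 * A := by
  rw [dS_succ hx, LinearIsometryEquiv.norm_map]
  exact ev_up _ fun i => by rw [← dS_pd hf hx]; exact h i
theorem dS_up2 (hf : ContDiffOn ℝ n (fderivWithin ℝ f Slab) Slab) (hx : x ∈ Slab) (hy : y ∈ Slab)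
    (h : ∀ i, ‖dS n (pdW i f) x - dS n (pdW i f) y‖ ≤ A) : ‖dS (n + 1) f x - dS (n + 1) f y‖ ≤ 3 * A := by
  rw [dS_succ2 hx hy]
  exact ev_up _ fun i => by rw [← ev_sub, ← dS_pd hf hx, ← dS_pd hf hy]; exact h i

/-- Hölder class in terms of iterated derivatives -/
structure GG (α : ℝ) (k : ℕ) (A : ℝ) (f : (Fin 3 → ℝ) → ℝ) : Prop where
  cd : ContDiffOn ℝ k f Slab
  bd : ∀ i ≤ k, ∀ x ∈ Slab, ‖dS i f x‖ ≤ A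
  hl : ∀ x ∈ Slab, ∀ y ∈ Slab, ‖dS k f x - dS k f y‖ ≤ A * ‖x - y‖ ^ α

theorem cd_succ {k : ℕ} : ContDiffOn ℝ ((k + 1 : ℕ) : WithTop ℕ∞) f Slab ↔ DifferentiableOn ℝ f Slab ∧ ContDiffOn ℝ k (fderivWithin ℝ f Slab) Slab := by
  rw [Nat.cast_add, Nat.cast_one, contDiffOn_succ_iff_fderivWithin slab_ud]
  simp

theorem cd_pd {k : ℕ} (h : ContDiffOn ℝ k (fderivWithin ℝ f Slab) Slab) (i : Fin 3) : ContDiffOn ℝ k (pdW i f) Slab :=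
  h.continuousLinearMap_comp (evS i)

theorem cd_of_pd {k : ℕ} (hf : DifferentiableOn ℝ f Slab) (h : ∀ i, ContDiffOn ℝ k (pdW i f) Slab) : ContDiffOn ℝ k (fderivWithin ℝ f Slab) Slab := by
  have : ContDiffOn ℝ k (fun x => linC (fun i => pdW i f x)) Slab := (contDiffOn_pi.2 h).continuousLinearMap_comp linC
  refine this.congr fun x hx => ?_
  exact (hasFD hf hx).fderivWithin (slab_ud x hx)

theorem dS0 : ‖dS 0 f x‖ = |f x| := by simp [dS]
theorem dS02 : ‖dS 0 f x - dS 0 f y‖ = |f x - f y| := by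
  simp only [dS, iteratedFDerivWithin_zero_eq_comp, Function.comp, ← map_sub, LinearIsometryEquiv.norm_map, Real.norm_eq_abs]

theorem HH.toGG : ∀ {k : ℕ} {M : ℝ} {f : (Fin 3 → ℝ) → ℝ}, 0 < α → HH α k M f → GG α k (3 ^ k * M) f
  | 0, M, f, hα, h => ⟨by simpa using h.cont hα, fun i hi x hx => by
      obtain rfl : i = 0 := by omega
      rw [dS0]; simpa using h.bd hx, fun x hx y hy => by rw [dS02]; simpa using h.hol hx hy⟩
  | k + 1, M, f, hα, h => by
    have g := fun i => HH.toGG hα (h.pd i)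
    have hM := h.nonneg
    have cf := cd_of_pd h.diff fun i => (g i).cd
    refine ⟨cd_succ.2 ⟨h.diff, cf⟩, fun i hi x hx => ?_, fun x hx y hy => ?_⟩
    · cases i with
      | zero =>
        rw [dS0]
        refine (h.bd hx).trans ?_
        have : (1:ℝ) ≤ 3 ^ (k + 1) := one_le_pow₀ (by norm_num)
        nlinarith
      | succ i =>
        rw [pow_succ', mul_assoc]
        exact dS_up (cf.of_le (by exact_mod_cast (by omega : i ≤ k))) hx fun j => (g j).bd i (by omega) x hx
    · rw [pow_succ', mul_assoc, mul_assoc]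
      refine dS_up2 cf hx hy fun j => ?_
      rw [← mul_assoc]
      exact (g j).hl x hx y hy

theorem GG.pd {k : ℕ} (h : GG α (k + 1) A f) (i : Fin 3) : GG α k A (pdW i f) := by
  have cf := (cd_succ.1 h.cd).2
  refine ⟨cd_pd cf i, fun j hj x hx => ?_, fun x hx y hy => (dS_down2 cf hx hy i).trans (h.hl x hx y hy)⟩
  exact (dS_down (cf.of_le (by exact_mod_cast hj)) hx i).trans (h.bd (j + 1) (by omega) x hx)

theorem GG.toHH : ∀ {k : ℕ} {A : ℝ} {f : (Fin 3 → ℝ) → ℝ}, 0 < α → α < 1 → GG α k A f → HH α k (5 * A) f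
  | 0, A, f, h0, h1, h => by
    have hA : 0 ≤ A := (norm_nonneg _).trans (h.bd 0 le_rfl 0 zero_mem_slab)
    refine ⟨fun x hx => ?_, fun x hx y hy => ?_⟩
    · have := h.bd 0 le_rfl x hx
      rw [dS0] at this; linarith
    · have := h.hl x hx y hy
      rw [dS02] at this
      have : 0 ≤ A * ‖x - y‖ ^ α := by positivity
      linarith
  | k + 1, A, f, h0, h1, h => by
    have hA : 0 ≤ A := (norm_nonneg _).trans (h.bd 0 (by omega) 0 zero_mem_slab)
    have hd := (cd_succ.1 h.cd).1
    have b := HH0_of_lip h0.le h1.le (f := f) (A := A) (L := 3 * A) (fun x hx => by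
      have := h.bd 0 (by omega) x hx
      rwa [dS0] at this) (by positivity) (fun x hx y hy => lip_of_pd hd (fun i x hx => by
        have := (h.pd i).bd 0 (by omega) x hx
        rwa [dS0] at this) hx hy)
    refine ⟨?_, hd, fun i => GG.toHH h0 h1 (h.pd i)⟩
    have : 2 * A + 3 * A = 5 * A := by ring
    rwa [this] at b

theorem MemHolder3.pd {k : ℕ} (h : MemHolder3 (k + 1) α f) (i : Fin 3) : MemHolder3 k α (pdW i f) := by
  obtain ⟨cd, M, hM⟩ := h
  have cf := (cd_succ.1 (by exact_mod_cast cd)).2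
  exact ⟨by exact_mod_cast cd_pd cf i, M, fun x hx y hy => (dS_down2 cf hx hy i).trans (hM x hx y hy)⟩

theorem bdd_of_per (hp : PerS f) (hc : ContinuousOn f Slab) : ∃ B, 0 ≤ B ∧ ∀ x ∈ Slab, |f x| ≤ B := by
  obtain ⟨a, ha, h1⟩ := exists_max hp hc
  obtain ⟨b, hb, h2⟩ := exists_max hp.neg hc.neg
  refine ⟨|f a| + |f b|, by positivity, fun x hx => abs_le.2 ⟨?_, ?_⟩⟩
  · have := h2 x hx
    have := neg_abs_le (f b)
    have := abs_nonneg (f a)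
    linarith
  · have := h1 x hx
    have := le_abs_self (f a)
    have := abs_nonneg (f b)
    linarith

theorem exists_HH : ∀ {k : ℕ} {f : (Fin 3 → ℝ) → ℝ}, 0 < α → α < 1 → MemHolder3 k α f → PerS f → ∃ A, HH α k A f
  | 0, f, h0, h1, h, hp => by
    obtain ⟨cd, M, hM⟩ := h
    obtain ⟨B, hB, hb⟩ := bdd_of_per hp cd.continuousOn
    refine ⟨max B M, fun x hx => (hb x hx).trans (le_max_left _ _), fun x hx y hy => ?_⟩
    have := hM x hx y hy
    rw [dS02] at this
    exact this.trans (mul_le_mul_of_nonneg_right (le_max_right _ _) (by positivity))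
  | k + 1, f, h0, h1, h, hp => by
    have hd := (cd_succ.1 (by exact_mod_cast h.1)).1
    obtain ⟨B, hB, hb⟩ := bdd_of_per hp hd.continuousOn
    have := fun i => exists_HH h0 h1 (MemHolder3.pd h i) (hp.pd hd i)
    choose A hA using this
    have A0 := fun i => (hA i).nonneg
    let S := A 0 + A 1 + A 2
    have hS : ∀ i, A i ≤ S := by
      intro i
      have := A0 0; have := A0 1; have := A0 2
      fin_cases i <;> simp only [S] <;> simp <;> linarith
    have S0 : 0 ≤ S := (A0 0).trans (hS 0)
    have b := HH0_of_lip h0.le h1.le hb (L := 3 * S) (by positivity) (fun x hx y hy => lip_of_pd hd (fun i x hx => ((hA i).bd hx).trans (hS i)) hx hy)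
    exact ⟨2 * B + 3 * S + S, b.mono (by linarith), hd, fun i => (hA i).mono (by have := hS i; linarith)⟩

theorem GG_of_norm {k : ℕ} (h0 : 0 < α) (h1 : α < 1) (h : MemHolder3 k α f) (hp : PerS f) : GG α k (normCkα k α f) f := by
  obtain ⟨A, hA⟩ := exists_HH h0 h1 h hp
  have g := hA.toGG h0
  have n1 : ∀ i, 0 ≤ sSup ((fun x => ‖iteratedFDerivWithin ℝ i f Slab x‖) '' Slab) := fun i =>
    Real.sSup_nonneg (by rintro _ ⟨x, hx, rfl⟩; exact norm_nonneg _)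
  have n2 : 0 ≤ sSup {r : ℝ | ∃ x ∈ Slab, ∃ y ∈ Slab, x ≠ y ∧
      r = ‖iteratedFDerivWithin ℝ k f Slab x - iteratedFDerivWithin ℝ k f Slab y‖ / ‖x - y‖ ^ α} :=
    Real.sSup_nonneg (by rintro _ ⟨x, hx, y, hy, hxy, rfl⟩; positivity)
  refine ⟨by exact_mod_cast h.1, fun i hi x hx => ?_, fun x hx y hy => ?_⟩
  · have b : ‖dS i f x‖ ≤ sSup ((fun x => ‖iteratedFDerivWithin ℝ i f Slab x‖) '' Slab) :=
      le_csSup ⟨_, by rintro _ ⟨y, hy, rfl⟩; exact g.bd i hi y hy⟩ ⟨x, hx, rfl⟩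
    have c := Finset.single_le_sum (f := fun i => sSup ((fun x => ‖iteratedFDerivWithin ℝ i f Slab x‖) '' Slab)) (fun i _ => n1 i)
      (Finset.mem_range.2 (by omega : i < k + 1))
    unfold normCkα
    linarith
  · by_cases hxy : x = y
    · subst hxy
      simp [Real.zero_rpow h0.ne']
    have hn : 0 < ‖x - y‖ ^ α := Real.rpow_pos_of_pos (norm_pos_iff.2 (sub_ne_zero.2 hxy)) _
    rw [← div_le_iff₀ hn]
    have b : ‖dS k f x - dS k f y‖ / ‖x - y‖ ^ α ≤ sSup {r : ℝ | ∃ x ∈ Slab, ∃ y ∈ Slab, x ≠ y ∧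
      r = ‖iteratedFDerivWithin ℝ k f Slab x - iteratedFDerivWithin ℝ k f Slab y‖ / ‖x - y‖ ^ α} := by
      refine le_csSup ⟨3 ^ k * A, ?_⟩ ⟨x, hx, y, hy, hxy, rfl⟩
      rintro _ ⟨x, hx, y, hy, hxy, rfl⟩
      have hn : 0 < ‖x - y‖ ^ α := Real.rpow_pos_of_pos (norm_pos_iff.2 (sub_ne_zero.2 hxy)) _
      rw [div_le_iff₀ hn]
      exact g.hl x hx y hy
    have c := Finset.sum_nonneg (s := Finset.range (k + 1)) (fun i _ => n1 i)
    unfold normCkα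
    linarith

theorem HH_of_norm {k : ℕ} (h0 : 0 < α) (h1 : α < 1) (h : MemHolder3 k α f) (hp : PerS f) : HH α k (5 * normCkα k α f) f :=
  (GG_of_norm h0 h1 h hp).toHH h0 h1

theorem HH.mem {k : ℕ} {M : ℝ} (h0 : 0 < α) (h : HH α k M f) : MemHolder3 k α f :=
  ⟨by exact_mod_cast (h.toGG h0).cd, _, (h.toGG h0).hl⟩

theorem HH.norm {k : ℕ} {M : ℝ} (h0 : 0 < α) (h : HH α k M f) : normCkα k α f ≤ (k + 2) * (3 ^ k * M) := by
  have g := h.toGG h0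
  have hM := h.nonneg
  have a : ∑ i ∈ Finset.range (k + 1), sSup ((fun x => ‖iteratedFDerivWithin ℝ i f Slab x‖) '' Slab) ≤ ∑ i ∈ Finset.range (k + 1), 3 ^ k * M := by
    refine Finset.sum_le_sum fun i hi => Real.sSup_le ?_ (by positivity)
    rintro _ ⟨x, hx, rfl⟩
    exact g.bd i (by have := Finset.mem_range.1 hi; omega) x hx
  have b : sSup {r : ℝ | ∃ x ∈ Slab, ∃ y ∈ Slab, x ≠ y ∧
      r = ‖iteratedFDerivWithin ℝ k f Slab x - iteratedFDerivWithin ℝ k f Slab y‖ / ‖x - y‖ ^ α} ≤ 3 ^ k * M := by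
    refine Real.sSup_le ?_ (by positivity)
    rintro _ ⟨x, hx, y, hy, hxy, rfl⟩
    have hn : 0 < ‖x - y‖ ^ α := Real.rpow_pos_of_pos (norm_pos_iff.2 (sub_ne_zero.2 hxy)) _
    rw [div_le_iff₀ hn]
    exact g.hl x hx y hy
  simp only [Finset.sum_const, Finset.card_range, nsmul_eq_mul, Nat.cast_add, Nat.cast_one] at a
  unfold normCkα
  linarith
end Inc

set_option linter.unusedVariables false
set_option linter.unusedSimpArgs false
open Set Filter Topology MeasureTheory
namespace Inc
variable {α : ℝ}

/-- projection on the cross section -/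
noncomputable def Pj : (Fin 3 → ℝ) →L[ℝ] (Fin 2 → ℝ) := ContinuousLinearMap.pi fun i => ContinuousLinearMap.proj i.succ
theorem Pj_apply (x : Fin 3 → ℝ) : Pj x = ![x 1, x 2] := by
  ext i; fin_cases i <;> rfl
theorem Pj_norm : ‖Pj‖ ≤ 1 := by
  refine ContinuousLinearMap.opNorm_le_bound _ zero_le_one fun x => ?_
  rw [one_mul]
  exact (pi_norm_le_iff_of_nonneg (norm_nonneg _)).2 fun j => norm_le_pi_norm x j.succ

/-- lift of a function on the cross section -/
def lft (g : (Fin 2 → ℝ) → ℝ) (x : Fin 3 → ℝ) : ℝ := g ![x 1, x 2]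
theorem lft_eq (g : (Fin 2 → ℝ) → ℝ) : lft g = g ∘ Pj := by
  funext x; simp [lft, Pj_apply]

variable {g : (Fin 2 → ℝ) → ℝ} {k : ℕ}

theorem lft_mem (h0 : 0 < α) (h : MemHolder2 k α g) : MemHolder3 k α (lft g) := by
  obtain ⟨cd, M, hM⟩ := h
  have cd' : ContDiff ℝ k g := by exact_mod_cast cd
  rw [lft_eq]
  have cc : ContDiff ℝ k (g ∘ Pj) := cd'.comp Pj.contDiff
  refine ⟨by exact_mod_cast cc.contDiffOn, |M|, fun x hx y hy => ?_⟩
  rw [iteratedFDerivWithin_eq_iteratedFDeriv slab_ud cc.contDiffAt hx, iteratedFDerivWithin_eq_iteratedFDeriv slab_ud cc.contDiffAt hy,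
    Pj.iteratedFDeriv_comp_right cd' x le_rfl, Pj.iteratedFDeriv_comp_right cd' y le_rfl]
  set T := iteratedFDeriv ℝ k g (Pj x)
  set S := iteratedFDeriv ℝ k g (Pj y)
  have e : T.compContinuousLinearMap (fun _ => Pj) - S.compContinuousLinearMap (fun _ => Pj) = (T - S).compContinuousLinearMap (fun _ => Pj) := by
    ext m; simp
  rw [e]
  refine (ContinuousMultilinearMap.norm_compContinuousLinearMap_le _ _).trans ?_
  have a : ∏ i : Fin k, ‖Pj‖ ≤ 1 := Finset.prod_le_one (fun _ _ => norm_nonneg _) fun _ _ => Pj_norm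
  have b : ‖Pj x - Pj y‖ ≤ ‖x - y‖ := by
    rw [← map_sub]
    exact (Pj.le_of_opNorm_le Pj_norm _).trans (by rw [one_mul])
  calc ‖T - S‖ * ∏ i : Fin k, ‖Pj‖ ≤ ‖T - S‖ * 1 := by gcongr
    _ ≤ M * ‖Pj x - Pj y‖ ^ α := by rw [mul_one]; exact hM _ _
    _ ≤ |M| * ‖Pj x - Pj y‖ ^ α := by gcongr; exact le_abs_self M
    _ ≤ |M| * ‖x - y‖ ^ α := by gcongr

theorem lft_per3 (h : Per2 g) : Per3 (lft g) := by
  intro x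
  have h1 := h ![x 1, x 2]
  constructor
  · refine (congrArg g ?_).trans h1.1
    ext i; fin_cases i <;> simp
  · refine (congrArg g ?_).trans h1.2
    ext i; fin_cases i <;> simp

theorem single2 (i : Fin 3) : (Pi.single i 2 : Fin 3 → ℝ) = (2:ℝ) • Pi.single i 1 := by
  ext j
  by_cases h : j = i
  · subst h; simp
  · simp [h]

theorem perS_of {f : (Fin 3 → ℝ) → ℝ} (h : Per3 f) : PerS f := by
  intro x _
  rw [single2, single2]
  exact h x

theorem lft_HH (h0 : 0 < α) (h1 : α < 1) (h : MemHolder2 k α g) (hp : Per2 g) : ∃ A, HH α k A (lft g) :=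
  exists_HH h0 h1 (lft_mem h0 h) (perS_of (lft_per3 hp))

theorem lft_x0 (h : Differentiable ℝ g) {x : Fin 3 → ℝ} (hx : x ∈ Slab) : pdW 0 (lft g) x = 0 := by
  have d : HasFDerivAt (lft g) ((fderiv ℝ g (Pj x)).comp Pj) x := by
    rw [lft_eq]
    exact (h (Pj x)).hasFDerivAt.comp x Pj.hasFDerivAt
  rw [pdW, d.hasFDerivWithinAt.fderivWithin (slab_ud x hx)]
  have : Pj (Pi.single 0 1) = 0 := by
    rw [Pj_apply]; ext i; fin_cases i <;> simp
  simp [this]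

/-- clamped extension -/
noncomputable def clp (x : Fin 3 → ℝ) : Fin 3 → ℝ := Function.update x 0 (max 0 (min 1 (x 0)))
theorem clp_mem (x : Fin 3 → ℝ) : clp x ∈ Slab := by
  simp [clp, Slab]
theorem clp_eq {x : Fin 3 → ℝ} (hx : x ∈ Slab) : clp x = x := by
  obtain ⟨a, b⟩ := hx
  rw [clp, min_eq_right b, max_eq_right a, Function.update_eq_self]
theorem clp_add (x : Fin 3 → ℝ) {i : Fin 3} (hi : i ≠ 0) (c : ℝ) : clp (x + Pi.single i c) = clp x + Pi.single i c := by
  ext j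
  by_cases h : j = 0
  · subst h; simp [clp, hi.symm, hi]
  · simp [clp, h]
theorem PerS.clp {f : (Fin 3 → ℝ) → ℝ} (h : PerS f) : Per3 (fun x => f (clp x)) := by
  intro x
  rw [← single2, ← single2]
  simp only [clp_add x (show (1 : Fin 3) ≠ 0 by decide), clp_add x (show (2 : Fin 3) ≠ 0 by decide)]
  exact h _ (clp_mem x)

theorem slab_vec {x : Fin 3 → ℝ} {a : ℝ} (h : x 0 = a) : x = ![a, x 1, x 2] := by
  ext i; fin_cases i <;> simp [h]

theorem vec_mem {a s t : ℝ} (h0 : 0 ≤ a) (h1 : a ≤ 1) : (![a, s, t] : Fin 3 → ℝ) ∈ Slab := by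
  simp [Slab, h0, h1]

theorem exists_Dat (h0 : 0 < α) (h1 : α < 1) {u₀ b2 b3 Bn pe : (Fin 2 → ℝ) → ℝ}
    (hu : MemHolder2 3 α u₀) (hup : Per2 u₀) (hpos : ∀ v, 0 < u₀ v)
    (h2 : MemHolder2 3 α b2) (h2p : Per2 b2) (h3 : MemHolder2 3 α b3) (h3p : Per2 b3)
    (hB : MemHolder2 3 α Bn) (hBp : Per2 Bn) (hpe : MemHolder2 3 α pe) (hpp : Per2 pe) :
    ∃ M m N, Dat α (lft u₀) M m N ![fun _ => 0, lft b2, lft b3] (lft Bn) (lft pe) := by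
  obtain ⟨M, hM⟩ := lft_HH h0 h1 hu hup
  obtain ⟨N2, hN2⟩ := lft_HH h0 h1 h2 h2p
  obtain ⟨N3, hN3⟩ := lft_HH h0 h1 h3 h3p
  obtain ⟨NB, hNB⟩ := lft_HH h0 h1 hB hBp
  obtain ⟨Np, hNp⟩ := lft_HH h0 h1 hpe hpp
  have du : Differentiable ℝ u₀ := hu.1.differentiable (by norm_num)
  have dp : Differentiable ℝ pe := hpe.1.differentiable (by norm_num)
  obtain ⟨a, ha, hmin⟩ := exists_max (perS_of (lft_per3 hup)).neg hM.diff.continuousOn.neg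
  have := hN2.nonneg
  have := hN3.nonneg
  have := hNB.nonneg
  have := hNp.nonneg
  refine ⟨M, lft u₀ a, N2 + N3 + NB + Np, ⟨hM, (perS_of (lft_per3 hup)), hpos _, fun x hx => ?_, fun x hx => lft_x0 du hx⟩, h0, h1, fun j => ?_, fun j => ?_,
    hNB.mono (by linarith), (perS_of (lft_per3 hBp)), hNp.mono (by linarith), (perS_of (lft_per3 hpp)), fun x hx => lft_x0 dp hx⟩
  · have := hmin x hx; linarith
  · fin_cases j
    · exact (HH.const (c := 0) 3).mono (by rw [abs_zero]; linarith)
    · exact hN2.mono (by linarith)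
    · exact hN3.mono (by linarith)
  · fin_cases j
    · exact PerS.const 0
    · exact (perS_of (lft_per3 h2p))
    · exact (perS_of (lft_per3 h3p))
end Inc

set_option linter.unusedVariables false
set_option linter.unusedSimpArgs false
open Set Filter Topology MeasureTheory
namespace Inc
variable {α : ℝ}

theorem norm_nn (k : ℕ) (f : (Fin 3 → ℝ) → ℝ) : 0 ≤ normCkα k α f := by
  refine add_nonneg (Finset.sum_nonneg fun i _ => Real.sSup_nonneg ?_) (Real.sSup_nonneg ?_)
  · rintro _ ⟨x, hx, rfl⟩; exact norm_nonneg _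
  · rintro _ ⟨x, hx, y, hy, hxy, rfl⟩; positivity

variable {u₀ b2 b3 Bn pe : (Fin 2 → ℝ) → ℝ} {M m N e p₀ C K A : ℝ} {p : (Fin 3 → ℝ) → ℝ} {v : Fin 3 → (Fin 3 → ℝ) → ℝ}

/-- lifted inlet angles -/
noncomputable abbrev bet (b2 b3 : (Fin 2 → ℝ) → ℝ) : Fin 3 → (Fin 3 → ℝ) → ℝ := ![fun _ => 0, lft b2, lft b3]

theorem sol_of_eul (D : Dat α (lft u₀) M m N (bet b2 b3) (lft Bn) (lft pe)) (hup : Per2 u₀) (hb : Ball α (K * e) p v)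
    (hpos : ∀ x ∈ Slab, 0 < uu (lft u₀) v x) (s : Eul (lft u₀) (bet b2 b3) (lft Bn) (lft pe) e p v)
    (hC : 243 * K * e ≤ C * e) :
    IsIncSolution α e p₀ C u₀ b2 b3 Bn pe (fun x => p₀ + p (clp x))
      ![fun x => lft u₀ x + v 0 (clp x), fun x => v 1 (clp x), fun x => v 2 (clp x)] := by
  have cp : EqOn (fun x => p (clp x)) p Slab := fun x hx => by simp only [clp_eq hx]
  have cv : ∀ j, EqOn (fun x => v j (clp x)) (v j) Slab := fun j x hx => by simp only [clp_eq hx]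
  have hp' : HH α 3 (K * e) (fun x => p (clp x)) := hb.hp.congr cp.symm
  have hv' : ∀ j, HH α 2 (K * e) (fun x => v j (clp x)) := fun j => (hb.hv j).congr (cv j).symm
  have du := D.bg.hh.diff
  have dv := fun j => (hv' j).diff
  have Pp : ∀ x ∈ Slab, ∀ i, pdW i (fun x => p₀ + p (clp x)) x = pdW i p x := by
    intro x hx i
    rw [pdW_add (f := fun _ => p₀) (g := fun x => p (clp x)) (differentiableOn_const _) hp'.diff hx, pdW_const p₀ hx, zero_add, pdW_congr cp hx]
  have Pu : ∀ x ∈ Slab, ∀ i, pdW i (fun x => lft u₀ x + v 0 (clp x)) x = pdW i (lft u₀) x + pdW i (v 0) x := by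
    intro x hx i
    rw [pdW_add (f := lft u₀) (g := fun x => v 0 (clp x)) du (dv 0) hx, pdW_congr (cv 0) hx]
  have Pv : ∀ x ∈ Slab, ∀ i j, pdW i (fun x => v j (clp x)) x = pdW i (v j) x := fun x hx i j => pdW_congr (cv j) hx i
  have P0 := fun x hx => D.bg.x0 x hx
  have pos' : ∀ x ∈ Slab, 0 < lft u₀ x + v 0 (clp x) := fun x hx => by rw [clp_eq hx]; exact hpos x hx
  refine ⟨?_, ?_, fun i => ?_, fun x hx => ?_, fun i x hx => ?_, pos', fun s2 s3 => ?_, fun s2 s3 => ?_, ?_⟩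
  · exact ((HH.const (c := p₀) 3).add hp').mem D.a0
  · intro x
    have := hb.pp.clp x
    exact ⟨by simp only [this.1], by simp only [this.2]⟩
  · fin_cases i
    · refine ⟨(D.bg.hh.of_succ.add (hv' 0)).mem D.a0, fun x => ?_⟩
      have h1 := (hb.pv 0).clp x
      have h2 := lft_per3 hup x
      exact ⟨congrArg₂ (· + ·) h2.1 h1.1, congrArg₂ (· + ·) h2.2 h1.2⟩
    · exact ⟨(hv' 1).mem D.a0, (hb.pv 1).clp⟩
    · exact ⟨(hv' 2).mem D.a0, (hb.pv 2).clp⟩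
  · have := s.dv x hx
    simp only [Matrix.cons_val]
    rw [Pu x hx, Pv x hx, Pv x hx, P0 x hx]
    linarith
  · have E : ∀ x ∈ Slab, lft u₀ x + v 0 (clp x) = uu (lft u₀) v x := fun x hx => by rw [clp_eq hx]; rfl
    fin_cases i
    · have := s.m0 x hx
      simp only [Matrix.cons_val, Fin.zero_eta, Fin.mk_one, Fin.reduceFinMk]
      rw [Pu x hx, Pu x hx, Pu x hx, Pp x hx, P0 x hx, E x hx, clp_eq hx]
      linarith
    · have := s.mt 1 (by decide) x hx
      simp only [Matrix.cons_val, Fin.zero_eta, Fin.mk_one, Fin.reduceFinMk]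
      rw [Pv x hx, Pv x hx, Pv x hx, Pp x hx, E x hx, clp_eq hx]
      linarith
    · have := s.mt 2 (by decide) x hx
      simp only [Matrix.cons_val, Fin.zero_eta, Fin.mk_one, Fin.reduceFinMk]
      rw [Pv x hx, Pv x hx, Pv x hx, Pp x hx, E x hx, clp_eq hx]
      linarith
  · have hx : (![0, s2, s3] : Fin 3 → ℝ) ∈ Slab := vec_mem le_rfl zero_le_one
    have q := hpos _ hx
    have i1 := s.inl 1 (by decide) _ hx rfl
    have i2 := s.inl 2 (by decide) _ hx rfl
    have i3 := s.ber _ hx rfl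
    simp only [Matrix.cons_val, clp_eq hx]
    change v 1 ![0, s2, s3] = e * (b2 ![s2, s3] * uu (lft u₀) v ![0, s2, s3]) at i1
    change v 2 ![0, s2, s3] = e * (b3 ![s2, s3] * uu (lft u₀) v ![0, s2, s3]) at i2
    change _ = u₀ ![s2, s3] ^ 2 / 2 + e * Bn ![s2, s3] at i3
    rw [show lft u₀ ![0, s2, s3] + v 0 ![0, s2, s3] = uu (lft u₀) v ![0, s2, s3] from rfl]
    refine ⟨?_, ?_, by linarith⟩
    · rw [i1, div_eq_iff q.ne']; ring
    · rw [i2, div_eq_iff q.ne']; ring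
  · have hx : (![1, s2, s3] : Fin 3 → ℝ) ∈ Slab := vec_mem zero_le_one le_rfl
    have := s.dir _ hx rfl
    simp only [clp_eq hx]
    rw [this]; rfl
  · have n0 : normCkα 2 α (fun x => lft u₀ x + v 0 (clp x) - u₀ ![x 1, x 2]) ≤ (2 + 2) * (3 ^ 2 * (K * e)) := by
      have := HH.norm (f := fun x => lft u₀ x + v 0 (clp x) - u₀ ![x 1, x 2]) D.a0 ((hv' 0).congr fun x hx => by simp [lft])
      exact_mod_cast this
    have n1 := (hv' 1).norm D.a0
    have n2 := (hv' 2).norm D.a0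
    have n3 : normCkα 3 α (fun x => p₀ + p (clp x) - p₀) ≤ (3 + 2) * (3 ^ 3 * (K * e)) := by
      have := HH.norm (f := fun x => p₀ + p (clp x) - p₀) D.a0 (hp'.congr fun x hx => by ring)
      exact_mod_cast this
    simp only [Matrix.cons_val]
    push_cast at n1 n2
    linarith

theorem eul_of_sol (D : Dat α (lft u₀) M m N (bet b2 b3) (lft Bn) (lft pe)) (hup : Per2 u₀) {u : Fin 3 → (Fin 3 → ℝ) → ℝ}
    (h : IsIncSolution α e p₀ C u₀ b2 b3 Bn pe p u) (hv : v = ![fun x => u 0 x - u₀ ![x 1, x 2], u 1, u 2]) :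
    Ball α (5 * C * e) (fun x => p x - p₀) v ∧ (∀ x ∈ Slab, 0 < uu (lft u₀) v x) ∧
      Eul (lft u₀) (bet b2 b3) (lft Bn) (lft pe) e (fun x => p x - p₀) v := by
  obtain ⟨mp, pp, mu, dv, mom, pos, inl, exi, est⟩ := h
  have h0 := D.a0
  have h1 := D.a1
  have v0 : v 0 = fun x => u 0 x - lft u₀ x := by rw [hv]; rfl
  have v1 : v 1 = u 1 := by rw [hv]; rfl
  have v2 : v 2 = u 2 := by rw [hv]; rfl
  have z0 := norm_nn (α := α) 2 (fun x => u 0 x - u₀ ![x 1, x 2])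
  have z1 := norm_nn (α := α) 2 (u 1)
  have z2 := norm_nn (α := α) 2 (u 2)
  have z3 := norm_nn (α := α) 3 (fun x => p x - p₀)
  have per : ∀ j, PerS (u j) := fun j => perS_of (mu j).2
  have perp := perS_of pp
  choose A hA using fun j => exists_HH h0 h1 (mu j).1 (per j)
  obtain ⟨Ap, hAp⟩ := exists_HH h0 h1 mp perp
  have hu0 : HH α 2 _ (fun x => u 0 x - lft u₀ x) := (hA 0).sub D.bg.hh.of_succ
  have pu0 : PerS (fun x => u 0 x - lft u₀ x) := (per 0).sub D.bg.per
  have hp0 : HH α 3 _ (fun x => p x - p₀) := hAp.sub (HH.const (c := p₀) 3)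
  have pp0 : PerS (fun x => p x - p₀) := perp.sub (PerS.const p₀)
  have hb : Ball α (5 * C * e) (fun x => p x - p₀) v := by
    refine ⟨(HH_of_norm h0 h1 (hp0.mem h0) pp0).mono (by linarith), fun j => ?_, pp0, fun j => ?_⟩
    · fin_cases j
      · change HH α 2 _ (v 0)
        rw [v0]
        refine (HH_of_norm h0 h1 (hu0.mem h0) pu0).mono ?_
        change 5 * normCkα 2 α (fun x => u 0 x - u₀ ![x 1, x 2]) ≤ _
        linarith
      · change HH α 2 _ (v 1)
        rw [v1]
        exact (HH_of_norm h0 h1 (mu 1).1 (per 1)).mono (by linarith)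
      · change HH α 2 _ (v 2)
        rw [v2]
        exact (HH_of_norm h0 h1 (mu 2).1 (per 2)).mono (by linarith)
    · fin_cases j
      · change PerS (v 0); rw [v0]; exact pu0
      · change PerS (v 1); rw [v1]; exact per 1
      · change PerS (v 2); rw [v2]; exact per 2
  have E : ∀ x, uu (lft u₀) v x = u 0 x := fun x => by simp [uu, v0]
  have P0 : ∀ x ∈ Slab, ∀ i, pdW i (v 0) x = pdW i (u 0) x - pdW i (lft u₀) x := fun x hx i => by
    rw [v0, pdW_sub (hA 0).diff D.bg.hh.diff hx]
  have Pp : ∀ x ∈ Slab, ∀ i, pdW i (fun x => p x - p₀) x = pdW i p x := fun x hx i => by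
    rw [pdW_sub (g := fun _ => p₀) hAp.diff (differentiableOn_const _) hx, pdW_const p₀ hx, sub_zero]
  have pos' : ∀ x ∈ Slab, 0 < uu (lft u₀) v x := fun x hx => by rw [E]; exact pos x hx
  have X0 := fun x hx => D.bg.x0 x hx
  refine ⟨hb, pos', fun x hx => ?_, fun x hx => ?_, fun k hk x hx => ?_, fun k hk x hx hx0 => ?_, fun x hx hx0 => ?_, fun x hx hx0 => ?_⟩
  · rw [P0 x hx, v1, v2, X0 x hx, sub_zero]; exact dv x hx
  · rw [P0 x hx, P0 x hx, P0 x hx, Pp x hx, E, v1, v2, X0 x hx]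
    have := mom 0 x hx
    linarith
  · have := mom k x hx
    have hvk : v k = u k := by
      fin_cases k
      · exact absurd rfl hk
      · exact v1
      · exact v2
    rw [hvk, E, v1, v2, Pp x hx]; exact this
  · have a := inl (x 1) (x 2)
    rw [← slab_vec hx0] at a
    have q := (pos x hx).ne'
    obtain ⟨a1, a2, -⟩ := a
    rw [div_eq_iff q] at a1 a2
    fin_cases k
    · exact absurd rfl hk
    · change v 1 x = e * (b2 ![x 1, x 2] * uu (lft u₀) v x)
      rw [v1, a1, E]; ring
    · change v 2 x = e * (b3 ![x 1, x 2] * uu (lft u₀) v x)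
      rw [v2, a2, E]; ring
  · obtain ⟨-, -, a⟩ := inl (x 1) (x 2)
    rw [← slab_vec hx0] at a
    rw [E, v1, v2]
    change _ = u₀ ![x 1, x 2] ^ 2 / 2 + e * Bn ![x 1, x 2]
    linarith
  · have a := exi (x 1) (x 2)
    rw [← slab_vec hx0] at a
    change _ = e * pe ![x 1, x 2]
    linarith
end Inc

theorem incompressible_flow_in_rectangular_cylinder
    (α p₀ : ℝ) (hα0 : 0 < α) (hα1 : α < 1)
    (u₀ β₂in β₃in Bin pe : (Fin 2 → ℝ) → ℝ)
    (hu₀reg : MemHolder2 3 α u₀) (hu₀per : Per2 u₀)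
    (hu₀pos : ∀ v, 0 < u₀ v) (hu₀compat : CompatScal u₀)
    (hβ₂reg : MemHolder2 3 α β₂in) (hβ₂per : Per2 β₂in) (hβ₂compat : CompatBeta2 β₂in)
    (hβ₃reg : MemHolder2 3 α β₃in) (hβ₃per : Per2 β₃in) (hβ₃compat : CompatBeta3 β₃in)
    (hBreg : MemHolder2 3 α Bin) (hBper : Per2 Bin) (hBcompat : CompatScal Bin)
    (hpereg : MemHolder2 3 α pe) (hpeper : Per2 pe) (hpecompat : CompatScal pe) :
    ∃ ε₀ > 0, ∃ C > 0, ∀ ε : ℝ, 0 < ε → ε < ε₀ →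
      ∃ (p : (Fin 3 → ℝ) → ℝ) (u : Fin 3 → (Fin 3 → ℝ) → ℝ),
        IsIncSolution α ε p₀ C u₀ β₂in β₃in Bin pe p u ∧
        ∀ (p' : (Fin 3 → ℝ) → ℝ) (u' : Fin 3 → (Fin 3 → ℝ) → ℝ),
          IsIncSolution α ε p₀ C u₀ β₂in β₃in Bin pe p' u' →
          ∀ x ∈ Slab, p' x = p x ∧ ∀ i, u' i x = u i x := by
  obtain ⟨M, m, N, D⟩ := Inc.exists_Dat hα0 hα1 hu₀reg hu₀per hu₀pos hβ₂reg hβ₂per hβ₃reg hβ₃per hBreg hBper hpereg hpeper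
  obtain ⟨K, hK, hmain⟩ := Inc.fixed_main D
  obtain ⟨e0, he0, hball, hfix⟩ := hmain (5 * (243 * K)) (by linarith)
  refine ⟨e0, he0, 243 * K, by positivity, fun e h1 h2 => ?_⟩
  obtain ⟨⟨p, v, hb, st⟩, huniq⟩ := hfix e h1 h2
  have hKe : 0 < K * e := by positivity
  have hb' : Inc.Ball α (5 * (243 * K) * e) p v := hb.mono (by nlinarith)
  obtain ⟨b1, b2⟩ := hball e p v h1 h2 hb'
  have hpos : ∀ x ∈ Slab, 0 < Inc.uu (Inc.lft u₀) v x := fun x hx => by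
    have := b1 x hx
    have := D.bg.pos
    linarith
  have eu := Inc.eul_of_step D hb hpos b2 st
  refine ⟨_, _, Inc.sol_of_eul D hu₀per hb hpos eu le_rfl, fun p' u' hs x hx => ?_⟩
  obtain ⟨c1, c2, c3⟩ := Inc.eul_of_sol D hu₀per hs rfl
  obtain ⟨d1, d2⟩ := huniq _ _ _ _ hb' c1 st (Inc.step_of_eul D c1 c2 c3)
  have d1 := d1 hx
  have d20 := d2 0 hx
  have d21 := d2 1 hx
  have d22 := d2 2 hx
  simp only [Matrix.cons_val] at d1 d20 d21 d22
  refine ⟨by simp only [Inc.clp_eq hx]; linarith, fun i => ?_⟩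
  fin_cases i <;> simp [Inc.clp_eq hx, d20, d21, d22, Inc.lft]
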